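/- Let 1 < p < ∞. The left ℍ-module K_p(B, ℍ), equipped with the Hardy norm, has an unconditional basis over the quaternion skew field: there exists a sequence (w_m)_{m∈ℕ} in K_p(B, ℍ) such that for every h ∈ K_p(B, ℍ) there exists a unique sequence of quaternion coefficients (a_m)_{m∈ℕ} for which the family (a_m·w_m)_{m∈ℕ} is unconditionally summable to h in the Hardy norm (i.e., the net of finite partial sums ∑_{m∈F} a_m·w_m over finite subsets F ⊂ ℕ converges to h in ‖·‖_p), where a_m·w_m denotes the pointwise left multiple z ↦ a_m·w_m(z). -/

import Mathlib

open MeasureTheory Metric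
open scoped Quaternion ENNReal

noncomputable instance : MeasurableSpace ℍ[ℝ] := borel _
instance : BorelSpace ℍ[ℝ] := ⟨rfl⟩

/-- The standard basis `1, i₁, i₂, i₃` of the quaternions over ℝ. -/
noncomputable def qe : Fin 4 → ℍ[ℝ]
  | 0 => ⟨1, 0, 0, 0⟩
  | 1 => ⟨0, 1, 0, 0⟩
  | 2 => ⟨0, 0, 1, 0⟩
  | 3 => ⟨0, 0, 0, 1⟩

/-- The Dirac operator `σf(z) = ∑ⱼ (∂f/∂zⱼ)(z)·iⱼ` (with `i₀ = 1`), where `∂/∂zⱼ` is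
the partial derivative in the `j`-th real coordinate direction of `ℍ ≅ ℝ⁴`. -/
noncomputable def Dirac (f : ℍ[ℝ] → ℍ[ℝ]) (z : ℍ[ℝ]) : ℍ[ℝ] :=
  ∑ j : Fin 4, fderiv ℝ f z (qe j) * qe j

/-- The Hardy norm `‖f‖_p = (sup_{0<r≤1} r^{−3} ∫_{S³} |f(r y)|^p ψ(dy))^{1/p}`
(with values in `ℝ≥0∞`). -/
noncomputable def hardyNorm (ψ : Measure ℍ[ℝ]) (p : ℝ) (f : ℍ[ℝ] → ℍ[ℝ]) : ℝ≥0∞ :=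
  (⨆ r ∈ Set.Ioc (0 : ℝ) 1,
    ENNReal.ofReal (r ^ (-(3 : ℝ))) * ∫⁻ y, ENNReal.ofReal (‖f (r • y)‖ ^ p) ∂ψ) ^ (1 / p)

/-- Membership in the Hardy–Dirac module `K_p(B, ℍ)`: measurable, continuously
ℝ-differentiable on `B`, annihilated by the Dirac operator on `B`, finite Hardy norm. -/
def memKp (ψ : Measure ℍ[ℝ]) (p : ℝ) (f : ℍ[ℝ] → ℍ[ℝ]) : Prop :=
  Measurable f ∧ ContDiffOn ℝ 1 f (ball 0 1) ∧
    (∀ z ∈ ball (0 : ℍ[ℝ]) 1, Dirac f z = 0) ∧ hardyNorm ψ p f < ⊤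

namespace HardyDirac

section

section UnconditionalBasis

open Filter Topology

variable {D V : Type*} [NormedDivisionRing D] [CompleteSpace D] [NormedAddCommGroup V]
  [Module D V] [NormSMulClass D V]

/-- A family whose coordinate projections are uniformly bounded on its dense span is an
unconditional basis. -/
theorem existsUnique_hasSum_of_projections_bounded {e : ℕ → V} {C : ℝ}
    (hspan : Dense (Submodule.span D (Set.range e) : Set V)) (he : ∀ m, e m ≠ 0)
    (hC : ∀ (F G : Finset ℕ) (c : ℕ → D), F ⊆ G →
      ‖∑ m ∈ F, c m • e m‖ ≤ C * ‖∑ m ∈ G, c m • e m‖) (v : V) :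
    ∃! a : ℕ → D, HasSum (fun m => a m • e m) v := by
  have hC' : ∀ (F : Finset ℕ) (c : ℕ →₀ D),
      ‖∑ m ∈ F, c m • e m‖ ≤ C * ‖c.sum fun m x => x • e m‖ := by
    intro F c
    have h1 : c.sum (fun m x => x • e m) = ∑ m ∈ c.support ∪ F, c m • e m :=
      Finsupp.sum_of_support_subset c Finset.subset_union_left (fun m x => x • e m) (by simp)
    rw [h1]
    exact hC F _ c Finset.subset_union_right
  have hC0 : ∀ (F : Finset ℕ) (c d : ℕ →₀ D),
      ‖∑ m ∈ F, (c m - d m) • e m‖ ≤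
        C * ‖(c.sum fun m x => x • e m) - d.sum fun m x => x • e m‖ := by
    intro F c d
    have h := hC' F (c - d)
    rwa [Finsupp.sum_sub_index (by simp [sub_smul])] at h
  have hCpos : 0 ≤ C := by
    have := hC {0} {0} (fun _ => 1) subset_rfl
    simp only [Finset.sum_singleton, one_smul] at this
    have h0 : 0 < ‖e 0‖ := norm_pos_iff.2 (he 0)
    by_contra! hneg
    nlinarith
  obtain ⟨x, hx, hxv⟩ := mem_closure_iff_seq_limit.1 (hspan v)
  have hcoef : ∀ n, ∃ c : ℕ →₀ D, (c.sum fun m y => y • e m) = x n := fun n =>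
    Finsupp.mem_span_range_iff_exists_finsupp.1 (hx n)
  choose c hc using hcoef
  have hlim : ∀ m, ∃ a, Tendsto (fun n => c n m) atTop (𝓝 a) := by
    intro m
    apply cauchySeq_tendsto_of_complete
    rw [Metric.cauchySeq_iff]
    intro ε hε
    have hem : 0 < ‖e m‖ := norm_pos_iff.2 (he m)
    obtain ⟨N, hN⟩ := Metric.cauchySeq_iff.1 hxv.cauchySeq (ε * ‖e m‖ / (C + 1)) (by positivity)
    refine ⟨N, fun i hi j hj => ?_⟩
    have h1 := hC0 {m} (c i) (c j)
    rw [hc, hc, Finset.sum_singleton, norm_smul, ← dist_eq_norm, ← dist_eq_norm] at h1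
    have h2 := hN i hi j hj
    rw [lt_div_iff₀ (by positivity)] at h2
    have h3 : dist (c i m) (c j m) * ‖e m‖ < ε * ‖e m‖ := by
      nlinarith [dist_nonneg (x := x i) (y := x j)]
    exact lt_of_mul_lt_mul_right h3 hem.le
  choose a ha using hlim
  have hbound : ∀ (F : Finset ℕ) n, ‖∑ m ∈ F, (a m - c n m) • e m‖ ≤ C * ‖v - x n‖ := by
    intro F n
    have h1 : Tendsto (fun k => ‖∑ m ∈ F, (c k m - c n m) • e m‖) atTop
        (𝓝 ‖∑ m ∈ F, (a m - c n m) • e m‖) :=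
      (tendsto_finsetSum _ fun m _ => ((ha m).sub_const _).smul_const _).norm
    have h2 : Tendsto (fun k => C * ‖x k - x n‖) atTop (𝓝 (C * ‖v - x n‖)) :=
      ((hxv.sub_const _).norm).const_mul _
    refine le_of_tendsto_of_tendsto' h1 h2 fun k => ?_
    have := hC0 F (c k) (c n)
    rwa [hc, hc] at this
  have hav : HasSum (fun m => a m • e m) v := by
    unfold HasSum
    rw [SummationFilter.unconditional_filter, Metric.tendsto_atTop]
    intro ε hε
    obtain ⟨n, hn⟩ := (Metric.tendsto_atTop.1 hxv (ε / (C + 1)) (by positivity))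
    have hn := hn n le_rfl
    refine ⟨(c n).support, fun F hF => ?_⟩
    have h1 : ∑ m ∈ F, c n m • e m = x n := by
      rw [← hc n]
      exact (Finsupp.sum_of_support_subset (c n) hF (fun m x => x • e m) (by simp)).symm
    have h2 : (∑ m ∈ F, a m • e m) - v = ∑ m ∈ F, (a m - c n m) • e m - (v - x n) := by
      simp only [sub_smul, Finset.sum_sub_distrib, h1]
      abel
    rw [dist_eq_norm, h2]
    have h3 := norm_sub_le (∑ m ∈ F, (a m - c n m) • e m) (v - x n)
    have h4 := hbound F n
    rw [dist_eq_norm, norm_sub_rev, lt_div_iff₀ (by positivity)] at hn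
    nlinarith
  refine ⟨a, hav, ?_⟩
  · intro b hb
    have key : ∀ m, b m = a m := by
      intro m
      have hsub : HasSum (fun m => (b m - a m) • e m) 0 := by
        have := hb.sub hav
        simpa [sub_smul] using this
      have h1 : Tendsto (fun F : Finset ℕ => C * ‖∑ k ∈ F, (b k - a k) • e k‖) atTop (𝓝 (C * ‖(0 : V)‖)) :=
        (Tendsto.norm (by simpa [HasSum] using hsub)).const_mul _
      have h2 : ‖(b m - a m) • e m‖ ≤ C * ‖(0 : V)‖ := by
        refine ge_of_tendsto h1 ?_
        filter_upwards [eventually_ge_atTop {m}] with F hF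
        simpa using hC {m} F (fun k => b k - a k) hF
      have h3 : (b m - a m) • e m = 0 := by simpa using h2
      rcases smul_eq_zero_iff_left (he m) |>.1 h3 with h
      exact sub_eq_zero.1 h
    exact funext key

end UnconditionalBasis

end

section

/-- Lebesgue measure on `[0,1)`. -/
noncomputable abbrev unitVol : Measure ℝ := volume.restrict (Set.Ico 0 1)

instance : IsProbabilityMeasure unitVol := ⟨by simp⟩

section LpTools

variable {α E : Type*} {m : MeasurableSpace α} {μ : Measure α} [NormedAddCommGroup E] {p : ℝ}

theorem ofReal_ne_zero_of_one_lt (hp : 1 < p) : ENNReal.ofReal p ≠ 0 := by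
  simp only [ne_eq, ENNReal.ofReal_eq_zero, not_le]; linarith

theorem toReal_ofReal_of_one_lt (hp : 1 < p) : (ENNReal.ofReal p).toReal = p :=
  ENNReal.toReal_ofReal (by linarith)

theorem integrable_rpow_norm (hp : 1 < p) (v : Lp E (ENNReal.ofReal p) μ) :
    Integrable (fun x => ‖v x‖ ^ p) μ := by
  have := (Lp.memLp v).integrable_norm_rpow (ofReal_ne_zero_of_one_lt hp) ENNReal.ofReal_ne_top
  rwa [toReal_ofReal_of_one_lt hp] at this

theorem norm_rpow_eq_integral (hp : 1 < p) (v : Lp E (ENNReal.ofReal p) μ) :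
    ‖v‖ ^ p = ∫ x, ‖v x‖ ^ p ∂μ := by
  have h0 : 0 ≤ ∫ x, ‖v x‖ ^ p ∂μ := integral_nonneg fun x => by positivity
  rw [Lp.norm_def, (Lp.memLp v).eLpNorm_eq_integral_rpow_norm (ofReal_ne_zero_of_one_lt hp)
    ENNReal.ofReal_ne_top, toReal_ofReal_of_one_lt hp, ENNReal.toReal_ofReal (by positivity),
    Real.rpow_inv_rpow h0 (by linarith)]

theorem norm_rpow_eq_lintegral (hp : 1 < p) (v : Lp E (ENNReal.ofReal p) μ) :
    ENNReal.ofReal (‖v‖ ^ p) = ∫⁻ x, ENNReal.ofReal (‖v x‖ ^ p) ∂μ := by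
  rw [norm_rpow_eq_integral hp, ofReal_integral_eq_lintegral_ofReal (integrable_rpow_norm hp v)
    (Filter.Eventually.of_forall fun x => by positivity)]

theorem memLp_ofReal_iff (hp : 1 < p) {f : α → E} (hf : AEStronglyMeasurable f μ) :
    MemLp f (ENNReal.ofReal p) μ ↔ ∫⁻ x, ENNReal.ofReal (‖f x‖ ^ p) ∂μ < ⊤ := by
  rw [MemLp, and_iff_right hf, eLpNorm_lt_top_iff_lintegral_rpow_enorm_lt_top
    (ofReal_ne_zero_of_one_lt hp) ENNReal.ofReal_ne_top, toReal_ofReal_of_one_lt hp]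
  simp only [← ENNReal.ofReal_rpow_of_nonneg (norm_nonneg _) (by linarith : 0 ≤ p),
    ofReal_norm]

/-- The crude quasi-triangle inequality for `p`-th powers. -/
theorem add_rpow_le (hp : 1 < p) {x y : ℝ} (hx : 0 ≤ x) (hy : 0 ≤ y) :
    (x + y) ^ p ≤ 2 ^ p * (x ^ p + y ^ p) := by
  have h1 : (x + y) ^ p ≤ (2 * max x y) ^ p :=
    Real.rpow_le_rpow (by positivity) (by
      have := le_max_left x y; have := le_max_right x y; linarith) (by linarith)
  rw [Real.mul_rpow (by norm_num) (le_max_of_le_left hx)] at h1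
  refine h1.trans (mul_le_mul_of_nonneg_left ?_ (by positivity))
  rcases max_choice x y with h | h <;> rw [h]
  · linarith [Real.rpow_nonneg hy p]
  · linarith [Real.rpow_nonneg hx p]

end LpTools

end

section

section Burkholder

/-- A function that is, off a countable set, a primitive of an antitone function lies below its
tangent lines. -/
theorem le_tangent_of_hasDerivAt_off_countable {f g : ℝ → ℝ} {s : Set ℝ} (hs : s.Countable)
    (hf : Continuous f) (hg : Antitone g) (hfg : ∀ t, t ∉ s → HasDerivAt f (g t) t) (t₀ t : ℝ) :
    f t ≤ f t₀ + g t₀ * (t - t₀) := by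
  have key : ∀ a b : ℝ, f b - f a = ∫ u in a..b, g u := fun a b =>
    (MeasureTheory.integral_eq_of_hasDerivAt_off_countable f g hs hf.continuousOn
      (fun x hx => hfg x hx.2) hg.intervalIntegrable).symm
  rcases le_total t₀ t with h | h
  · have h1 : ∫ u in t₀..t, g u ≤ ∫ u in t₀..t, g t₀ :=
      intervalIntegral.integral_mono_on h hg.intervalIntegrable (by simp)
        fun x hx => hg hx.1
    have := key t₀ t
    simp at h1
    linarith
  · have h1 : ∫ u in t..t₀, g t₀ ≤ ∫ u in t..t₀, g u :=
      intervalIntegral.integral_mono_on h (by simp) hg.intervalIntegrable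
        fun x hx => hg hx.2
    have := key t t₀
    simp at h1
    linarith

/-- The building block of Burkholder's function for martingale transforms. -/
noncomputable def burkholderAux (p x y : ℝ) : ℝ :=
  (|x| + |y|) ^ p - p * |x| * (|x| + |y|) ^ (p - 1)

noncomputable def slopeOut (p d s : ℝ) : ℝ := p * (2 - p) * s ^ (p - 1) + p * (p - 1) * d * s ^ (p - 2)
noncomputable def slopeIn (p d s : ℝ) : ℝ := p * (p - 2) * s ^ (p - 1) + p * (p - 1) * d * s ^ (p - 2)

/-- The slope of `burkholderAux` along the line `t ↦ (t, t + d)`. -/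
noncomputable def burkholderSlope (p d t : ℝ) : ℝ :=
  if 0 ≤ t then slopeOut p d (2 * t + d)
  else if -d ≤ t then p * d ^ (p - 1) else slopeIn p d (-2 * t - d)

variable {p : ℝ}

theorem continuous_burkholderAux (hp : 1 < p) :
    Continuous fun z : ℝ × ℝ => burkholderAux p z.1 z.2 := by
  unfold burkholderAux
  have h1 : (0 : ℝ) ≤ p := by linarith
  have h2 : (0 : ℝ) ≤ p - 1 := by linarith
  fun_prop (disch := assumption)

theorem hasDerivAt_burkholderAux {d t : ℝ} (hd : 0 ≤ d) (h0 : t ≠ 0) (h1 : t ≠ -d) :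
    HasDerivAt (fun u => burkholderAux p u (u + d)) (burkholderSlope p d t) t := by
  rcases lt_or_gt_of_ne h0 with ht | ht
  · rcases lt_or_gt_of_ne h1 with ht' | ht'
    · have hs : 0 < -2 * t - d := by linarith
      have e : (fun u => burkholderAux p u (u + d)) =ᶠ[nhds t] fun u =>
          (-2 * u - d) ^ p - p * (-u) * (-2 * u - d) ^ (p - 1) := by
        filter_upwards [Iio_mem_nhds ht'] with u (hu : u < -d)
        rw [burkholderAux, abs_of_neg (by linarith), abs_of_neg (by linarith)]
        ring_nf
      have hb : HasDerivAt (fun u : ℝ => -2 * u - d) (-2) t := by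
        simpa using ((hasDerivAt_id t).const_mul (-2)).sub_const d
      have hm := (hb.rpow_const (p := p) (Or.inl hs.ne')).sub
        ((((hasDerivAt_id t).neg).const_mul p).mul (hb.rpow_const (p := p - 1) (Or.inl hs.ne')))
      refine (hm.congr_of_eventuallyEq e).congr_deriv ?_
      rw [burkholderSlope, if_neg (by linarith), if_neg (by linarith), slopeIn]
      have e1 : (-2 * t - d) ^ (p - 1) = (-2 * t - d) ^ (p - 2) * (-2 * t - d) := by
        rw [← Real.rpow_add_one hs.ne']; ring_nf
      simp only [id, Pi.neg_apply, show p - 1 - 1 = p - 2 by ring, e1]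
      ring
    · have hs : 0 < d := by linarith
      have e : (fun u => burkholderAux p u (u + d)) =ᶠ[nhds t] fun u =>
          d ^ p - p * (-u) * d ^ (p - 1) := by
        filter_upwards [Ioo_mem_nhds ht' ht] with u hu
        rw [burkholderAux, abs_of_neg hu.2, abs_of_pos (by linarith [hu.1])]
        ring_nf
      have hm := (((((hasDerivAt_id t).neg).const_mul p).mul_const (d ^ (p - 1))).const_sub (d ^ p))
      refine (hm.congr_of_eventuallyEq e).congr_deriv ?_
      rw [burkholderSlope, if_neg (by linarith), if_pos (by linarith)]
      ring
  · have hs : 0 < 2 * t + d := by linarith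
    have e : (fun u => burkholderAux p u (u + d)) =ᶠ[nhds t] fun u =>
        (2 * u + d) ^ p - p * u * (2 * u + d) ^ (p - 1) := by
      filter_upwards [Ioi_mem_nhds ht] with u (hu : 0 < u)
      rw [burkholderAux, abs_of_pos hu, abs_of_pos (by linarith)]
      ring_nf
    have hb : HasDerivAt (fun u : ℝ => 2 * u + d) 2 t := by
      simpa using ((hasDerivAt_id t).const_mul 2).add_const d
    have hm := (hb.rpow_const (p := p) (Or.inl hs.ne')).sub
      (((hasDerivAt_id t).const_mul p).mul (hb.rpow_const (p := p - 1) (Or.inl hs.ne')))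
    refine (hm.congr_of_eventuallyEq e).congr_deriv ?_
    rw [burkholderSlope, if_pos ht.le, slopeOut]
    have e1 : (2 * t + d) ^ (p - 1) = (2 * t + d) ^ (p - 2) * (2 * t + d) := by
      rw [← Real.rpow_add_one hs.ne']; ring_nf
    simp only [id, show p - 1 - 1 = p - 2 by ring, e1]
    ring

theorem hasDerivAt_slope (a b : ℝ) {s : ℝ} (hs : 0 < s) :
    HasDerivAt (fun s => a * s ^ (p - 1) + b * s ^ (p - 2))
      (s ^ (p - 3) * (a * (p - 1) * s + b * (p - 2))) s := by
  have hm := ((Real.hasDerivAt_rpow_const (x := s) (p := p - 1) (Or.inl hs.ne')).const_mul a).add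
    ((Real.hasDerivAt_rpow_const (x := s) (p := p - 2) (Or.inl hs.ne')).const_mul b)
  refine hm.congr_deriv ?_
  have e1 : s ^ (p - 2) = s ^ (p - 3) * s := by
    rw [← Real.rpow_add_one hs.ne']; ring_nf
  simp only [show p - 1 - 1 = p - 2 by ring, show p - 2 - 1 = p - 3 by ring, e1]
  ring

theorem slope_mono {a b d : ℝ} (hd : 0 < d)
    (h : ∀ s, d < s → 0 ≤ a * (p - 1) * s + b * (p - 2)) :
    MonotoneOn (fun s => a * s ^ (p - 1) + b * s ^ (p - 2)) (Set.Ici d) := by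
  refine monotoneOn_of_deriv_nonneg (convex_Ici d) (fun s hs => ?_) (fun s hs => ?_) fun s hs => ?_
  · exact (hasDerivAt_slope a b (hd.trans_le hs)).continuousAt.continuousWithinAt
  · rw [interior_Ici] at hs
    exact (hasDerivAt_slope a b (hd.trans hs)).differentiableAt.differentiableWithinAt
  · rw [interior_Ici] at hs
    rw [(hasDerivAt_slope a b (hd.trans hs)).deriv]
    exact mul_nonneg (Real.rpow_nonneg (hd.trans hs).le _) (h s hs)

theorem slope_anti {a b d : ℝ} (hd : 0 < d)
    (h : ∀ s, d < s → a * (p - 1) * s + b * (p - 2) ≤ 0) :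
    AntitoneOn (fun s => a * s ^ (p - 1) + b * s ^ (p - 2)) (Set.Ici d) := by
  intro x hx y hy hxy
  have := slope_mono (p := p) (a := -a) (b := -b) hd (fun s hs => by linarith [h s hs]) hx hy hxy
  simp only at this ⊢
  linarith

theorem slopeOut_self (hp : 1 < p) {d : ℝ} (hd : 0 ≤ d) : slopeOut p d d = p * d ^ (p - 1) := by
  rcases hd.eq_or_lt with rfl | hd
  · simp [slopeOut, Real.zero_rpow (sub_pos.2 hp).ne']
  · have e1 : d ^ (p - 1) = d ^ (p - 2) * d := by
      rw [← Real.rpow_add_one hd.ne']; ring_nf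
    rw [slopeOut, e1]; ring

theorem slopeIn_self (hp : 1 < p) {d : ℝ} (hd : 0 ≤ d) :
    slopeIn p d d = p * (2 * p - 3) * d ^ (p - 1) := by
  rcases hd.eq_or_lt with rfl | hd
  · simp [slopeIn, Real.zero_rpow (sub_pos.2 hp).ne']
  · have e1 : d ^ (p - 1) = d ^ (p - 2) * d := by
      rw [← Real.rpow_add_one hd.ne']; ring_nf
    rw [slopeIn, e1]; ring

theorem antitone_of_pieces {A B : ℝ → ℝ} {c d : ℝ} (hA : AntitoneOn A (Set.Ici d))
    (hB : MonotoneOn B (Set.Ici d)) (hAc : A d = c) (hBc : c ≤ B d) :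
    Antitone fun t : ℝ => if 0 ≤ t then A (2 * t + d) else if -d ≤ t then c else B (-2 * t - d) := by
  have hA' : ∀ t : ℝ, 0 ≤ t → A (2 * t + d) ≤ c := fun t ht =>
    hAc ▸ hA (Set.self_mem_Ici) (by simp; linarith) (by linarith)
  have hB' : ∀ t : ℝ, t ≤ -d → c ≤ B (-2 * t - d) := fun t ht =>
    hBc.trans (hB (Set.self_mem_Ici) (by simp; linarith) (by linarith))
  intro x y hxy
  simp only
  by_cases h1 : 0 ≤ x
  · rw [if_pos h1, if_pos (h1.trans hxy)]
    exact hA (by simp; linarith) (by simp; linarith) (by linarith)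
  rw [if_neg h1]
  by_cases h2 : -d ≤ x
  · rw [if_pos h2]
    by_cases h3 : 0 ≤ y
    · rw [if_pos h3]; exact hA' y h3
    · rw [if_neg h3, if_pos (h2.trans hxy)]
  rw [if_neg h2]
  by_cases h3 : 0 ≤ y
  · rw [if_pos h3]; exact (hA' y h3).trans (hB' x (by linarith))
  rw [if_neg h3]
  by_cases h4 : -d ≤ y
  · rw [if_pos h4]; exact hB' x (by linarith)
  rw [if_neg h4]
  exact hB (by simp; linarith) (by simp; linarith) (by linarith)

theorem antitone_burkholderSlope (hp : 2 ≤ p) {d : ℝ} (hd : 0 ≤ d) :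
    Antitone (burkholderSlope p d) := by
  have hp1 : 1 < p := by linarith
  refine antitone_of_pieces ?_ ?_ (slopeOut_self hp1 hd) ?_
  · rcases hd.eq_or_lt with rfl | hd
    · intro x hx y hy hxy
      have := Real.rpow_le_rpow hx hxy (by linarith : 0 ≤ p - 1)
      simp only [slopeOut, mul_zero, zero_mul, add_zero]
      have h2 : p * (2 - p) ≤ 0 := by nlinarith
      nlinarith
    · refine slope_anti hd fun s hs => ?_
      have h1 : 0 ≤ p * (p - 1) * (p - 2) := by
        apply mul_nonneg (mul_nonneg _ _) <;> linarith
      nlinarith [mul_nonneg h1 (sub_pos.2 hs).le]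
  · rcases hd.eq_or_lt with rfl | hd
    · intro x hx y hy hxy
      have := Real.rpow_le_rpow hx hxy (by linarith : 0 ≤ p - 1)
      simp only [slopeIn, mul_zero, zero_mul, add_zero]
      have h2 : 0 ≤ p * (p - 2) := by nlinarith
      nlinarith
    · refine slope_mono hd fun s hs => ?_
      have h1 : 0 ≤ p * (p - 1) * (p - 2) := by
        apply mul_nonneg (mul_nonneg _ _) <;> linarith
      nlinarith [mul_nonneg h1 (by linarith : 0 ≤ s + d)]
  · rw [slopeIn_self hp1 hd]
    have := Real.rpow_nonneg hd (p - 1)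
    have h2 : p ≤ p * (2 * p - 3) := by nlinarith
    nlinarith

theorem antitone_neg_burkholderSlope (hp1 : 1 < p) (hp : p ≤ 2) {d : ℝ} (hd : 0 ≤ d) :
    Antitone fun t => -burkholderSlope p d t := by
  have h : Antitone fun t : ℝ => if 0 ≤ t then -slopeOut p d (2 * t + d)
      else if -d ≤ t then -(p * d ^ (p - 1)) else -slopeIn p d (-2 * t - d) := by
    refine antitone_of_pieces (A := fun s => -slopeOut p d s) (B := fun s => -slopeIn p d s)
      ?_ ?_ (by simp only [slopeOut_self hp1 hd]) ?_
    · rcases hd.eq_or_lt with rfl | hd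
      · intro x hx y hy hxy
        have := Real.rpow_le_rpow hx hxy (by linarith : 0 ≤ p - 1)
        simp only [slopeOut, mul_zero, zero_mul, add_zero]
        have h2 : 0 ≤ p * (2 - p) := by nlinarith
        nlinarith
      · refine (slope_mono hd fun s hs => ?_).neg
        have h1 : 0 ≤ p * (p - 1) * (2 - p) := by
          apply mul_nonneg (mul_nonneg _ _) <;> linarith
        nlinarith [mul_nonneg h1 (sub_pos.2 hs).le]
    · rcases hd.eq_or_lt with rfl | hd
      · intro x hx y hy hxy
        have := Real.rpow_le_rpow hx hxy (by linarith : 0 ≤ p - 1)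
        simp only [slopeIn, mul_zero, zero_mul, add_zero]
        have h2 : p * (p - 2) ≤ 0 := by nlinarith
        nlinarith
      · refine (slope_anti hd fun s hs => ?_).neg
        have h1 : 0 ≤ p * (p - 1) * (2 - p) := by
          apply mul_nonneg (mul_nonneg _ _) <;> linarith
        nlinarith [mul_nonneg h1 (by linarith : 0 ≤ s + d)]
    · simp only [slopeIn_self hp1 hd]
      have := Real.rpow_nonneg hd (p - 1)
      have h2 : p * (2 * p - 3) ≤ p := by nlinarith
      nlinarith
  convert h using 2 with t
  unfold burkholderSlope
  split_ifs <;> rfl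

/-- Burkholder's function. -/
noncomputable def burkholder (p x y : ℝ) : ℝ :=
  if 2 ≤ p then burkholderAux p x y else -burkholderAux p y x

theorem burkholderAux_neg_neg (x y : ℝ) : burkholderAux p (-x) (-y) = burkholderAux p x y := by
  simp [burkholderAux]

theorem burkholderAux_neg_right (x y : ℝ) : burkholderAux p x (-y) = burkholderAux p x y := by
  simp [burkholderAux]

theorem burkholderAux_neg_left (x y : ℝ) : burkholderAux p (-x) y = burkholderAux p x y := by
  simp [burkholderAux]

theorem tangent_of_line {σ : ℝ} (hp : 1 < p)
    (hσ : ∀ d, 0 ≤ d → Antitone fun t => σ * burkholderSlope p d t) (x y : ℝ) :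
    ∃ c, ∀ t, σ * burkholderAux p (x + t) (y + t) ≤ σ * burkholderAux p x y + c * t := by
  have key : ∀ d, 0 ≤ d → ∀ t₀ t, σ * burkholderAux p t (t + d) ≤
      σ * burkholderAux p t₀ (t₀ + d) + σ * burkholderSlope p d t₀ * (t - t₀) := by
    intro d hd t₀ t
    refine le_tangent_of_hasDerivAt_off_countable (f := fun t => σ * burkholderAux p t (t + d))
      (g := fun t => σ * burkholderSlope p d t) (s := {0, -d})
      (Set.toFinite _).countable ?_ (hσ d hd) (fun t ht => ?_) t₀ t
    · exact ((continuous_burkholderAux hp).comp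
        (continuous_id.prodMk (continuous_id.add continuous_const))).const_mul σ
    · simp only [Set.mem_insert_iff, Set.mem_singleton_iff, not_or] at ht
      exact (hasDerivAt_burkholderAux hd ht.1 ht.2).const_mul σ
  rcases le_total x y with h | h
  · refine ⟨σ * burkholderSlope p (y - x) x, fun t => ?_⟩
    have := key (y - x) (by linarith) x (x + t)
    rw [show x + t + (y - x) = y + t by ring, show x + (y - x) = y by ring,
      show x + t - x = t by ring] at this
    exact this
  · refine ⟨-(σ * burkholderSlope p (x - y) (-x)), fun t => ?_⟩
    have := key (x - y) (by linarith) (-x) (-(x + t))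
    rw [show -(x + t) + (x - y) = -(y + t) by ring, show -x + (x - y) = -y by ring,
      burkholderAux_neg_neg, burkholderAux_neg_neg] at this
    linarith

/-- Burkholder's function is zigzag concave. -/
theorem burkholder_tangent (hp : 1 < p) {ε : ℝ} (hε : ε = 1 ∨ ε = -1) (x y : ℝ) :
    ∃ c, ∀ t, burkholder p (x + t) (y + ε * t) ≤ burkholder p x y + c * t := by
  unfold burkholder
  split_ifs with h
  · have H := tangent_of_line (σ := 1) hp (fun d hd => by simpa using antitone_burkholderSlope h hd)
    rcases hε with rfl | rfl
    · simpa using H x y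
    · obtain ⟨c, hc⟩ := H x (-y)
      refine ⟨c, fun t => ?_⟩
      have := hc t
      rw [one_mul, one_mul, burkholderAux_neg_right, ← burkholderAux_neg_right (x + t)] at this
      convert this using 3
      ring
  · have H := tangent_of_line (σ := -1) hp
      (fun d hd => by simpa using antitone_neg_burkholderSlope hp (not_le.1 h).le hd)
    rcases hε with rfl | rfl
    · simpa using H y x
    · obtain ⟨c, hc⟩ := H (-y) x
      refine ⟨c, fun t => ?_⟩
      have := hc t
      rw [neg_one_mul, neg_one_mul, burkholderAux_neg_left, ← burkholderAux_neg_left (-y + t)] at this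
      rw [show y + -1 * t = -(-y + t) by ring]
      linarith

theorem burkholderAux_eq {x y : ℝ} (hxy : 0 < |x| + |y|) :
    burkholderAux p x y = (|y| - (p - 1) * |x|) * (|x| + |y|) ^ (p - 1) := by
  rw [burkholderAux]
  have e1 : (|x| + |y|) ^ p = (|x| + |y|) ^ (p - 1) * (|x| + |y|) := by
    rw [← Real.rpow_add_one hxy.ne']; ring_nf
  rw [e1]; ring

theorem majorant_aux (hp : 1 < p) {a K : ℝ} (ha : 0 < a) (hK : 0 < K) :
    ∃ c C : ℝ, 0 < c ∧ 0 ≤ C ∧ ∀ x y : ℝ, 0 ≤ x → 0 ≤ y →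
      c * y ^ p ≤ (a * y - K * x) * (x + y) ^ (p - 1) + C * x ^ p := by
  have hp1 : 0 ≤ p - 1 := by linarith
  set B := 2 * K / a with hB
  have hBpos : 0 < B := by positivity
  refine ⟨a / 2, K * (1 + B) ^ (p - 1) + a / 2 * B ^ p, by positivity, by positivity,
    fun x y hx hy => ?_⟩
  have hpow : ∀ z : ℝ, 0 ≤ z → z ^ p = z ^ (p - 1) * z := fun z hz => by
    rcases hz.eq_or_lt with rfl | hz
    · simp [Real.zero_rpow (by linarith : p ≠ 0)]
    · rw [← Real.rpow_add_one hz.ne']; ring_nf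
  rcases le_total (B * x) y with h | h
  · have h1 : a / 2 * y ≤ a * y - K * x := by
      have : B * x * a = 2 * K * x := by rw [hB]; field_simp
      nlinarith
    have h2 : y ^ (p - 1) ≤ (x + y) ^ (p - 1) := Real.rpow_le_rpow hy (by linarith) hp1
    have h3 : a / 2 * y * y ^ (p - 1) ≤ (a * y - K * x) * (x + y) ^ (p - 1) :=
      mul_le_mul h1 h2 (by positivity) (by nlinarith)
    have h4 : 0 ≤ (K * (1 + B) ^ (p - 1) + a / 2 * B ^ p) * x ^ p := by positivity
    rw [hpow y hy]
    linarith
  · have h2 : (x + y) ^ (p - 1) ≤ ((1 + B) * x) ^ (p - 1) :=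
      Real.rpow_le_rpow (by positivity) (by linarith) hp1
    rw [Real.mul_rpow (by positivity) hx] at h2
    have h3 : y ^ p ≤ (B * x) ^ p := Real.rpow_le_rpow hy h (by linarith)
    rw [Real.mul_rpow (by positivity) hx] at h3
    have h5 : 0 ≤ a * y * (x + y) ^ (p - 1) := by positivity
    have h6 : K * x * (x + y) ^ (p - 1) ≤ K * x * ((1 + B) ^ (p - 1) * x ^ (p - 1)) := by gcongr
    have h7 := hpow x hx
    rw [add_mul, h7]
    rw [h7] at h3
    nlinarith

theorem burkholder_majorant (hp : 1 < p) :
    ∃ c C : ℝ, 0 < c ∧ 0 ≤ C ∧ ∀ x y : ℝ, c * |y| ^ p ≤ burkholder p x y + C * |x| ^ p := by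
  have hz : burkholderAux p 0 0 = 0 := by simp [burkholderAux, Real.zero_rpow (by linarith : p ≠ 0)]
  by_cases h2 : 2 ≤ p
  · obtain ⟨c, C, hc, hC, H⟩ := majorant_aux hp one_pos (sub_pos.2 hp)
    refine ⟨c, C, hc, hC, fun x y => ?_⟩
    rw [burkholder, if_pos h2]
    rcases (add_nonneg (abs_nonneg x) (abs_nonneg y)).eq_or_lt with h | h
    · have hx : x = 0 := abs_eq_zero.1 (by linarith [abs_nonneg x, abs_nonneg y])
      have hy : y = 0 := abs_eq_zero.1 (by linarith [abs_nonneg x, abs_nonneg y])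
      subst hx hy
      simp [hz, Real.zero_rpow (by linarith : p ≠ 0)]
    · rw [burkholderAux_eq h]
      simpa using H |x| |y| (abs_nonneg _) (abs_nonneg _)
  · obtain ⟨c, C, hc, hC, H⟩ := majorant_aux hp (sub_pos.2 hp) one_pos
    refine ⟨c, C, hc, hC, fun x y => ?_⟩
    rw [burkholder, if_neg h2]
    rcases (add_nonneg (abs_nonneg y) (abs_nonneg x)).eq_or_lt with h | h
    · have hx : x = 0 := abs_eq_zero.1 (by linarith [abs_nonneg x, abs_nonneg y])
      have hy : y = 0 := abs_eq_zero.1 (by linarith [abs_nonneg x, abs_nonneg y])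
      subst hx hy
      simp [hz, Real.zero_rpow (by linarith : p ≠ 0)]
    · rw [burkholderAux_eq h]
      have := H |x| |y| (abs_nonneg _) (abs_nonneg _)
      rw [add_comm |x|] at this
      linarith

theorem continuous_burkholder (hp : 1 < p) :
    Continuous fun z : ℝ × ℝ => burkholder p z.1 z.2 := by
  unfold burkholder
  split_ifs
  · exact continuous_burkholderAux hp
  · exact ((continuous_burkholderAux hp).comp continuous_swap).neg

theorem burkholder_zero (hp : 1 < p) : burkholder p 0 0 = 0 := by
  simp [burkholder, burkholderAux, Real.zero_rpow (by linarith : p ≠ 0)]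

theorem burkholder_diag (hp : 1 < p) {x y : ℝ} (hxy : |y| = |x|) : burkholder p x y ≤ 0 := by
  have key : burkholderAux p x y = (2 - p) * |x| * (2 * |x|) ^ (p - 1) ∧ 
      burkholderAux p y x = (2 - p) * |x| * (2 * |x|) ^ (p - 1) := by
    rcases (abs_nonneg x).eq_or_lt with h | h
    · simp [burkholderAux, hxy, ← h, Real.zero_rpow (by linarith : p ≠ 0)]
    · rw [burkholderAux_eq (by positivity), burkholderAux_eq (by positivity), hxy]
      constructor <;> ring_nf
  rw [burkholder, key.1, key.2]
  have h0 : 0 ≤ |x| * (2 * |x|) ^ (p - 1) := by positivity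
  split_ifs with h2 <;> nlinarith

end Burkholder

end

section

section Haar

/-- The dyadic interval of `[0,1)` with tree index `n ≥ 1`. -/
def dyadicIco (n : ℕ) : Set ℝ := {t | (n : ℝ) ≤ 2 ^ Nat.log 2 n * (1 + t) ∧ 2 ^ Nat.log 2 n * (1 + t) < n + 1}

theorem dyadicIco_eq (n : ℕ) : dyadicIco n =
    Set.Ico ((n : ℝ) / 2 ^ Nat.log 2 n - 1) ((n + 1 : ℝ) / 2 ^ Nat.log 2 n - 1) := by
  ext t
  have h : (0 : ℝ) < 2 ^ Nat.log 2 n := by positivity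
  simp only [dyadicIco, Set.mem_ofPred_eq, Set.mem_Ico, sub_le_iff_le_add, lt_sub_iff_add_lt,
    div_le_iff₀ h, lt_div_iff₀ h]
  constructor <;> rintro ⟨h1, h2⟩ <;> constructor <;> linarith

theorem measurableSet_dyadicIco (n : ℕ) : MeasurableSet (dyadicIco n) := by
  rw [dyadicIco_eq]; exact measurableSet_Ico

theorem log_two_mul {n : ℕ} (hn : n ≠ 0) : Nat.log 2 (2 * n) = Nat.log 2 n + 1 := by
  rw [mul_comm, Nat.log_mul_base (by norm_num) hn]

theorem log_two_mul_add_one {n : ℕ} (hn : n ≠ 0) : Nat.log 2 (2 * n + 1) = Nat.log 2 n + 1 := by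
  rw [Nat.log_of_one_lt_of_le (by norm_num) (by omega)]
  congr 2
  omega

theorem dyadicIco_one : dyadicIco 1 = Set.Ico 0 1 := by
  rw [dyadicIco_eq]; norm_num

theorem mem_dyadicIco_iff {n : ℕ} (hn : n ≠ 0) (t : ℝ) :
    t ∈ dyadicIco n ↔ t ∈ dyadicIco (2 * n) ∨ t ∈ dyadicIco (2 * n + 1) := by
  simp only [dyadicIco, Set.mem_ofPred_eq, log_two_mul hn, log_two_mul_add_one hn, pow_succ]
  push_cast
  constructor
  · rintro ⟨h1, h2⟩
    rcases lt_or_ge (2 ^ Nat.log 2 n * 2 * (1 + t)) (2 * n + 1 : ℝ) with h | h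
    · exact Or.inl ⟨by linarith, h⟩
    · exact Or.inr ⟨h, by linarith⟩
  · rintro (⟨h1, h2⟩ | ⟨h1, h2⟩) <;> constructor <;> linarith

theorem disjoint_dyadicIco_siblings {n : ℕ} (hn : n ≠ 0) :
    Disjoint (dyadicIco (2 * n)) (dyadicIco (2 * n + 1)) := by
  rw [Set.disjoint_left]
  simp only [dyadicIco, Set.mem_ofPred_eq, log_two_mul hn, log_two_mul_add_one hn]
  push_cast
  rintro t ⟨h1, h2⟩ ⟨h3, h4⟩
  linarith

theorem dyadicIco_subset_parent {n : ℕ} (hn : 2 ≤ n) : dyadicIco n ⊆ dyadicIco (n / 2) := by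
  intro t ht
  rw [mem_dyadicIco_iff (by omega)]
  rcases Nat.even_or_odd' n with ⟨k, rfl | rfl⟩
  · left; rwa [show 2 * k / 2 = k by omega]
  · right; rwa [show (2 * k + 1) / 2 = k by omega]

theorem dyadicIco_subset_one {n : ℕ} (hn : n ≠ 0) : dyadicIco n ⊆ Set.Ico 0 1 := by
  induction n using Nat.strong_induction_on with
  | _ n ih =>
    rcases Nat.lt_or_ge n 2 with h | h
    · obtain rfl : n = 1 := by omega
      exact dyadicIco_one.subset
    · exact (dyadicIco_subset_parent h).trans (ih _ (by omega) (by omega))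

theorem disjoint_dyadicIco {m n : ℕ} (hm : m ≠ 0) (h : n / 2 < m) (hmn : m < n) :
    Disjoint (dyadicIco m) (dyadicIco n) := by
  induction n using Nat.strong_induction_on generalizing m with
  | _ n ih =>
    rcases Nat.lt_or_ge (m / 2) (n / 2) with h1 | h1
    · exact ((@ih m hmn (n / 2) (by omega) h1 h).mono_left
        (dyadicIco_subset_parent (by omega))).symm
    · have e1 : m = 2 * (n / 2) := by omega
      have e2 : n = 2 * (n / 2) + 1 := by omega
      have h2 := disjoint_dyadicIco_siblings (n := n / 2) (by omega)
      rw [← e1] at h2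
      rwa [show n = m + 1 by omega]

theorem dyadicIco_trichotomy {m n : ℕ} (hm : m ≠ 0) (hmn : m < n) :
    dyadicIco n ⊆ dyadicIco (2 * m) ∨ dyadicIco n ⊆ dyadicIco (2 * m + 1) ∨
      Disjoint (dyadicIco m) (dyadicIco n) := by
  induction n using Nat.strong_induction_on with
  | _ n ih =>
    rcases lt_trichotomy (n / 2) m with h | h | h
    · exact Or.inr (Or.inr (disjoint_dyadicIco hm h hmn))
    · rcases Nat.even_or_odd' n with ⟨k, rfl | rfl⟩
      · left; rw [show k = m by omega]
      · right; left; rw [show k = m by omega]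
    · have hs := dyadicIco_subset_parent (n := n) (by omega)
      rcases ih (n / 2) (by omega) h with h1 | h1 | h1
      · exact Or.inl (hs.trans h1)
      · exact Or.inr (Or.inl (hs.trans h1))
      · exact Or.inr (Or.inr (h1.mono_right hs))

theorem volume_dyadicIco (n : ℕ) : volume (dyadicIco n) = ENNReal.ofReal ((2 ^ Nat.log 2 n)⁻¹) := by
  rw [dyadicIco_eq, Real.volume_Ico]
  congr 1
  field_simp
  ring

/-- The Haar functions on `[0,1)`. -/
noncomputable def haar (n : ℕ) : ℝ → ℝ :=
  if n = 0 then 1 else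
    (dyadicIco (2 * n)).indicator 1 - (dyadicIco (2 * n + 1)).indicator 1

theorem haar_zero : haar 0 = 1 := if_pos rfl

theorem haar_of_ne {n : ℕ} (hn : n ≠ 0) : haar n =
    (dyadicIco (2 * n)).indicator 1 - (dyadicIco (2 * n + 1)).indicator 1 := if_neg hn

theorem measurable_haar (n : ℕ) : Measurable (haar n) := by
  rcases eq_or_ne n 0 with rfl | hn
  · rw [haar_zero]; exact measurable_one
  · rw [haar_of_ne hn]
    exact (measurable_one.indicator (measurableSet_dyadicIco _)).sub
      (measurable_one.indicator (measurableSet_dyadicIco _))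

theorem haar_abs_le (n : ℕ) (t : ℝ) : |haar n t| ≤ 1 := by
  rcases eq_or_ne n 0 with rfl | hn
  · simp [haar_zero]
  · have : t ∈ dyadicIco (2 * n) → t ∉ dyadicIco (2 * n + 1) := fun h =>
      Set.disjoint_left.1 (disjoint_dyadicIco_siblings hn) h
    simp only [haar_of_ne hn, Pi.sub_apply, Set.indicator]
    split_ifs <;> simp_all

theorem haar_eq_zero {n : ℕ} (hn : n ≠ 0) {t : ℝ} (ht : t ∉ dyadicIco n) : haar n t = 0 := by
  rw [mem_dyadicIco_iff hn, not_or] at ht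
  simp [haar_of_ne hn, ht.1, ht.2]

theorem haar_const {m n : ℕ} (hmn : m < n) : ∃ v, ∀ t ∈ dyadicIco n, haar m t = v := by
  rcases eq_or_ne m 0 with rfl | hm
  · exact ⟨1, fun t _ => by simp [haar_zero]⟩
  · have hd := disjoint_dyadicIco_siblings hm
    rcases dyadicIco_trichotomy hm hmn with h | h | h
    · refine ⟨1, fun t ht => ?_⟩
      simp [haar_of_ne hm, h ht, Set.disjoint_left.1 hd (h ht)]
    · refine ⟨-1, fun t ht => ?_⟩
      simp [haar_of_ne hm, h ht, Set.disjoint_right.1 hd (h ht)]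
    · exact ⟨0, fun t ht => haar_eq_zero hm (Set.disjoint_right.1 h ht)⟩

theorem unitVol_dyadicIco {n : ℕ} (hn : n ≠ 0) :
    unitVol (dyadicIco n) = ENNReal.ofReal ((2 ^ Nat.log 2 n)⁻¹) := by
  rw [Measure.restrict_apply (measurableSet_dyadicIco n),
    Set.inter_eq_left.2 (dyadicIco_subset_one hn), volume_dyadicIco]

theorem integral_haar {n : ℕ} (hn : n ≠ 0) : ∫ t, haar n t ∂unitVol = 0 := by
  rw [haar_of_ne hn]
  simp only [Pi.sub_apply]
  have hi : ∀ k, Integrable ((dyadicIco k).indicator (1 : ℝ → ℝ)) unitVol := fun k =>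
    (integrable_const (1 : ℝ)).indicator (measurableSet_dyadicIco _)
  rw [integral_sub (hi _) (hi _), integral_indicator_one (measurableSet_dyadicIco _),
    integral_indicator_one (measurableSet_dyadicIco _), Measure.real, Measure.real,
    unitVol_dyadicIco (by omega), unitVol_dyadicIco (by omega), log_two_mul hn,
    log_two_mul_add_one hn, sub_self]

variable {p : ℝ}

theorem exists_forall_norm_sum_haar_le {E : Type*} [NormedAddCommGroup E] [NormedSpace ℝ E]
    (G : Finset ℕ) (c : ℕ → E) (t : ℝ) :
    ‖∑ m ∈ G, haar m t • c m‖ ≤ ∑ m ∈ G, ‖c m‖ := by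
  refine (norm_sum_le _ _).trans (Finset.sum_le_sum fun m _ => ?_)
  rw [norm_smul]
  exact mul_le_of_le_one_left (norm_nonneg _) (haar_abs_le m t)

theorem integrable_comp_haar_sums {Φ : ℝ × ℝ → ℝ} (hΦ : Continuous Φ) (G : Finset ℕ)
    (c d : ℕ → ℝ) :
    Integrable (fun t => Φ (∑ m ∈ G, c m * haar m t, ∑ m ∈ G, d m * haar m t)) unitVol := by
  set R := max (∑ m ∈ G, |c m|) (∑ m ∈ G, |d m|)
  obtain ⟨M, hM⟩ := (isCompact_closedBall (0 : ℝ × ℝ) R).exists_bound_of_continuousOn hΦ.continuousOn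
  have hmeas : ∀ c : ℕ → ℝ, Measurable fun t => ∑ m ∈ G, c m * haar m t := fun c =>
    Finset.measurable_sum _ fun m _ => (measurable_haar m).const_mul _
  have hb : ∀ (c : ℕ → ℝ) (t : ℝ), |∑ m ∈ G, c m * haar m t| ≤ ∑ m ∈ G, |c m| := fun c t => by
    simpa [mul_comm] using exists_forall_norm_sum_haar_le G c t
  refine Integrable.of_bound
    (hΦ.measurable.comp ((hmeas c).prodMk (hmeas d))).aestronglyMeasurable M
    (Filter.Eventually.of_forall fun t => hM _ ?_)
  rw [mem_closedBall_zero_iff, Prod.norm_def]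
  exact max_le_max (hb c t) (hb d t)

theorem integral_burkholder_le (hp : 1 < p) (c ε : ℕ → ℝ) (hε : ∀ m, ε m = 1 ∨ ε m = -1) (N : ℕ) :
    ∫ t, burkholder p (∑ m ∈ Finset.range N, c m * haar m t)
      (∑ m ∈ Finset.range N, ε m * c m * haar m t) ∂unitVol ≤ 0 := by
  induction N with
  | zero => simp [burkholder_zero hp]
  | succ N ih =>
    rcases eq_or_ne N 0 with rfl | hN
    · refine integral_nonpos fun t => ?_
      refine burkholder_diag hp ?_
      rcases hε 0 with h | h <;> simp [h]
    · refine le_trans ?_ ih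
      choose! v hv using fun m (hm : m < N) => haar_const hm
      obtain ⟨k, hk⟩ := burkholder_tangent hp (hε N) (∑ m ∈ Finset.range N, c m * v m)
        (∑ m ∈ Finset.range N, ε m * c m * v m)
      have hI := fun N => integrable_comp_haar_sums (continuous_burkholder hp) (Finset.range N) c
        (fun m => ε m * c m)
      have hh : Integrable (fun t => k * c N * haar N t) unitVol :=
        (Integrable.of_bound (measurable_haar N).aestronglyMeasurable 1
          (Filter.Eventually.of_forall fun t => haar_abs_le N t)).const_mul _
      have : ∫ t, burkholder p (∑ m ∈ Finset.range (N + 1), c m * haar m t)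
          (∑ m ∈ Finset.range (N + 1), ε m * c m * haar m t) ∂unitVol ≤
          ∫ t, (burkholder p (∑ m ∈ Finset.range N, c m * haar m t)
            (∑ m ∈ Finset.range N, ε m * c m * haar m t) + k * c N * haar N t) ∂unitVol := by
        refine integral_mono (hI (N + 1)) ((hI N).add hh) fun t => ?_
        simp only [Finset.sum_range_succ]
        by_cases ht : t ∈ dyadicIco N
        · have e : ∀ c : ℕ → ℝ, ∑ m ∈ Finset.range N, c m * haar m t =
              ∑ m ∈ Finset.range N, c m * v m := fun c =>
            Finset.sum_congr rfl fun m hm => by rw [hv m (Finset.mem_range.1 hm) t ht]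
          rw [e c, e fun m => ε m * c m]
          have := hk (c N * haar N t)
          rw [mul_assoc (ε N), mul_assoc k]
          exact this
        · simp [haar_eq_zero hN ht]
      rw [integral_add (hI N) hh, integral_const_mul, integral_haar hN, mul_zero, add_zero] at this
      exact this

theorem exists_haar_sign_bound (hp : 1 < p) : ∃ C : ℝ, 0 ≤ C ∧ ∀ (G : Finset ℕ) (c ε : ℕ → ℝ),
    (∀ m, ε m = 1 ∨ ε m = -1) → ∫ t, |∑ m ∈ G, ε m * c m * haar m t| ^ p ∂unitVol ≤
      C * ∫ t, |∑ m ∈ G, c m * haar m t| ^ p ∂unitVol := by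
  obtain ⟨a, C, ha, hC, H⟩ := burkholder_majorant hp
  refine ⟨C / a, by positivity, fun G c ε hε => ?_⟩
  obtain ⟨N, hN⟩ : ∃ N, G ⊆ Finset.range N := G.exists_nat_subset_range
  set c' : ℕ → ℝ := fun m => if m ∈ G then c m else 0
  have e1 : ∀ t, ∑ m ∈ G, c m * haar m t = ∑ m ∈ Finset.range N, c' m * haar m t := fun t => by
    rw [← Finset.sum_subset hN fun m _ hm => by simp [c', hm]]
    exact Finset.sum_congr rfl fun m hm => by simp [c', hm]
  have e2 : ∀ t, ∑ m ∈ G, ε m * c m * haar m t =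
      ∑ m ∈ Finset.range N, ε m * c' m * haar m t := fun t => by
    rw [← Finset.sum_subset hN fun m _ hm => by simp [c', hm]]
    exact Finset.sum_congr rfl fun m hm => by simp [c', hm]
  simp only [e1, e2]
  have h1 := integral_burkholder_le hp c' ε hε N
  have hp0 : 0 ≤ p := by linarith
  have hI1 := integrable_comp_haar_sums (Φ := fun z => |z.1| ^ p)
    (by fun_prop (disch := assumption)) (Finset.range N) c' fun m => ε m * c' m
  have hI2 := integrable_comp_haar_sums (Φ := fun z => |z.2| ^ p)
    (by fun_prop (disch := assumption)) (Finset.range N) c' fun m => ε m * c' m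
  have hI3 := integrable_comp_haar_sums (continuous_burkholder hp) (Finset.range N) c'
    fun m => ε m * c' m
  have h2 := integral_mono (hI2.const_mul a) (hI3.add (hI1.const_mul C)) fun t => H _ _
  simp only [Pi.add_apply] at h2
  rw [integral_add hI3 (hI1.const_mul C), integral_const_mul, integral_const_mul] at h2
  rw [div_mul_eq_mul_div, le_div_iff₀ ha]
  linarith

theorem exists_haar_subset_bound (hp : 1 < p) : ∃ C : ℝ, 0 ≤ C ∧ ∀ (F G : Finset ℕ) (c : ℕ → ℝ),
    F ⊆ G → ∫ t, |∑ m ∈ F, c m * haar m t| ^ p ∂unitVol ≤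
      C * ∫ t, |∑ m ∈ G, c m * haar m t| ^ p ∂unitVol := by
  obtain ⟨C, hC, H⟩ := exists_haar_sign_bound hp
  refine ⟨1 + C, by positivity, fun F G c hFG => ?_⟩
  have hp0 : 0 ≤ p := by linarith
  set ε : ℕ → ℝ := fun m => if m ∈ F then 1 else -1
  have hε : ∀ m, ε m = 1 ∨ ε m = -1 := fun m => by simp only [ε]; split_ifs <;> simp
  have h1 := H G c ε hε
  have e : ∀ t, ∑ m ∈ F, c m * haar m t =
      (∑ m ∈ G, c m * haar m t + ∑ m ∈ G, ε m * c m * haar m t) / 2 := fun t => by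
    rw [← Finset.sum_add_distrib, Finset.sum_div, ← Finset.sum_subset hFG fun m _ hm => by
      simp [ε, hm]]
    refine Finset.sum_congr rfl fun m hm => by simp [ε, hm]
  have hI1 := integrable_comp_haar_sums (Φ := fun z => |z.1| ^ p)
    (by fun_prop (disch := assumption)) G c fun m => ε m * c m
  have hI2 := integrable_comp_haar_sums (Φ := fun z => |z.2| ^ p)
    (by fun_prop (disch := assumption)) G c fun m => ε m * c m
  have hI3 := integrable_comp_haar_sums (Φ := fun z => |z.1| ^ p)
    (by fun_prop (disch := assumption)) F c fun m => ε m * c m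
  have h2 := integral_mono hI3 (hI1.add hI2) fun t => by
    simp only [Pi.add_apply, e]
    set x := ∑ m ∈ G, c m * haar m t
    set y := ∑ m ∈ G, ε m * c m * haar m t
    have h1 : |(x + y) / 2| ≤ max |x| |y| := by
      rw [abs_div, abs_two, div_le_iff₀ (by norm_num)]
      have := abs_add_le x y; have := le_max_left |x| |y|; have := le_max_right |x| |y|
      linarith
    refine (Real.rpow_le_rpow (abs_nonneg _) h1 hp0).trans ?_
    rcases max_choice |x| |y| with h | h <;> rw [h]
    · linarith [Real.rpow_nonneg (abs_nonneg y) p]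
    · linarith [Real.rpow_nonneg (abs_nonneg x) p]
  simp only [Pi.add_apply] at h2
  rw [integral_add hI1 hI2] at h2
  linarith

end Haar

end

section

section HaarLp

variable {p : ℝ}

theorem quaternion_norm_le (q : ℍ[ℝ]) : ‖q‖ ≤ (|q.re| + |q.imI|) + (|q.imJ| + |q.imK|) := by
  refine abs_le_of_sq_le_sq' ?_ (by positivity) |>.2
  rw [sq ‖q‖, ← Quaternion.normSq_eq_norm_mul_self, Quaternion.normSq_def',
    ← sq_abs q.re, ← sq_abs q.imI, ← sq_abs q.imJ, ← sq_abs q.imK]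
  have := abs_nonneg q.re; have := abs_nonneg q.imI
  have := abs_nonneg q.imJ; have := abs_nonneg q.imK
  have : 0 ≤ |q.re| * |q.imI| := by positivity
  have : 0 ≤ |q.re| * |q.imJ| := by positivity
  have : 0 ≤ |q.re| * |q.imK| := by positivity
  have : 0 ≤ |q.imI| * |q.imJ| := by positivity
  have : 0 ≤ |q.imI| * |q.imK| := by positivity
  have : 0 ≤ |q.imJ| * |q.imK| := by positivity
  nlinarith

theorem quaternion_coords_abs_le (q : ℍ[ℝ]) :
    |q.re| ≤ ‖q‖ ∧ |q.imI| ≤ ‖q‖ ∧ |q.imJ| ≤ ‖q‖ ∧ |q.imK| ≤ ‖q‖ := by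
  have h : q.re ^ 2 + q.imI ^ 2 + q.imJ ^ 2 + q.imK ^ 2 = ‖q‖ ^ 2 := by
    rw [sq ‖q‖, ← Quaternion.normSq_eq_norm_mul_self, Quaternion.normSq_def']
  refine ⟨?_, ?_, ?_, ?_⟩ <;> refine abs_le_of_sq_le_sq ?_ (norm_nonneg _) <;>
    nlinarith [sq_nonneg q.re, sq_nonneg q.imI, sq_nonneg q.imJ, sq_nonneg q.imK]

theorem quaternion_norm_rpow_le (hp : 1 < p) (q : ℍ[ℝ]) :
    ‖q‖ ^ p ≤ 2 ^ p * 2 ^ p * (|q.re| ^ p + |q.imI| ^ p + |q.imJ| ^ p + |q.imK| ^ p) := by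
  have h1 := Real.rpow_le_rpow (norm_nonneg q) (quaternion_norm_le q) (by linarith : 0 ≤ p)
  have h2 := add_rpow_le hp (x := |q.re| + |q.imI|) (y := |q.imJ| + |q.imK|) (by positivity)
    (by positivity)
  have h3 := add_rpow_le hp (abs_nonneg q.re) (abs_nonneg q.imI)
  have h4 := add_rpow_le hp (abs_nonneg q.imJ) (abs_nonneg q.imK)
  have h5 : (0 : ℝ) ≤ 2 ^ p := by positivity
  calc ‖q‖ ^ p ≤ _ := h1.trans h2
    _ ≤ 2 ^ p * (2 ^ p * (|q.re| ^ p + |q.imI| ^ p) + 2 ^ p * (|q.imJ| ^ p + |q.imK| ^ p)) := by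
      gcongr
    _ = _ := by ring

theorem quaternion_sum_smul_coords (G : Finset ℕ) (a : ℕ → ℝ) (c : ℕ → ℍ[ℝ]) :
    (∑ m ∈ G, a m • c m).re = ∑ m ∈ G, (c m).re * a m ∧
    (∑ m ∈ G, a m • c m).imI = ∑ m ∈ G, (c m).imI * a m ∧
    (∑ m ∈ G, a m • c m).imJ = ∑ m ∈ G, (c m).imJ * a m ∧
    (∑ m ∈ G, a m • c m).imK = ∑ m ∈ G, (c m).imK * a m := by
  induction G using Finset.induction_on with
  | empty => simp
  | insert m G hm ih =>
    obtain ⟨h1, h2, h3, h4⟩ := ih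
    simp [Finset.sum_insert hm, h1, h2, h3, h4, mul_comm]

theorem integrable_rpow_haar_sum (hp : 1 < p) {E : Type*} [NormedAddCommGroup E] [NormedSpace ℝ E]
    (G : Finset ℕ) (c : ℕ → E) : 
    Integrable (fun t => ‖∑ m ∈ G, haar m t • c m‖ ^ p) unitVol := by
  have hm : StronglyMeasurable fun t => ∑ m ∈ G, haar m t • c m :=
    Finset.stronglyMeasurable_fun_sum _ fun m _ =>
      (measurable_haar m).stronglyMeasurable.smul_const _
  refine Integrable.of_bound (hm.norm.measurable.pow_const p).aestronglyMeasurable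
    ((∑ m ∈ G, ‖c m‖) ^ p) (Filter.Eventually.of_forall fun t => ?_)
  rw [Real.norm_of_nonneg (by positivity)]
  exact Real.rpow_le_rpow (norm_nonneg _) (exists_forall_norm_sum_haar_le G c t) (by linarith)

theorem exists_haar_quaternion_bound (hp : 1 < p) : ∃ C : ℝ, 0 ≤ C ∧
    ∀ (F G : Finset ℕ) (c : ℕ → ℍ[ℝ]), F ⊆ G →
      ∫ t, ‖∑ m ∈ F, haar m t • c m‖ ^ p ∂unitVol ≤
        C * ∫ t, ‖∑ m ∈ G, haar m t • c m‖ ^ p ∂unitVol := by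
  obtain ⟨C, hC, H⟩ := exists_haar_subset_bound hp
  refine ⟨2 ^ p * 2 ^ p * (4 * C), by positivity, fun F G c hFG => ?_⟩
  have hI := fun (G : Finset ℕ) (c : ℕ → ℝ) => integrable_rpow_haar_sum hp G c
  simp only [smul_eq_mul, Real.norm_eq_abs, mul_comm (haar _ _)] at hI
  set I := ∫ t, ‖∑ m ∈ G, haar m t • c m‖ ^ p ∂unitVol
  have hG := integrable_rpow_haar_sum hp G c
  have hle : ∀ d : ℕ → ℝ, (∀ t, |∑ m ∈ G, d m * haar m t| ≤ ‖∑ m ∈ G, haar m t • c m‖) →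
      ∫ t, |∑ m ∈ F, d m * haar m t| ^ p ∂unitVol ≤ C * I := fun d hd => by
    refine (H F G d hFG).trans (mul_le_mul_of_nonneg_left ?_ hC)
    exact integral_mono (hI G d) hG fun t =>
      Real.rpow_le_rpow (abs_nonneg _) (hd t) (by linarith)
  have c1 := hle (fun m => (c m).re) fun t => by
    rw [← (quaternion_sum_smul_coords G (fun m => haar m t) c).1]
    exact (quaternion_coords_abs_le _).1
  have c2 := hle (fun m => (c m).imI) fun t => by
    rw [← (quaternion_sum_smul_coords G (fun m => haar m t) c).2.1]
    exact (quaternion_coords_abs_le _).2.1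
  have c3 := hle (fun m => (c m).imJ) fun t => by
    rw [← (quaternion_sum_smul_coords G (fun m => haar m t) c).2.2.1]
    exact (quaternion_coords_abs_le _).2.2.1
  have c4 := hle (fun m => (c m).imK) fun t => by
    rw [← (quaternion_sum_smul_coords G (fun m => haar m t) c).2.2.2]
    exact (quaternion_coords_abs_le _).2.2.2
  have hFI := hI F
  have := integral_mono (integrable_rpow_haar_sum hp F c)
    (((((hFI fun m => (c m).re).add (hFI fun m => (c m).imI)).add (hFI fun m => (c m).imJ)).add
      (hFI fun m => (c m).imK)).const_mul (2 ^ p * 2 ^ p)) fun t => by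
    have h := quaternion_norm_rpow_le hp (∑ m ∈ F, haar m t • c m)
    obtain ⟨h1, h2, h3, h4⟩ := quaternion_sum_smul_coords F (fun m => haar m t) c
    rw [h1, h2, h3, h4] at h
    simpa only [Pi.add_apply] using h
  refine this.trans ?_
  rw [integral_const_mul]
  refine (mul_le_mul_of_nonneg_left ?_ (by positivity) :
    _ ≤ 2 ^ p * 2 ^ p * (4 * (C * I))).trans (le_of_eq (by ring))
  rw [integral_add' (((hFI _).add (hFI _)).add (hFI _)) (hFI _), integral_add' ((hFI _).add (hFI _))
    (hFI _), integral_add' (hFI _) (hFI _)]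
  linarith

theorem memLp_of_real {f : ℝ → ℝ} (hf : Measurable f) {M : ℝ} (hM : ∀ t, |f t| ≤ M) (c : ℍ[ℝ]) :
    MemLp (fun t => f t • c) (ENNReal.ofReal p) unitVol :=
  MemLp.of_bound (hf.stronglyMeasurable.smul_const c).aestronglyMeasurable (M * ‖c‖)
    (Filter.Eventually.of_forall fun t => by
      rw [norm_smul]; exact mul_le_mul_of_nonneg_right (hM t) (norm_nonneg _))

variable [Fact (1 ≤ ENNReal.ofReal p)]

/-- The Haar functions as quaternion valued `L^p` functions. -/
noncomputable def haarLp (p : ℝ) [Fact (1 ≤ ENNReal.ofReal p)] (n : ℕ) :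
    Lp ℍ[ℝ] (ENNReal.ofReal p) unitVol :=
  (memLp_of_real (measurable_haar n) (haar_abs_le n) 1).toLp _

theorem coeFn_sum_haarLp (F : Finset ℕ) (c : ℕ → ℍ[ℝ]) :
    ⇑(∑ m ∈ F, c m • haarLp p m) =ᵐ[unitVol] fun t => ∑ m ∈ F, haar m t • c m := by
  induction F using Finset.induction_on with
  | empty =>
    simp only [Finset.sum_empty]
    exact Lp.coeFn_zero ℍ[ℝ] (ENNReal.ofReal p) unitVol
  | insert m F hm ih =>
    rw [Finset.sum_insert hm]
    filter_upwards [Lp.coeFn_add (c m • haarLp p m) (∑ m ∈ F, c m • haarLp p m), ih,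
      Lp.coeFn_smul (c m) (haarLp p m),
      (memLp_of_real (p := p) (measurable_haar m) (haar_abs_le m) 1).coeFn_toLp] with t h1 h2 h3 h4
    rw [h1, Pi.add_apply, h2, h3, Finset.sum_insert hm, Pi.smul_apply, haarLp, h4]
    simp only [smul_eq_mul, mul_smul_comm, mul_one]

theorem exists_haarLp_bound (hp : 1 < p) : ∃ C : ℝ, ∀ (F G : Finset ℕ) (c : ℕ → ℍ[ℝ]), F ⊆ G →
    ‖∑ m ∈ F, c m • haarLp p m‖ ≤ C * ‖∑ m ∈ G, c m • haarLp p m‖ := by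
  obtain ⟨C, hC, H⟩ := exists_haar_quaternion_bound hp
  refine ⟨C ^ p⁻¹, fun F G c hFG => ?_⟩
  have hp0 : p ≠ 0 := by linarith
  have e : ∀ F : Finset ℕ, ‖∑ m ∈ F, c m • haarLp p m‖ ^ p =
      ∫ t, ‖∑ m ∈ F, haar m t • c m‖ ^ p ∂unitVol := fun F => by
    rw [norm_rpow_eq_integral hp]
    exact integral_congr_ae ((coeFn_sum_haarLp (p := p) F c).mono fun t ht => by simp only [ht])
  rw [← Real.rpow_le_rpow_iff (norm_nonneg _) (by positivity) (by linarith : 0 < p),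
    Real.mul_rpow (by positivity) (norm_nonneg _), Real.rpow_inv_rpow hC hp0, e, e]
  exact H F G c hFG

theorem haarLp_ne_zero (n : ℕ) : haarLp p n ≠ 0 := by
  intro h
  have h1 : haar n =ᵐ[unitVol] 0 := by
    filter_upwards [(memLp_of_real (p := p) (measurable_haar n) (haar_abs_le n) 1).coeFn_toLp,
      Lp.coeFn_zero ℍ[ℝ] (ENNReal.ofReal p) unitVol] with t h1 h2
    rw [haarLp] at h
    rw [h, h2] at h1
    simpa using h1.symm
  rcases eq_or_ne n 0 with rfl | hn
  · rw [haar_zero] at h1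
    have := h1.exists
    simp at this
  · have h2 : unitVol (dyadicIco (2 * n)) = 0 := by
      refine measure_mono_null (fun t ht => ?_) (ae_iff.1 h1)
      simp [haar_of_ne hn, ht, Set.disjoint_left.1 (disjoint_dyadicIco_siblings hn) ht]
    rw [unitVol_dyadicIco (by omega), ENNReal.ofReal_eq_zero] at h2
    have : (0 : ℝ) < (2 ^ Nat.log 2 (2 * n))⁻¹ := by positivity
    linarith

def InHaarSpan (p : ℝ) [Fact (1 ≤ ENNReal.ofReal p)] (f : ℝ → ℍ[ℝ]) : Prop :=
  ∃ hf : MemLp f (ENNReal.ofReal p) unitVol,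
    hf.toLp f ∈ Submodule.span ℍ[ℝ] (Set.range (haarLp p))

theorem InHaarSpan.add {f g : ℝ → ℍ[ℝ]} (hf : InHaarSpan p f) (hg : InHaarSpan p g) :
    InHaarSpan p (f + g) :=
  ⟨hf.1.add hg.1, by rw [MemLp.toLp_add hf.1 hg.1]; exact add_mem hf.2 hg.2⟩

theorem InHaarSpan.const_smul {f : ℝ → ℍ[ℝ]} (c : ℍ[ℝ]) (hf : InHaarSpan p f) :
    InHaarSpan p (c • f) :=
  ⟨hf.1.const_smul c, by rw [MemLp.toLp_const_smul c hf.1]; exact Submodule.smul_mem _ c hf.2⟩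

theorem inHaarSpan_haar (n : ℕ) : InHaarSpan p (fun t => haar n t • 1) :=
  ⟨memLp_of_real (measurable_haar n) (haar_abs_le n) 1, Submodule.subset_span ⟨n, rfl⟩⟩

theorem InHaarSpan.congr {f g : ℝ → ℍ[ℝ]} (hf : InHaarSpan p f) (h : f =ᵐ[unitVol] g) :
    InHaarSpan p g :=
  ⟨hf.1.ae_eq h, by rw [← (MemLp.toLp_eq_toLp_iff hf.1 (hf.1.ae_eq h)).2 h]; exact hf.2⟩

theorem inHaarSpan_dyadicIco {n : ℕ} (hn : n ≠ 0) :
    InHaarSpan p ((dyadicIco n).indicator fun _ => 1) := by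
  induction n using Nat.strong_induction_on with
  | _ n ih =>
    rcases Nat.lt_or_ge n 2 with h | h
    · obtain rfl : n = 1 := by omega
      refine (inHaarSpan_haar 0).congr ?_
      filter_upwards [ae_restrict_mem measurableSet_Ico] with t ht
      rw [dyadicIco_one, Set.indicator_of_mem ht]
      simp [haar_zero]
    · have hq : (2⁻¹ : ℍ[ℝ]) + 2⁻¹ = 1 := by
        have h2 : (2 : ℍ[ℝ]) ≠ 0 := fun h => by
          have := congrArg (fun q : ℍ[ℝ] => q.re) (one_add_one_eq_two.trans h)
          exact two_ne_zero (one_add_one_eq_two.symm.trans this : (2 : ℝ) = 0)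
        rw [← two_mul, mul_inv_cancel₀ h2]
      have hm : n / 2 ≠ 0 := by omega
      have h1 := ih (n / 2) (by omega) hm
      have h2 := inHaarSpan_haar (p := p) (n / 2)
      have hd : ∀ t, t ∈ dyadicIco (2 * (n / 2)) → t ∉ dyadicIco (2 * (n / 2) + 1) := fun t =>
        fun h => Set.disjoint_left.1 (disjoint_dyadicIco_siblings hm) h
      rcases Nat.even_or_odd' n with ⟨k, hk | hk⟩
      · refine (((h1.const_smul 2⁻¹).add (h2.const_smul 2⁻¹))).congr
          (Filter.Eventually.of_forall fun t => ?_)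
        have := hd t
        have h3 := mem_dyadicIco_iff hm t
        rw [show 2 * (n / 2) = n by omega] at this h3
        simp only [Pi.add_apply, Pi.smul_apply, Set.indicator, haar_of_ne hm, Pi.sub_apply,
          show 2 * (n / 2) = n by omega, Pi.one_apply, smul_eq_mul]
        by_cases a : t ∈ dyadicIco n
        · simp [h3, a, this a, hq]
        · by_cases b : t ∈ dyadicIco (n + 1) <;> simp [h3, a, b]
      · refine (((h1.const_smul 2⁻¹).add (h2.const_smul (-2⁻¹)))).congr
          (Filter.Eventually.of_forall fun t => ?_)
        have := hd t
        have h3 := mem_dyadicIco_iff hm t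
        rw [show 2 * (n / 2) + 1 = n by omega] at this h3
        simp only [Pi.add_apply, Pi.smul_apply, Set.indicator, haar_of_ne hm, Pi.sub_apply,
          show 2 * (n / 2) + 1 = n by omega, Pi.one_apply, smul_eq_mul]
        by_cases a : t ∈ dyadicIco (2 * (n / 2))
        · simp [h3, a, this a]
        · by_cases b : t ∈ dyadicIco n <;> simp [h3, a, b, hq]

theorem inHaarSpan_sum (F : Finset ℕ) (hF : ∀ n ∈ F, n ≠ 0) (c : ℕ → ℍ[ℝ]) :
    InHaarSpan p (∑ n ∈ F, c n • (dyadicIco n).indicator fun _ => (1 : ℍ[ℝ])) := by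
  induction F using Finset.induction_on with
  | empty => exact ⟨MemLp.zero, by simp⟩
  | insert m F hm ih =>
    rw [Finset.sum_insert hm]
    exact ((inHaarSpan_dyadicIco (hF m (by simp))).const_smul _).add
      (ih fun n hn => hF n (by simp [hn]))

theorem exists_inHaarSpan_near {g : ℝ → ℍ[ℝ]} (hg : Continuous g) {δ : ℝ} (hδ : 0 < δ) :
    ∃ s, InHaarSpan p s ∧ ∀ t ∈ Set.Ico (0 : ℝ) 1, ‖g t - s t‖ ≤ δ := by
  have huc := isCompact_Icc.uniformContinuousOn_of_continuous (s := Set.Icc (0 : ℝ) 1)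
    hg.continuousOn
  obtain ⟨η, hη, H⟩ := Metric.uniformContinuousOn_iff.1 huc δ hδ
  obtain ⟨l, hl⟩ := exists_pow_lt_of_lt_one hη (by norm_num : (1 / 2 : ℝ) < 1)
  set c : ℕ → ℍ[ℝ] := fun n => g ((n : ℝ) / 2 ^ l - 1)
  refine ⟨_, inHaarSpan_sum (Finset.Ico (2 ^ l) (2 ^ (l + 1))) (fun n hn => ?_) c,
    fun t ht => ?_⟩
  · have := (Finset.mem_Ico.1 hn).1
    have : 0 < 2 ^ l := by positivity
    omega
  · set n₀ := ⌊2 ^ l * (1 + t)⌋₊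
    have hpos : (0 : ℝ) < 2 ^ l := by positivity
    have h0 : 0 ≤ 2 ^ l * (1 + t) := mul_nonneg hpos.le (by linarith [ht.1])
    have hlog : ∀ n ∈ Finset.Ico (2 ^ l) (2 ^ (l + 1)), Nat.log 2 n = l := fun n hn => by
      rw [Finset.mem_Ico] at hn
      exact Nat.log_eq_of_pow_le_of_lt_pow hn.1 hn.2
    have hmem : ∀ n ∈ Finset.Ico (2 ^ l) (2 ^ (l + 1)), t ∈ dyadicIco n ↔ n = n₀ := fun n hn => by
      rw [dyadicIco, Set.mem_ofPred_eq, hlog n hn, eq_comm, Nat.floor_eq_iff h0]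
    have hn₀ : n₀ ∈ Finset.Ico (2 ^ l) (2 ^ (l + 1)) := by
      rw [Finset.mem_Ico]
      constructor
      · refine Nat.le_floor ?_
        push_cast
        nlinarith [ht.1]
      · rw [Nat.floor_lt h0]
        push_cast
        rw [pow_succ]
        nlinarith [ht.2]
    have hval : (∑ n ∈ Finset.Ico (2 ^ l) (2 ^ (l + 1)),
        c n • (dyadicIco n).indicator fun _ => (1 : ℍ[ℝ])) t = c n₀ := by
      rw [Finset.sum_apply, Finset.sum_eq_single_of_mem n₀ hn₀]
      · simp [(hmem n₀ hn₀).2 rfl]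
      · intro n hn hne
        simp [mt (hmem n hn).1 hne]
    rw [hval, ← dist_eq_norm]
    have h1 := Nat.floor_le h0
    have h2 := Nat.lt_floor_add_one (2 ^ l * (1 + t))
    have h3 : (2 ^ l : ℝ) ≤ n₀ := by exact_mod_cast (Finset.mem_Ico.1 hn₀).1
    have h4 : (n₀ : ℝ) / 2 ^ l - 1 ≤ t := by
      rw [sub_le_iff_le_add, div_le_iff₀ hpos]; linarith
    have h5 : t < (n₀ : ℝ) / 2 ^ l - 1 + (1 / 2) ^ l := by
      rw [one_div, inv_pow]
      have : t < (n₀ + 1 : ℝ) / 2 ^ l - 1 := by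
        rw [lt_sub_iff_add_lt, lt_div_iff₀ hpos]; linarith
      rw [add_div, one_div] at this
      linarith
    refine (H t ⟨ht.1, ht.2.le⟩ _ ⟨?_, ?_⟩ ?_).le
    · rw [sub_nonneg, le_div_iff₀ hpos]; linarith
    · linarith [ht.2]
    · rw [Real.dist_eq, abs_of_nonneg (by linarith)]
      linarith

theorem dense_span_haarLp :
    Dense (Submodule.span ℍ[ℝ] (Set.range (haarLp p)) : Set (Lp ℍ[ℝ] (ENNReal.ofReal p) unitVol)) := by
  intro v
  rw [Metric.mem_closure_iff]
  intro ε hε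
  obtain ⟨g, hg, hg'⟩ := (Lp.memLp v).exists_boundedContinuous_eLpNorm_sub_le ENNReal.ofReal_ne_top
    (ε := ENNReal.ofReal (ε / 4)) (by simpa using hε)
  obtain ⟨s, hs, hs'⟩ := exists_inHaarSpan_near (p := p) g.continuous (δ := ε / 4) (by linarith)
  refine ⟨_, hs.2, ?_⟩
  have h1 : edist v (hg'.toLp g) ≤ ENNReal.ofReal (ε / 4) := by
    rw [Lp.edist_def]
    refine le_trans (le_of_eq (eLpNorm_congr_ae ?_)) hg
    filter_upwards [hg'.coeFn_toLp] with t ht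
    simp [ht]
  have h2 : edist (hg'.toLp g) (hs.1.toLp s) ≤ ENNReal.ofReal (ε / 4) := by
    rw [Lp.edist_toLp_toLp]
    refine (eLpNorm_le_of_ae_bound (C := ε / 4) ?_).trans (by simp)
    filter_upwards [ae_restrict_mem measurableSet_Ico] with t ht
    exact hs' t ht
  rw [edist_dist, ENNReal.ofReal_le_ofReal_iff (by linarith)] at h1 h2
  linarith [dist_triangle v (hg'.toLp g) (hs.1.toLp s)]

end HaarLp

end

section

section Isomorphism

open ProbabilityTheory in
theorem exists_inverse_cdf (μ : Measure ℝ) [IsProbabilityMeasure μ] [NullSingletonClass μ] :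
    ∃ (θ φ : ℝ → ℝ), MeasurePreserving θ μ unitVol ∧ MeasurePreserving φ unitVol μ ∧
      (∀ᵐ x ∂μ, φ (θ x) = x) ∧ ∀ᵐ t ∂unitVol, θ (φ t) = t := by
  set F : ℝ → ℝ := fun x => cdf μ x
  have hmono : Monotone F := monotone_cdf μ
  have hF : ∀ x, μ (Set.Iic x) = ENNReal.ofReal (F x) := fun x => (ofReal_cdf μ x).symm
  have hcont : ∀ x u : ℝ, (∀ y < x, F y ≤ u) → F x ≤ u := by
    intro x u h
    have h1 : Function.leftLim F x = F x := by
      have h2 := (cdf μ).measure_singleton x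
      rw [measure_cdf, measure_singleton] at h2
      have h3 := (hmono.leftLim_le (le_refl x))
      have h4 : F x - Function.leftLim F x ≤ 0 := ENNReal.ofReal_eq_zero.1 h2.symm
      linarith
    rw [← h1]
    exact le_of_tendsto (hmono.tendsto_leftLim x) (by
      filter_upwards [self_mem_nhdsWithin] with y hy using h y hy)
  set G : ℝ → ℝ := fun u => sInf {x | u ≤ F x}
  have hgal : ∀ u ∈ Set.Ioo (0 : ℝ) 1, ∀ x, G u ≤ x ↔ u ≤ F x := by
    intro u hu x
    have hne : {x | u ≤ F x}.Nonempty := by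
      obtain ⟨y, hy⟩ := ((tendsto_cdf_atTop μ).eventually (lt_mem_nhds hu.2)).exists
      exact ⟨y, hy.le⟩
    have hbdd : BddBelow {x | u ≤ F x} := by
      obtain ⟨y, hy⟩ := ((tendsto_cdf_atBot μ).eventually (gt_mem_nhds hu.1)).exists
      exact ⟨y, fun z hz => by
        by_contra hlt
        have h1 : u ≤ F z := hz
        have h2 := hmono (not_le.1 hlt).le
        have h3 : F y < u := hy
        linarith⟩
    constructor
    · intro h
      refine le_trans ?_ (hmono h)
      refine ge_of_tendsto (((cdf μ).right_continuous (G u)).tendsto.mono_left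
        (nhdsWithin_mono _ Set.Ioi_subset_Ici_self)) ?_
      filter_upwards [self_mem_nhdsWithin] with y hy
      obtain ⟨z, hz, hzy⟩ := exists_lt_of_csInf_lt hne (show sInf _ < y from hy)
      exact le_trans hz (hmono hzy.le)
    · intro h
      exact csInf_le hbdd h
  have hFG : ∀ u ∈ Set.Ioo (0 : ℝ) 1, F (G u) = u := by
    intro u hu
    refine le_antisymm (hcont _ _ fun y hy => ?_) ((hgal u hu _).1 le_rfl)
    by_contra h
    exact absurd ((hgal u hu y).2 (not_le.1 h).le) (not_le.2 hy)
  have hae : ∀ᵐ u ∂unitVol, u ∈ Set.Ioo (0 : ℝ) 1 := by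
    rw [unitVol, ← restrict_Ioo_eq_restrict_Ico]
    exact ae_restrict_mem measurableSet_Ioo
  have hGm : AEMeasurable G unitVol := by
    rw [unitVol, ← restrict_Ioo_eq_restrict_Ico]
    refine aemeasurable_restrict_of_monotoneOn measurableSet_Ioo fun u hu v hv huv => ?_
    exact (hgal u hu _).2 (huv.trans ((hgal v hv _).1 le_rfl))
  obtain ⟨φ, hφm, hφG⟩ := hGm
  have hFm : Measurable F := hmono.measurable
  have hφ : unitVol.map φ = μ := by
    have : IsProbabilityMeasure (unitVol.map φ) := Measure.isProbabilityMeasure_map hφm.aemeasurable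
    refine Measure.ext_of_Iic _ _ fun x => ?_
    rw [Measure.map_apply hφm measurableSet_Iic, hF]
    have : (φ ⁻¹' Set.Iic x : Set ℝ) =ᵐ[unitVol] Set.Iic (F x) := by
      filter_upwards [hφG, hae] with u h1 h2
      refine propext ?_
      change φ u ≤ x ↔ u ≤ F x
      rw [← h1, hgal u h2]
    rw [measure_congr this, Measure.restrict_apply measurableSet_Iic]
    have h0 : 0 ≤ F x := cdf_nonneg μ x
    have h1 : F x ≤ 1 := cdf_le_one μ x
    refine le_antisymm ?_ ?_
    · refine (measure_mono (t := Set.Icc 0 (F x)) fun u hu => ⟨hu.2.1, hu.1⟩).trans ?_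
      simp
    · refine le_trans ?_ (measure_mono (s := Set.Ico 0 (F x)) fun u hu =>
        ⟨hu.2.le, hu.1, hu.2.trans_le h1⟩)
      simp
  have hFφ : ∀ᵐ u ∂unitVol, F (φ u) = u := by
    filter_upwards [hφG, hae] with u h1 h2
    rw [← h1, hFG u h2]
  refine ⟨F, φ, ⟨hFm, ?_⟩, ⟨hφm, hφ⟩, ?_, hFφ⟩
  · rw [← hφ, Measure.map_map hFm hφm, Measure.map_congr (f := F ∘ φ) (g := id) hFφ, Measure.map_id]
  · rw [← hφ]
    refine (ae_map_iff hφm.aemeasurable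
      (measurableSet_eq_fun (hφm.comp hFm) measurable_id)).2 ?_
    filter_upwards [hFφ] with u hu
    simp [hu]

/-- Atomless standard probability spaces are isomorphic mod null sets to `[0,1)`. -/
theorem exists_ae_iso_unitVol {Ω : Type*} [MeasurableSpace Ω] (e : Ω ≃ᵐ ℝ) (μ : Measure Ω)
    [IsProbabilityMeasure μ] [NullSingletonClass μ] :
    ∃ (θ : Ω → ℝ) (φ : ℝ → Ω), MeasurePreserving θ μ unitVol ∧ MeasurePreserving φ unitVol μ ∧
      (∀ᵐ x ∂μ, φ (θ x) = x) ∧ ∀ᵐ t ∂unitVol, θ (φ t) = t := by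
  have : IsProbabilityMeasure (μ.map e) := Measure.isProbabilityMeasure_map e.measurable.aemeasurable
  have : NullSingletonClass (μ.map e) := ⟨fun x => by
    rw [e.map_apply, show e ⁻¹' {x} = {e.symm x} by ext y; simp [e.eq_symm_apply],
      measure_singleton]⟩
  obtain ⟨θ, φ, h1, h2, h3, h4⟩ := exists_inverse_cdf (μ.map e)
  have he : MeasurePreserving e μ (μ.map e) := ⟨e.measurable, rfl⟩
  refine ⟨θ ∘ e, e.symm ∘ φ, h1.comp he, (he.symm e).comp h2, ?_, ?_⟩
  · filter_upwards [he.quasiMeasurePreserving.ae h3] with x hx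
    simp [hx]
  · filter_upwards [h4] with t ht
    simp [ht]

/-- Atomless standard probability spaces are isomorphic mod null sets. -/
theorem exists_ae_iso {Ω Ω' : Type*} [MeasurableSpace Ω] [MeasurableSpace Ω'] (e : Ω ≃ᵐ ℝ)
    (e' : Ω' ≃ᵐ ℝ) (μ : Measure Ω) [IsProbabilityMeasure μ] [NullSingletonClass μ] (μ' : Measure Ω')
    [IsProbabilityMeasure μ'] [NullSingletonClass μ'] :
    ∃ (α : Ω → Ω') (β : Ω' → Ω), MeasurePreserving α μ μ' ∧ MeasurePreserving β μ' μ ∧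
      (∀ᵐ x ∂μ, β (α x) = x) ∧ ∀ᵐ t ∂μ', α (β t) = t := by
  obtain ⟨θ, φ, h1, h2, h3, h4⟩ := exists_ae_iso_unitVol e μ
  obtain ⟨θ', φ', h1', h2', h3', h4'⟩ := exists_ae_iso_unitVol e' μ'
  refine ⟨φ' ∘ θ, φ ∘ θ', h2'.comp h1, h2.comp h1', ?_, ?_⟩
  · filter_upwards [h1.quasiMeasurePreserving.ae h4', h3] with x h5 h6
    simp [h5, h6]
  · filter_upwards [h1'.quasiMeasurePreserving.ae h4, h3'] with x h5 h6
    simp [h5, h6]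

end Isomorphism

end

section

/-- The rotation invariant probability measure on the unit sphere of the quaternions. -/
structure IsSphereMeasure (ψ : Measure ℍ[ℝ]) : Prop where
  sphere_eq_one : ψ (sphere (0 : ℍ[ℝ]) 1) = 1
  compl_sphere : ψ (sphere (0 : ℍ[ℝ]) 1)ᶜ = 0
  map_eq : ∀ T : ℍ[ℝ] ≃ₗᵢ[ℝ] ℍ[ℝ], ψ.map T = ψ

/-- Left multiplication by a unit quaternion. -/
noncomputable def mulLeftIsometry (u : ℍ[ℝ]) (hu : ‖u‖ = 1) : ℍ[ℝ] ≃ₗᵢ[ℝ] ℍ[ℝ] :=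
  LinearIsometryEquiv.ofSurjective
    { toLinearMap := LinearMap.mulLeft ℝ u
      norm_map' := fun x => by simp [hu] }
    (fun y => ⟨u⁻¹ * y, by
      have : u ≠ 0 := fun h => by simp [h] at hu
      simp [mul_inv_cancel_left₀ this]⟩)

@[simp] theorem mulLeftIsometry_apply (u : ℍ[ℝ]) (hu : ‖u‖ = 1) (x : ℍ[ℝ]) :
    mulLeftIsometry u hu x = u * x := rfl

/-- Right multiplication by a unit quaternion. -/
noncomputable def mulRightIsometry (u : ℍ[ℝ]) (hu : ‖u‖ = 1) : ℍ[ℝ] ≃ₗᵢ[ℝ] ℍ[ℝ] :=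
  LinearIsometryEquiv.ofSurjective
    { toLinearMap := LinearMap.mulRight ℝ u
      norm_map' := fun x => by simp [hu] }
    (fun y => ⟨y * u⁻¹, by
      have : u ≠ 0 := fun h => by simp [h] at hu
      simp [mul_assoc, inv_mul_cancel₀ this]⟩)

@[simp] theorem mulRightIsometry_apply (u : ℍ[ℝ]) (hu : ‖u‖ = 1) (x : ℍ[ℝ]) :
    mulRightIsometry u hu x = x * u := rfl

/-- Quaternion conjugation as an isometry. -/
noncomputable def starIsometry : ℍ[ℝ] ≃ₗᵢ[ℝ] ℍ[ℝ] where
  toLinearEquiv := { (starAddEquiv : ℍ[ℝ] ≃+ ℍ[ℝ]) with map_smul' := fun r x => by simp }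
  norm_map' := fun x => norm_star x

@[simp] theorem starIsometry_apply (x : ℍ[ℝ]) : starIsometry x = star x := rfl

theorem self_mul_star_of_norm_eq_one {u : ℍ[ℝ]} (hu : ‖u‖ = 1) : u * star u = 1 := by
  rw [Quaternion.self_mul_star, Quaternion.normSq_eq_norm_mul_self, hu]; simp

theorem star_mul_self_of_norm_eq_one {u : ℍ[ℝ]} (hu : ‖u‖ = 1) : star u * u = 1 := by
  rw [Quaternion.star_mul_self, Quaternion.normSq_eq_norm_mul_self, hu]; simp

theorem infinite_sphere : (sphere (0 : ℍ[ℝ]) 1).Infinite := by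
  refine (isPreconnected_sphere ?_ 0 1).infinite_of_nontrivial ⟨1, by simp, -1, by simp, fun h => ?_⟩
  · rw [Quaternion.rank_eq_four]; norm_num
  · have := congrArg (fun q : ℍ[ℝ] => q.re) h
    simp at this
    linarith

namespace IsSphereMeasure

variable {ψ : Measure ℍ[ℝ]}

theorem isProbabilityMeasure (hψ : IsSphereMeasure ψ) : IsProbabilityMeasure ψ :=
  ⟨by rw [← measure_add_measure_compl (s := sphere (0 : ℍ[ℝ]) 1) isClosed_sphere.measurableSet,
    hψ.sphere_eq_one, hψ.compl_sphere, add_zero]⟩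

theorem ae_norm (hψ : IsSphereMeasure ψ) : ∀ᵐ y ∂ψ, ‖y‖ = 1 := by
  rw [ae_iff]
  convert hψ.compl_sphere using 2
  ext y
  simp

theorem measurePreserving (hψ : IsSphereMeasure ψ) (T : ℍ[ℝ] ≃ₗᵢ[ℝ] ℍ[ℝ]) :
    MeasurePreserving T ψ ψ := ⟨T.continuous.measurable, hψ.map_eq T⟩

theorem nullSingletonClass (hψ : IsSphereMeasure ψ) : NullSingletonClass ψ := by
  refine ⟨fun x => ?_⟩
  by_cases hx : ‖x‖ = 1
  · by_contra h
    have h1 : ∀ y ∈ sphere (0 : ℍ[ℝ]) 1, ψ {x} ≤ ψ {y} := fun y hy => by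
      rw [mem_sphere_zero_iff_norm] at hy
      have hn : ‖y * x⁻¹‖ = 1 := by simp [hx, hy]
      have hx0 : x ≠ 0 := fun h => by simp [h] at hx
      have := (hψ.measurePreserving (mulLeftIsometry _ hn)).measure_preimage
        (measurableSet_singleton y).nullMeasurableSet
      rw [← this]
      refine measure_mono fun z hz => ?_
      rw [Set.mem_singleton_iff] at hz
      simp [hz, mul_assoc, inv_mul_cancel₀ hx0]
    have := infinite_sphere.meas_eq_top (μ := ψ) ⟨_, h, h1⟩
    rw [hψ.sphere_eq_one] at this
    exact ENNReal.one_ne_top this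
  · exact measure_mono_null (by simpa using hx) hψ.compl_sphere

end IsSphereMeasure

end

section

theorem hasSum_of_tsum_ofReal {f : ℕ → ℝ} {s : ℝ} (hf : ∀ n, 0 ≤ f n) (hs : 0 ≤ s)
    (h : ENNReal.ofReal s = ∑' n, ENNReal.ofReal (f n)) : HasSum f s := by
  have h1 : ∑' n, ENNReal.ofReal (f n) ≠ ⊤ := h ▸ ENNReal.ofReal_ne_top
  have h2 := ENNReal.hasSum_toReal h1
  rw [← ENNReal.tsum_toReal_eq (fun n => ENNReal.ofReal_ne_top), ← h,
    ENNReal.toReal_ofReal hs] at h2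
  simpa only [ENNReal.toReal_ofReal (hf _)] using h2

theorem exists_linearMap_comp {α β 𝕜 E : Type*} {mα : MeasurableSpace α} {mβ : MeasurableSpace β}
    [NormedRing 𝕜] [NormedAddCommGroup E] [Module 𝕜 E] [IsBoundedSMul 𝕜 E] {P : ℝ≥0∞}
    {μ : Measure α} {ν : Measure β} {q : α → β} (hq : Measurable q) {C : ℝ≥0∞} (hC : C ≠ ⊤)
    (h : μ.map q ≤ C • ν) :
    ∃ T : Lp E P ν →ₗ[𝕜] Lp E P μ, ∀ v, T v =ᵐ[μ] fun x => v (q x) := by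
  have hqm : Measure.QuasiMeasurePreserving q μ ν :=
    ⟨hq, (Measure.absolutelyContinuous_of_le h).trans (Measure.smul_absolutelyContinuous)⟩
  have hm : ∀ v : Lp E P ν, MemLp (fun x => v (q x)) P μ := fun v =>
    (memLp_map_measure_iff ((Lp.aestronglyMeasurable v).mono_ac hqm.absolutelyContinuous)
      hq.aemeasurable).1 ((Lp.memLp v).of_measure_le_smul hC h)
  refine ⟨{ toFun := fun v => (hm v).toLp _
            map_add' := fun v w => ?_
            map_smul' := fun c v => ?_ }, fun v => (hm v).coeFn_toLp⟩
  · rw [← MemLp.toLp_add]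
    exact MemLp.toLp_congr _ _ (hqm.ae (Lp.coeFn_add v w))
  · rw [RingHom.id_apply, ← MemLp.toLp_const_smul]
    exact MemLp.toLp_congr _ _ (hqm.ae (Lp.coeFn_smul c v))

section

variable {ψ : Measure ℍ[ℝ]} {p : ℝ} 

theorem not_countable_quaternion : ¬ Countable ℍ[ℝ] := fun h => by
  have : Function.Injective (fun r : ℝ => (r : ℍ[ℝ])) := fun a b h => by
    simpa using congrArg (fun q : ℍ[ℝ] => q.re) h
  exact not_countable_iff.2 inferInstance this.countable

theorem exists_linearIsometry_unitVol (hψ : IsSphereMeasure ψ) :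
    ∃ Ψ : Lp ℍ[ℝ] (ENNReal.ofReal p) ψ →ₗ[ℍ[ℝ]] Lp ℍ[ℝ] (ENNReal.ofReal p) unitVol,
      (∀ v, ‖Ψ v‖ = ‖v‖) ∧ Function.Surjective Ψ := by
  have := hψ.isProbabilityMeasure
  have := hψ.nullSingletonClass
  have hR : ¬ Countable ℝ := not_countable_iff.2 inferInstance
  obtain ⟨θ, φ, hθ, hφ, h1, h2⟩ := exists_ae_iso_unitVol
    (PolishSpace.measurableEquivOfNotCountable not_countable_quaternion hR) ψ
  refine ⟨Lp.compMeasurePreservingₗ ℍ[ℝ] φ hφ, fun v => Lp.norm_compMeasurePreserving v hφ,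
    fun w => ⟨Lp.compMeasurePreserving θ hθ w, ?_⟩⟩
  refine Lp.ext ?_
  have e1 := Lp.coeFn_compMeasurePreserving (Lp.compMeasurePreserving θ hθ w) hφ
  have e2 := hφ.quasiMeasurePreserving.ae (Lp.coeFn_compMeasurePreserving w hθ)
  filter_upwards [e1, e2, h2] with t h3 h4 h5
  refine Eq.trans h3 ?_
  rw [Function.comp_apply, h4, Function.comp_apply, h5]

theorem exists_sequence_maps [Fact (1 ≤ ENNReal.ofReal p)] (hψ : IsSphereMeasure ψ) (hp : 1 < p) :
    ∃ R : ℕ → Lp ℍ[ℝ] (ENNReal.ofReal p) ψ →ₗ[ℍ[ℝ]] Lp ℍ[ℝ] (ENNReal.ofReal p) ψ,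
      (∀ v, HasSum (fun n => ‖R n v‖ ^ p) (‖v‖ ^ p)) ∧
      ∀ u : ℕ → Lp ℍ[ℝ] (ENNReal.ofReal p) ψ, Summable (fun n => ‖u n‖ ^ p) →
        ∃ v, ∀ n, R n v = u n := by
  have := hψ.isProbabilityMeasure
  have := hψ.nullSingletonClass
  have hp0 : p ≠ 0 := by linarith
  set a : ℕ → ℝ := fun n => (1 / 2) ^ (n + 1) with ha
  have ha0 : ∀ n, 0 < a n := fun n => by positivity
  set A : ℕ → ℝ≥0∞ := fun n => ENNReal.ofReal (a n) with hA
  have hA0 : ∀ n, A n ≠ 0 := fun n => by simpa [hA] using ha0 n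
  have hAt : ∀ n, A n ≠ ⊤ := fun n => ENNReal.ofReal_ne_top
  have hmk : ∀ n : ℕ, Measurable (Prod.mk n : ℍ[ℝ] → ℕ × ℍ[ℝ]) := fun n =>
    measurable_prodMk_left
  set ν : Measure (ℕ × ℍ[ℝ]) := Measure.sum (fun n => A n • ψ.map (Prod.mk n)) with hν
  have hAsum : ∑' n, A n = 1 := by
    have h1 : HasSum a 1 := by
      refine (hasSum_geometric_two' 1).congr_fun fun n => ?_
      rw [ha]
      simp only [one_div, inv_pow, pow_succ]
      ring
    rw [hA, ← ENNReal.ofReal_tsum_of_nonneg (fun n => (ha0 n).le) h1.summable, h1.tsum_eq,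
      ENNReal.ofReal_one]
  have hνp : IsProbabilityMeasure ν := ⟨by
    rw [hν, Measure.sum_apply _ MeasurableSet.univ]
    simp [Measure.map_apply (hmk _), hAsum]⟩
  have hνn : NullSingletonClass ν := ⟨fun x => by
    rw [hν, Measure.sum_apply _ (measurableSet_singleton x)]
    simp only [Measure.smul_apply, Measure.map_apply (hmk _) (measurableSet_singleton x),
      ENNReal.tsum_eq_zero, smul_eq_mul, mul_eq_zero]
    refine fun n => Or.inr (Set.Subsingleton.measure_zero (fun y hy z hz => ?_) _)
    simp only [Set.mem_preimage, Set.mem_singleton_iff] at hy hz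
    exact (Prod.ext_iff.1 (hy.trans hz.symm)).2⟩
  have hle : ∀ n, A n • ψ.map (Prod.mk n) ≤ ν := fun n => Measure.le_sum _ n
  have hR : ¬ Countable ℝ := not_countable_iff.2 inferInstance
  have hP : ¬ Countable (ℕ × ℍ[ℝ]) := fun h => not_countable_quaternion
    (Function.Injective.countable (f := (Prod.mk 0 : ℍ[ℝ] → ℕ × ℍ[ℝ]))
      (Prod.mk_right_injective 0))
  obtain ⟨α, β, hα, hβ, h1, h2⟩ := exists_ae_iso
    (PolishSpace.measurableEquivOfNotCountable not_countable_quaternion hR)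
    (PolishSpace.measurableEquivOfNotCountable hP hR) ψ ν
  have hmap : ∀ n, ψ.map (fun y => β (n, y)) ≤ (A n)⁻¹ • ψ := fun n => by
    have e1 : ψ.map (fun y => β (n, y)) = (ψ.map (Prod.mk n)).map β :=
      (Measure.map_map hβ.measurable (hmk n)).symm
    have e2 : ψ.map (Prod.mk n) ≤ (A n)⁻¹ • ν := by
      calc ψ.map (Prod.mk n) = (A n)⁻¹ • (A n • ψ.map (Prod.mk n)) := by
            rw [smul_smul, ENNReal.inv_mul_cancel (hA0 n) (hAt n), one_smul]
        _ ≤ _ := by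
            intro s
            simp only [Measure.smul_apply, smul_eq_mul]
            gcongr
            exact hle n s
    rw [e1]
    refine (Measure.map_mono e2 hβ.measurable).trans ?_
    rw [Measure.map_smul, hβ.map_eq]
  have hqm : ∀ n, Measure.QuasiMeasurePreserving (fun y => β (n, y)) ψ ψ := fun n =>
    ⟨hβ.measurable.comp (hmk n),
      (Measure.absolutelyContinuous_of_le (hmap n)).trans (Measure.smul_absolutelyContinuous)⟩
  have hae : ∀ n, ∀ Pr : ℕ × ℍ[ℝ] → Prop, (∀ᵐ x ∂ν, Pr x) → ∀ᵐ y ∂ψ, Pr (n, y) :=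
    fun n Pr hPr => by
      have h3 : ψ.map (Prod.mk n) ≪ ν := by
        refine Measure.AbsolutelyContinuous.trans ?_ (Measure.absolutelyContinuous_of_le (hle n))
        exact Measure.absolutelyContinuous_smul (hA0 n)
      exact (Measure.QuasiMeasurePreserving.mk (hmk n) h3).ae hPr
  have hlint : ∀ f : ℕ × ℍ[ℝ] → ℝ≥0∞, Measurable f →
      ∫⁻ x, f x ∂ν = ∑' n, A n * ∫⁻ y, f (n, y) ∂ψ := fun f hf => by
    rw [hν, lintegral_sum_measure]
    refine tsum_congr fun n => ?_
    rw [lintegral_smul_measure, lintegral_map hf (hmk n), smul_eq_mul]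
  choose T hT using fun n => exists_linearMap_comp (𝕜 := ℍ[ℝ]) (E := ℍ[ℝ])
    (P := ENNReal.ofReal p) (hβ.measurable.comp (hmk n)) (ENNReal.inv_ne_top.2 (hA0 n)) (hmap n)
  have hcp : ∀ n, (a n ^ (1 / p)) ^ p = a n := fun n => by
    rw [← Real.rpow_mul (ha0 n).le, one_div_mul_cancel hp0, Real.rpow_one]
  refine ⟨fun n => (a n ^ (1 / p)) • T n, fun v => ?_, fun u hu => ?_⟩
  · have hnn : ∀ n, ‖((a n ^ (1 / p)) • T n) v‖ ^ p = a n * ‖T n v‖ ^ p := fun n => by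
      rw [LinearMap.smul_apply, norm_smul, Real.mul_rpow (norm_nonneg _) (norm_nonneg _),
        Real.norm_of_nonneg (by have := ha0 n; positivity), hcp]
    simp only [hnn]
    refine hasSum_of_tsum_ofReal (fun n => mul_nonneg (ha0 n).le (by positivity))
      (by positivity) ?_
    have hm : Measurable fun x => ENNReal.ofReal (‖v x‖ ^ p) :=
      ((Lp.stronglyMeasurable v).measurable.norm.pow_const p).ennreal_ofReal
    rw [norm_rpow_eq_lintegral hp v, ← hβ.lintegral_comp hm]
    refine (hlint (fun x => ENNReal.ofReal (‖v (β x)‖ ^ p)) (hm.comp hβ.measurable)).trans ?_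
    refine tsum_congr fun n => ?_
    rw [ENNReal.ofReal_mul (ha0 n).le, norm_rpow_eq_lintegral hp (T n v)]
    congr 1
    refine lintegral_congr_ae ?_
    filter_upwards [hT n v] with y hy
    rw [hy]
    rfl
  · have hgm : Measurable fun x : ℕ × ℍ[ℝ] => (a x.1 ^ (1 / p))⁻¹ • u x.1 x.2 :=
      measurable_from_prod_countable_right fun n =>
        (Lp.stronglyMeasurable (u n)).measurable.const_smul ((a n ^ (1 / p))⁻¹)
    set g : ℕ × ℍ[ℝ] → ℍ[ℝ] := fun x => (a x.1 ^ (1 / p))⁻¹ • u x.1 x.2 with hg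
    have hgnorm : ∀ n y, ENNReal.ofReal (‖g (n, y)‖ ^ p) =
        (A n)⁻¹ * ENNReal.ofReal (‖u n y‖ ^ p) := fun n y => by
      have h0 := ha0 n
      have h3 : (0 : ℝ) ≤ (a n ^ (1 / p))⁻¹ := by positivity
      rw [hg, norm_smul, Real.mul_rpow (norm_nonneg _) (norm_nonneg _),
        Real.norm_of_nonneg h3, Real.inv_rpow (by positivity), hcp,
        ENNReal.ofReal_mul (by positivity), ENNReal.ofReal_inv_of_pos h0]
    have hvL : MemLp (fun x => g (α x)) (ENNReal.ofReal p) ψ := by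
      refine (memLp_ofReal_iff hp (hgm.comp hα.measurable).aestronglyMeasurable).2 ?_
      have hm : Measurable fun x => ENNReal.ofReal (‖g x‖ ^ p) :=
        (hgm.norm.pow_const p).ennreal_ofReal
      have h3 := hα.lintegral_comp hm
      refine lt_of_eq_of_lt (h3.trans (hlint _ hm)) ?_
      have h4 : ∀ n, A n * ∫⁻ y, ENNReal.ofReal (‖g (n, y)‖ ^ p) ∂ψ =
          ENNReal.ofReal (‖u n‖ ^ p) := fun n => by
        simp only [hgnorm]
        rw [lintegral_const_mul' _ _ (ENNReal.inv_ne_top.2 (hA0 n)), ← mul_assoc,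
          ENNReal.mul_inv_cancel (hA0 n) (hAt n), one_mul, norm_rpow_eq_lintegral hp]
      simp only [h4]
      rw [← ENNReal.ofReal_tsum_of_nonneg (fun n => by positivity) hu]
      exact ENNReal.ofReal_lt_top
    refine ⟨hvL.toLp _, fun n => Lp.ext ?_⟩
    have e1 : (((a n ^ (1 / p)) • T n) (hvL.toLp _) : Lp ℍ[ℝ] (ENNReal.ofReal p) ψ) =ᵐ[ψ]
        (a n ^ (1 / p)) • (T n (hvL.toLp _)) := Lp.coeFn_smul _ _
    filter_upwards [e1, hT n (hvL.toLp _), (hqm n).ae hvL.coeFn_toLp,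
      hae n (fun x => α (β x) = x) h2] with y h3 h4 h5 h6
    rw [h3, Pi.smul_apply, h4, Function.comp_apply, h5, h6, hg, smul_smul,
      mul_inv_cancel₀ (by have := ha0 n; positivity), one_smul]

end

end

section

section Minkowski

variable {G X : Type*} [MeasurableSpace G] [MeasurableSpace X] {m : Measure G} {ψ : Measure X}
  {p : ℝ}

theorem rpow_lintegral_mul_le (hp : 1 < p) {k F : G → ℝ≥0∞} (hk : AEMeasurable k m)
    (hF : AEMeasurable F m) :
    (∫⁻ g, k g * F g ∂m) ^ p ≤ (∫⁻ g, k g ∂m) ^ (p - 1) * ∫⁻ g, k g * F g ^ p ∂m := by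
  have hp0 : 0 < p := by linarith
  have hpq : p.HolderConjugate (p / (p - 1)) := Real.HolderConjugate.conjExponent hp
  have hq : 0 < p / (p - 1) := hpq.symm.pos
  have h1 := ENNReal.lintegral_mul_le_Lp_mul_Lq m hpq
    (f := fun g => k g ^ (1 / p) * F g) (g := fun g => k g ^ (1 / (p / (p - 1))))
    ((hk.pow_const _).mul hF) (hk.pow_const _)
  have e1 : ∀ g, ((fun g => k g ^ (1 / p) * F g) * fun g => k g ^ (1 / (p / (p - 1)))) g =
      k g * F g := fun g => by
    simp only [Pi.mul_apply]
    rw [mul_right_comm, ← ENNReal.rpow_add_of_nonneg _ _ (by positivity) (by positivity)]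
    have : 1 / p + 1 / (p / (p - 1)) = 1 := by
      simpa [one_div] using hpq.inv_add_inv_eq_one
    rw [this, ENNReal.rpow_one]
  have e2 : ∀ g, (k g ^ (1 / p) * F g) ^ p = k g * F g ^ p := fun g => by
    rw [ENNReal.mul_rpow_of_nonneg _ _ hp0.le, ← ENNReal.rpow_mul, one_div_mul_cancel hp0.ne',
      ENNReal.rpow_one]
  have e3 : ∀ g, (k g ^ (1 / (p / (p - 1)))) ^ (p / (p - 1)) = k g := fun g => by
    rw [← ENNReal.rpow_mul, one_div_mul_cancel hq.ne', ENNReal.rpow_one]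
  simp only [e1, e2, e3] at h1
  have h2 := ENNReal.rpow_le_rpow h1 hp0.le
  rw [ENNReal.mul_rpow_of_nonneg _ _ hp0.le, ← ENNReal.rpow_mul, ← ENNReal.rpow_mul,
    one_div_mul_cancel hp0.ne', ENNReal.rpow_one] at h2
  have : 1 / (p / (p - 1)) * p = p - 1 := by
    have : p - 1 ≠ 0 := by linarith
    field_simp
  rw [this, mul_comm] at h2
  exact h2

theorem lintegral_rpow_lintegral_mul_le [SFinite m] [SFinite ψ] (hp : 1 < p) {k : G → ℝ≥0∞} {F : G → X → ℝ≥0∞}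
    {B : ℝ≥0∞} (hk : AEMeasurable k m) (hF : AEMeasurable (Function.uncurry F) (m.prod ψ))
    (hB : ∀ᵐ g ∂m, ∫⁻ x, F g x ^ p ∂ψ ≤ B) :
    ∫⁻ x, (∫⁻ g, k g * F g x ∂m) ^ p ∂ψ ≤ (∫⁻ g, k g ∂m) ^ p * B := by
  have hF' : AEMeasurable (fun z : X × G => F z.2 z.1) (ψ.prod m) := hF.prod_swap
  have hF1 : ∀ᵐ x ∂ψ, AEMeasurable (fun g => F g x) m := hF'.aestronglyMeasurable.prodMk_left.mono
    fun x hx => hx.aemeasurable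
  have hF2 : ∀ᵐ g ∂m, AEMeasurable (F g) ψ := hF.aestronglyMeasurable.prodMk_left.mono
    fun x hx => hx.aemeasurable
  have hk' : AEMeasurable (fun z : X × G => k z.2) (ψ.prod m) := hk.comp_snd
  calc ∫⁻ x, (∫⁻ g, k g * F g x ∂m) ^ p ∂ψ
      ≤ ∫⁻ x, (∫⁻ g, k g ∂m) ^ (p - 1) * ∫⁻ g, k g * F g x ^ p ∂m ∂ψ := by
        refine lintegral_mono_ae ?_
        filter_upwards [hF1] with x hx
        exact rpow_lintegral_mul_le hp hk hx
    _ = (∫⁻ g, k g ∂m) ^ (p - 1) * ∫⁻ x, ∫⁻ g, k g * F g x ^ p ∂m ∂ψ := by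
        rw [lintegral_const_mul'']
        exact (hk'.mul (hF'.pow_const p)).lintegral_prod_right'
    _ = (∫⁻ g, k g ∂m) ^ (p - 1) * ∫⁻ g, ∫⁻ x, k g * F g x ^ p ∂ψ ∂m := by
        rw [lintegral_lintegral_swap]
        exact hk'.mul (hF'.pow_const p)
    _ ≤ (∫⁻ g, k g ∂m) ^ (p - 1) * ∫⁻ g, k g * B ∂m := by
        gcongr 1
        refine lintegral_mono_ae ?_
        filter_upwards [hB, hF2] with g hg hg2
        rw [lintegral_const_mul'' _ (hg2.pow_const p)]
        gcongr
    _ = (∫⁻ g, k g ∂m) ^ p * B := by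
        rw [lintegral_mul_const'' _ hk, ← mul_assoc]
        congr 1
        conv_lhs => rw [← ENNReal.rpow_one (∫⁻ g, k g ∂m), ← ENNReal.rpow_mul, one_mul]
        rw [← ENNReal.rpow_add_of_nonneg _ _ (by linarith) zero_le_one]
        congr 1
        ring

end Minkowski

section UnitMeasure

theorem restrict_sphere_eq {𝔸 : Type*} [NormedAddCommGroup 𝔸] [MeasurableSpace 𝔸] {m : Measure 𝔸}
    (hm : ∀ᵐ y ∂m, ‖y‖ = 1) : m.restrict (sphere (0 : 𝔸) 1) = m :=
  Measure.restrict_eq_self_of_ae_mem (hm.mono fun y hy => by simpa using hy)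

variable {𝔸 𝔹 E : Type*} [NormedAddCommGroup 𝔸] [ProperSpace 𝔸] [MeasurableSpace 𝔸] [BorelSpace 𝔸]
  [NormedAddCommGroup 𝔹] [ProperSpace 𝔹] [MeasurableSpace 𝔹] [BorelSpace 𝔹]
  [NormedAddCommGroup E] {m : Measure 𝔸} {m' : Measure 𝔹}

theorem integrable_of_continuousOn_sphere [IsFiniteMeasure m] (hm : ∀ᵐ y ∂m, ‖y‖ = 1) {f : 𝔸 → E}
    (hf : ContinuousOn f (sphere 0 1)) : Integrable f m := by
  have := hf.integrableOn_compact (μ := m) (isCompact_sphere 0 1)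
  rwa [IntegrableOn, restrict_sphere_eq hm] at this

theorem integrable_prod_of_continuousOn_sphere [IsFiniteMeasure m] [IsFiniteMeasure m']
    [SecondCountableTopology 𝔸]
    (hm : ∀ᵐ y ∂m, ‖y‖ = 1) (hm' : ∀ᵐ y ∂m', ‖y‖ = 1) {f : 𝔸 × 𝔹 → E}
    (hf : ContinuousOn f (sphere 0 1 ×ˢ sphere 0 1)) : Integrable f (m.prod m') := by
  have := hf.integrableOn_compact (μ := m.prod m') ((isCompact_sphere 0 1).prod (isCompact_sphere 0 1))
  rwa [IntegrableOn, ← Measure.prod_restrict, restrict_sphere_eq hm, restrict_sphere_eq hm'] at this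

theorem integral_norm_rpow_integral_smul_le [NormedSpace ℝ E] [IsFiniteMeasure m]
    [IsFiniteMeasure m'] [SecondCountableTopology 𝔸] {p : ℝ} (hp : 1 < p)
    (hm : ∀ᵐ y ∂m, ‖y‖ = 1) (hm' : ∀ᵐ y ∂m', ‖y‖ = 1)
    {F : 𝔸 → 𝔹 → E} {k : 𝔸 → ℝ} {B : ℝ}
    (hF : ContinuousOn (Function.uncurry F) (sphere 0 1 ×ˢ sphere 0 1))
    (hk : ContinuousOn k (sphere 0 1)) (hB : ∀ g ∈ sphere (0 : 𝔸) 1, ∫ x, ‖F g x‖ ^ p ∂m' ≤ B)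
    (hB0 : 0 ≤ B) :
    ∫ x, ‖∫ g, k g • F g x ∂m‖ ^ p ∂m' ≤ (∫ g, |k g| ∂m) ^ p * B := by
  have hp0 : 0 < p := by linarith
  have hki : Integrable (fun g => |k g|) m := (integrable_of_continuousOn_sphere hm hk).norm
  have hFi := integrable_prod_of_continuousOn_sphere hm hm' hF
  have key := lintegral_rpow_lintegral_mul_le (m := m) (ψ := m') hp
    (k := fun g => ENNReal.ofReal |k g|) (F := fun g x => ‖F g x‖ₑ) (B := ENNReal.ofReal B)
    (hki.aestronglyMeasurable.aemeasurable.ennreal_ofReal)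
    (hFi.aestronglyMeasurable.enorm) (by
      filter_upwards [hm] with g hg
      have hg' : g ∈ sphere (0 : 𝔸) 1 := by simpa using hg
      have hc : ContinuousOn (F g) (sphere 0 1) :=
        hF.comp (Continuous.prodMk_right g).continuousOn fun x hx => ⟨hg', hx⟩
      have hi : Integrable (fun x => ‖F g x‖ ^ p) m' :=
        integrable_of_continuousOn_sphere hm' (hc.norm.rpow_const fun x _ => Or.inr hp0.le)
      refine le_trans (le_of_eq ?_) (ENNReal.ofReal_le_ofReal (hB g hg'))
      rw [ofReal_integral_eq_lintegral_ofReal hi (ae_of_all _ fun x => by positivity)]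
      refine lintegral_congr fun x => ?_
      rw [← ofReal_norm, ENNReal.ofReal_rpow_of_nonneg (norm_nonneg _) hp0.le])
  by_cases hintg : Integrable (fun x => ‖∫ g, k g • F g x ∂m‖ ^ p) m'
  · rw [← ENNReal.ofReal_le_ofReal_iff (by positivity),
      ofReal_integral_eq_lintegral_ofReal hintg (ae_of_all _ fun x => by positivity),
      ENNReal.ofReal_mul (by positivity), ← ENNReal.ofReal_rpow_of_nonneg (by positivity) hp0.le,
      ofReal_integral_eq_lintegral_ofReal hki (ae_of_all _ fun x => by positivity)]
    refine le_trans (lintegral_mono fun x => ?_) key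
    rw [← ENNReal.ofReal_rpow_of_nonneg (norm_nonneg _) hp0.le, ofReal_norm]
    gcongr
    refine (enorm_integral_le_lintegral_enorm _).trans (lintegral_mono fun g => ?_)
    rw [enorm_smul, ← ofReal_norm (k g), Real.norm_eq_abs]
  · rw [integral_undef hintg]
    positivity

theorem integral_fderiv_rotation_eq_zero [NormedSpace ℝ 𝔸] [NormedSpace ℝ E] [IsFiniteMeasure m]
    (hm : ∀ᵐ y ∂m, ‖y‖ = 1) {A : 𝔸 →L[ℝ] 𝔸}
    (hU : ∀ t : ℝ, MeasurePreserving (fun y => Real.cos t • y + Real.sin t • A y) m m)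
    (hUn : ∀ (t : ℝ) y, ‖y‖ = 1 → ‖Real.cos t • y + Real.sin t • A y‖ = 1)
    {G : 𝔸 → E} {G' : 𝔸 → 𝔸 →L[ℝ] E} (hG : ∀ y, ‖y‖ = 1 → HasFDerivAt G (G' y) y)
    (hG' : ContinuousOn G' (sphere 0 1)) : ∫ y, G' y (A y) ∂m = 0 := by
  have hGc : ContinuousOn G (sphere 0 1) := fun y hy =>
    (hG y (by simpa using hy)).continuousAt.continuousWithinAt
  set U : ℝ → 𝔸 → 𝔸 := fun t y => Real.cos t • y + Real.sin t • A y with hUdef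
  have hUs : ∀ t, Set.MapsTo (U t) (sphere 0 1) (sphere 0 1) := fun t y hy => by
    simpa using hUn t y (by simpa using hy)
  have hUc : ∀ t, Continuous (U t) := fun t => by fun_prop
  obtain ⟨M, hM⟩ := (isCompact_sphere (0 : 𝔸) 1).exists_bound_of_continuousOn hG'
  have hGU : ∀ t, ContinuousOn (fun y => G (U t y)) (sphere 0 1) := fun t =>
    hGc.comp (hUc t).continuousOn (hUs t)
  have hconst : ∀ t, ∫ y, G (U t y) ∂m = ∫ y, G y ∂m := fun t => by
    have h1 := integral_map (μ := m) (φ := U t) (hUc t).measurable.aemeasurable (f := G) (by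
      rw [(hU t).map_eq]
      exact (integrable_of_continuousOn_sphere hm hGc).aestronglyMeasurable)
    rw [(hU t).map_eq] at h1
    exact h1.symm
  have hd := hasDerivAt_integral_of_dominated_loc_of_deriv_le (μ := m) (𝕜 := ℝ)
    (F := fun t y => G (U t y)) (x₀ := 0) (s := Set.univ)
    (F' := fun t y => G' (U t y) (-Real.sin t • y + Real.cos t • A y))
    (bound := fun _ => M * (1 + ‖A‖)) Filter.univ_mem
    (Filter.Eventually.of_forall fun t =>
      (integrable_of_continuousOn_sphere hm (hGU t)).aestronglyMeasurable)
    (integrable_of_continuousOn_sphere hm (hGU 0))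
    (by
      refine (integrable_of_continuousOn_sphere hm ?_).aestronglyMeasurable
      refine ContinuousOn.clm_apply (hG'.comp (hUc 0).continuousOn (hUs 0)) ?_
      fun_prop)
    (by
      filter_upwards [hm] with y hy t _
      have h1 := hM _ (hUs t (show y ∈ sphere (0 : 𝔸) 1 by simpa using hy))
      have h2 : ‖-Real.sin t • y + Real.cos t • A y‖ ≤ 1 + ‖A‖ := by
        refine (norm_add_le _ _).trans (add_le_add ?_ ?_)
        · rw [norm_smul, hy, mul_one, norm_neg]
          exact Real.abs_sin_le_one t
        · rw [norm_smul]
          calc _ ≤ 1 * ‖A y‖ := by gcongr; exact Real.abs_cos_le_one t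
            _ ≤ ‖A‖ := by simpa [hy] using A.le_opNorm y
      exact (ContinuousLinearMap.le_opNorm _ _).trans
        (mul_le_mul h1 h2 (norm_nonneg _) ((norm_nonneg _).trans h1)))
    (integrable_const _)
    (by
      filter_upwards [hm] with y hy t _
      refine (hG _ (hUn t y hy)).comp_hasDerivAt t ?_
      exact ((Real.hasDerivAt_cos t).smul_const y).add ((Real.hasDerivAt_sin t).smul_const (A y)))
  have h0 := hd.2.unique ((hasDerivAt_const (0 : ℝ) (∫ y, G y ∂m)).congr_of_eventuallyEq
    (Filter.Eventually.of_forall hconst))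
  simpa [hUdef] using h0

end UnitMeasure

end

instance : Fact (0 < 2 * Real.pi) := ⟨Real.two_pi_pos⟩

/-- The normalized arc length measure on the unit circle of `ℂ`. -/
noncomputable def circ : Measure ℂ :=
  (AddCircle.haarAddCircle (T := 2 * Real.pi)).map (fun x => (AddCircle.toCircle x : ℂ))

theorem continuous_coe_toCircle :
    Continuous (fun x : AddCircle (2 * Real.pi) => (AddCircle.toCircle x : ℂ)) :=
  continuous_subtype_val.comp AddCircle.continuous_toCircle

instance : IsProbabilityMeasure circ :=
  Measure.isProbabilityMeasure_map continuous_coe_toCircle.measurable.aemeasurable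

theorem circ_ae_norm : ∀ᵐ c ∂circ, ‖c‖ = 1 := by
  refine (ae_map_iff continuous_coe_toCircle.measurable.aemeasurable
    (isClosed_eq continuous_norm continuous_const).measurableSet).2 (ae_of_all _ fun x => Circle.norm_coe _)

theorem exists_toCircle_eq {u : ℂ} (hu : ‖u‖ = 1) :
    ∃ x : AddCircle (2 * Real.pi), (AddCircle.toCircle x : ℂ) = u := by
  refine ⟨(Complex.arg u : ℝ), ?_⟩
  rw [AddCircle.toCircle_apply_mk, div_self Real.two_pi_pos.ne', one_mul, Circle.coe_exp]
  simpa [hu] using Complex.norm_mul_exp_arg_mul_I u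

theorem measurePreserving_circ_mul {u : ℂ} (hu : ‖u‖ = 1) :
    MeasurePreserving (fun c => u * c) circ circ := by
  refine ⟨(continuous_const_mul u).measurable, ?_⟩
  obtain ⟨x, hx⟩ := exists_toCircle_eq hu
  rw [circ, Measure.map_map (continuous_const_mul u).measurable continuous_coe_toCircle.measurable]
  have : (fun c => u * c) ∘ (fun x : AddCircle (2 * Real.pi) => (AddCircle.toCircle x : ℂ)) =
      (fun x : AddCircle (2 * Real.pi) => (AddCircle.toCircle x : ℂ)) ∘ (fun y => x + y) := by
    ext y
    simp [AddCircle.toCircle_add, hx]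
  rw [this, ← Measure.map_map continuous_coe_toCircle.measurable (measurable_const_add x),
    map_add_left_eq_self]

theorem measurePreserving_circ_conj :
    MeasurePreserving (fun c : ℂ => star c) circ circ := by
  refine ⟨continuous_star.measurable, ?_⟩
  rw [circ, Measure.map_map continuous_star.measurable continuous_coe_toCircle.measurable]
  have : (fun c : ℂ => star c) ∘ (fun x : AddCircle (2 * Real.pi) => (AddCircle.toCircle x : ℂ)) =
      (fun x : AddCircle (2 * Real.pi) => (AddCircle.toCircle x : ℂ)) ∘ (fun y => -y) := by
    ext y
    simp [AddCircle.toCircle_neg, ← Circle.coe_inv_eq_conj]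
  rw [this, ← Measure.map_map continuous_coe_toCircle.measurable measurable_neg,
    Measure.map_neg_eq_self]

theorem integral_circ {E : Type*} [NormedAddCommGroup E] [NormedSpace ℝ E] {f : ℂ → E}
    (hf : ContinuousOn f (sphere 0 1)) : ∫ c, f c ∂circ = Real.circleAverage f 0 1 := by
  have h := (integrable_of_continuousOn_sphere circ_ae_norm hf).aestronglyMeasurable
  rw [circ] at h ⊢
  rw [integral_map continuous_coe_toCircle.measurable.aemeasurable h,
    AddCircle.integral_haarAddCircle, Real.circleAverage,
    ← AddCircle.intervalIntegral_preimage (2 * Real.pi) 0, zero_add]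
  congr 1
  refine intervalIntegral.integral_congr fun θ _ => ?_
  rw [AddCircle.toCircle_apply_mk, div_self Real.two_pi_pos.ne', one_mul, Circle.coe_exp]
  simp [circleMap]

theorem integral_comp_measurePreserving {𝔸 E : Type*} [NormedAddCommGroup 𝔸] [ProperSpace 𝔸]
    [MeasurableSpace 𝔸] [BorelSpace 𝔸] [NormedAddCommGroup E] [NormedSpace ℝ E] {m : Measure 𝔸}
    [IsFiniteMeasure m] (hm : ∀ᵐ y ∂m, ‖y‖ = 1) {T : 𝔸 → 𝔸} (hT : MeasurePreserving T m m)
    {f : 𝔸 → E} (hf : ContinuousOn f (sphere 0 1)) : ∫ y, f (T y) ∂m = ∫ y, f y ∂m := by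
  have h1 := integral_map (μ := m) (φ := T) hT.measurable.aemeasurable (f := f) (by
    rw [hT.map_eq]
    exact (integrable_of_continuousOn_sphere hm hf).aestronglyMeasurable)
  rw [hT.map_eq] at h1
  exact h1.symm

/-- The weight `(Re c)ⁿ` has the moments of the semicircle law against `2 (Im c)² dc`. -/
theorem circ_moment (n : ℕ) : ∫ c : ℂ, c.re ^ (n + 2) * c.im ^ 2 ∂circ =
    (n + 1) / (n + 4) * ∫ c : ℂ, c.re ^ n * c.im ^ 2 ∂circ := by
  have hU : ∀ (t : ℝ) (y : ℂ), Real.cos t • y + Real.sin t •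
      (ContinuousLinearMap.mul ℝ ℂ Complex.I) y = Complex.exp (t * Complex.I) * y := fun t y => by
    rw [Complex.exp_mul_I]
    simp
    ring
  have hn : ∀ t : ℝ, ‖Complex.exp (t * Complex.I)‖ = 1 := Complex.norm_exp_ofReal_mul_I
  have hre : ∀ y : ℂ, HasFDerivAt (fun c : ℂ => c.re) Complex.reCLM y := fun y =>
    Complex.reCLM.hasFDerivAt
  have him : ∀ y : ℂ, HasFDerivAt (fun c : ℂ => c.im) Complex.imCLM y := fun y =>
    Complex.imCLM.hasFDerivAt
  have h := integral_fderiv_rotation_eq_zero (m := circ) circ_ae_norm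
    (A := ContinuousLinearMap.mul ℝ ℂ Complex.I)
    (fun t => by simpa only [hU] using measurePreserving_circ_mul (hn t))
    (fun t y hy => by rw [hU, norm_mul, hn, hy, one_mul])
    (fun y _ => ((hre y).pow (n + 1)).mul ((him y).pow 3)) (by fun_prop)
  have hi : ∀ a b : ℕ, Integrable (fun c : ℂ => c.re ^ a * c.im ^ b) circ := fun a b =>
    integrable_of_continuousOn_sphere circ_ae_norm (by fun_prop)
  have e : ∀ᵐ c ∂circ, c.re ^ n * c.im ^ 4 = c.re ^ n * c.im ^ 2 - c.re ^ (n + 2) * c.im ^ 2 := by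
    filter_upwards [circ_ae_norm] with c hc
    have : c.re ^ 2 + c.im ^ 2 = 1 := by
      rw [← one_pow 2, ← hc, ← Complex.normSq_eq_norm_sq, Complex.normSq_apply]; ring
    linear_combination (c.re ^ n * c.im ^ 2) * this
  have h2 : ∫ c : ℂ, c.re ^ n * c.im ^ 4 ∂circ = ∫ c : ℂ, c.re ^ n * c.im ^ 2 ∂circ -
      ∫ c : ℂ, c.re ^ (n + 2) * c.im ^ 2 ∂circ := by
    rw [integral_congr_ae e, integral_sub (hi _ _) (hi _ _)]
  have h3 : 3 * ∫ c : ℂ, c.re ^ (n + 2) * c.im ^ 2 ∂circ - (n + 1) *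
      ∫ c : ℂ, c.re ^ n * c.im ^ 4 ∂circ = 0 := by
    rw [← integral_const_mul, ← integral_const_mul, ← integral_sub ((hi _ _).const_mul _)
      ((hi _ _).const_mul _), ← h]
    refine integral_congr_ae (ae_of_all _ fun c => ?_)
    simp
    ring
  rw [h2] at h3
  have : (n : ℝ) + 4 ≠ 0 := by positivity
  field_simp
  linarith

theorem exists_riesz_inequality {p : ℝ} (hp : 1 < p) (hp2 : p ≤ 2) :
    ∃ C D : ℝ, 0 ≤ C ∧ 0 ≤ D ∧ ∀ z : ℂ, 0 < z.re →
      ‖z‖ ^ p ≤ C * z.re ^ p - D * (z ^ (p : ℂ)).re := by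
  have hπ := Real.pi_pos
  have hp0 : 0 < p := by linarith
  set φ₀ : ℝ := Real.pi * (p + 1) / (4 * p) with hφ
  have h1 : p * φ₀ = Real.pi * (p + 1) / 4 := by rw [hφ]; field_simp
  have h2 : φ₀ < Real.pi / 2 := by
    rw [hφ, div_lt_div_iff₀ (by positivity) (by positivity)]
    nlinarith
  have h3 : 0 < φ₀ := by positivity
  have h4 : Real.cos (p * φ₀) < 0 := by
    refine Real.cos_neg_of_pi_div_two_lt_of_lt ?_ ?_ <;> rw [h1] <;> nlinarith
  set κ : ℝ := -Real.cos (p * φ₀) with hκ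
  have hκ0 : 0 < κ := by linarith
  have hc0 : 0 < Real.cos φ₀ := Real.cos_pos_of_mem_Ioo ⟨by linarith, h2⟩
  refine ⟨(1 + 1 / κ) / Real.cos φ₀ ^ p, 1 / κ, by positivity, by positivity, fun z hz => ?_⟩
  have hre : z.re = ‖z‖ * Real.cos z.arg := (Complex.norm_mul_cos_arg z).symm
  have hz0 : 0 < ‖z‖ := norm_pos_iff.2 fun h => by simp [h] at hz
  have hcos : 0 < Real.cos z.arg := by
    rw [hre] at hz
    exact (pos_iff_pos_of_mul_pos hz).1 hz0
  have harg : |z.arg| < Real.pi / 2 := Complex.abs_arg_lt_pi_div_two_iff.2 (Or.inl hz)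
  have key : 1 ≤ (1 + 1 / κ) / Real.cos φ₀ ^ p * Real.cos z.arg ^ p -
      1 / κ * Real.cos (z.arg * p) := by
    rw [← Real.cos_abs z.arg, ← Real.cos_abs (z.arg * p), abs_mul, abs_of_pos hp0]
    rw [← Real.cos_abs z.arg] at hcos
    set φ := |z.arg| with hφd
    have hφ0 : 0 ≤ φ := abs_nonneg _
    rcases le_total φ φ₀ with h | h
    · have e1 : Real.cos φ₀ ≤ Real.cos φ :=
        Real.cos_le_cos_of_nonneg_of_le_pi hφ0 (by linarith) h
      have e2 : 1 + 1 / κ ≤ (1 + 1 / κ) / Real.cos φ₀ ^ p * Real.cos φ ^ p := by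
        rw [div_mul_eq_mul_div, le_div_iff₀ (by positivity)]
        gcongr
      have e3 : 1 / κ * Real.cos (φ * p) ≤ 1 / κ * 1 := by
        gcongr
        exact Real.cos_le_one _
      linarith
    · have e1 : Real.cos (φ * p) ≤ Real.cos (p * φ₀) := by
        refine Real.cos_le_cos_of_nonneg_of_le_pi (by positivity) ?_ (by nlinarith)
        nlinarith
      have e2 : 1 / κ * Real.cos (φ * p) ≤ -1 := by
        calc 1 / κ * Real.cos (φ * p) ≤ 1 / κ * (-κ) := by
              gcongr
              rw [hκ]
              linarith
          _ = -1 := by field_simp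
      have e3 : 0 ≤ (1 + 1 / κ) / Real.cos φ₀ ^ p * Real.cos φ ^ p := by positivity
      linarith
  rw [Complex.cpow_ofReal_re]
  conv_rhs => rw [hre, Real.mul_rpow hz0.le hcos.le]
  have : 0 < ‖z‖ ^ p := by positivity
  nlinarith

/-- The kernel of the conjugate Poisson integral on the circle. -/
noncomputable def conjPoisson (r : ℝ) (c : ℂ) : ℝ := 2 * r * c.im / ‖1 - r * c‖ ^ 2

theorem one_sub_mul_ne_zero {r : ℝ} (hr0 : 0 ≤ r) (hr : r < 1) {c : ℂ} (hc : c ∈ sphere (0 : ℂ) 1) :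
    (1 : ℂ) - r * c ≠ 0 := fun h => by
  have h1 : ‖(r : ℂ) * c‖ = 1 := by rw [← sub_eq_zero.1 h, norm_one]
  rw [norm_mul, mem_sphere_zero_iff_norm.1 hc, Complex.norm_real, Real.norm_of_nonneg hr0] at h1
  linarith

theorem continuousOn_conjPoisson {r : ℝ} (hr0 : 0 ≤ r) (hr : r < 1) :
    ContinuousOn (conjPoisson r) (sphere 0 1) := by
  refine ContinuousOn.div (by fun_prop) (by fun_prop) fun c hc => ?_
  have := one_sub_mul_ne_zero hr0 hr hc
  positivity

theorem herglotz_im {r : ℝ} {φ c : ℂ} (hφ : ‖φ‖ = 1) (hc : ‖c‖ = 1) :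
    (herglotzRieszKernel 0 (r * φ) (c * φ)).im = -conjPoisson r c := by
  have h0 : φ ≠ 0 := norm_ne_zero_iff.1 (by simp [hφ])
  have e1 : herglotzRieszKernel 0 (r * φ) (c * φ) = (c + r) / (c - r) := by
    rw [herglotzRieszKernel_def]
    simp only [sub_zero]
    rw [← add_mul, ← sub_mul, mul_div_mul_right _ _ h0]
  have hn : c.re * c.re + c.im * c.im = 1 := by
    rw [← Complex.normSq_apply, Complex.normSq_eq_norm_sq, hc, one_pow]
  have e2 : ‖1 - (r : ℂ) * c‖ ^ 2 = 1 - 2 * r * c.re + r ^ 2 := by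
    rw [← Complex.normSq_eq_norm_sq, Complex.normSq_apply]
    simp
    linear_combination r ^ 2 * hn
  have e3 : Complex.normSq (c - r) = 1 - 2 * r * c.re + r ^ 2 := by
    rw [Complex.normSq_apply]
    simp
    linear_combination hn
  rw [e1, Complex.div_im, e3, conjPoisson, e2]
  simp
  ring

/-- The Poisson kernel of the circle. -/
noncomputable def circlePoisson (r : ℝ) (c : ℂ) : ℝ := (1 - r ^ 2) / ‖1 - r * c‖ ^ 2

theorem continuousOn_circlePoisson {r : ℝ} (hr0 : 0 ≤ r) (hr : r < 1) :
    ContinuousOn (circlePoisson r) (sphere 0 1) := by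
  refine ContinuousOn.div (by fun_prop) (by fun_prop) fun c hc => ?_
  have := one_sub_mul_ne_zero hr0 hr hc
  positivity

theorem circlePoisson_pos {r : ℝ} (hr0 : 0 ≤ r) (hr : r < 1) {c : ℂ} (hc : c ∈ sphere (0 : ℂ) 1) :
    0 < circlePoisson r c := by
  have := one_sub_mul_ne_zero hr0 hr hc
  have h1 : 0 < 1 - r ^ 2 := by nlinarith
  unfold circlePoisson
  positivity

theorem herglotz_re {r : ℝ} {φ c : ℂ} (hφ : ‖φ‖ = 1) (hc : ‖c‖ = 1) :
    (herglotzRieszKernel 0 (r * φ) (c * φ)).re = circlePoisson r c := by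
  have := congrFun (poissonKernel_eq_re_herglotzRieszKernel (c := 0) (w := r * φ)) (c * φ)
  rw [Function.comp_apply] at this
  rw [← this, poissonKernel_def, circlePoisson]
  simp only [sub_zero, norm_mul, hφ, hc, mul_one, one_pow, Complex.norm_real, Real.norm_eq_abs,
    sq_abs, ← sub_mul]
  congr 2
  have h1 : c * (1 - r * star c) = c - r := by
    have : c * star c = 1 := by
      rw [Complex.star_def, Complex.mul_conj, Complex.normSq_eq_norm_sq, hc]; simp
    linear_combination (-(r : ℂ)) * this
  rw [← h1, norm_mul, hc, one_mul, ← norm_star (1 - (r : ℂ) * c)]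
  simp

theorem integral_circ_comp_mul {E : Type*} [NormedAddCommGroup E] [NormedSpace ℝ E] {f : ℂ → E}
    (hf : ContinuousOn f (sphere 0 1)) {u : ℂ} (hu : ‖u‖ = 1) :
    ∫ c, f (c * u) ∂circ = ∫ c, f c ∂circ := by
  simp_rw [mul_comm _ u]
  exact integral_comp_measurePreserving circ_ae_norm (measurePreserving_circ_mul hu) hf

theorem mapsTo_mul_sphere {u : ℂ} (hu : ‖u‖ = 1) :
    Set.MapsTo (fun c : ℂ => c * u) (sphere 0 1) (sphere 0 1) := fun c hc => by
  simpa [hu] using hc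

/-- The Herglotz transform of a function on the circle. -/
noncomputable def herglotz (g : ℂ → ℝ) (w : ℂ) : ℂ :=
  Real.circleAverage (fun ζ => herglotzRieszKernel 0 w ζ • (g ζ : ℂ)) 0 1

theorem differentiableOn_herglotz {g : ℂ → ℝ} (hg : ContinuousOn g (sphere 0 1)) :
    DifferentiableOn ℂ (herglotz g) (ball 0 1) :=
  differentiableOn_circleAverage_herglotzRieszKernel_smul
    (ContinuousOn.circleIntegrable zero_le_one (by fun_prop))

theorem mul_mem_ball {r : ℝ} (hr0 : 0 ≤ r) (hr : r < 1) {φ : ℂ} (hφ : ‖φ‖ = 1) :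
    (r : ℂ) * φ ∈ ball (0 : ℂ) 1 := by
  simpa [hφ, abs_of_nonneg hr0] using hr

theorem herglotz_mul {g : ℂ → ℝ} (hg : ContinuousOn g (sphere 0 1)) {r : ℝ} (hr0 : 0 ≤ r)
    (hr : r < 1) {φ : ℂ} (hφ : ‖φ‖ = 1) :
    (herglotz g (r * φ)).re = ∫ c, circlePoisson r c * g (c * φ) ∂circ ∧
      (herglotz g (r * φ)).im = -∫ c, conjPoisson r c * g (c * φ) ∂circ := by
  have hw := mul_mem_ball hr0 hr hφ
  have hk : ContinuousOn (herglotzRieszKernel 0 (r * φ)) (sphere 0 1) := by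
    simpa using continuousOn_herglotzRieszKernel_sphere hw
  have hc : ContinuousOn (fun ζ => herglotzRieszKernel 0 (r * φ) ζ • (g ζ : ℂ)) (sphere 0 1) := by
    fun_prop
  have hc' := hc.comp (by fun_prop) (mapsTo_mul_sphere hφ)
  have hi := integrable_of_continuousOn_sphere circ_ae_norm hc'
  rw [herglotz, ← integral_circ hc, ← integral_circ_comp_mul hc hφ]
  constructor
  · refine (integral_re hi).symm.trans (integral_congr_ae ?_)
    filter_upwards [circ_ae_norm] with c hc
    rw [← herglotz_re hφ hc]
    simp
  · refine (integral_im hi).symm.trans ?_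
    rw [← integral_neg]
    refine integral_congr_ae ?_
    filter_upwards [circ_ae_norm] with c hc
    rw [← neg_mul, ← herglotz_im hφ hc]
    simp

theorem herglotz_zero {g : ℂ → ℝ} (hg : ContinuousOn g (sphere 0 1)) :
    herglotz g 0 = (∫ c, g c ∂circ : ℝ) := by
  have h := herglotz_mul hg le_rfl zero_lt_one (φ := 1) norm_one
  simp only [Complex.ofReal_zero, zero_mul, circlePoisson, conjPoisson] at h
  apply Complex.ext <;> simp [h]

theorem integral_circlePoisson {r : ℝ} (hr0 : 0 ≤ r) (hr : r < 1) :
    ∫ c, circlePoisson r c ∂circ = 1 := by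
  have h := DiffContOnCl.circleAverage_poissonKernel_smul (f := fun _ : ℂ => (1 : ℂ)) (c := 0)
    (R := 1) (w := r * 1) diffContOnCl_const (mul_mem_ball hr0 hr norm_one)
  have hk : ContinuousOn (poissonKernel 0 (r * 1)) (sphere 0 1) := by
    rw [poissonKernel_eq_re_herglotzRieszKernel]
    have := continuousOn_herglotzRieszKernel_sphere (mul_mem_ball hr0 hr norm_one)
    simp only [abs_one] at this
    exact Complex.continuous_re.comp_continuousOn this
  rw [← integral_circ (by exact hk.smul continuousOn_const)] at h
  have h2 : ∫ c, ((circlePoisson r c : ℝ) : ℂ) ∂circ = 1 := by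
    rw [← h]
    refine integral_congr_ae ?_
    filter_upwards [circ_ae_norm] with c hc
    rw [← herglotz_re (φ := 1) norm_one hc, poissonKernel_eq_re_herglotzRieszKernel]
    simp
  rw [integral_complex_ofReal] at h2
  exact_mod_cast h2

theorem integral_abs_circlePoisson {r : ℝ} (hr0 : 0 ≤ r) (hr : r < 1) :
    ∫ c, |circlePoisson r c| ∂circ = 1 := by
  rw [← integral_circlePoisson hr0 hr]
  refine integral_congr_ae ?_
  filter_upwards [circ_ae_norm] with c hc
  exact abs_of_pos (circlePoisson_pos hr0 hr (by simpa using hc))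

/-- Convolution on the circle with a kernel is bounded by the `L¹` norm of the kernel. -/
theorem integral_norm_rpow_circ_conv_le {E : Type*} [NormedAddCommGroup E] [NormedSpace ℝ E]
    {p : ℝ} (hp : 1 < p) {k : ℂ → ℝ} (hk : ContinuousOn k (sphere 0 1)) {g : ℂ → E}
    (hg : ContinuousOn g (sphere 0 1)) :
    ∫ φ, ‖∫ c, k c • g (c * φ) ∂circ‖ ^ p ∂circ ≤
      (∫ c, |k c| ∂circ) ^ p * ∫ φ, ‖g φ‖ ^ p ∂circ := by
  refine integral_norm_rpow_integral_smul_le hp circ_ae_norm circ_ae_norm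
    (F := fun c φ => g (c * φ)) ?_ hk ?_ (by positivity)
  · refine hg.comp (by fun_prop) fun x hx => ?_
    have h1 := hx.1; have h2 := hx.2
    rw [mem_sphere_zero_iff_norm] at *
    simp [h1, h2]
  · intro c hc
    simp_rw [mul_comm c]
    exact (integral_circ_comp_mul (f := fun x => ‖g x‖ ^ p)
      (hg.norm.rpow_const fun _ _ => Or.inr (by linarith)) (by simpa using hc)).le

theorem exists_re_herglotz_pos {g : ℂ → ℝ} (hg : ContinuousOn g (sphere 0 1))
    (hg0 : ∀ c ∈ sphere (0 : ℂ) 1, 0 < g c) {w : ℂ} (hw : w ∈ ball (0 : ℂ) 1) :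
    0 < (herglotz g w).re := by
  obtain ⟨r, φ, hr0, hφ, rfl⟩ : ∃ (r : ℝ) (φ : ℂ), 0 ≤ r ∧ ‖φ‖ = 1 ∧ w = (r : ℂ) * φ := by
    rcases eq_or_ne w 0 with rfl | h
    · exact ⟨0, 1, le_rfl, norm_one, by simp⟩
    · have : (‖w‖ : ℂ) ≠ 0 := by simpa using h
      exact ⟨‖w‖, w / ‖w‖, norm_nonneg _, by simp [h], by field_simp⟩
  have hr : r < 1 := by simpa [hφ, abs_of_nonneg hr0] using hw
  rw [(herglotz_mul hg hr0 hr hφ).1]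
  have hgφ : ContinuousOn (fun c => g (c * φ)) (sphere 0 1) :=
    hg.comp (by fun_prop) (mapsTo_mul_sphere hφ)
  have hP := continuousOn_circlePoisson hr0 hr
  obtain ⟨x, hx, hmin⟩ := (isCompact_sphere (0 : ℂ) 1).exists_isMinOn ⟨1, by simp⟩ hgφ
  have hx0 : 0 < g (x * φ) := hg0 _ (mapsTo_mul_sphere hφ hx)
  calc 0 < g (x * φ) := hx0
    _ = ∫ c, circlePoisson r c * g (x * φ) ∂circ := by
      rw [integral_mul_const, integral_circlePoisson hr0 hr, one_mul]
    _ ≤ ∫ c, circlePoisson r c * g (c * φ) ∂circ := by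
      refine integral_mono_ae
        (integrable_of_continuousOn_sphere circ_ae_norm (hP.mul continuousOn_const))
        (integrable_of_continuousOn_sphere circ_ae_norm (hP.mul hgφ)) ?_
      filter_upwards [circ_ae_norm] with c hc
      have hc' : c ∈ sphere (0 : ℂ) 1 := by simpa using hc
      exact mul_le_mul_of_nonneg_left (hmin hc') (circlePoisson_pos hr0 hr hc').le

theorem exists_conjPoisson_bound_pos {p : ℝ} (hp : 1 < p) (hp2 : p ≤ 2) :
    ∃ C : ℝ, 0 ≤ C ∧ ∀ r : ℝ, 0 ≤ r → r < 1 → ∀ g : ℂ → ℝ, ContinuousOn g (sphere 0 1) →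
      (∀ c ∈ sphere (0 : ℂ) 1, 0 < g c) →
      ∫ φ, |∫ c, conjPoisson r c * g (c * φ) ∂circ| ^ p ∂circ ≤ C * ∫ φ, |g φ| ^ p ∂circ := by
  obtain ⟨C, D, hC, hD, hz⟩ := exists_riesz_inequality hp hp2
  have hp0 : 0 < p := by linarith
  refine ⟨C, hC, fun r hr0 hr g hg hg0 => ?_⟩
  have hpos := fun w hw => exists_re_herglotz_pos hg hg0 (w := w) hw
  have hdiff := differentiableOn_herglotz hg
  have hsl : Set.MapsTo (herglotz g) (ball 0 1) Complex.slitPlane := fun w hw =>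
    Or.inl (hpos w hw)
  have hpow : DifferentiableOn ℂ (fun w => herglotz g w ^ (p : ℂ)) (ball 0 1) :=
    hdiff.cpow (differentiableOn_const _) hsl
  have hsub : closedBall (0 : ℂ) |r| ⊆ ball 0 1 :=
    closedBall_subset_ball (by rwa [abs_of_nonneg hr0])
  have hmean : ∫ φ, herglotz g (r * φ) ^ (p : ℂ) ∂circ = herglotz g 0 ^ (p : ℂ) := by
    have h := DiffContOnCl.circleAverage (f := fun w => herglotz g w ^ (p : ℂ)) (c := 0) (R := r)
      ((hpow.mono hsub).diffContOnCl_ball subset_rfl)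
    rw [Real.circleAverage_eq_circleAverage_zero_one] at h
    simp only [add_zero] at h
    rw [← h, integral_circ]
    exact hpow.continuousOn.comp (by fun_prop) fun φ hφ => mul_mem_ball hr0 hr (by simpa using hφ)
  have hF : ContinuousOn (fun φ => herglotz g (r * φ)) (sphere 0 1) :=
    hdiff.continuousOn.comp (by fun_prop) fun φ hφ => mul_mem_ball hr0 hr (by simpa using hφ)
  have hFp : ContinuousOn (fun φ => herglotz g (r * φ) ^ (p : ℂ)) (sphere 0 1) :=
    hpow.continuousOn.comp (by fun_prop) fun φ hφ => mul_mem_ball hr0 hr (by simpa using hφ)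
  have hintg := integrable_of_continuousOn_sphere circ_ae_norm hFp
  have hintg' : Integrable (fun φ => (herglotz g (r * φ) ^ (p : ℂ)).re) circ := hintg.re
  have hmean' : 0 ≤ ∫ φ, (herglotz g (r * φ) ^ (p : ℂ)).re ∂circ := by
    have h1 : ∫ φ, (herglotz g (r * φ) ^ (p : ℂ)).re ∂circ = (herglotz g 0 ^ (p : ℂ)).re := by
      rw [← hmean]
      exact integral_re hintg
    have h2 : 0 < ∫ c, g c ∂circ := by
      have := hpos 0 (by simp)
      rwa [herglotz_zero hg, Complex.ofReal_re] at this
    rw [h1, herglotz_zero hg, ← Complex.ofReal_cpow h2.le, Complex.ofReal_re]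
    positivity
  have hFre : ContinuousOn (fun φ => (herglotz g (r * φ)).re) (sphere 0 1) :=
    Complex.continuous_re.comp_continuousOn hF
  have hFim : ContinuousOn (fun φ => (herglotz g (r * φ)).im) (sphere 0 1) :=
    Complex.continuous_im.comp_continuousOn hF
  have hi1 : Integrable (fun φ => (herglotz g (r * φ)).re ^ p) circ :=
    integrable_of_continuousOn_sphere circ_ae_norm
      (hFre.rpow_const fun _ _ => Or.inr hp0.le)
  calc ∫ φ, |∫ c, conjPoisson r c * g (c * φ) ∂circ| ^ p ∂circ
      = ∫ φ, |(herglotz g (r * φ)).im| ^ p ∂circ := by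
        refine integral_congr_ae ?_
        filter_upwards [circ_ae_norm] with φ hφ
        rw [(herglotz_mul hg hr0 hr hφ).2, abs_neg]
    _ ≤ ∫ φ, (C * (herglotz g (r * φ)).re ^ p - D * (herglotz g (r * φ) ^ (p : ℂ)).re) ∂circ := by
        refine integral_mono_ae (integrable_of_continuousOn_sphere circ_ae_norm
          (hFim.abs.rpow_const fun _ _ => Or.inr hp0.le)) ((hi1.const_mul C).sub
          (hintg'.const_mul D)) ?_
        filter_upwards [circ_ae_norm] with φ hφ
        refine le_trans ?_ (hz _ (hpos _ (mul_mem_ball hr0 hr hφ)))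
        gcongr
        exact Complex.abs_im_le_norm _
    _ ≤ C * ∫ φ, (herglotz g (r * φ)).re ^ p ∂circ := by
        rw [integral_sub (hi1.const_mul C) (hintg'.const_mul D), integral_const_mul,
          integral_const_mul]
        have := mul_nonneg hD hmean'
        linarith
    _ ≤ C * ∫ φ, |g φ| ^ p ∂circ := by
        refine mul_le_mul_of_nonneg_left ?_ hC
        have h := integral_norm_rpow_circ_conv_le hp (continuousOn_circlePoisson hr0 hr) hg
        rw [integral_abs_circlePoisson hr0 hr, Real.one_rpow, one_mul] at h
        refine le_trans (le_of_eq (integral_congr_ae ?_)) h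
        filter_upwards [circ_ae_norm] with φ hφ
        have := (hpos _ (mul_mem_ball hr0 hr hφ)).le
        rw [(herglotz_mul hg hr0 hr hφ).1] at *
        simp only [smul_eq_mul, Real.norm_eq_abs, abs_of_nonneg this]

theorem continuousOn_integral_of_sphere {𝔸 𝔹 E : Type*} [NormedAddCommGroup 𝔸] [ProperSpace 𝔸]
    [MeasurableSpace 𝔸] [BorelSpace 𝔸] [NormedAddCommGroup 𝔹] [NormedAddCommGroup E]
    [NormedSpace ℝ E] {m : Measure 𝔸} [IsFiniteMeasure m] (hm : ∀ᵐ y ∂m, ‖y‖ = 1)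
    {f : 𝔹 → 𝔸 → E} {s : Set 𝔹} (hs : IsCompact s)
    (hf : ContinuousOn (Function.uncurry f) (s ×ˢ sphere 0 1)) :
    ContinuousOn (fun x => ∫ y, f x y ∂m) s := by
  obtain ⟨M, hM⟩ := (hs.prod (isCompact_sphere (0 : 𝔸) 1)).exists_bound_of_continuousOn hf
  refine continuousOn_of_dominated (bound := fun _ => M) (fun x hx => ?_) (fun x hx => ?_)
    (integrable_const _) ?_
  · refine (integrable_of_continuousOn_sphere hm ?_).aestronglyMeasurable
    exact hf.comp (f := fun y => (x, y)) (by fun_prop) fun y hy => ⟨hx, hy⟩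
  · filter_upwards [hm] with y hy
    exact hM (x, y) ⟨hx, by simpa using hy⟩
  · filter_upwards [hm] with y hy
    exact hf.comp (f := fun x => (x, y)) (by fun_prop) fun x hx => ⟨hx, by simpa using hy⟩

theorem uncurry_mul_continuousOn {E : Type*} [TopologicalSpace E] {g : ℂ → E}
    (hg : ContinuousOn g (sphere 0 1)) :
    ContinuousOn (fun x : ℂ × ℂ => g (x.1 * x.2)) (sphere 0 1 ×ˢ sphere 0 1) := by
  refine hg.comp (by fun_prop) fun x hx => ?_
  have h1 := hx.1; have h2 := hx.2
  rw [mem_sphere_zero_iff_norm] at *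
  simp [h1, h2]

theorem continuousOn_circ_conv {E : Type*} [NormedAddCommGroup E] [NormedSpace ℝ E] {k : ℂ → ℝ}
    (hk : ContinuousOn k (sphere 0 1)) {g : ℂ → E} (hg : ContinuousOn g (sphere 0 1)) :
    ContinuousOn (fun φ => ∫ c, k c • g (c * φ) ∂circ) (sphere 0 1) := by
  refine continuousOn_integral_of_sphere circ_ae_norm (isCompact_sphere 0 1) ?_
  refine ContinuousOn.smul (hk.comp continuousOn_snd fun x hx => hx.2) ?_
  exact (uncurry_mul_continuousOn hg).comp (f := fun x : ℂ × ℂ => (x.2, x.1)) (by fun_prop)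
    fun x hx => ⟨hx.2, hx.1⟩

theorem integral_circ_mul_conv {k g h : ℂ → ℝ} (hk : ContinuousOn k (sphere 0 1))
    (hg : ContinuousOn g (sphere 0 1)) (hh : ContinuousOn h (sphere 0 1)) :
    ∫ φ, h φ * ∫ c, k c * g (c * φ) ∂circ ∂circ =
      ∫ φ, g φ * ∫ c, k (star c) * h (c * φ) ∂circ ∂circ := by
  have hks : ContinuousOn (fun c => k (star c)) (sphere 0 1) :=
    hk.comp (by fun_prop) fun c hc => by simpa using hc
  have hkf : ContinuousOn (fun x : ℂ × ℂ => k x.1) (sphere 0 1 ×ˢ sphere 0 1) :=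
    hk.comp continuousOn_fst fun x hx => hx.1
  have hksf : ContinuousOn (fun x : ℂ × ℂ => k (star x.1)) (sphere 0 1 ×ˢ sphere 0 1) :=
    hks.comp continuousOn_fst fun x hx => hx.1
  have hhs : ContinuousOn (fun x : ℂ × ℂ => h x.2) (sphere 0 1 ×ˢ sphere 0 1) :=
    hh.comp continuousOn_snd fun x hx => hx.2
  have hgs : ContinuousOn (fun x : ℂ × ℂ => g x.2) (sphere 0 1 ×ˢ sphere 0 1) :=
    hg.comp continuousOn_snd fun x hx => hx.2
  have hI : Integrable (fun x : ℂ × ℂ => k x.1 * (h x.2 * g (x.1 * x.2))) (circ.prod circ) :=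
    integrable_prod_of_continuousOn_sphere circ_ae_norm circ_ae_norm
      (hkf.mul (hhs.mul (uncurry_mul_continuousOn hg)))
  have hI' : Integrable (fun x : ℂ × ℂ => k (star x.1) * (g x.2 * h (x.1 * x.2)))
      (circ.prod circ) :=
    integrable_prod_of_continuousOn_sphere circ_ae_norm circ_ae_norm
      (hksf.mul (hgs.mul (uncurry_mul_continuousOn hh)))
  calc ∫ φ, h φ * ∫ c, k c * g (c * φ) ∂circ ∂circ
      = ∫ φ, ∫ c, k c * (h φ * g (c * φ)) ∂circ ∂circ := by
        refine integral_congr_ae (ae_of_all _ fun φ => ?_)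
        simp only
        rw [← integral_const_mul]
        exact integral_congr_ae (ae_of_all _ fun c => by simp only; ring)
    _ = ∫ c, ∫ φ, k c * (h φ * g (c * φ)) ∂circ ∂circ := integral_integral_swap hI.swap
    _ = ∫ c, k c * ∫ φ, g φ * h (star c * φ) ∂circ ∂circ := by
        refine integral_congr_ae ?_
        filter_upwards [circ_ae_norm] with c hc
        rw [integral_const_mul]
        congr 1
        have hcc : star c * c = 1 := by
          rw [mul_comm, Complex.star_def, Complex.mul_conj, Complex.normSq_eq_norm_sq, hc]; simp
        have h1 : ContinuousOn (fun φ => g φ * h (star c * φ)) (sphere 0 1) := by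
          refine hg.mul (hh.comp (by fun_prop) fun x hx => ?_)
          rw [mem_sphere_zero_iff_norm] at *
          rw [norm_mul, norm_star, hc, hx, one_mul]
        rw [← integral_comp_measurePreserving circ_ae_norm (measurePreserving_circ_mul hc) h1]
        refine integral_congr_ae (ae_of_all _ fun φ => ?_)
        simp only
        rw [← mul_assoc, hcc, one_mul, mul_comm]
    _ = ∫ c, k (star c) * ∫ φ, g φ * h (c * φ) ∂circ ∂circ := by
        have h2 : ContinuousOn (fun c => k (star c) * ∫ φ, g φ * h (c * φ) ∂circ) (sphere 0 1) := by
          refine hks.mul (continuousOn_integral_of_sphere circ_ae_norm (isCompact_sphere 0 1) ?_)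
          exact hgs.mul (uncurry_mul_continuousOn hh)
        rw [← integral_comp_measurePreserving circ_ae_norm measurePreserving_circ_conj h2]
        simp
    _ = ∫ c, ∫ φ, k (star c) * (g φ * h (c * φ)) ∂circ ∂circ := by
        simp_rw [integral_const_mul]
    _ = ∫ φ, ∫ c, k (star c) * (g φ * h (c * φ)) ∂circ ∂circ := integral_integral_swap hI'
    _ = ∫ φ, g φ * ∫ c, k (star c) * h (c * φ) ∂circ ∂circ := by
        refine integral_congr_ae (ae_of_all _ fun φ => ?_)
        simp only
        rw [← integral_const_mul]
        exact integral_congr_ae (ae_of_all _ fun c => by simp only; ring)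

theorem conjPoisson_star (r : ℝ) (c : ℂ) : conjPoisson r (star c) = -conjPoisson r c := by
  have : ‖1 - (r : ℂ) * star c‖ = ‖1 - (r : ℂ) * c‖ := by
    rw [← norm_star]
    simp
  rw [conjPoisson, this, conjPoisson]
  simp
  ring

theorem exists_conjPoisson_bound_le_two {p : ℝ} (hp : 1 < p) (hp2 : p ≤ 2) :
    ∃ C : ℝ, 0 ≤ C ∧ ∀ r : ℝ, 0 ≤ r → r < 1 → ∀ g : ℂ → ℝ, ContinuousOn g (sphere 0 1) →
      ∫ φ, |∫ c, conjPoisson r c * g (c * φ) ∂circ| ^ p ∂circ ≤ C * ∫ φ, |g φ| ^ p ∂circ := by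
  obtain ⟨C, hC, hbd⟩ := exists_conjPoisson_bound_pos hp hp2
  have hp0 : 0 < p := by linarith
  have hpow : ∀ {f : ℂ → ℝ}, ContinuousOn f (sphere 0 1) →
      Integrable (fun φ => |f φ| ^ p) circ := fun hf =>
    integrable_of_continuousOn_sphere circ_ae_norm (hf.abs.rpow_const fun _ _ => Or.inr hp0.le)
  set K := 2 ^ p * (2 * (C * (2 ^ p * 2 ^ p))) with hK
  refine ⟨K, by positivity, fun r hr0 hr g hg => ?_⟩
  have hk := continuousOn_conjPoisson hr0 hr
  suffices h : ∀ ε : ℝ, 0 < ε → ∫ φ, |∫ c, conjPoisson r c * g (c * φ) ∂circ| ^ p ∂circ ≤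
      K * (∫ φ, |g φ| ^ p ∂circ + ε ^ p) by
    have hlim : Filter.Tendsto (fun ε : ℝ => K * (∫ φ, |g φ| ^ p ∂circ + ε ^ p))
        (nhdsWithin 0 (Set.Ioi 0)) (nhds (K * (∫ φ, |g φ| ^ p ∂circ + 0))) := by
      have h0 : Filter.Tendsto (fun ε : ℝ => ε ^ p) (nhdsWithin 0 (Set.Ioi 0)) (nhds 0) := by
        have := (Real.continuousAt_rpow_const 0 p (Or.inr hp0.le)).tendsto
        rw [Real.zero_rpow hp0.ne'] at this
        exact this.mono_left nhdsWithin_le_nhds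
      exact (h0.const_add _).const_mul K
    rw [add_zero] at hlim
    exact ge_of_tendsto hlim (eventually_nhdsWithin_of_forall fun ε hε => h ε hε)
  intro ε hε
  have hconv : ∀ {f : ℂ → ℝ}, ContinuousOn f (sphere 0 1) →
      ContinuousOn (fun φ => ∫ c, conjPoisson r c * f (c * φ) ∂circ) (sphere 0 1) := fun hf =>
    continuousOn_circ_conv hk hf
  have hsize : ∀ f : ℂ → ℝ, ContinuousOn f (sphere 0 1) →
      (∀ c ∈ sphere (0 : ℂ) 1, 0 < f c ∧ f c ≤ 2 * (|g c| + ε)) →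
      ∫ φ, |∫ c, conjPoisson r c * f (c * φ) ∂circ| ^ p ∂circ ≤
        C * (2 ^ p * 2 ^ p) * (∫ φ, |g φ| ^ p ∂circ + ε ^ p) := by
    intro f hf hfg
    refine (hbd r hr0 hr f hf fun c hc => (hfg c hc).1).trans ?_
    rw [mul_assoc]
    refine mul_le_mul_of_nonneg_left ?_ hC
    calc ∫ φ, |f φ| ^ p ∂circ ≤ ∫ φ, 2 ^ p * 2 ^ p * (|g φ| ^ p + ε ^ p) ∂circ := by
          refine integral_mono_ae (hpow hf) (((hpow hg).add (integrable_const _)).const_mul _) ?_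
          filter_upwards [circ_ae_norm] with c hc
          have := hfg c (by simpa using hc)
          rw [abs_of_pos this.1]
          calc f c ^ p ≤ (2 * (|g c| + ε)) ^ p := Real.rpow_le_rpow this.1.le this.2 hp0.le
            _ = 2 ^ p * (|g c| + ε) ^ p := Real.mul_rpow (by norm_num) (by positivity)
            _ ≤ 2 ^ p * (2 ^ p * (|g c| ^ p + ε ^ p)) := by
              gcongr
              exact add_rpow_le hp (abs_nonneg _) hε.le
            _ = _ := by ring
      _ = _ := by
          rw [integral_const_mul, integral_add (hpow hg) (integrable_const _)]
          simp
  set g₁ : ℂ → ℝ := fun c => |g c| + g c + ε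
  set g₂ : ℂ → ℝ := fun c => |g c| + ε
  have hg₁ : ContinuousOn g₁ (sphere 0 1) := by fun_prop
  have hg₂ : ContinuousOn g₂ (sphere 0 1) := by fun_prop
  have h1 := hsize g₁ hg₁ fun c _ => by
    have := neg_abs_le (g c); have := le_abs_self (g c)
    exact ⟨by simp only [g₁]; linarith, by simp only [g₁]; linarith⟩
  have h2 := hsize g₂ hg₂ fun c _ => by
    have := abs_nonneg (g c)
    exact ⟨by simp only [g₂]; linarith, by simp only [g₂]; linarith⟩
  have hi : ∀ {f : ℂ → ℝ} {φ : ℂ}, ContinuousOn f (sphere 0 1) → ‖φ‖ = 1 →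
      Integrable (fun c => conjPoisson r c * f (c * φ)) circ := fun hf hφ =>
    integrable_of_continuousOn_sphere circ_ae_norm
      (hk.mul (hf.comp (by fun_prop) (mapsTo_mul_sphere hφ)))
  calc ∫ φ, |∫ c, conjPoisson r c * g (c * φ) ∂circ| ^ p ∂circ
      ≤ ∫ φ, 2 ^ p * (|∫ c, conjPoisson r c * g₁ (c * φ) ∂circ| ^ p +
          |∫ c, conjPoisson r c * g₂ (c * φ) ∂circ| ^ p) ∂circ := by
        refine integral_mono_ae (hpow (hconv hg))
          (((hpow (hconv hg₁)).add (hpow (hconv hg₂))).const_mul _) ?_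
        filter_upwards [circ_ae_norm] with φ hφ
        have e : ∫ c, conjPoisson r c * g (c * φ) ∂circ =
            ∫ c, conjPoisson r c * g₁ (c * φ) ∂circ - ∫ c, conjPoisson r c * g₂ (c * φ) ∂circ := by
          rw [← integral_sub (hi hg₁ hφ) (hi hg₂ hφ)]
          exact integral_congr_ae (ae_of_all _ fun c => by simp only [g₁, g₂]; ring)
        rw [e]
        refine le_trans ?_ (add_rpow_le hp (abs_nonneg _) (abs_nonneg _))
        exact Real.rpow_le_rpow (abs_nonneg _) (abs_sub _ _) hp0.le
    _ = 2 ^ p * (∫ φ, |∫ c, conjPoisson r c * g₁ (c * φ) ∂circ| ^ p ∂circ +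
          ∫ φ, |∫ c, conjPoisson r c * g₂ (c * φ) ∂circ| ^ p ∂circ) := by
        rw [integral_const_mul, integral_add (hpow (hconv hg₁)) (hpow (hconv hg₂))]
    _ ≤ 2 ^ p * (C * (2 ^ p * 2 ^ p) * (∫ φ, |g φ| ^ p ∂circ + ε ^ p) +
          C * (2 ^ p * 2 ^ p) * (∫ φ, |g φ| ^ p ∂circ + ε ^ p)) := by gcongr
    _ = K * (∫ φ, |g φ| ^ p ∂circ + ε ^ p) := by rw [hK]; ring

theorem exists_conjPoisson_bound {p : ℝ} (hp : 1 < p) :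
    ∃ C : ℝ, 0 ≤ C ∧ ∀ r : ℝ, 0 ≤ r → r < 1 → ∀ g : ℂ → ℝ, ContinuousOn g (sphere 0 1) →
      ∫ φ, |∫ c, conjPoisson r c * g (c * φ) ∂circ| ^ p ∂circ ≤ C * ∫ φ, |g φ| ^ p ∂circ := by
  rcases le_total p 2 with hp2 | hp2
  · exact exists_conjPoisson_bound_le_two hp hp2
  have hp0 : 0 < p := by linarith
  set q := p / (p - 1) with hq
  have hpq : p.HolderConjugate q := Real.HolderConjugate.conjExponent hp
  have hq1 : 1 < q := hpq.symm.lt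
  have hq0 : 0 < q := by linarith
  have hq2 : q ≤ 2 := by
    rw [hq, div_le_iff₀ (by linarith)]
    linarith
  obtain ⟨C, hC, hbd⟩ := exists_conjPoisson_bound_le_two hq1 hq2
  set L : ℝ := (2 * (C + 1)) ^ (1 / q) with hL
  have hL0 : 0 < L := by positivity
  have hLq : L ^ q = 2 * (C + 1) := by
    rw [hL, ← Real.rpow_mul (by positivity), one_div_mul_cancel hq0.ne', Real.rpow_one]
  refine ⟨2 * L ^ p, by positivity, fun r hr0 hr g hg => ?_⟩
  have hk := continuousOn_conjPoisson hr0 hr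
  have hconv : ∀ {f : ℂ → ℝ}, ContinuousOn f (sphere 0 1) →
      ContinuousOn (fun φ => ∫ c, conjPoisson r c * f (c * φ) ∂circ) (sphere 0 1) := fun hf =>
    continuousOn_circ_conv hk hf
  have hpow : ∀ {f : ℂ → ℝ} {s : ℝ}, 0 < s → ContinuousOn f (sphere 0 1) →
      Integrable (fun φ => |f φ| ^ s) circ := fun hs hf =>
    integrable_of_continuousOn_sphere circ_ae_norm (hf.abs.rpow_const fun _ _ => Or.inr hs.le)
  set h : ℂ → ℝ := fun φ => ∫ c, conjPoisson r c * g (c * φ) ∂circ with hh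
  have hhc : ContinuousOn h (sphere 0 1) := hconv hg
  set u : ℂ → ℝ := fun φ => |h φ| ^ (p - 2) * h φ with hu
  have huc : ContinuousOn u (sphere 0 1) :=
    (hhc.abs.rpow_const fun _ _ => Or.inr (by linarith)).mul hhc
  have hu1 : ∀ φ, u φ * h φ = |h φ| ^ p := fun φ => by
    have e : |h φ| ^ p = |h φ| ^ (p - 2) * |h φ| ^ (2 : ℝ) := by
      rw [← Real.rpow_add_of_nonneg (abs_nonneg _) (by linarith) (by norm_num)]
      ring_nf
    rw [e, Real.rpow_two, sq_abs]
    simp only [hu]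
    ring
  have hu2 : ∀ φ, |u φ| ^ q = |h φ| ^ p := fun φ => by
    have e : |u φ| = |h φ| ^ (p - 1) := by
      simp only [hu]
      rw [abs_mul, abs_of_nonneg (a := |h φ| ^ (p - 2)) (by positivity)]
      have := Real.rpow_add_of_nonneg (abs_nonneg (h φ)) (y := p - 2) (z := 1) (by linarith)
        zero_le_one
      rw [Real.rpow_one] at this
      rw [← this]
      ring_nf
    rw [e, ← Real.rpow_mul (abs_nonneg _), hq]
    congr 1
    have : p - 1 ≠ 0 := by linarith
    field_simp
  have hdual : ∫ φ, |h φ| ^ p ∂circ = -∫ φ, g φ * ∫ c, conjPoisson r c * u (c * φ) ∂circ ∂circ := by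
    simp_rw [← hu1]
    rw [integral_circ_mul_conv hk hg huc, ← integral_neg]
    refine integral_congr_ae (ae_of_all _ fun φ => ?_)
    simp only [conjPoisson_star, neg_mul, integral_neg, mul_neg]
  have hyoung : -∫ φ, g φ * ∫ c, conjPoisson r c * u (c * φ) ∂circ ∂circ ≤
      L ^ p * ∫ φ, |g φ| ^ p ∂circ +
        1 / (2 * (C + 1)) * ∫ φ, |∫ c, conjPoisson r c * u (c * φ) ∂circ| ^ q ∂circ := by
    rw [← integral_neg, ← integral_const_mul, ← integral_const_mul, ← integral_add
      ((hpow hp0 hg).const_mul _) ((hpow hq0 (hconv huc)).const_mul _)]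
    refine integral_mono (integrable_of_continuousOn_sphere circ_ae_norm (hg.mul (hconv huc))).neg
      (((hpow hp0 hg).const_mul _).add ((hpow hq0 (hconv huc)).const_mul _)) fun φ => ?_
    simp only
    set b := ∫ c, conjPoisson r c * u (c * φ) ∂circ
    have h1 := Real.young_inequality_of_nonneg (a := L * |g φ|) (b := |b| / L) (by positivity)
      (by positivity) hpq
    have h2 : L * |g φ| * (|b| / L) = |g φ| * |b| := by field_simp
    rw [h2, Real.mul_rpow hL0.le (abs_nonneg _), Real.div_rpow (abs_nonneg _) hL0.le, hLq] at h1
    have h3 : -(g φ * b) ≤ |g φ| * |b| := by rw [← abs_mul]; exact neg_le_abs _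
    have h4 : L ^ p * |g φ| ^ p / p ≤ L ^ p * |g φ| ^ p := div_le_self (by positivity) hp.le
    have h5 : |b| ^ q / (2 * (C + 1)) / q ≤ |b| ^ q / (2 * (C + 1)) :=
      div_le_self (by positivity) hq1.le
    rw [one_div_mul_eq_div]
    linarith
  have hfin := hbd r hr0 hr u huc
  simp_rw [hu2] at hfin
  set A := ∫ φ, |h φ| ^ p ∂circ
  have hA : 0 ≤ A := integral_nonneg fun φ => by positivity
  have h6 : 1 / (2 * (C + 1)) * ∫ φ, |∫ c, conjPoisson r c * u (c * φ) ∂circ| ^ q ∂circ ≤ A / 2 := by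
    calc _ ≤ 1 / (2 * (C + 1)) * (C * A) := by gcongr
      _ ≤ 1 / (2 * (C + 1)) * ((C + 1) * A) := by gcongr; linarith
      _ = A / 2 := by field_simp
  linarith

theorem exists_quaternion_coords : ∃ ℓ : Fin 4 → ℍ[ℝ] →L[ℝ] ℝ, (∀ j q, |ℓ j q| ≤ ‖q‖) ∧
    ∀ p : ℝ, 1 < p → ∀ q, ‖q‖ ^ p ≤ 2 ^ p * 2 ^ p * ∑ j, |ℓ j q| ^ p := by
  let a : ℍ[ℝ] →ₗ[ℝ] ℝ := ⟨⟨fun q => q.re, by simp⟩, by simp⟩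
  let b : ℍ[ℝ] →ₗ[ℝ] ℝ := ⟨⟨fun q => q.imI, by simp⟩, by simp⟩
  let c : ℍ[ℝ] →ₗ[ℝ] ℝ := ⟨⟨fun q => q.imJ, by simp⟩, by simp⟩
  let d : ℍ[ℝ] →ₗ[ℝ] ℝ := ⟨⟨fun q => q.imK, by simp⟩, by simp⟩
  refine ⟨![a.toContinuousLinearMap, b.toContinuousLinearMap, c.toContinuousLinearMap,
    d.toContinuousLinearMap], fun j q => ?_, fun p hp q => ?_⟩
  · have := quaternion_coords_abs_le q
    fin_cases j
    exacts [this.1, this.2.1, this.2.2.1, this.2.2.2]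
  · refine (quaternion_norm_rpow_le hp q).trans (le_of_eq ?_)
    rw [Fin.sum_univ_four]
    rfl

theorem integral_norm_add_rpow_le {𝔸 E : Type*} [MeasurableSpace 𝔸] [NormedAddCommGroup E]
    {m : Measure 𝔸} {p : ℝ} (hp : 1 < p) {f g : 𝔸 → E} (hf : Integrable (fun x => ‖f x‖ ^ p) m)
    (hg : Integrable (fun x => ‖g x‖ ^ p) m) (hfm : AEStronglyMeasurable f m)
    (hgm : AEStronglyMeasurable g m) :
    ∫ x, ‖f x + g x‖ ^ p ∂m ≤ 2 ^ p * (∫ x, ‖f x‖ ^ p ∂m + ∫ x, ‖g x‖ ^ p ∂m) := by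
  have hle : ∀ x, ‖f x + g x‖ ^ p ≤ 2 ^ p * (‖f x‖ ^ p + ‖g x‖ ^ p) := fun x =>
    (Real.rpow_le_rpow (norm_nonneg _) (norm_add_le _ _) (by linarith)).trans
      (add_rpow_le hp (norm_nonneg _) (norm_nonneg _))
  have hi := (hf.add hg).const_mul (2 ^ p)
  rw [← integral_add hf hg, ← integral_const_mul]
  refine integral_mono (hi.mono' ?_ (ae_of_all _ fun x => ?_)) hi hle
  · exact ((hfm.add hgm).norm.aemeasurable.pow_const p).aestronglyMeasurable
  · rw [Real.norm_of_nonneg (by positivity)]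
    exact hle x

theorem integrable_circ_conv {k : ℂ → ℝ} (hk : ContinuousOn k (sphere 0 1)) {G : ℂ → ℍ[ℝ]}
    (hG : ContinuousOn G (sphere 0 1)) {φ : ℂ} (hφ : ‖φ‖ = 1) :
    Integrable (fun c => k c • G (c * φ)) circ :=
  integrable_of_continuousOn_sphere circ_ae_norm
    (hk.smul (hG.comp (by fun_prop) (mapsTo_mul_sphere hφ)))

theorem integral_norm_rpow_conjPoisson_le {p : ℝ} (hp : 1 < p) :
    ∃ C : ℝ, 0 ≤ C ∧ ∀ r : ℝ, 0 ≤ r → r < 1 → ∀ G : ℂ → ℍ[ℝ], ContinuousOn G (sphere 0 1) →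
      ∫ φ, ‖∫ c, conjPoisson r c • G (c * φ) ∂circ‖ ^ p ∂circ ≤ C * ∫ φ, ‖G φ‖ ^ p ∂circ := by
  obtain ⟨C, hC, hbd⟩ := exists_conjPoisson_bound hp
  obtain ⟨ℓ, hℓ, hℓp⟩ := exists_quaternion_coords
  have hp0 : 0 < p := by linarith
  refine ⟨2 ^ p * 2 ^ p * (4 * C), by positivity, fun r hr0 hr G hG => ?_⟩
  have hk := continuousOn_conjPoisson hr0 hr
  have hpow : ∀ {f : ℂ → ℝ}, ContinuousOn f (sphere 0 1) →
      Integrable (fun φ => |f φ| ^ p) circ := fun hf =>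
    integrable_of_continuousOn_sphere circ_ae_norm (hf.abs.rpow_const fun _ _ => Or.inr hp0.le)
  have hT := continuousOn_circ_conv hk hG
  have hℓT : ∀ j, ContinuousOn (fun φ => ℓ j (∫ c, conjPoisson r c • G (c * φ) ∂circ))
      (sphere 0 1) := fun j => (ℓ j).continuous.comp_continuousOn hT
  have hGp : Integrable (fun φ => ‖G φ‖ ^ p) circ :=
    integrable_of_continuousOn_sphere circ_ae_norm (hG.norm.rpow_const fun _ _ => Or.inr hp0.le)
  calc ∫ φ, ‖∫ c, conjPoisson r c • G (c * φ) ∂circ‖ ^ p ∂circ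
      ≤ ∫ φ, 2 ^ p * 2 ^ p * ∑ j, |ℓ j (∫ c, conjPoisson r c • G (c * φ) ∂circ)| ^ p ∂circ :=
        integral_mono (integrable_of_continuousOn_sphere circ_ae_norm
          (hT.norm.rpow_const fun _ _ => Or.inr hp0.le))
          ((integrable_finsetSum _ fun j _ => hpow (hℓT j)).const_mul _) fun φ => hℓp p hp _
    _ = 2 ^ p * 2 ^ p * ∑ j, ∫ φ, |ℓ j (∫ c, conjPoisson r c • G (c * φ) ∂circ)| ^ p ∂circ := by
        rw [integral_const_mul, integral_finsetSum _ fun j _ => hpow (hℓT j)]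
    _ ≤ 2 ^ p * 2 ^ p * ∑ j : Fin 4, C * ∫ φ, ‖G φ‖ ^ p ∂circ := by
        refine mul_le_mul_of_nonneg_left (Finset.sum_le_sum fun j _ => ?_) (by positivity)
        have hℓG : ContinuousOn (fun c => ℓ j (G c)) (sphere 0 1) :=
          (ℓ j).continuous.comp_continuousOn hG
        calc _ = ∫ φ, |∫ c, conjPoisson r c * ℓ j (G (c * φ)) ∂circ| ^ p ∂circ := by
              refine integral_congr_ae ?_
              filter_upwards [circ_ae_norm] with φ hφ
              rw [← (ℓ j).integral_comp_comm (integrable_circ_conv hk hG hφ)]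
              simp
          _ ≤ C * ∫ φ, |ℓ j (G φ)| ^ p ∂circ := hbd r hr0 hr _ hℓG
          _ ≤ C * ∫ φ, ‖G φ‖ ^ p ∂circ := by
              refine mul_le_mul_of_nonneg_left (integral_mono (hpow hℓG) hGp fun φ => ?_) hC
              exact Real.rpow_le_rpow (abs_nonneg _) (hℓ _ _) hp0.le
    _ = _ := by simp; ring

/-- The circular kernel of the odd part of the quaternionic Cauchy kernel. -/
noncomputable def oddKernel (r : ℝ) (c : ℂ) : ℝ := 2 * r * c.im ^ 3 / ‖1 - r * c‖ ^ 4

theorem continuousOn_oddKernel {r : ℝ} (hr0 : 0 ≤ r) (hr : r < 1) :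
    ContinuousOn (oddKernel r) (sphere 0 1) := by
  refine ContinuousOn.div (by fun_prop) (by fun_prop) fun c hc => ?_
  have := one_sub_mul_ne_zero hr0 hr hc
  positivity

theorem norm_one_sub_mul_sq {r : ℝ} {c : ℂ} (hc : ‖c‖ = 1) :
    ‖1 - (r : ℂ) * c‖ ^ 2 = 1 - 2 * r * c.re + r ^ 2 := by
  have hn : c.re * c.re + c.im * c.im = 1 := by
    rw [← Complex.normSq_apply, Complex.normSq_eq_norm_sq, hc, one_pow]
  rw [← Complex.normSq_eq_norm_sq, Complex.normSq_apply]
  simp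
  linear_combination r ^ 2 * hn

theorem abs_im_le_norm_one_sub_mul {r : ℝ} {c : ℂ} (hc : ‖c‖ = 1) :
    |c.im| ≤ ‖1 - (r : ℂ) * c‖ := by
  have hn : c.re * c.re + c.im * c.im = 1 := by
    rw [← Complex.normSq_apply, Complex.normSq_eq_norm_sq, hc, one_pow]
  refine abs_le_of_sq_le_sq ?_ (norm_nonneg _)
  rw [norm_one_sub_mul_sq hc]
  nlinarith [sq_nonneg (r - c.re)]

theorem one_sub_le_norm_one_sub_mul {r : ℝ} (hr0 : 0 ≤ r) {c : ℂ} (hc : ‖c‖ = 1) :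
    1 - r ≤ ‖1 - (r : ℂ) * c‖ := by
  have := norm_sub_norm_le (1 : ℂ) (r * c)
  rwa [norm_mul, hc, Complex.norm_real, norm_one, mul_one, Real.norm_of_nonneg hr0] at this

/-- The difference of the odd kernel and a multiple of the conjugate Poisson kernel. -/
theorem abs_oddKernel_sub_le {r : ℝ} (hr0 : 1 / 2 ≤ r) (hr : r < 1) {c : ℂ} (hc : ‖c‖ = 1) :
    |oddKernel r c - (1 + r ^ 2) / (2 * r ^ 2) * conjPoisson r c| ≤ 2 * circlePoisson r c + 1 := by
  have hN : 0 < ‖1 - (r : ℂ) * c‖ := norm_pos_iff.2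
    (one_sub_mul_ne_zero (by linarith) hr (by simpa using hc))
  have hsq := norm_one_sub_mul_sq (r := r) hc
  have him := abs_im_le_norm_one_sub_mul (r := r) hc
  have h1r := one_sub_le_norm_one_sub_mul (r := r) (by linarith) hc
  have hn : c.re * c.re + c.im * c.im = 1 := by
    rw [← Complex.normSq_apply, Complex.normSq_eq_norm_sq, hc, one_pow]
  have him1 : |c.im| ≤ 1 := hc ▸ Complex.abs_im_le_norm c
  unfold oddKernel conjPoisson circlePoisson
  set N := ‖1 - (r : ℂ) * c‖
  have e : 2 * r * c.im ^ 3 / N ^ 4 - (1 + r ^ 2) / (2 * r ^ 2) * (2 * r * c.im / N ^ 2) =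
      -(c.im / (2 * r) * ((1 - r ^ 2) ^ 2 / N ^ 4 + 1)) := by
    have hr1 : r ≠ 0 := by linarith
    have h4 : N ^ 4 = (N ^ 2) ^ 2 := by ring
    have hD : (1 - 2 * r * c.re + r ^ 2) ≠ 0 := by rw [← hsq]; positivity
    rw [h4, hsq]
    field_simp
    linear_combination (4 * r ^ 2 * c.im) * hn
  have e1 : |c.im / (2 * r)| ≤ |c.im| := by
    rw [abs_div, abs_of_pos (by linarith : 0 < 2 * r)]
    exact div_le_self (abs_nonneg _) (by linarith)
  rw [e, abs_neg, abs_mul, abs_of_nonneg (a := (1 - r ^ 2) ^ 2 / N ^ 4 + 1) (by positivity)]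
  have e2 : |c.im| * (1 - r ^ 2) ≤ 2 * N ^ 2 := by
    have h5 : 1 - r ^ 2 ≤ 2 * N := by nlinarith
    calc |c.im| * (1 - r ^ 2) ≤ N * (2 * N) := mul_le_mul him h5 (by nlinarith) hN.le
      _ = _ := by ring
  have e3 : |c.im| * ((1 - r ^ 2) ^ 2 / N ^ 4) ≤ 2 * ((1 - r ^ 2) / N ^ 2) := by
    rw [← mul_div_assoc, ← mul_div_assoc, div_le_div_iff₀ (by positivity) (by positivity)]
    have : 0 ≤ (1 - r ^ 2) * N ^ 2 := mul_nonneg (by nlinarith) (by positivity)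
    nlinarith
  calc |c.im / (2 * r)| * ((1 - r ^ 2) ^ 2 / N ^ 4 + 1) ≤
      |c.im| * ((1 - r ^ 2) ^ 2 / N ^ 4 + 1) := by gcongr
    _ ≤ _ := by linarith

theorem exists_oddKernel_bound {p : ℝ} (hp : 1 < p) :
    ∃ C : ℝ, 0 ≤ C ∧ ∀ r : ℝ, 0 ≤ r → r < 1 → ∀ G : ℂ → ℍ[ℝ], ContinuousOn G (sphere 0 1) →
      ∫ φ, ‖∫ c, oddKernel r c • G (c * φ) ∂circ‖ ^ p ∂circ ≤ C * ∫ φ, ‖G φ‖ ^ p ∂circ := by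
  obtain ⟨C, hC, hbd⟩ := integral_norm_rpow_conjPoisson_le hp
  have hp0 : 0 < p := by linarith
  refine ⟨16 ^ p + 2 ^ p * (3 ^ p + 4 ^ p * C), by positivity, fun r hr0 hr G hG => ?_⟩
  have hk := continuousOn_conjPoisson hr0 hr
  have hP := continuousOn_circlePoisson hr0 hr
  have ho := continuousOn_oddKernel hr0 hr
  have hI : 0 ≤ ∫ φ, ‖G φ‖ ^ p ∂circ := by positivity
  rcases lt_or_ge r (1 / 2) with h2 | h2
  · have h1 := integral_norm_rpow_circ_conv_le hp ho hG
    have h3 : ∫ c, |oddKernel r c| ∂circ ≤ 16 := by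
      calc ∫ c, |oddKernel r c| ∂circ ≤ ∫ c, 16 ∂circ := by
            refine integral_mono_ae (integrable_of_continuousOn_sphere circ_ae_norm ho.abs)
              (integrable_const _) ?_
            filter_upwards [circ_ae_norm] with c hc
            have h1r := one_sub_le_norm_one_sub_mul hr0 hc
            have h4 : (1 / 2) ^ 4 ≤ ‖1 - (r : ℂ) * c‖ ^ 4 :=
              pow_le_pow_left₀ (by norm_num) (by linarith) 4
            have him1 : |c.im| ≤ 1 := hc ▸ Complex.abs_im_le_norm c
            rw [oddKernel, abs_div, abs_of_nonneg (a := ‖1 - (r : ℂ) * c‖ ^ 4) (by positivity),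
              div_le_iff₀ (by linarith), abs_mul, abs_of_nonneg (a := 2 * r) (by positivity),
              abs_pow]
            have h5 : |c.im| ^ 3 ≤ 1 := pow_le_one₀ (abs_nonneg _) him1
            nlinarith [pow_nonneg (abs_nonneg c.im) 3]
        _ = 16 := by simp
    calc _ ≤ _ := h1
      _ ≤ 16 ^ p * ∫ φ, ‖G φ‖ ^ p ∂circ := by gcongr
      _ ≤ _ := by
        refine mul_le_mul_of_nonneg_right ?_ hI
        have : 0 ≤ 2 ^ p * (3 ^ p + 4 ^ p * C) := by positivity
        linarith
  · set A := (1 + r ^ 2) / (2 * r ^ 2) with hA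
    have hA4 : A ≤ 4 := by
      rw [hA, div_le_iff₀ (by positivity)]
      nlinarith
    have hA0 : 0 ≤ A := by positivity
    set k₁ : ℂ → ℝ := fun c => oddKernel r c - A * conjPoisson r c
    have hk₁ : ContinuousOn k₁ (sphere 0 1) := ho.sub (continuousOn_const.mul hk)
    have hk₁L : ∫ c, |k₁ c| ∂circ ≤ 3 := by
      have hPi := integrable_of_continuousOn_sphere circ_ae_norm hP
      calc ∫ c, |k₁ c| ∂circ ≤ ∫ c, (2 * circlePoisson r c + 1) ∂circ := by
            refine integral_mono_ae (integrable_of_continuousOn_sphere circ_ae_norm hk₁.abs)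
              ((hPi.const_mul _).add (integrable_const _)) ?_
            filter_upwards [circ_ae_norm] with c hc
            exact abs_oddKernel_sub_le h2 hr hc
        _ = 3 := by
            rw [integral_add (hPi.const_mul _) (integrable_const _), integral_const_mul,
              integral_circlePoisson hr0 hr]
            norm_num
    have hT₁ := continuousOn_circ_conv hk₁ hG
    have hT₂ := continuousOn_circ_conv hk hG
    have hT₂' : ContinuousOn (fun φ => A • ∫ c, conjPoisson r c • G (c * φ) ∂circ) (sphere 0 1) :=
      hT₂.const_smul A
    have hpow : ∀ {f : ℂ → ℍ[ℝ]}, ContinuousOn f (sphere 0 1) →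
        Integrable (fun φ => ‖f φ‖ ^ p) circ := fun hf =>
      integrable_of_continuousOn_sphere circ_ae_norm (hf.norm.rpow_const fun _ _ => Or.inr hp0.le)
    calc ∫ φ, ‖∫ c, oddKernel r c • G (c * φ) ∂circ‖ ^ p ∂circ
        = ∫ φ, ‖∫ c, k₁ c • G (c * φ) ∂circ +
            A • ∫ c, conjPoisson r c • G (c * φ) ∂circ‖ ^ p ∂circ := by
          refine integral_congr_ae ?_
          filter_upwards [circ_ae_norm] with φ hφ
          have hI₂ : Integrable (fun c => A • (conjPoisson r c • G (c * φ))) circ :=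
            (integrable_circ_conv hk hG hφ).smul A
          rw [← integral_smul, ← integral_add (integrable_circ_conv hk₁ hG hφ) hI₂]
          congr 2
          refine integral_congr_ae (ae_of_all _ fun c => ?_)
          simp only [k₁]
          rw [smul_smul, ← add_smul]
          ring_nf
      _ ≤ 2 ^ p * (∫ φ, ‖∫ c, k₁ c • G (c * φ) ∂circ‖ ^ p ∂circ +
            ∫ φ, ‖A • ∫ c, conjPoisson r c • G (c * φ) ∂circ‖ ^ p ∂circ) :=
          integral_norm_add_rpow_le hp (hpow hT₁) (hpow hT₂')
            (integrable_of_continuousOn_sphere circ_ae_norm hT₁).aestronglyMeasurable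
            (integrable_of_continuousOn_sphere circ_ae_norm hT₂').aestronglyMeasurable
      _ ≤ 2 ^ p * (3 ^ p * ∫ φ, ‖G φ‖ ^ p ∂circ + 4 ^ p * (C * ∫ φ, ‖G φ‖ ^ p ∂circ)) := by
          refine mul_le_mul_of_nonneg_left (add_le_add ?_ ?_) (by positivity)
          · refine (integral_norm_rpow_circ_conv_le hp hk₁ hG).trans ?_
            gcongr
          · simp_rw [norm_smul, Real.mul_rpow (norm_nonneg _) (norm_nonneg _)]
            rw [integral_const_mul, Real.norm_of_nonneg hA0]
            have := hbd r hr0 hr G hG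
            gcongr
      _ ≤ _ := by
          have : 0 ≤ (16 : ℝ) ^ p * ∫ φ, ‖G φ‖ ^ p ∂circ := by positivity
          linarith

section

variable {ψ : Measure ℍ[ℝ]}

theorem norm_cos_add_sin {n : ℍ[ℝ]} (hn : star n = -n) (hn1 : ‖n‖ = 1) (t : ℝ) :
    ‖((Real.cos t : ℝ) : ℍ[ℝ]) + Real.sin t • n‖ = 1 := by
  have h0 : n.re = 0 := by
    have := congrArg (fun q : ℍ[ℝ] => q.re) hn
    simp at this
    linarith
  have h1 : n.imI ^ 2 + n.imJ ^ 2 + n.imK ^ 2 = 1 := by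
    have := Quaternion.normSq_eq_norm_mul_self n
    rw [hn1, Quaternion.normSq_def', h0] at this
    linarith
  have h2 : ‖((Real.cos t : ℝ) : ℍ[ℝ]) + Real.sin t • n‖ ^ 2 = 1 := by
    rw [sq, ← Quaternion.normSq_eq_norm_mul_self, Quaternion.normSq_def']
    simp [h0]
    linear_combination (Real.sin t) ^ 2 * h1 + Real.sin_sq_add_cos_sq t
  exact (pow_eq_one_iff_of_nonneg (norm_nonneg _) two_ne_zero).1 h2

theorem IsSphereMeasure.integral_fderiv_eq_zero {E : Type*} [NormedAddCommGroup E] [NormedSpace ℝ E]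
    (hψ : IsSphereMeasure ψ) {n : ℍ[ℝ]} (hn : star n = -n) (hn1 : ‖n‖ = 1) {G : ℍ[ℝ] → E}
    {G' : ℍ[ℝ] → ℍ[ℝ] →L[ℝ] E} (hG : ∀ y, ‖y‖ = 1 → HasFDerivAt G (G' y) y)
    (hGc : ContinuousOn G' (sphere 0 1)) : ∫ y, G' y (n * y) ∂ψ = 0 := by
  have := hψ.isProbabilityMeasure
  have hU : ∀ (t : ℝ) (y : ℍ[ℝ]), Real.cos t • y + Real.sin t •
      (ContinuousLinearMap.mul ℝ ℍ[ℝ] n) y =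
      (((Real.cos t : ℝ) : ℍ[ℝ]) + Real.sin t • n) * y := fun t y => by
    rw [add_mul, Quaternion.coe_mul_eq_smul, smul_mul_assoc]
    rfl
  exact integral_fderiv_rotation_eq_zero hψ.ae_norm (A := ContinuousLinearMap.mul ℝ ℍ[ℝ] n)
    (fun t => by
      simp only [hU]
      exact hψ.measurePreserving (mulLeftIsometry _ (norm_cos_add_sin hn hn1 t)))
    (fun t y hy => by rw [hU, norm_mul, norm_cos_add_sin hn hn1, hy, one_mul]) hG hGc

/-- The real coordinate functional as a continuous linear map. -/
noncomputable def innerLeft (x : ℍ[ℝ]) : ℍ[ℝ] →L[ℝ] ℝ := innerSL ℝ x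

theorem innerLeft_apply (x y : ℍ[ℝ]) : innerLeft x y =
    x.re * y.re + x.imI * y.imI + x.imJ * y.imJ + x.imK * y.imK := by
  have h : innerLeft x y = (x * star y).re := Quaternion.inner_def x y
  rw [h]
  simp

theorem qe_coords : ((qe 0).re = 1 ∧ (qe 0).imI = 0 ∧ (qe 0).imJ = 0 ∧ (qe 0).imK = 0) ∧
    ((qe 1).re = 0 ∧ (qe 1).imI = 1 ∧ (qe 1).imJ = 0 ∧ (qe 1).imK = 0) ∧
    ((qe 2).re = 0 ∧ (qe 2).imI = 0 ∧ (qe 2).imJ = 1 ∧ (qe 2).imK = 0) ∧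
    ((qe 3).re = 0 ∧ (qe 3).imI = 0 ∧ (qe 3).imJ = 0 ∧ (qe 3).imK = 1) := by
  simp only [qe, and_self]

theorem innerLeft_qe (y : ℍ[ℝ]) : innerLeft (qe 0) y = y.re ∧ innerLeft (qe 1) y = y.imI ∧
    innerLeft (qe 2) y = y.imJ ∧ innerLeft (qe 3) y = y.imK := by
  simp [innerLeft_apply, qe_coords]

theorem star_qe (k : Fin 4) (hk : k ≠ 0) : star (qe k) = -qe k := by
  fin_cases k
  · exact absurd rfl hk
  all_goals
    simp only [Fin.mk_one, Fin.reduceFinMk]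
    apply Quaternion.ext <;> simp [qe_coords]

theorem norm_qe (k : Fin 4) : ‖qe k‖ = 1 := by
  have : ‖qe k‖ ^ 2 = 1 := by
    rw [sq, ← Quaternion.normSq_eq_norm_mul_self, Quaternion.normSq_def']
    fin_cases k <;> simp [qe_coords]
  exact (pow_eq_one_iff_of_nonneg (norm_nonneg _) two_ne_zero).1 this

theorem innerLeft_qe_mul (y : ℍ[ℝ]) (k : Fin 4) (hk : k ≠ 0) :
    innerLeft (qe 0) (qe k * y) = -innerLeft (qe k) y ∧
      innerLeft (qe k) (qe k * y) = innerLeft (qe 0) y := by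
  fin_cases k
  · exact absurd rfl hk
  all_goals simp [innerLeft_apply, qe_coords]

theorem sum_sq_innerLeft (y : ℍ[ℝ]) : ∑ k, innerLeft (qe k) y ^ 2 = ‖y‖ ^ 2 := by
  obtain ⟨h0, h1, h2, h3⟩ := innerLeft_qe y
  rw [Fin.sum_univ_four, h0, h1, h2, h3, sq ‖y‖, ← Quaternion.normSq_eq_norm_mul_self,
    Quaternion.normSq_def']

theorem integral_re_pow_mul_sq (hψ : IsSphereMeasure ψ) (n : ℕ) (k : Fin 4) (hk : k ≠ 0) :
    ∫ y, innerLeft (qe 0) y ^ (n + 2) ∂ψ =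
      (n + 1) * ∫ y, innerLeft (qe 0) y ^ n * innerLeft (qe k) y ^ 2 ∂ψ := by
  have := hψ.isProbabilityMeasure
  have h := hψ.integral_fderiv_eq_zero (star_qe k hk) (norm_qe k)
    (fun y _ => (((innerLeft (qe 0)).hasFDerivAt (x := y)).pow (n + 1)).mul
      ((innerLeft (qe k)).hasFDerivAt (x := y))) (by fun_prop)
  rw [← sub_eq_zero, ← integral_const_mul, ← integral_sub
    (integrable_of_continuousOn_sphere hψ.ae_norm (by fun_prop))
    (integrable_of_continuousOn_sphere hψ.ae_norm (by fun_prop)), ← h]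
  refine integral_congr_ae (ae_of_all _ fun y => ?_)
  obtain ⟨h1, h2⟩ := innerLeft_qe_mul y k hk
  simp [h1, h2]
  ring

theorem sphere_moment (hψ : IsSphereMeasure ψ) (n : ℕ) :
    ∫ y, innerLeft (qe 0) y ^ (n + 2) ∂ψ =
      (n + 1) / (n + 4) * ∫ y, innerLeft (qe 0) y ^ n ∂ψ := by
  have := hψ.isProbabilityMeasure
  have h1 := integral_re_pow_mul_sq hψ n 1 (by decide)
  have h2 := integral_re_pow_mul_sq hψ n 2 (by decide)
  have h3 := integral_re_pow_mul_sq hψ n 3 (by decide)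
  have hi : ∀ k, Integrable (fun y => innerLeft (qe 0) y ^ n * innerLeft (qe k) y ^ 2) ψ :=
    fun k => integrable_of_continuousOn_sphere hψ.ae_norm (by fun_prop)
  have h : ∫ y, innerLeft (qe 0) y ^ n ∂ψ =
      ∑ k, ∫ y, innerLeft (qe 0) y ^ n * innerLeft (qe k) y ^ 2 ∂ψ := by
    rw [← integral_finsetSum _ fun k _ => hi k]
    refine integral_congr_ae ?_
    filter_upwards [hψ.ae_norm] with y hy
    rw [← Finset.mul_sum, sum_sq_innerLeft, hy]
    simp
  rw [Fin.sum_univ_four] at h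
  have h0 : ∫ y, innerLeft (qe 0) y ^ n * innerLeft (qe 0) y ^ 2 ∂ψ =
      ∫ y, innerLeft (qe 0) y ^ (n + 2) ∂ψ := by simp_rw [pow_add]
  rw [h0] at h
  have : (n : ℝ) + 4 ≠ 0 := by positivity
  field_simp
  rw [h]
  linarith

theorem sphere_moment_eq_circ (hψ : IsSphereMeasure ψ) (n : ℕ) :
    ∫ y, innerLeft (qe 0) y ^ n ∂ψ = 2 * ∫ c : ℂ, c.re ^ n * c.im ^ 2 ∂circ := by
  have := hψ.isProbabilityMeasure
  induction n using Nat.twoStepInduction with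
  | zero =>
    simp only [pow_zero, one_mul, integral_const, probReal_univ, smul_eq_mul, mul_one]
    have h1 : ∫ c : ℂ, c.re ^ 2 ∂circ = ∫ c : ℂ, c.im ^ 2 ∂circ := by
      rw [← integral_comp_measurePreserving circ_ae_norm
        (measurePreserving_circ_mul (u := Complex.I) (by simp)) (f := fun c => c.im ^ 2)
        (by fun_prop)]
      simp
    have h2 : ∫ c : ℂ, c.re ^ 2 ∂circ + ∫ c : ℂ, c.im ^ 2 ∂circ = 1 := by
      rw [← integral_add (integrable_of_continuousOn_sphere circ_ae_norm (by fun_prop))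
        (integrable_of_continuousOn_sphere circ_ae_norm (by fun_prop))]
      rw [← probReal_univ (μ := circ), ← mul_one (circ.real Set.univ), ← smul_eq_mul,
        ← integral_const]
      refine integral_congr_ae ?_
      filter_upwards [circ_ae_norm] with c hc
      rw [← one_pow 2, ← hc, ← Complex.normSq_eq_norm_sq, Complex.normSq_apply]
      ring
    linarith
  | one =>
    have h1 : ∫ y, innerLeft (qe 0) y ^ 1 ∂ψ = -∫ y, innerLeft (qe 0) y ^ 1 ∂ψ := by
      rw [← integral_neg]
      rw [← integral_comp_measurePreserving hψ.ae_norm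
        (hψ.measurePreserving (mulLeftIsometry (-1) (by simp)))
        (f := fun y => innerLeft (qe 0) y ^ 1) (by fun_prop)]
      simp
    have h2 : ∫ c : ℂ, c.re ^ 1 * c.im ^ 2 ∂circ = -∫ c : ℂ, c.re ^ 1 * c.im ^ 2 ∂circ := by
      rw [← integral_neg]
      rw [← integral_comp_measurePreserving circ_ae_norm
        (measurePreserving_circ_mul (u := -1) (by simp)) (f := fun c => c.re ^ 1 * c.im ^ 2)
        (by fun_prop)]
      simp
    linarith
  | more n ih _ =>
    rw [sphere_moment hψ, ih, circ_moment]
    ring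

/-- The law of the real part of a random point of `S³` is the semicircle law. -/
theorem integral_comp_re (hψ : IsSphereMeasure ψ) {φ : ℝ → ℝ}
    (hφ : ContinuousOn φ (Set.Icc (-1) 1)) :
    ∫ y, φ (innerLeft (qe 0) y) ∂ψ = ∫ c : ℂ, 2 * c.im ^ 2 * φ c.re ∂circ := by
  have := hψ.isProbabilityMeasure
  have hmap : Set.MapsTo (fun y => innerLeft (qe 0) y) (sphere 0 1) (Set.Icc (-1) 1) :=
    fun y hy => by
      change innerLeft (qe 0) y ∈ _
      rw [(innerLeft_qe y).1]
      exact abs_le.1 ((quaternion_coords_abs_le y).1.trans (mem_sphere_zero_iff_norm.1 hy).le)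
  have hmap' : Set.MapsTo (fun c : ℂ => c.re) (sphere 0 1) (Set.Icc (-1) 1) := fun y hy =>
    abs_le.1 ((Complex.abs_re_le_norm y).trans (mem_sphere_zero_iff_norm.1 hy).le)
  have hi : ∀ {f : ℝ → ℝ}, ContinuousOn f (Set.Icc (-1) 1) →
      Integrable (fun y => f (innerLeft (qe 0) y)) ψ := fun hf =>
    integrable_of_continuousOn_sphere hψ.ae_norm (hf.comp (by fun_prop) hmap)
  have hi' : ∀ {f : ℝ → ℝ}, ContinuousOn f (Set.Icc (-1) 1) →
      Integrable (fun c : ℂ => 2 * c.im ^ 2 * f c.re) circ := fun hf =>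
    integrable_of_continuousOn_sphere circ_ae_norm
      (ContinuousOn.mul (by fun_prop) (hf.comp (by fun_prop) hmap'))
  have hpoly : ∀ P : Polynomial ℝ, ∫ y, P.eval (innerLeft (qe 0) y) ∂ψ =
      ∫ c : ℂ, 2 * c.im ^ 2 * P.eval c.re ∂circ := fun P => by
    induction P using Polynomial.induction_on' with
    | add P Q hP hQ =>
      simp only [Polynomial.eval_add, mul_add]
      rw [integral_add (hi (f := fun x => P.eval x) (by fun_prop))
          (hi (f := fun x => Q.eval x) (by fun_prop)),
        integral_add (hi' (f := fun x => P.eval x) (by fun_prop))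
          (hi' (f := fun x => Q.eval x) (by fun_prop)), hP, hQ]
    | monomial n a =>
      simp only [Polynomial.eval_monomial]
      rw [integral_const_mul, sphere_moment_eq_circ hψ, ← integral_const_mul, ← integral_const_mul]
      exact integral_congr_ae (ae_of_all _ fun c => by ring)
  refine eq_of_forall_dist_le fun ε hε => ?_
  obtain ⟨P, hP⟩ := exists_polynomial_near_of_continuousOn (-1) 1 φ hφ (ε / 3) (by positivity)
  have hPc : ContinuousOn (fun x => P.eval x) (Set.Icc (-1) 1) := by fun_prop
  have h1 : |∫ y, P.eval (innerLeft (qe 0) y) ∂ψ - ∫ y, φ (innerLeft (qe 0) y) ∂ψ| ≤ ε / 3 := by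
    rw [← integral_sub (hi hPc) (hi hφ)]
    rw [← Real.norm_eq_abs, ← mul_one (ε / 3), ← probReal_univ (μ := ψ)]
    refine norm_integral_le_of_norm_le_const ?_
    filter_upwards [hψ.ae_norm] with y hy
    exact (hP _ (hmap (mem_sphere_zero_iff_norm.2 hy))).le
  have h2 : |∫ c : ℂ, 2 * c.im ^ 2 * P.eval c.re ∂circ - ∫ c : ℂ, 2 * c.im ^ 2 * φ c.re ∂circ| ≤
      2 * (ε / 3) := by
    rw [← integral_sub (hi' hPc) (hi' hφ)]
    rw [← Real.norm_eq_abs, ← mul_one (2 * (ε / 3)), ← probReal_univ (μ := circ)]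
    refine norm_integral_le_of_norm_le_const ?_
    filter_upwards [circ_ae_norm] with c hc
    have him : |c.im| ≤ 1 := hc ▸ Complex.abs_im_le_norm c
    have him2 : c.im ^ 2 ≤ 1 := by rw [← sq_abs]; exact pow_le_one₀ (abs_nonneg _) him
    rw [← mul_sub, norm_mul, Real.norm_of_nonneg (by positivity)]
    exact mul_le_mul (by linarith) (hP _ (hmap' (mem_sphere_zero_iff_norm.2 hc))).le (norm_nonneg _)
      (by norm_num)
  rw [hpoly] at h1
  rw [Real.dist_eq]
  rw [abs_le] at *
  constructor <;> linarith

end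

section

variable {ψ : Measure ℍ[ℝ]}

theorem continuous_coeComplex : Continuous (fun c : ℂ => (c : ℍ[ℝ])) :=
  Quaternion.ofComplex.toLinearMap.continuous_of_finiteDimensional

theorem norm_coeComplex (c : ℂ) : ‖(c : ℍ[ℝ])‖ = ‖c‖ := by
  have h : ‖(c : ℍ[ℝ])‖ ^ 2 = ‖c‖ ^ 2 := by
    rw [sq, ← Quaternion.normSq_eq_norm_mul_self, Quaternion.normSq_def',
      ← Complex.normSq_eq_norm_sq, Complex.normSq_apply]
    simp
    ring
  exact (pow_left_inj₀ (norm_nonneg _) (norm_nonneg _) two_ne_zero).1 h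

theorem norm_conj_mul {u g : ℍ[ℝ]} (hu : ‖u‖ = 1) : ‖u * g * star u‖ = ‖g‖ := by
  simp [hu]

/-- The point of the unit circle with a given real part and nonnegative imaginary part. -/
noncomputable def upperPoint (t : ℝ) : ℍ[ℝ] := ((⟨t, Real.sqrt (1 - t ^ 2)⟩ : ℂ) : ℍ[ℝ])

theorem continuous_upperPoint : Continuous upperPoint := by
  have h : upperPoint = fun t : ℝ =>
      (((t : ℂ) + (Real.sqrt (1 - t ^ 2) : ℝ) * Complex.I : ℂ) : ℍ[ℝ]) := by
    funext t
    rw [upperPoint]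
    congr 1
    apply Complex.ext <;> simp
  rw [h]
  exact continuous_coeComplex.comp (by fun_prop)

theorem norm_upperPoint {t : ℝ} (ht : t ∈ Set.Icc (-1 : ℝ) 1) : ‖upperPoint t‖ = 1 := by
  have h : ‖upperPoint t‖ ^ 2 = 1 := by
    rw [upperPoint, norm_coeComplex, ← Complex.normSq_eq_norm_sq, Complex.normSq_apply]
    simp only
    rw [Real.mul_self_sqrt (by nlinarith [ht.1, ht.2])]
    ring
  exact (pow_eq_one_iff_of_nonneg (norm_nonneg _) two_ne_zero).1 h

/-- Unit quaternions are classified up to conjugation by their real part. -/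
theorem exists_conj_eq_upperPoint {g : ℍ[ℝ]} (hg : ‖g‖ = 1) :
    ∃ v : ℍ[ℝ], ‖v‖ = 1 ∧ v * g * star v = upperPoint g.re := by
  suffices h : ∃ x : ℍ[ℝ], x ≠ 0 ∧ x * g = upperPoint g.re * x by
    obtain ⟨x, hx, hxg⟩ := h
    have hx' : ‖x‖ ≠ 0 := norm_ne_zero_iff.2 hx
    have hv : ‖‖x‖⁻¹ • x‖ = 1 := by rw [norm_smul, norm_inv, norm_norm, inv_mul_cancel₀ hx']
    refine ⟨‖x‖⁻¹ • x, hv, ?_⟩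
    have h1 : (‖x‖⁻¹ • x) * g = upperPoint g.re * (‖x‖⁻¹ • x) := by
      rw [smul_mul_assoc, hxg, mul_smul_comm]
    rw [h1, mul_assoc, self_mul_star_of_norm_eq_one hv, mul_one]
  have hn : g.re ^ 2 + g.imI ^ 2 + g.imJ ^ 2 + g.imK ^ 2 = 1 := by
    rw [← Quaternion.normSq_def', Quaternion.normSq_eq_norm_mul_self, hg, one_mul]
  set b := Real.sqrt (1 - g.re ^ 2) with hb
  have hb2 : b ^ 2 = g.imI ^ 2 + g.imJ ^ 2 + g.imK ^ 2 := by
    rw [hb, Real.sq_sqrt (by nlinarith [sq_nonneg g.imI, sq_nonneg g.imJ, sq_nonneg g.imK])]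
    linarith
  have hU0 : (upperPoint g.re).re = g.re := Quaternion.re_coeComplex _
  have hU1 : (upperPoint g.re).imI = b := Quaternion.imI_coeComplex _
  have hU2 : (upperPoint g.re).imJ = 0 := Quaternion.imJ_coeComplex _
  have hU3 : (upperPoint g.re).imK = 0 := Quaternion.imK_coeComplex _
  generalize upperPoint g.re = U at hU0 hU1 hU2 hU3
  by_cases hb0 : b = 0
  · refine ⟨1, one_ne_zero, ?_⟩
    rw [hb0] at hb2 hU1
    rw [one_mul, mul_one]
    apply Quaternion.ext
    · rw [hU0]
    · rw [hU1]
      nlinarith [sq_nonneg g.imI, sq_nonneg g.imJ, sq_nonneg g.imK]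
    · rw [hU2]
      nlinarith [sq_nonneg g.imI, sq_nonneg g.imJ, sq_nonneg g.imK]
    · rw [hU3]
      nlinarith [sq_nonneg g.imI, sq_nonneg g.imJ, sq_nonneg g.imK]
  by_cases hx : b + g.imI = 0 ∧ g.imJ = 0 ∧ g.imK = 0
  · obtain ⟨h1, h2, h3⟩ := hx
    obtain ⟨x0, x1, x2, x3⟩ := qe_coords.2.2.1
    refine ⟨qe 2, fun h => by simp [h] at x2, ?_⟩
    apply Quaternion.ext
    · rw [Quaternion.re_mul, Quaternion.re_mul, x0, x1, x2, x3, hU0, hU1, hU2, hU3]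
      linear_combination -h2
    · rw [Quaternion.imI_mul, Quaternion.imI_mul, x0, x1, x2, x3, hU0, hU1, hU2, hU3]
      linear_combination h3
    · rw [Quaternion.imJ_mul, Quaternion.imJ_mul, x0, x1, x2, x3, hU0, hU1, hU2, hU3]
      ring
    · rw [Quaternion.imK_mul, Quaternion.imK_mul, x0, x1, x2, x3, hU0, hU1, hU2, hU3]
      linear_combination -h1
  · obtain ⟨x, x0, x1, x2, x3⟩ : ∃ x : ℍ[ℝ], x.re = 0 ∧ x.imI = b + g.imI ∧ x.imJ = g.imJ ∧
        x.imK = g.imK := ⟨⟨0, b + g.imI, g.imJ, g.imK⟩, rfl, rfl, rfl, rfl⟩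
    refine ⟨x, fun h => hx ?_, ?_⟩
    · rw [← x1, ← x2, ← x3, h]
      simp
    apply Quaternion.ext
    · rw [Quaternion.re_mul, Quaternion.re_mul, x0, x1, x2, x3, hU0, hU1, hU2, hU3]
      linear_combination hb2
    · rw [Quaternion.imI_mul, Quaternion.imI_mul, x0, x1, x2, x3, hU0, hU1, hU2, hU3]
      ring
    · rw [Quaternion.imJ_mul, Quaternion.imJ_mul, x0, x1, x2, x3, hU0, hU1, hU2, hU3]
      ring
    · rw [Quaternion.imK_mul, Quaternion.imK_mul, x0, x1, x2, x3, hU0, hU1, hU2, hU3]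
      ring

theorem continuousOn_conj_comp {E : Type*} [TopologicalSpace E] {F : ℍ[ℝ] → E}
    (hF : ContinuousOn F (sphere 0 1)) :
    ContinuousOn (Function.uncurry fun g u : ℍ[ℝ] => F (u * g * star u))
      (sphere 0 1 ×ˢ sphere 0 1) := by
  refine hF.comp (f := fun x : ℍ[ℝ] × ℍ[ℝ] => x.2 * x.1 * star x.2) (by fun_prop) fun x hx => ?_
  rw [mem_sphere_zero_iff_norm, norm_conj_mul (mem_sphere_zero_iff_norm.1 hx.2)]
  exact mem_sphere_zero_iff_norm.1 hx.1

/-- The Weyl integration formula on the unit quaternions, for real functions. -/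
theorem weyl_integral_real (hψ : IsSphereMeasure ψ) {F : ℍ[ℝ] → ℝ}
    (hF : ContinuousOn F (sphere 0 1)) :
    ∫ g, F g ∂ψ = ∫ u, ∫ c : ℂ, 2 * c.im ^ 2 * F (u * c * star u) ∂circ ∂ψ := by
  have := hψ.isProbabilityMeasure
  set Φ : ℍ[ℝ] → ℝ := fun g => ∫ u, F (u * g * star u) ∂ψ with hΦ
  have hΦc : ContinuousOn Φ (sphere 0 1) := continuousOn_integral_of_sphere hψ.ae_norm
    (isCompact_sphere _ _) (continuousOn_conj_comp hF)
  have hΦF : ∫ g, Φ g ∂ψ = ∫ g, F g ∂ψ := by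
    rw [hΦ, integral_integral_swap (f := fun g u : ℍ[ℝ] => F (u * g * star u))
      (integrable_prod_of_continuousOn_sphere hψ.ae_norm hψ.ae_norm (continuousOn_conj_comp hF))]
    have h : ∀ᵐ u ∂ψ, ∫ g, F (u * g * star u) ∂ψ = ∫ g, F g ∂ψ := by
      filter_upwards [hψ.ae_norm] with u hu
      exact integral_comp_measurePreserving hψ.ae_norm (f := F)
        (hψ.measurePreserving ((mulLeftIsometry u hu).trans
          (mulRightIsometry (star u) (by simpa using hu)))) hF
    rw [integral_congr_ae h, integral_const, probReal_univ, one_smul]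
  have hΦconj : ∀ g v, ‖g‖ = 1 → ‖v‖ = 1 → Φ (v * g * star v) = Φ g := fun g v hg hv => by
    refine Eq.trans ?_ (integral_comp_measurePreserving hψ.ae_norm
      (f := fun u => F (u * g * star u)) (hψ.measurePreserving (mulRightIsometry v hv)) ?_)
    · simp only [mulRightIsometry_apply, star_mul, mul_assoc, hΦ]
    · exact (continuousOn_conj_comp hF).comp (f := fun u => (g, u)) (by fun_prop)
        fun u hu => ⟨by simpa using hg, hu⟩
  have hΦre : ∀ g, ‖g‖ = 1 → Φ g = Φ (upperPoint g.re) := fun g hg => by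
    obtain ⟨v, hv, hvg⟩ := exists_conj_eq_upperPoint hg
    rw [← hvg, hΦconj g v hg hv]
  have hφc : ContinuousOn (fun t => Φ (upperPoint t)) (Set.Icc (-1) 1) :=
    hΦc.comp continuous_upperPoint.continuousOn fun t ht => by simpa using norm_upperPoint ht
  calc ∫ g, F g ∂ψ = ∫ g, Φ (upperPoint (innerLeft (qe 0) g)) ∂ψ := by
        rw [← hΦF]
        refine integral_congr_ae ?_
        filter_upwards [hψ.ae_norm] with g hg
        rw [hΦre g hg, (innerLeft_qe g).1]
    _ = ∫ c : ℂ, 2 * c.im ^ 2 * Φ (upperPoint c.re) ∂circ := integral_comp_re hψ hφc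
    _ = ∫ c : ℂ, ∫ u, 2 * c.im ^ 2 * F (u * c * star u) ∂ψ ∂circ := by
        refine integral_congr_ae ?_
        filter_upwards [circ_ae_norm] with c hc
        have := hΦre c (by rw [norm_coeComplex, hc])
        rw [Quaternion.re_coeComplex] at this
        rw [← this, hΦ, integral_const_mul]
    _ = _ := by
        refine integral_integral_swap (integrable_prod_of_continuousOn_sphere circ_ae_norm
          hψ.ae_norm ?_)
        refine ContinuousOn.mul (by fun_prop) ?_
        refine (continuousOn_conj_comp hF).comp (f := fun x : ℂ × ℍ[ℝ] => ((x.1 : ℍ[ℝ]), x.2))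
          (Continuous.continuousOn (by have := continuous_coeComplex; fun_prop)) fun x hx => ?_
        exact ⟨by simpa [norm_coeComplex] using hx.1, hx.2⟩

end

section

variable {ψ : Measure ℍ[ℝ]}

theorem ext_innerLeft {x y : ℍ[ℝ]} (h : ∀ k, innerLeft (qe k) x = innerLeft (qe k) y) : x = y := by
  apply Quaternion.ext
  · rw [← (innerLeft_qe x).1, h, (innerLeft_qe y).1]
  · rw [← (innerLeft_qe x).2.1, h, (innerLeft_qe y).2.1]
  · rw [← (innerLeft_qe x).2.2.1, h, (innerLeft_qe y).2.2.1]
  · rw [← (innerLeft_qe x).2.2.2, h, (innerLeft_qe y).2.2.2]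

theorem continuousOn_conj_circle {E : Type*} [TopologicalSpace E] {F : ℍ[ℝ] → E}
    (hF : ContinuousOn F (sphere 0 1)) :
    ContinuousOn (Function.uncurry fun (u : ℍ[ℝ]) (c : ℂ) => F (u * c * star u))
      (sphere 0 1 ×ˢ sphere 0 1) := by
  refine (continuousOn_conj_comp hF).comp (f := fun x : ℍ[ℝ] × ℂ => ((x.2 : ℍ[ℝ]), x.1))
    (Continuous.continuousOn (by have := continuous_coeComplex; fun_prop)) fun x hx => ?_
  exact ⟨by simpa [norm_coeComplex] using hx.2, hx.1⟩

theorem weyl_integral (hψ : IsSphereMeasure ψ) {F : ℍ[ℝ] → ℍ[ℝ]}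
    (hF : ContinuousOn F (sphere 0 1)) :
    ∫ g, F g ∂ψ = ∫ u, ∫ c : ℂ, (2 * c.im ^ 2) • F (u * c * star u) ∂circ ∂ψ := by
  have := hψ.isProbabilityMeasure
  have hF2 : ContinuousOn (Function.uncurry fun (u : ℍ[ℝ]) (c : ℂ) =>
      (2 * c.im ^ 2) • F (u * c * star u)) (sphere 0 1 ×ˢ sphere 0 1) :=
    ContinuousOn.smul (f := fun x : ℍ[ℝ] × ℂ => 2 * x.2.im ^ 2) (by fun_prop)
      (continuousOn_conj_circle hF)
  have hF3 : ContinuousOn (fun u : ℍ[ℝ] => ∫ c : ℂ, (2 * c.im ^ 2) • F (u * c * star u) ∂circ)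
      (sphere 0 1) := continuousOn_integral_of_sphere circ_ae_norm (isCompact_sphere _ _) hF2
  refine ext_innerLeft fun k => ?_
  rw [← (innerLeft (qe k)).integral_comp_comm (integrable_of_continuousOn_sphere hψ.ae_norm hF),
    ← (innerLeft (qe k)).integral_comp_comm (integrable_of_continuousOn_sphere hψ.ae_norm hF3),
    weyl_integral_real hψ (F := fun g => innerLeft (qe k) (F g))
      ((innerLeft (qe k)).continuous.comp_continuousOn hF)]
  refine integral_congr_ae ?_
  filter_upwards [hψ.ae_norm] with u hu
  have hc : ContinuousOn (fun c : ℂ => (2 * c.im ^ 2) • F (u * c * star u)) (sphere 0 1) :=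
    hF2.comp (f := fun c : ℂ => (u, c)) (by fun_prop) fun c hc => ⟨by simpa using hu, hc⟩
  rw [← (innerLeft (qe k)).integral_comp_comm (integrable_of_continuousOn_sphere circ_ae_norm hc)]
  simp only [map_smul, smul_eq_mul]

/-- The Cauchy kernel of the unit ball. -/
noncomputable def cauchyKernel (x : ℍ[ℝ]) : ℍ[ℝ] := (‖1 - x‖ ^ 4)⁻¹ • (1 - x)

theorem one_sub_smul_ne_zero {r : ℝ} (hr0 : 0 ≤ r) (hr : r < 1) {g : ℍ[ℝ]} (hg : ‖g‖ = 1) :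
    1 - r • g ≠ 0 := fun h => by
  have h1 : ‖r • g‖ = 1 := by rw [← sub_eq_zero.1 h, norm_one]
  rw [norm_smul, hg, mul_one, Real.norm_of_nonneg hr0] at h1
  exact hr.ne h1

theorem norm_one_sub_smul_sq (r : ℝ) {g : ℍ[ℝ]} (hg : ‖g‖ = 1) :
    ‖1 - r • g‖ ^ 2 = 1 - 2 * r * g.re + r ^ 2 := by
  have hn : g.re ^ 2 + g.imI ^ 2 + g.imJ ^ 2 + g.imK ^ 2 = 1 := by
    rw [← Quaternion.normSq_def', Quaternion.normSq_eq_norm_mul_self, hg, one_mul]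
  rw [sq ‖_‖, ← Quaternion.normSq_eq_norm_mul_self, Quaternion.normSq_def']
  simp
  linear_combination r ^ 2 * hn

theorem continuousOn_cauchyKernel_smul {r : ℝ} (hr0 : 0 ≤ r) (hr : r < 1) :
    ContinuousOn (fun g : ℍ[ℝ] => cauchyKernel (r • g)) (sphere 0 1) := by
  refine ContinuousOn.smul (f := fun g : ℍ[ℝ] => (‖1 - r • g‖ ^ 4)⁻¹)
    (g := fun g : ℍ[ℝ] => 1 - r • g)
    (ContinuousOn.inv₀ (by fun_prop) fun g hg => ?_) (by fun_prop)
  have := one_sub_smul_ne_zero hr0 hr (mem_sphere_zero_iff_norm.1 hg)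
  positivity

/-- The real part of the Cauchy kernel on a sphere. -/
noncomputable def evenKernel (r : ℝ) (g : ℍ[ℝ]) : ℝ := (1 - r * g.re) / ‖1 - r • g‖ ^ 4

theorem continuous_quaternion_re : Continuous fun g : ℍ[ℝ] => g.re := by
  simp only [← (innerLeft_qe _).1]
  exact (innerLeft (qe 0)).continuous

theorem continuous_quaternion_im : Continuous fun g : ℍ[ℝ] => g.im := by
  have h : (fun g : ℍ[ℝ] => g.im) = fun g : ℍ[ℝ] => g - (g.re : ℍ[ℝ]) :=
    funext fun g => (Quaternion.sub_re_self g).symm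
  rw [h]
  exact continuous_id.sub (Quaternion.continuous_coe.comp continuous_quaternion_re)

theorem continuousOn_evenKernel {r : ℝ} (hr0 : 0 ≤ r) (hr : r < 1) :
    ContinuousOn (evenKernel r) (sphere 0 1) := by
  have := continuous_quaternion_re
  refine ContinuousOn.div (by fun_prop) (by fun_prop) fun g hg => ?_
  have := one_sub_smul_ne_zero hr0 hr (mem_sphere_zero_iff_norm.1 hg)
  positivity

theorem cauchyKernel_smul (r : ℝ) (g : ℍ[ℝ]) :
    cauchyKernel (r • g) = (evenKernel r g : ℍ[ℝ]) - (r / ‖1 - r • g‖ ^ 4) • g.im := by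
  have h : 1 - r • g = ((1 - r * g.re : ℝ) : ℍ[ℝ]) - r • g.im := by
    nth_rewrite 1 [← Quaternion.re_add_im g]
    rw [smul_add, ← Quaternion.coe_mul_eq_smul r (g.re : ℍ[ℝ])]
    push_cast
    abel
  rw [cauchyKernel, evenKernel]
  nth_rewrite 2 [h]
  rw [smul_sub, smul_smul, ← Quaternion.coe_mul_eq_smul, ← Quaternion.coe_mul, div_eq_inv_mul,
    div_eq_inv_mul]

theorem integral_abs_evenKernel_le (hψ : IsSphereMeasure ψ) {r : ℝ} (hr0 : 0 ≤ r) (hr : r < 1) :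
    ∫ g, |evenKernel r g| ∂ψ ≤ 2 := by
  have := hψ.isProbabilityMeasure
  set φ : ℝ → ℝ := fun t => (1 - r * t) / (1 - 2 * r * t + r ^ 2) ^ 2 with hφ
  have hD : ∀ t ∈ Set.Icc (-1 : ℝ) 1, 0 < 1 - 2 * r * t + r ^ 2 := fun t ht => by
    nlinarith [mul_le_mul_of_nonneg_left ht.2 hr0, sq_pos_of_pos (sub_pos.2 hr)]
  have hφc : ContinuousOn φ (Set.Icc (-1) 1) :=
    ContinuousOn.div (by fun_prop) (by fun_prop) fun t ht => (pow_pos (hD t ht) 2).ne'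
  have h1 : ∫ g, |evenKernel r g| ∂ψ = ∫ g, φ (innerLeft (qe 0) g) ∂ψ := by
    refine integral_congr_ae ?_
    filter_upwards [hψ.ae_norm] with g hg
    have hre : |g.re| ≤ 1 := (quaternion_coords_abs_le g).1.trans hg.le
    have hpos : 0 ≤ 1 - r * g.re := by nlinarith [abs_le.1 hre]
    have hpos' : 0 ≤ evenKernel r g := div_nonneg hpos (by positivity)
    rw [(innerLeft_qe g).1, abs_of_nonneg hpos', evenKernel, hφ,
      show ‖1 - r • g‖ ^ 4 = (‖1 - r • g‖ ^ 2) ^ 2 by ring, norm_one_sub_smul_sq r hg]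
  rw [h1, integral_comp_re hψ hφc]
  have hP : Integrable (circlePoisson r) circ :=
    integrable_of_continuousOn_sphere circ_ae_norm (continuousOn_circlePoisson hr0 hr)
  have h2 : ∫ c, (1 + circlePoisson r c) ∂circ = 2 := by
    rw [integral_add (integrable_const _) hP, integral_circlePoisson hr0 hr, integral_const,
      probReal_univ]
    norm_num
  refine le_of_le_of_eq ?_ h2
  have hmap' : Set.MapsTo (fun c : ℂ => c.re) (sphere 0 1) (Set.Icc (-1) 1) := fun y hy =>
    abs_le.1 ((Complex.abs_re_le_norm y).trans (mem_sphere_zero_iff_norm.1 hy).le)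
  refine integral_mono_ae (integrable_of_continuousOn_sphere circ_ae_norm
    (ContinuousOn.mul (by fun_prop) (hφc.comp (by fun_prop) hmap')))
    ((integrable_const _).add hP) ?_
  filter_upwards [circ_ae_norm] with c hc
  have hDc := hD c.re (hmap' (mem_sphere_zero_iff_norm.2 hc))
  have him : c.im ^ 2 ≤ 1 - 2 * r * c.re + r ^ 2 := by
    rw [← norm_one_sub_mul_sq hc, ← sq_abs]
    exact pow_le_pow_left₀ (abs_nonneg _) (abs_im_le_norm_one_sub_mul hc) 2
  simp only [hφ, circlePoisson]
  rw [norm_one_sub_mul_sq hc]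
  set D := 1 - 2 * r * c.re + r ^ 2 with hDdef
  have e : 2 * c.im ^ 2 * ((1 - r * c.re) / D ^ 2) = c.im ^ 2 / D * (1 + (1 - r ^ 2) / D) := by
    have : 1 - r * c.re = (D + 1 - r ^ 2) / 2 := by rw [hDdef]; ring
    rw [this]
    field_simp
    ring
  rw [e]
  have hq : c.im ^ 2 / D ≤ 1 := (div_le_one hDc).2 him
  have hr2 : 0 ≤ (1 - r ^ 2) / D := div_nonneg (by nlinarith) hDc.le
  nlinarith

end

section

variable {ψ : Measure ℍ[ℝ]}

theorem mapsTo_mul_unit {z : ℍ[ℝ]} (hz : ‖z‖ = 1) :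
    Set.MapsTo (fun g : ℍ[ℝ] => g * z) (sphere 0 1) (sphere 0 1) := fun g hg => by
  simpa [hz] using hg

theorem continuousOn_comp_mul {E : Type*} [TopologicalSpace E] {f : ℍ[ℝ] → E}
    (hf : ContinuousOn f (sphere 0 1)) :
    ContinuousOn (Function.uncurry fun g z : ℍ[ℝ] => f (g * z)) (sphere 0 1 ×ˢ sphere 0 1) :=
  hf.comp (f := fun x : ℍ[ℝ] × ℍ[ℝ] => x.1 * x.2) (by fun_prop) fun x hx =>
    mapsTo_mul_unit (mem_sphere_zero_iff_norm.1 hx.2) hx.1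

theorem continuousOn_rpow_norm {𝔸 E : Type*} [TopologicalSpace 𝔸] [NormedAddCommGroup E]
    {f : 𝔸 → E} {s : Set 𝔸} {p : ℝ} (hp : 0 ≤ p) (hf : ContinuousOn f s) :
    ContinuousOn (fun x => ‖f x‖ ^ p) s :=
  hf.norm.rpow_const fun _ _ => Or.inr hp

theorem integral_rpow_norm_comp_mul_left (hψ : IsSphereMeasure ψ) {p : ℝ} (hp : 1 < p)
    {f : ℍ[ℝ] → ℍ[ℝ]} (hf : ContinuousOn f (sphere 0 1)) {g : ℍ[ℝ]} (hg : ‖g‖ = 1) :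
    ∫ z, ‖f (g * z)‖ ^ p ∂ψ = ∫ z, ‖f z‖ ^ p ∂ψ :=
  have := hψ.isProbabilityMeasure
  integral_comp_measurePreserving hψ.ae_norm (hψ.measurePreserving (mulLeftIsometry g hg))
    (continuousOn_rpow_norm (by linarith) hf)

theorem integral_rpow_norm_real_multiplier_le (hψ : IsSphereMeasure ψ) {p : ℝ} (hp : 1 < p)
    {f : ℍ[ℝ] → ℍ[ℝ]} (hf : ContinuousOn f (sphere 0 1)) {k : ℍ[ℝ] → ℝ}
    (hk : ContinuousOn k (sphere 0 1)) :
    ∫ z, ‖∫ g, k g • f (g * z) ∂ψ‖ ^ p ∂ψ ≤ (∫ g, |k g| ∂ψ) ^ p * ∫ z, ‖f z‖ ^ p ∂ψ := by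
  have := hψ.isProbabilityMeasure
  exact integral_norm_rpow_integral_smul_le hp hψ.ae_norm hψ.ae_norm (continuousOn_comp_mul hf) hk
    (fun g hg => (integral_rpow_norm_comp_mul_left hψ hp hf (mem_sphere_zero_iff_norm.1 hg)).le)
    (by positivity)

/-- `L^p` bounds for circle multipliers transfer to conjugates of the circle acting on `S³`. -/
theorem integral_rpow_norm_transfer_le (hψ : IsSphereMeasure ψ) {p C : ℝ} (hp : 1 < p)
    {k : ℂ → ℝ} (hk : ContinuousOn k (sphere 0 1))
    (hC : ∀ G : ℂ → ℍ[ℝ], ContinuousOn G (sphere 0 1) →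
      ∫ φ, ‖∫ c, k c • G (c * φ) ∂circ‖ ^ p ∂circ ≤ C * ∫ φ, ‖G φ‖ ^ p ∂circ)
    {f : ℍ[ℝ] → ℍ[ℝ]} (hf : ContinuousOn f (sphere 0 1)) {u : ℍ[ℝ]} (hu : ‖u‖ = 1) :
    ∫ z, ‖∫ c : ℂ, k c • f (u * c * star u * z) ∂circ‖ ^ p ∂ψ ≤ C * ∫ z, ‖f z‖ ^ p ∂ψ := by
  have := hψ.isProbabilityMeasure
  have hp0 : 0 ≤ p := by linarith
  have hcc := continuous_coeComplex
  have hunit : ∀ {c : ℂ}, ‖c‖ = 1 → ‖u * c * star u‖ = 1 := fun hc => by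
    rw [norm_conj_mul hu, norm_coeComplex, hc]
  have hG : ContinuousOn (Function.uncurry fun (z : ℍ[ℝ]) (c : ℂ) => f (u * c * star u * z))
      (sphere 0 1 ×ˢ sphere 0 1) :=
    (continuousOn_comp_mul hf).comp (f := fun x : ℍ[ℝ] × ℂ => (u * x.2 * star u, x.1))
      (Continuous.continuousOn (by fun_prop)) fun x hx =>
      ⟨mem_sphere_zero_iff_norm.2 (hunit (mem_sphere_zero_iff_norm.1 hx.2)), hx.1⟩
  have hkG : ContinuousOn (Function.uncurry fun (z : ℍ[ℝ]) (c : ℂ) =>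
      k c • f (u * c * star u * z)) (sphere 0 1 ×ˢ sphere 0 1) :=
    ContinuousOn.smul (f := fun x : ℍ[ℝ] × ℂ => k x.2)
      (hk.comp continuousOn_snd fun x hx => hx.2) hG
  set A : ℍ[ℝ] → ℝ := fun z => ‖∫ c : ℂ, k c • f (u * c * star u * z) ∂circ‖ ^ p with hA
  have hAc : ContinuousOn A (sphere 0 1) := continuousOn_rpow_norm hp0
    (continuousOn_integral_of_sphere circ_ae_norm (isCompact_sphere _ _) hkG)
  have hAz : ContinuousOn (Function.uncurry fun (φ : ℂ) (z : ℍ[ℝ]) => A (u * φ * star u * z))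
      (sphere 0 1 ×ˢ sphere 0 1) :=
    hAc.comp (f := fun x : ℂ × ℍ[ℝ] => u * x.1 * star u * x.2)
      (Continuous.continuousOn (by fun_prop)) fun x hx =>
      mapsTo_mul_unit (mem_sphere_zero_iff_norm.1 hx.2)
        (mem_sphere_zero_iff_norm.2 (hunit (mem_sphere_zero_iff_norm.1 hx.1)))
  have hfz : ContinuousOn (Function.uncurry fun (z : ℍ[ℝ]) (φ : ℂ) =>
      ‖f (u * φ * star u * z)‖ ^ p) (sphere 0 1 ×ˢ sphere 0 1) := continuousOn_rpow_norm hp0 hG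
  have hconst : ∀ B : ℍ[ℝ] → ℝ, ContinuousOn B (sphere 0 1) →
      ∫ φ : ℂ, ∫ z, B (u * φ * star u * z) ∂ψ ∂circ = ∫ z, B z ∂ψ := fun B hB => by
    have h : ∀ᵐ φ : ℂ ∂circ, ∫ z, B (u * φ * star u * z) ∂ψ = ∫ z, B z ∂ψ := by
      filter_upwards [circ_ae_norm] with φ hφ
      exact integral_comp_measurePreserving hψ.ae_norm
        (hψ.measurePreserving (mulLeftIsometry _ (hunit hφ))) hB
    rw [integral_congr_ae h, integral_const, probReal_univ, one_smul]
  have hrot : ∀ z φ, A (u * (φ : ℂ) * star u * z) =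
      ‖∫ c : ℂ, k c • f (u * ((c * φ : ℂ) : ℍ[ℝ]) * star u * z) ∂circ‖ ^ p := fun z φ => by
    have h : ∀ c : ℂ, u * (c : ℍ[ℝ]) * star u * (u * (φ : ℍ[ℝ]) * star u * z) =
        u * ((c * φ : ℂ) : ℍ[ℝ]) * star u * z := fun c => by
      calc u * (c : ℍ[ℝ]) * star u * (u * (φ : ℍ[ℝ]) * star u * z) =
          u * (c : ℍ[ℝ]) * (star u * u) * (φ : ℍ[ℝ]) * star u * z := by simp only [mul_assoc]
        _ = _ := by
          rw [star_mul_self_of_norm_eq_one hu, Quaternion.coeComplex_mul]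
          simp only [mul_assoc, one_mul]
    simp only [hA, h]
  calc ∫ z, A z ∂ψ = ∫ φ : ℂ, ∫ z, A (u * φ * star u * z) ∂ψ ∂circ := (hconst A hAc).symm
    _ = ∫ z, ∫ φ : ℂ, A (u * φ * star u * z) ∂circ ∂ψ := integral_integral_swap
        (integrable_prod_of_continuousOn_sphere circ_ae_norm hψ.ae_norm hAz)
    _ ≤ ∫ z, C * ∫ φ : ℂ, ‖f (u * φ * star u * z)‖ ^ p ∂circ ∂ψ := by
        refine integral_mono_ae ?_ ?_ ?_
        · exact (integrable_prod_of_continuousOn_sphere circ_ae_norm hψ.ae_norm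
            hAz).integral_prod_right
        · exact (integrable_prod_of_continuousOn_sphere hψ.ae_norm circ_ae_norm
            hfz).integral_prod_left.const_mul C
        · filter_upwards [hψ.ae_norm] with z hz
          simp only [hrot]
          exact hC (fun φ => f (u * φ * star u * z)) (hG.comp (f := fun φ : ℂ => (z, φ))
            (by fun_prop) fun φ hφ => ⟨mem_sphere_zero_iff_norm.2 hz, hφ⟩)
    _ = C * ∫ z, ‖f z‖ ^ p ∂ψ := by
        rw [integral_const_mul, integral_integral_swap
          (integrable_prod_of_continuousOn_sphere hψ.ae_norm circ_ae_norm hfz),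
          hconst (fun z => ‖f z‖ ^ p) (continuousOn_rpow_norm hp0 hf)]

theorem coeComplex_im (c : ℂ) : (c : ℍ[ℝ]).im = c.im • qe 1 := by
  obtain ⟨x0, x1, x2, x3⟩ := qe_coords.2.1
  apply Quaternion.ext <;> simp [x0, x1, x2, x3]

theorem re_conj {u g : ℍ[ℝ]} (hu : ‖u‖ = 1) : (u * g * star u).re = g.re := by
  have h : ∀ a b : ℍ[ℝ], (a * b).re = (b * a).re := fun a b => by
    rw [Quaternion.re_mul, Quaternion.re_mul]
    ring
  rw [h, ← mul_assoc, star_mul_self_of_norm_eq_one hu, one_mul]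

theorem im_conj {u g : ℍ[ℝ]} (hu : ‖u‖ = 1) : (u * g * star u).im = u * g.im * star u := by
  rw [← Quaternion.sub_re_self, ← Quaternion.sub_re_self, re_conj hu, mul_sub, sub_mul,
    ← Quaternion.coe_commutes, mul_assoc _ u, self_mul_star_of_norm_eq_one hu, mul_one]

/-- The odd part of the Cauchy transform as an average of circle multipliers. -/
theorem integral_mul_im_eq (hψ : IsSphereMeasure ψ) {r : ℝ} (hr0 : 0 ≤ r) (hr : r < 1)
    {f : ℍ[ℝ] → ℍ[ℝ]} (hf : ContinuousOn f (sphere 0 1)) {z : ℍ[ℝ]} (hz : ‖z‖ = 1) :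
    ∫ g, (r / ‖1 - r • g‖ ^ 4) • (f (g * z) * g.im) ∂ψ =
      ∫ u, (∫ c : ℂ, oddKernel r c • f (u * c * star u * z) ∂circ) * (u * qe 1 * star u) ∂ψ := by
  have him := continuous_quaternion_im
  have hfz : ContinuousOn (fun g => f (g * z)) (sphere 0 1) :=
    hf.comp (by fun_prop) (mapsTo_mul_unit hz)
  have hK : ContinuousOn (fun g : ℍ[ℝ] => r / ‖1 - r • g‖ ^ 4) (sphere 0 1) := by
    refine ContinuousOn.div (by fun_prop) (by fun_prop) fun g hg => ?_
    have := one_sub_smul_ne_zero hr0 hr (mem_sphere_zero_iff_norm.1 hg)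
    positivity
  have hFc : ContinuousOn (fun g => (r / ‖1 - r • g‖ ^ 4) • (f (g * z) * g.im)) (sphere 0 1) :=
    hK.smul (hfz.mul him.continuousOn)
  rw [weyl_integral hψ hFc]
  refine integral_congr_ae ?_
  filter_upwards [hψ.ae_norm] with u hu
  have hi : Integrable (fun c : ℂ => oddKernel r c • f (u * c * star u * z)) circ :=
    integrable_of_continuousOn_sphere circ_ae_norm ((continuousOn_oddKernel hr0 hr).smul
      ((continuousOn_conj_circle hfz).comp (f := fun c : ℂ => (u, c)) (by fun_prop)
        fun c hc => ⟨mem_sphere_zero_iff_norm.2 hu, hc⟩))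
  refine Eq.trans ?_ (integral_mul_const_of_integrable hi)
  refine integral_congr_ae ?_
  filter_upwards [circ_ae_norm] with c hc
  have h2 : ‖u * (c : ℍ[ℝ]) * star u‖ = 1 := by rw [norm_conj_mul hu, norm_coeComplex, hc]
  have h1 : ‖1 - r • (u * (c : ℍ[ℝ]) * star u)‖ = ‖1 - (r : ℂ) * c‖ := by
    have h3 : ‖1 - r • (u * (c : ℍ[ℝ]) * star u)‖ ^ 2 = ‖1 - (r : ℂ) * c‖ ^ 2 := by
      rw [norm_one_sub_smul_sq r h2, norm_one_sub_mul_sq hc, re_conj hu, Quaternion.re_coeComplex]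
    exact (pow_left_inj₀ (norm_nonneg _) (norm_nonneg _) two_ne_zero).1 h3
  rw [im_conj hu, coeComplex_im, h1, oddKernel]
  simp only [mul_smul_comm, smul_mul_assoc, smul_smul]
  congr 1
  ring

theorem cauchy_integral_eq (hψ : IsSphereMeasure ψ) {r : ℝ} (hr0 : 0 ≤ r) (hr : r < 1)
    {f : ℍ[ℝ] → ℍ[ℝ]} (hf : ContinuousOn f (sphere 0 1)) {z : ℍ[ℝ]} (hz : ‖z‖ = 1) :
    ∫ g, f (g * z) * cauchyKernel (r • g) ∂ψ = ∫ g, evenKernel r g • f (g * z) ∂ψ +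
      -∫ u, (∫ c : ℂ, oddKernel r c • f (u * c * star u * z) ∂circ) * (u * qe 1 * star u) ∂ψ := by
  have := hψ.isProbabilityMeasure
  have hfz : ContinuousOn (fun g => f (g * z)) (sphere 0 1) :=
    hf.comp (by fun_prop) (mapsTo_mul_unit hz)
  have hE : Integrable (fun g => evenKernel r g • f (g * z)) ψ :=
    integrable_of_continuousOn_sphere hψ.ae_norm ((continuousOn_evenKernel hr0 hr).smul hfz)
  have hT : Integrable (fun g => f (g * z) * cauchyKernel (r • g)) ψ :=
    integrable_of_continuousOn_sphere hψ.ae_norm (hfz.mul (continuousOn_cauchyKernel_smul hr0 hr))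
  rw [← integral_mul_im_eq hψ hr0 hr hf hz, ← sub_eq_iff_eq_add', ← integral_sub hT hE,
    ← integral_neg]
  refine integral_congr_ae (ae_of_all _ fun g => ?_)
  simp only [cauchyKernel_smul, mul_sub, mul_smul_comm, ← Quaternion.coe_commutes,
    Quaternion.coe_mul_eq_smul]
  abel

/-- The Cauchy transform on `S³` is bounded on `L^p`, uniformly in the radius. -/
theorem exists_cauchy_integral_bound (hψ : IsSphereMeasure ψ) {p : ℝ} (hp : 1 < p) :
    ∃ C : ℝ, 0 ≤ C ∧ ∀ r : ℝ, 0 ≤ r → r < 1 → ∀ f : ℍ[ℝ] → ℍ[ℝ], ContinuousOn f (sphere 0 1) →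
      ∫ z, ‖∫ g, f (g * z) * cauchyKernel (r • g) ∂ψ‖ ^ p ∂ψ ≤ C * ∫ z, ‖f z‖ ^ p ∂ψ := by
  have := hψ.isProbabilityMeasure
  have hp0 : 0 ≤ p := by linarith
  have hcc := continuous_coeComplex
  obtain ⟨C, hC0, hC⟩ := exists_oddKernel_bound hp
  refine ⟨2 ^ p * (2 ^ p + C), by positivity, fun r hr0 hr f hf => ?_⟩
  set I := ∫ z, ‖f z‖ ^ p ∂ψ with hI
  have hI0 : 0 ≤ I := by positivity
  set F : ℍ[ℝ] → ℍ[ℝ] → ℍ[ℝ] := fun u z =>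
    (∫ c : ℂ, oddKernel r c • f (u * c * star u * z) ∂circ) * (u * qe 1 * star u) with hF
  have hFc : ContinuousOn (Function.uncurry F) (sphere 0 1 ×ˢ sphere 0 1) := by
    refine ContinuousOn.mul (f := fun x : ℍ[ℝ] × ℍ[ℝ] =>
      ∫ c : ℂ, oddKernel r c • f (x.1 * c * star x.1 * x.2) ∂circ)
      (g := fun x : ℍ[ℝ] × ℍ[ℝ] => x.1 * qe 1 * star x.1) ?_ (by fun_prop)
    refine continuousOn_integral_of_sphere (f := fun (x : ℍ[ℝ] × ℍ[ℝ]) (c : ℂ) =>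
      oddKernel r c • f (x.1 * c * star x.1 * x.2)) circ_ae_norm
      ((isCompact_sphere _ _).prod (isCompact_sphere _ _)) ?_
    refine ContinuousOn.smul (f := fun x : (ℍ[ℝ] × ℍ[ℝ]) × ℂ => oddKernel r x.2)
      ((continuousOn_oddKernel hr0 hr).comp continuousOn_snd fun x hx => hx.2) ?_
    refine hf.comp (f := fun x : (ℍ[ℝ] × ℍ[ℝ]) × ℂ => x.1.1 * x.2 * star x.1.1 * x.1.2)
      (Continuous.continuousOn (by fun_prop)) fun x hx => ?_
    rw [mem_sphere_zero_iff_norm, norm_mul, norm_conj_mul (mem_sphere_zero_iff_norm.1 hx.1.1),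
      norm_coeComplex, mem_sphere_zero_iff_norm.1 hx.1.2, mem_sphere_zero_iff_norm.1 hx.2, mul_one]
  have hodd : ∫ z, ‖∫ u, F u z ∂ψ‖ ^ p ∂ψ ≤ C * I := by
    have h := integral_norm_rpow_integral_smul_le (m := ψ) (m' := ψ) (k := fun _ => 1)
      (B := C * I) hp hψ.ae_norm hψ.ae_norm hFc continuousOn_const (fun u hu => ?_) (by positivity)
    · simpa using h
    · have hu := mem_sphere_zero_iff_norm.1 hu
      refine le_of_eq_of_le ?_ (integral_rpow_norm_transfer_le hψ hp
        (continuousOn_oddKernel hr0 hr) (hC r hr0 hr) hf hu)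
      simp only [hF, norm_mul, norm_star, hu, norm_qe, mul_one]
  have heven : ∫ z, ‖∫ g, evenKernel r g • f (g * z) ∂ψ‖ ^ p ∂ψ ≤ 2 ^ p * I :=
    (integral_rpow_norm_real_multiplier_le hψ hp hf (continuousOn_evenKernel hr0 hr)).trans
      (mul_le_mul_of_nonneg_right (Real.rpow_le_rpow (by positivity)
        (integral_abs_evenKernel_le hψ hr0 hr) hp0) hI0)
  have hEc : ContinuousOn (fun z => ∫ g, evenKernel r g • f (g * z) ∂ψ) (sphere 0 1) := by
    refine continuousOn_integral_of_sphere (f := fun z g => evenKernel r g • f (g * z))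
      hψ.ae_norm (isCompact_sphere _ _) ?_
    refine ContinuousOn.smul (f := fun x : ℍ[ℝ] × ℍ[ℝ] => evenKernel r x.2)
      ((continuousOn_evenKernel hr0 hr).comp continuousOn_snd fun x hx => hx.2) ?_
    exact (continuousOn_comp_mul hf).comp (f := fun x : ℍ[ℝ] × ℍ[ℝ] => (x.2, x.1)) (by fun_prop)
      fun x hx => ⟨hx.2, hx.1⟩
  have hOc : ContinuousOn (fun z => -∫ u, F u z ∂ψ) (sphere 0 1) :=
    (continuousOn_integral_of_sphere (f := fun z u => F u z) hψ.ae_norm (isCompact_sphere _ _)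
      (hFc.comp (f := fun x : ℍ[ℝ] × ℍ[ℝ] => (x.2, x.1)) (by fun_prop)
        fun x hx => ⟨hx.2, hx.1⟩)).neg
  have hsum : ∀ᵐ z ∂ψ, ‖∫ g, f (g * z) * cauchyKernel (r • g) ∂ψ‖ ^ p =
      ‖∫ g, evenKernel r g • f (g * z) ∂ψ + -∫ u, F u z ∂ψ‖ ^ p := by
    filter_upwards [hψ.ae_norm] with z hz
    rw [cauchy_integral_eq hψ hr0 hr hf hz]
  rw [integral_congr_ae hsum]
  refine (integral_norm_add_rpow_le hp
    (integrable_of_continuousOn_sphere hψ.ae_norm (continuousOn_rpow_norm hp0 hEc))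
    (integrable_of_continuousOn_sphere hψ.ae_norm (continuousOn_rpow_norm hp0 hOc))
    (integrable_of_continuousOn_sphere hψ.ae_norm hEc).aestronglyMeasurable
    (integrable_of_continuousOn_sphere hψ.ae_norm hOc).aestronglyMeasurable).trans ?_
  simp only [norm_neg]
  rw [mul_assoc]
  refine mul_le_mul_of_nonneg_left ?_ (by positivity)
  linarith

end

/-- The derivative of the Cauchy kernel. -/
noncomputable def cauchyKernelDeriv (x : ℍ[ℝ]) : ℍ[ℝ] →L[ℝ] ℍ[ℝ] :=
  (-(‖1 - x‖ ^ 4)⁻¹) • ContinuousLinearMap.id ℝ ℍ[ℝ] +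
    (4 * (‖1 - x‖ ^ 6)⁻¹) • (innerLeft (1 - x)).smulRight (1 - x)

theorem cauchyKernelDeriv_apply (x h : ℍ[ℝ]) : cauchyKernelDeriv x h =
    (-(‖1 - x‖ ^ 4)⁻¹) • h + (4 * (‖1 - x‖ ^ 6)⁻¹ * innerLeft (1 - x) h) • (1 - x) := by
  simp [cauchyKernelDeriv, smul_smul]

theorem hasFDerivAt_cauchyKernel {x : ℍ[ℝ]} (hx : x ≠ 1) :
    HasFDerivAt cauchyKernel (cauchyKernelDeriv x) x := by
  have hx0 : ‖1 - x‖ ≠ 0 := norm_ne_zero_iff.2 (sub_ne_zero.2 hx.symm)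
  have h1 : HasFDerivAt (fun x : ℍ[ℝ] => 1 - x) (-ContinuousLinearMap.id ℝ ℍ[ℝ]) x := by
    simpa using (hasFDerivAt_id x).const_sub (1 : ℍ[ℝ])
  have h2 := h1.norm_sq
  have h3 : HasDerivAt (fun t : ℝ => (t ^ 2)⁻¹) (-(2 * ‖1 - x‖ ^ 2) / ((‖1 - x‖ ^ 2) ^ 2) ^ 2)
      (‖1 - x‖ ^ 2) := by
    have := (hasDerivAt_pow 2 (‖1 - x‖ ^ 2)).fun_inv (by positivity)
    simpa using this
  have h4 := (h3.comp_hasFDerivAt x h2).smul h1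
  have he : (fun x : ℍ[ℝ] => ((fun t : ℝ => (t ^ 2)⁻¹) ∘ fun y : ℍ[ℝ] => ‖1 - y‖ ^ 2) x • (1 - x)) =
      cauchyKernel := by
    funext y
    rw [cauchyKernel, Function.comp_apply, ← pow_mul]
  change HasFDerivAt (fun x : ℍ[ℝ] => ((fun t : ℝ => (t ^ 2)⁻¹) ∘ fun y : ℍ[ℝ] => ‖1 - y‖ ^ 2) x •
    (1 - x)) _ x at h4
  rw [he] at h4
  refine h4.congr_fderiv ?_
  ext1 h
  rw [cauchyKernelDeriv_apply]
  simp only [Function.comp_apply, add_apply, smul_apply,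
    ContinuousLinearMap.smulRight_apply, neg_apply,
    ContinuousLinearMap.comp_apply, ContinuousLinearMap.id_apply, innerSL_apply_apply, innerLeft]
  simp only [inner_neg_right, smul_eq_mul, nsmul_eq_mul, smul_neg, neg_smul]
  congr 2
  · rw [← pow_mul]
  · field_simp
    norm_num
    ring

theorem sum_innerLeft_smul_qe (x : ℍ[ℝ]) : ∑ j, innerLeft (qe j) x • qe j = x := by
  obtain ⟨h0, h1, h2, h3⟩ := innerLeft_qe x
  rw [Fin.sum_univ_four, h0, h1, h2, h3]
  apply Quaternion.ext <;> simp [qe_coords]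

theorem innerLeft_mul_star (x y q : ℍ[ℝ]) : innerLeft x (y * star q) = innerLeft q (star x * y) := by
  simp [innerLeft_apply]
  ring

theorem innerLeft_mul_left (x y q : ℍ[ℝ]) : innerLeft x (q * y) = innerLeft q (x * star y) := by
  simp [innerLeft_apply]
  ring

theorem star_qe_mul_qe (j : Fin 4) : star (qe j) * qe j = 1 :=
  star_mul_self_of_norm_eq_one (norm_qe j)

theorem sum_innerLeft_star_smul_qe (x y : ℍ[ℝ]) :
    ∑ j, innerLeft x (y * star (qe j)) • qe j = star x * y := by
  simp only [innerLeft_mul_star, sum_innerLeft_smul_qe]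

theorem sum_mul_star_qe_mul_qe (y : ℍ[ℝ]) : ∑ j, y * star (qe j) * qe j = (4 : ℝ) • y := by
  simp only [mul_assoc, star_qe_mul_qe, mul_one, Finset.sum_const, Finset.card_univ,
    Fintype.card_fin]
  rw [← Nat.cast_smul_eq_nsmul ℝ]
  norm_num

/-- The Cauchy kernel is monogenic in its second variable. -/
theorem sum_cauchyKernelDeriv (x y : ℍ[ℝ]) :
    ∑ j, cauchyKernelDeriv x (y * star (qe j)) * qe j = 0 := by
  simp only [cauchyKernelDeriv_apply, add_mul, smul_mul_assoc, Finset.sum_add_distrib,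
    ← Finset.smul_sum, sum_mul_star_qe_mul_qe]
  have h : ∑ j, (4 * (‖1 - x‖ ^ 6)⁻¹ * innerLeft (1 - x) (y * star (qe j))) • ((1 - x) * qe j) =
      (4 * (‖1 - x‖ ^ 6)⁻¹) • ((1 - x) * ∑ j, innerLeft (1 - x) (y * star (qe j)) • qe j) := by
    rw [Finset.mul_sum, Finset.smul_sum]
    exact Finset.sum_congr rfl fun j _ => by rw [mul_smul_comm, mul_smul]
  rw [h, sum_innerLeft_star_smul_qe, ← mul_assoc, Quaternion.self_mul_star,
    Quaternion.normSq_eq_norm_mul_self, Quaternion.coe_mul_eq_smul, smul_smul, smul_smul,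
    ← add_smul]
  by_cases hx : ‖1 - x‖ = 0
  · simp [hx]
  · convert zero_smul ℝ y
    field_simp
    ring


theorem innerLeft_one_sub_smul_one_sub (x : ℍ[ℝ]) : (2 * innerLeft (1 - x) x) • (1 - x) =
    ‖1 - x‖ ^ 2 • x + (1 - x) * star x * (1 - x) := by
  rw [sq ‖_‖, ← Quaternion.normSq_eq_norm_mul_self, Quaternion.normSq_def', innerLeft_apply]
  apply Quaternion.ext <;>
  simp only [Quaternion.re_smul, Quaternion.imI_smul, Quaternion.imJ_smul, Quaternion.imK_smul,
    Quaternion.re_add, Quaternion.imI_add, Quaternion.imJ_add, Quaternion.imK_add,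
    Quaternion.re_mul, Quaternion.imI_mul, Quaternion.imJ_mul, Quaternion.imK_mul,
    Quaternion.re_sub, Quaternion.imI_sub, Quaternion.imJ_sub, Quaternion.imK_sub,
    Quaternion.re_star, Quaternion.imI_star, Quaternion.imJ_star, Quaternion.imK_star,
    Quaternion.re_one, Quaternion.imI_one, Quaternion.imJ_one, Quaternion.imK_one, smul_eq_mul] <;>
  ring

theorem sum_qe_mul_qe_mul (x : ℍ[ℝ]) : ∑ j, qe j * (qe j * x) = (-2 : ℝ) • x := by
  rw [Fin.sum_univ_four]
  apply Quaternion.ext <;> simp [qe_coords] <;> ring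

/-- The rotational derivatives of the Cauchy kernel determine its radial derivative. -/
theorem sum_qe_mul_cauchyKernelDeriv (x : ℍ[ℝ]) :
    ∑ j, qe j * cauchyKernelDeriv x (qe j * x) = (2 : ℝ) • cauchyKernelDeriv x x := by
  simp only [cauchyKernelDeriv_apply, mul_add, mul_smul_comm, Finset.sum_add_distrib,
    ← Finset.smul_sum, sum_qe_mul_qe_mul]
  have h : ∑ j, (4 * (‖1 - x‖ ^ 6)⁻¹ * innerLeft (1 - x) (qe j * x)) • (qe j * (1 - x)) =
      (4 * (‖1 - x‖ ^ 6)⁻¹) • ((1 - x) * star x * (1 - x)) := by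
    rw [← sum_innerLeft_smul_qe ((1 - x) * star x), Finset.sum_mul, Finset.smul_sum]
    exact Finset.sum_congr rfl fun j _ => by
      rw [innerLeft_mul_left, smul_mul_assoc, mul_smul]
  have h2 : (1 - x) * star x * (1 - x) =
      (2 * innerLeft (1 - x) x) • (1 - x) - ‖1 - x‖ ^ 2 • x := by
    rw [innerLeft_one_sub_smul_one_sub, add_sub_cancel_left]
  rw [h, h2]
  by_cases hx : ‖1 - x‖ = 0
  · simp [hx]
  · have h3 : (‖1 - x‖ ^ 4)⁻¹ = (‖1 - x‖ ^ 6)⁻¹ * ‖1 - x‖ ^ 2 := by field_simp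
    rw [h3]
    module

/-- The homogeneous terms of low degree in the expansion of the Cauchy kernel at the origin. -/
noncomputable def zonal : ℕ → ℍ[ℝ] → ℍ[ℝ]
  | 0 => fun _ => 1
  | 1 => fun x => (4 * innerLeft (qe 0) x) • (1 : ℍ[ℝ]) - x
  | 2 => fun x => (12 * innerLeft (qe 0) x ^ 2 - 2 * ‖x‖ ^ 2) • (1 : ℍ[ℝ]) -
      (4 * innerLeft (qe 0) x) • x
  | _ => fun _ => 0

/-- The derivatives of the functions `zonal`. -/
noncomputable def zonalDeriv : ℕ → ℍ[ℝ] → ℍ[ℝ] →L[ℝ] ℍ[ℝ]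
  | 1 => fun _ => ((4 : ℝ) • innerLeft (qe 0)).smulRight 1 - ContinuousLinearMap.id ℝ ℍ[ℝ]
  | 2 => fun x => ((24 * innerLeft (qe 0) x) • innerLeft (qe 0) - (4 : ℝ) • innerLeft x).smulRight 1
      - (((4 : ℝ) • innerLeft (qe 0)).smulRight x + (4 * innerLeft (qe 0) x) •
        ContinuousLinearMap.id ℝ ℍ[ℝ])
  | _ => fun _ => 0

theorem innerLeft_qe_zero_le (x : ℍ[ℝ]) : |innerLeft (qe 0) x| ≤ ‖x‖ := by
  rw [(innerLeft_qe x).1]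
  exact (quaternion_coords_abs_le x).1

theorem zonal_smul (n : ℕ) (r : ℝ) (x : ℍ[ℝ]) : zonal n (r • x) = r ^ n • zonal n x := by
  rcases n with _ | _ | _ | n
  · simp [zonal]
  · simp only [zonal, map_smul, smul_eq_mul]
    module
  · simp only [zonal, map_smul, smul_eq_mul, norm_smul, mul_pow, Real.norm_eq_abs, sq_abs]
    module
  · simp [zonal]

theorem hasFDerivAt_zonal (n : ℕ) (x : ℍ[ℝ]) : HasFDerivAt (zonal n) (zonalDeriv n x) x := by
  have ha := (innerLeft (qe 0)).hasFDerivAt (x := x)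
  have hi := hasFDerivAt_id (𝕜 := ℝ) x
  rcases n with _ | _ | _ | n
  · exact hasFDerivAt_const _ _
  · exact ((ha.const_mul 4).smul_const (1 : ℍ[ℝ])).sub hi
  · have h := ((((ha.pow 2).const_mul 12).sub (hi.norm_sq.const_mul 2)).smul_const (1 : ℍ[ℝ])).sub
      ((ha.const_mul 4).smul hi)
    refine h.congr_fderiv ?_
    ext1 h
    simp only [zonalDeriv, sub_apply, add_apply, smul_apply, ContinuousLinearMap.smulRight_apply,
      ContinuousLinearMap.id_apply, ContinuousLinearMap.comp_apply, innerSL_apply_apply, innerLeft,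
      smul_eq_mul, nsmul_eq_mul, id_eq]
    module
  · exact hasFDerivAt_const _ _

theorem continuous_zonalDeriv (n : ℕ) : Continuous (zonalDeriv n) := by
  have h : Continuous innerLeft := (innerSL ℝ).continuous
  rcases n with _ | _ | _ | n
  · exact continuous_const
  · exact continuous_const
  · simp only [zonalDeriv]
    refine Continuous.sub ?_ (Continuous.add ?_ (by fun_prop))
    · exact (ContinuousLinearMap.smulRightL ℝ ℍ[ℝ] ℍ[ℝ]).flip (1 : ℍ[ℝ]) |>.continuous.comp
        (by fun_prop)
    · exact ((ContinuousLinearMap.smulRightL ℝ ℍ[ℝ] ℍ[ℝ]) ((4 : ℝ) • innerLeft (qe 0))).continuous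
  · exact continuous_const

theorem sum_zonalDeriv (n : ℕ) (x y : ℍ[ℝ]) :
    ∑ j, zonalDeriv n x (y * star (qe j)) * qe j = 0 := by
  have h1 : ∑ j, innerLeft (qe 0) (y * star (qe j)) • qe j = y := by
    rw [sum_innerLeft_star_smul_qe]
    apply Quaternion.ext <;> simp [qe_coords]
  have h2 (x : ℍ[ℝ]) : ∑ j, innerLeft (qe 0) (y * star (qe j)) • (x * qe j) = x * y := by
    rw [← h1, Finset.mul_sum, h1]
    exact Finset.sum_congr rfl fun j _ => (mul_smul_comm _ _ _).symm
  rcases n with _ | _ | _ | n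
  · simp [zonalDeriv]
  · simp only [zonalDeriv, sub_apply, smul_apply, ContinuousLinearMap.smulRight_apply,
      ContinuousLinearMap.id_apply, smul_eq_mul, sub_mul, smul_mul_assoc, one_mul,
      Finset.sum_sub_distrib, sum_mul_star_qe_mul_qe, mul_smul, ← Finset.smul_sum, h1, sub_self]
  · simp only [zonalDeriv, sub_apply, add_apply, smul_apply, ContinuousLinearMap.smulRight_apply,
      ContinuousLinearMap.id_apply, smul_eq_mul, sub_mul, add_mul, smul_mul_assoc, one_mul, sub_smul,
      Finset.sum_sub_distrib, Finset.sum_add_distrib, sum_mul_star_qe_mul_qe, mul_smul,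
      ← Finset.smul_sum, h1, h2, sum_innerLeft_star_smul_qe]
    have h3 : star x * y = (2 * innerLeft (qe 0) x) • y - x * y := by
      rw [(innerLeft_qe x).1]
      apply Quaternion.ext <;> simp <;> ring
    rw [h3]
    module
  · simp [zonalDeriv]

theorem norm_zonal_le (n : ℕ) (x : ℍ[ℝ]) : ‖zonal n x‖ ≤ 18 * ‖x‖ ^ n := by
  have h := innerLeft_qe_zero_le x
  rcases n with _ | _ | _ | n
  · simp [zonal]
  · calc ‖zonal 1 x‖ ≤ ‖(4 * innerLeft (qe 0) x) • (1 : ℍ[ℝ])‖ + ‖x‖ := norm_sub_le _ _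
      _ ≤ 18 * ‖x‖ ^ (0 + 1) := by
        rw [norm_smul, norm_mul, norm_one, Real.norm_eq_abs, Real.norm_eq_abs,
          abs_of_pos four_pos, zero_add, pow_one]
        linarith [norm_nonneg x]
  · calc ‖zonal 2 x‖ ≤ ‖(12 * innerLeft (qe 0) x ^ 2 - 2 * ‖x‖ ^ 2) • (1 : ℍ[ℝ])‖ +
          ‖(4 * innerLeft (qe 0) x) • x‖ := norm_sub_le _ _
      _ = |12 * innerLeft (qe 0) x ^ 2 - 2 * ‖x‖ ^ 2| + 4 * |innerLeft (qe 0) x| * ‖x‖ := by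
        rw [norm_smul, norm_smul, norm_mul, norm_one, mul_one, Real.norm_ofNat]
        simp only [Real.norm_eq_abs]
      _ ≤ 14 * ‖x‖ ^ 2 + 4 * ‖x‖ * ‖x‖ := by
        gcongr
        have h2 : innerLeft (qe 0) x ^ 2 ≤ ‖x‖ ^ 2 := sq_le_sq' (abs_le.1 h).1 (abs_le.1 h).2
        rw [abs_le]
        constructor <;> nlinarith [sq_nonneg (innerLeft (qe 0) x)]
      _ = 18 * ‖x‖ ^ (0 + 1 + 1) := by ring
  · simp only [zonal, norm_zero]
    positivity

theorem abs_zonal_remainder_le {a r : ℝ} (hr0 : 0 ≤ r) (hx : r ≤ 1 / 2) (har : |a| ≤ r) :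
    |1 - (1 - 2 * a + r ^ 2) ^ 2 * (1 + 4 * a + 12 * a ^ 2 - 2 * r ^ 2)| ≤ 300 * r ^ 3 ∧
      |-1 + (1 - 2 * a + r ^ 2) ^ 2 * (1 + 4 * a)| ≤ 300 * r ^ 2 := by
  obtain ⟨u, hu⟩ : ∃ u, u = 4 * a ^ 2 + 2 * r ^ 2 - 4 * a * r ^ 2 + r ^ 4 := ⟨_, rfl⟩
  obtain ⟨v, hv⟩ : ∃ v, v = 12 * a ^ 2 - 2 * r ^ 2 := ⟨_, rfl⟩
  have ha2 : a ^ 2 ≤ r ^ 2 := sq_le_sq' (abs_le.1 har).1 (abs_le.1 har).2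
  have hr2 : 0 ≤ r ^ 2 := sq_nonneg r
  have har2 : |a * r ^ 2| ≤ r ^ 3 := by
    rw [abs_mul, abs_of_nonneg hr2]
    nlinarith
  have hr3 : r ^ 3 ≤ r ^ 2 / 2 := by nlinarith
  have hr4 : r ^ 4 ≤ r ^ 3 / 2 := by nlinarith [pow_nonneg hr0 3]
  have hr40 : 0 ≤ r ^ 4 := by positivity
  have hu1 : |u| ≤ 9 * r ^ 2 := by
    rw [hu, abs_le]
    have := abs_le.1 har2
    constructor <;> nlinarith [sq_nonneg a]
  have hv1 : |v| ≤ 14 * r ^ 2 := by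
    rw [hv, abs_le]
    constructor <;> nlinarith [sq_nonneg a]
  have hα1 : |1 - (1 - 2 * a + r ^ 2) ^ 2 * (1 + 4 * a + 12 * a ^ 2 - 2 * r ^ 2)| ≤
      300 * r ^ 3 := by
    have h1 : 1 - (1 - 2 * a + r ^ 2) ^ 2 * (1 + 4 * a + 12 * a ^ 2 - 2 * r ^ 2) =
        4 * (a * r ^ 2) - r ^ 4 + 4 * (a * (v - u)) - u * v := by
      rw [hu, hv]
      ring
    have h2 : |a * (v - u)| ≤ 23 * r ^ 3 := by
      calc |a * (v - u)| ≤ r * (23 * r ^ 2) := by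
            rw [abs_mul]
            gcongr
            linarith [abs_sub v u]
        _ = _ := by ring
    have h3 : |u * v| ≤ 126 * r ^ 4 := by
      calc |u * v| ≤ (9 * r ^ 2) * (14 * r ^ 2) := by
            rw [abs_mul]
            gcongr
        _ = _ := by ring
    rw [h1, abs_le]
    have h1' := abs_le.1 har2
    have h2' := abs_le.1 h2
    have h3' := abs_le.1 h3
    constructor <;> linarith
  have hβ1 : |-1 + (1 - 2 * a + r ^ 2) ^ 2 * (1 + 4 * a)| ≤ 300 * r ^ 2 := by
    have h1 : -1 + (1 - 2 * a + r ^ 2) ^ 2 * (1 + 4 * a) = u - 16 * a ^ 2 + 4 * (a * u) := by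
      rw [hu]
      ring
    have h2 : |a * u| ≤ 9 * r ^ 3 := by
      calc |a * u| ≤ r * (9 * r ^ 2) := by
            rw [abs_mul]
            gcongr
        _ = _ := by ring
    rw [h1, abs_le]
    have h2' := abs_le.1 h2
    have h1' := abs_le.1 hu1
    constructor <;> nlinarith [sq_nonneg a]
  exact ⟨hα1, hβ1⟩

theorem norm_cauchyKernel_sub_zonal_le {x : ℍ[ℝ]} (hx : ‖x‖ ≤ 1 / 2) :
    ‖cauchyKernel x - ∑ n ∈ Finset.range 3, zonal n x‖ ≤ 10000 * ‖x‖ ^ 3 := by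
  set a := innerLeft (qe 0) x with ha
  set r := ‖x‖ with hr
  have har : |a| ≤ r := innerLeft_qe_zero_le x
  have hr0 : 0 ≤ r := norm_nonneg x
  have hD : ‖1 - x‖ ^ 2 = 1 - 2 * a + r ^ 2 := by
    rw [ha, hr, (innerLeft_qe x).1, sq, sq, ← Quaternion.normSq_eq_norm_mul_self,
      ← Quaternion.normSq_eq_norm_mul_self, Quaternion.normSq_def', Quaternion.normSq_def']
    simp
    ring
  have hD4 : ‖1 - x‖ ^ 4 = (1 - 2 * a + r ^ 2) ^ 2 := by rw [← hD]; ring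
  have hlow : 1 / 2 ≤ ‖1 - x‖ := by
    have := norm_sub_norm_le (1 : ℍ[ℝ]) x
    rw [norm_one] at this
    linarith
  have hlow4 : 1 / 16 ≤ ‖1 - x‖ ^ 4 := by
    calc (1 / 16 : ℝ) = (1 / 2) ^ 4 := by norm_num
      _ ≤ _ := by gcongr
  set α := 1 - (1 - 2 * a + r ^ 2) ^ 2 * (1 + 4 * a + 12 * a ^ 2 - 2 * r ^ 2) with hα
  set β := -1 + (1 - 2 * a + r ^ 2) ^ 2 * (1 + 4 * a) with hβ
  have key : cauchyKernel x - ∑ n ∈ Finset.range 3, zonal n x =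
      (‖1 - x‖ ^ 4)⁻¹ • (α • (1 : ℍ[ℝ]) + β • x) := by
    have h1 : ‖1 - x‖ ^ 4 • (cauchyKernel x - ∑ n ∈ Finset.range 3, zonal n x) =
        α • (1 : ℍ[ℝ]) + β • x := by
      rw [smul_sub, cauchyKernel, smul_inv_smul₀ (by positivity), hD4]
      simp only [Finset.sum_range_succ, Finset.sum_range_zero, zonal, ← ha, ← hr]
      module
    rw [← h1, inv_smul_smul₀ (by positivity)]
  obtain ⟨hα1, hβ1⟩ := abs_zonal_remainder_le hr0 hx har
  rw [key, norm_smul, norm_inv, norm_pow, norm_norm]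
  calc (‖1 - x‖ ^ 4)⁻¹ * ‖α • (1 : ℍ[ℝ]) + β • x‖ ≤ 16 * (300 * r ^ 3 + 300 * r ^ 2 * r) := by
        have h16 : (‖1 - x‖ ^ 4)⁻¹ ≤ 16 := by
          rw [inv_le_comm₀ (by positivity) (by norm_num)]
          linarith
        have h2 : ‖α • (1 : ℍ[ℝ]) + β • x‖ ≤ 300 * r ^ 3 + 300 * r ^ 2 * r := by
          refine (norm_add_le _ _).trans ?_
          rw [norm_smul, norm_smul, norm_one, mul_one, Real.norm_eq_abs, Real.norm_eq_abs]
          gcongr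
        gcongr
    _ ≤ 10000 * r ^ 3 := by nlinarith [pow_nonneg hr0 3]

section

section ParametricIntegral

variable {𝔸 E F G H : Type*} [NormedAddCommGroup 𝔸] [ProperSpace 𝔸]
  [NormedAddCommGroup E] [NormedSpace ℝ E] [NormedAddCommGroup F] [NormedSpace ℝ F]
  [NormedAddCommGroup G] [NormedSpace ℝ G] [NormedAddCommGroup H] [NormedSpace ℝ H]
  {B : F →L[ℝ] G →L[ℝ] H} {v : 𝔸 → F} {w : E → 𝔸 → G} {w' : E → 𝔸 → E →L[ℝ] G}

theorem exists_deriv_bound [ProperSpace E]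
    (hw' : ContinuousOn (Function.uncurry w') (ball 0 1 ×ˢ sphere 0 1))
    {r : ℝ} (hr : r < 1) : ∃ M, ∀ z y a, ‖z‖ ≤ r → ‖y‖ = 1 → ‖(B a).comp (w' z y)‖ ≤ ‖a‖ * M := by
  obtain ⟨M, hM⟩ := ((isCompact_closedBall (0 : E) r).prod
    (isCompact_sphere (0 : 𝔸) 1)).exists_bound_of_continuousOn
    (hw'.mono (Set.prod_mono (closedBall_subset_ball hr) subset_rfl))
  refine ⟨‖B‖ * M, fun z y a hz hy => (ContinuousLinearMap.opNorm_comp_le _ _).trans ?_⟩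
  calc ‖B a‖ * ‖w' z y‖ ≤ (‖B‖ * ‖a‖) * M := by
        have h1 := hM (z, y) ⟨by simpa using hz, by simpa using hy⟩
        gcongr
        · exact B.le_opNorm a
        · exact h1
    _ = _ := by ring

variable [MeasurableSpace 𝔸] [BorelSpace 𝔸] {m : Measure 𝔸} [IsFiniteMeasure m]

theorem integrable_bilin_of_continuousOn (hm : ∀ᵐ y ∂m, ‖y‖ = 1) (hv : Integrable v m)
    {w : 𝔸 → G} (hw : ContinuousOn w (sphere 0 1)) : Integrable (fun y => B (v y) (w y)) m := by
  obtain ⟨M, hM⟩ := (isCompact_sphere (0 : 𝔸) 1).exists_bound_of_continuousOn hw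
  refine (hv.norm.mul_const (‖B‖ * M)).mono' (B.aestronglyMeasurable_comp₂ hv.aestronglyMeasurable
    (integrable_of_continuousOn_sphere hm hw).aestronglyMeasurable) ?_
  filter_upwards [hm] with y hy
  calc ‖B (v y) (w y)‖ ≤ ‖B‖ * ‖v y‖ * ‖w y‖ := B.le_opNorm₂ _ _
    _ ≤ ‖B‖ * ‖v y‖ * M := by
      gcongr
      exact hM y (mem_sphere_zero_iff_norm.2 hy)
    _ = _ := by ring

theorem integrable_bilin_deriv (hm : ∀ᵐ y ∂m, ‖y‖ = 1)
    (hw' : ContinuousOn (Function.uncurry w') (ball 0 1 ×ˢ sphere 0 1))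
    (hv : Integrable v m) {z : E} (hz : ‖z‖ < 1) :
    Integrable (fun y => (B (v y)).comp (w' z y)) m :=
  integrable_bilin_of_continuousOn (B := (ContinuousLinearMap.compL ℝ E G H).comp B) hm hv
    (hw'.comp (f := fun y => (z, y)) (by fun_prop) fun y hy => ⟨by simpa using hz, hy⟩)

theorem hasFDerivAt_integral_bilin [ProperSpace E] (hm : ∀ᵐ y ∂m, ‖y‖ = 1)
    (hw : ∀ z y, ‖z‖ < 1 → ‖y‖ = 1 → HasFDerivAt (fun z => w z y) (w' z y) z)
    (hwc : ∀ z, ‖z‖ < 1 → ContinuousOn (w z) (sphere 0 1))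
    (hw' : ContinuousOn (Function.uncurry w') (ball 0 1 ×ˢ sphere 0 1))
    (hv : Integrable v m) {z : E} (hz : ‖z‖ < 1) :
    HasFDerivAt (fun z => ∫ y, B (v y) (w z y) ∂m) (∫ y, (B (v y)).comp (w' z y) ∂m) z := by
  obtain ⟨r, hzr, hr⟩ := exists_between hz
  obtain ⟨M, hM⟩ := exists_deriv_bound (B := B) hw' hr
  refine hasFDerivAt_integral_of_dominated_of_fderiv_le (𝕜 := ℝ)
    (F := fun z y => B (v y) (w z y)) (F' := fun z y => (B (v y)).comp (w' z y))
    (s := closedBall (0 : E) r) (bound := fun y => ‖v y‖ * M) ?_ ?_ ?_ ?_ ?_ (hv.norm.mul_const M) ?_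
  · exact mem_nhds_iff.2 ⟨ball 0 r, ball_subset_closedBall, isOpen_ball, by simpa using hzr⟩
  · filter_upwards [isOpen_ball.mem_nhds (mem_ball_zero_iff.2 hz)] with x hx
    exact (integrable_bilin_of_continuousOn hm hv
      (hwc x (mem_ball_zero_iff.1 hx))).aestronglyMeasurable
  · exact integrable_bilin_of_continuousOn hm hv (hwc z hz)
  · exact (integrable_bilin_deriv hm hw' hv hz).aestronglyMeasurable
  · filter_upwards [hm] with y hy x hx
    exact hM x y _ (by simpa using hx) hy
  · filter_upwards [hm] with y hy x hx
    exact (B (v y)).hasFDerivAt.comp x (f := fun x => w x y)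
      (hw x y ((mem_closedBall_zero_iff.1 hx).trans_lt hr) hy)

theorem contDiffOn_integral_bilin [ProperSpace E] (hm : ∀ᵐ y ∂m, ‖y‖ = 1)
    (hw : ∀ z y, ‖z‖ < 1 → ‖y‖ = 1 → HasFDerivAt (fun z => w z y) (w' z y) z)
    (hwc : ∀ z, ‖z‖ < 1 → ContinuousOn (w z) (sphere 0 1))
    (hw' : ContinuousOn (Function.uncurry w') (ball 0 1 ×ˢ sphere 0 1))
    (hv : Integrable v m) : ContDiffOn ℝ 1 (fun z => ∫ y, B (v y) (w z y) ∂m) (ball 0 1) := by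
  have h1 : ∀ z ∈ ball (0 : E) 1, HasFDerivAt (fun z => ∫ y, B (v y) (w z y) ∂m) _ z :=
    fun z hz => hasFDerivAt_integral_bilin hm hw hwc hw' hv (mem_ball_zero_iff.1 hz)
  rw [show (1 : WithTop ℕ∞) = 0 + 1 by rfl, contDiffOn_succ_iff_fderiv_of_isOpen isOpen_ball]
  refine ⟨fun z hz => (h1 z hz).differentiableAt.differentiableWithinAt, by simp, ?_⟩
  rw [contDiffOn_zero]
  refine ContinuousOn.congr (f := fun z => ∫ y, (B (v y)).comp (w' z y) ∂m) ?_
    fun z hz => (h1 z hz).fderiv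
  intro z hz
  obtain ⟨r, hzr, hr⟩ := exists_between (mem_ball_zero_iff.1 hz)
  obtain ⟨M, hM⟩ := exists_deriv_bound (B := B) hw' hr
  have hnhds : ball (0 : E) r ∈ nhds z := isOpen_ball.mem_nhds (mem_ball_zero_iff.2 hzr)
  refine ContinuousAt.continuousWithinAt (continuousAt_of_dominated (bound := fun y => ‖v y‖ * M)
    ?_ ?_ (hv.norm.mul_const M) ?_)
  · filter_upwards [hnhds] with x hx
    exact (integrable_bilin_deriv hm hw' hv ((mem_ball_zero_iff.1 hx).trans hr)).aestronglyMeasurable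
  · filter_upwards [hnhds] with x hx
    filter_upwards [hm] with y hy
    exact hM x y _ (mem_ball_zero_iff.1 hx).le hy
  · filter_upwards [hm] with y hy
    exact ((ContinuousLinearMap.compL ℝ E G H (B (v y))).continuous.comp_continuousOn
      (hw'.comp (f := fun x => (x, y)) (s := ball 0 1) (by fun_prop)
      fun x hx => ⟨hx, by simpa using hy⟩)).continuousAt (isOpen_ball.mem_nhds hz)

theorem fderiv_integral_bilin_apply [ProperSpace E] (hm : ∀ᵐ y ∂m, ‖y‖ = 1)
    (hw : ∀ z y, ‖z‖ < 1 → ‖y‖ = 1 → HasFDerivAt (fun z => w z y) (w' z y) z)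
    (hwc : ∀ z, ‖z‖ < 1 → ContinuousOn (w z) (sphere 0 1))
    (hw' : ContinuousOn (Function.uncurry w') (ball 0 1 ×ˢ sphere 0 1))
    (hv : Integrable v m) {z : E} (hz : ‖z‖ < 1) (h : E) :
    Integrable (fun y => B (v y) (w' z y h)) m ∧
      fderiv ℝ (fun z => ∫ y, B (v y) (w z y) ∂m) z h = ∫ y, B (v y) (w' z y h) ∂m := by
  have hi := integrable_bilin_deriv (B := B) hm hw' hv hz
  refine ⟨hi.apply_continuousLinearMap h, ?_⟩
  rw [(hasFDerivAt_integral_bilin hm hw hwc hw' hv hz).fderiv,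
    ContinuousLinearMap.integral_apply hi]
  rfl

end ParametricIntegral

variable {ψ : Measure ℍ[ℝ]}

theorem norm_mul_star_of_norm_eq_one {y : ℍ[ℝ]} (hy : ‖y‖ = 1) (z : ℍ[ℝ]) : ‖y * star z‖ = ‖z‖ := by
  rw [norm_mul, hy, one_mul, norm_star]

/-- The derivative of `z ↦ k (y * star z)`, where `k'` is the derivative of `k`. -/
noncomputable def transformDeriv (k' : ℍ[ℝ] → ℍ[ℝ] →L[ℝ] ℍ[ℝ]) (z y : ℍ[ℝ]) : ℍ[ℝ] →L[ℝ] ℍ[ℝ] :=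
  (k' (y * star z)).comp ((ContinuousLinearMap.mul ℝ ℍ[ℝ] y).comp
    (starIsometry.toContinuousLinearEquiv : ℍ[ℝ] →L[ℝ] ℍ[ℝ]))

theorem mapsTo_mul_star_ball :
    Set.MapsTo (fun x : ℍ[ℝ] × ℍ[ℝ] => x.2 * star x.1) (ball 0 1 ×ˢ sphere 0 1) (ball 0 1) :=
  fun x hx => by
    rw [mem_ball_zero_iff, norm_mul_star_of_norm_eq_one (mem_sphere_zero_iff_norm.1 hx.2)]
    exact mem_ball_zero_iff.1 hx.1

theorem continuousOn_transformDeriv {k' : ℍ[ℝ] → ℍ[ℝ] →L[ℝ] ℍ[ℝ]} (hk' : ContinuousOn k' (ball 0 1)) :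
    ContinuousOn (Function.uncurry (transformDeriv k')) (ball 0 1 ×ˢ sphere 0 1) := by
  refine ContinuousOn.clm_comp (hk'.comp (by fun_prop) mapsTo_mul_star_ball) ?_
  exact Continuous.continuousOn (by fun_prop)

theorem hasFDerivAt_comp_mul_star {k : ℍ[ℝ] → ℍ[ℝ]} {k' : ℍ[ℝ] → ℍ[ℝ] →L[ℝ] ℍ[ℝ]} {y z : ℍ[ℝ]}
    (hk : HasFDerivAt k (k' (y * star z)) (y * star z)) :
    HasFDerivAt (fun z => k (y * star z)) (transformDeriv k' z y) z :=
  hk.comp z (f := fun z : ℍ[ℝ] => y * star z) (((ContinuousLinearMap.mul ℝ ℍ[ℝ] y).comp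
    (starIsometry.toContinuousLinearEquiv : ℍ[ℝ] →L[ℝ] ℍ[ℝ])).hasFDerivAt)

/-- The integral transform with kernel `k (y * star z)` of a function on the sphere. -/
noncomputable def transform (ψ : Measure ℍ[ℝ]) (k v : ℍ[ℝ] → ℍ[ℝ]) (z : ℍ[ℝ]) : ℍ[ℝ] :=
  ∫ y, v y * k (y * star z) ∂ψ

section

variable {k : ℍ[ℝ] → ℍ[ℝ]} {k' : ℍ[ℝ] → ℍ[ℝ] →L[ℝ] ℍ[ℝ]} {v : ℍ[ℝ] → ℍ[ℝ]}

theorem continuousOn_kernel_mul_star (hk : ContinuousOn k (ball 0 1)) {z : ℍ[ℝ]} (hz : ‖z‖ < 1) :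
    ContinuousOn (fun y => k (y * star z)) (sphere 0 1) :=
  hk.comp (by fun_prop) fun _ hy => mapsTo_mul_star_ball (x := (z, _)) ⟨by simpa using hz, hy⟩

theorem integrable_mul_of_continuousOn (hψ : IsSphereMeasure ψ) (hv : Integrable v ψ)
    {w : ℍ[ℝ] → ℍ[ℝ]} (hw : ContinuousOn w (sphere 0 1)) : Integrable (fun y => v y * w y) ψ := by
  have := hψ.isProbabilityMeasure
  exact integrable_bilin_of_continuousOn (B := ContinuousLinearMap.mul ℝ ℍ[ℝ]) hψ.ae_norm hv hw

theorem continuousOn_of_hasFDerivAt (hk : ∀ x, ‖x‖ < 1 → HasFDerivAt k (k' x) x) :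
    ContinuousOn k (ball 0 1) := fun x hx =>
  (hk x (mem_ball_zero_iff.1 hx)).continuousAt.continuousWithinAt

theorem contDiffOn_transform (hψ : IsSphereMeasure ψ)
    (hk : ∀ x, ‖x‖ < 1 → HasFDerivAt k (k' x) x) (hk' : ContinuousOn k' (ball 0 1))
    (hv : Integrable v ψ) : ContDiffOn ℝ 1 (transform ψ k v) (ball 0 1) := by
  have := hψ.isProbabilityMeasure
  refine contDiffOn_integral_bilin (B := ContinuousLinearMap.mul ℝ ℍ[ℝ]) hψ.ae_norm
    (w := fun z y => k (y * star z)) (fun z y hz hy => hasFDerivAt_comp_mul_star (hk _ ?_))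
    (fun z hz => continuousOn_kernel_mul_star (continuousOn_of_hasFDerivAt hk) hz)
    (continuousOn_transformDeriv hk') hv
  rwa [norm_mul_star_of_norm_eq_one hy]

theorem dirac_transform (hψ : IsSphereMeasure ψ)
    (hk : ∀ x, ‖x‖ < 1 → HasFDerivAt k (k' x) x) (hk' : ContinuousOn k' (ball 0 1))
    (hmono : ∀ x y, ∑ j, k' x (y * star (qe j)) * qe j = 0)
    (hv : Integrable v ψ) {z : ℍ[ℝ]} (hz : ‖z‖ < 1) : Dirac (transform ψ k v) z = 0 := by
  have := hψ.isProbabilityMeasure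
  have h := fun j : Fin 4 => fderiv_integral_bilin_apply (B := ContinuousLinearMap.mul ℝ ℍ[ℝ])
    (w := fun z y => k (y * star z)) (w' := transformDeriv k') hψ.ae_norm
    (fun z y hz hy => hasFDerivAt_comp_mul_star (hk _ (by rwa [norm_mul_star_of_norm_eq_one hy])))
    (fun z hz => continuousOn_kernel_mul_star (continuousOn_of_hasFDerivAt hk) hz)
    (continuousOn_transformDeriv hk') hv hz (qe j)
  have h2 : ∀ j : Fin 4, fderiv ℝ (transform ψ k v) z (qe j) * qe j =
      ∫ y, v y * (k' (y * star z) (y * star (qe j))) * qe j ∂ψ := fun j => by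
    have h3 := (h j).2
    have h4 : (fun z => ∫ y, (ContinuousLinearMap.mul ℝ ℍ[ℝ] (v y)) (k (y * star z)) ∂ψ) =
      transform ψ k v := rfl
    rw [h4] at h3
    rw [h3, ← integral_mul_const_of_integrable (h j).1]
    rfl
  rw [Dirac, Finset.sum_congr rfl fun j _ => h2 j, ← integral_finsetSum]
  · simp only [mul_assoc, ← Finset.mul_sum]
    simp only [hmono, mul_zero, integral_zero]
  · exact fun j _ => (h j).1.mul_const (qe j)

end

end

section

variable {ψ : Measure ℍ[ℝ]}

theorem hasDerivAt_integral_sphere {𝔸 E : Type*} [NormedAddCommGroup 𝔸] [ProperSpace 𝔸]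
    [MeasurableSpace 𝔸] [BorelSpace 𝔸] {m : Measure 𝔸} [IsFiniteMeasure m]
    [NormedAddCommGroup E] [NormedSpace ℝ E] (hm : ∀ᵐ y ∂m, ‖y‖ = 1) {F F' : ℝ → 𝔸 → E} {U : Set ℝ}
    (hU : IsOpen U) (hF : ∀ s ∈ U, ∀ y, ‖y‖ = 1 → HasDerivAt (fun s => F s y) (F' s y) s)
    (hFc : ∀ s ∈ U, ContinuousOn (F s) (sphere 0 1))
    (hF' : ContinuousOn (Function.uncurry F') (U ×ˢ sphere 0 1)) {s : ℝ} (hs : s ∈ U) :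
    HasDerivAt (fun s => ∫ y, F s y ∂m) (∫ y, F' s y ∂m) s := by
  obtain ⟨ε, hε, hεU⟩ := Metric.nhds_basis_closedBall.mem_iff.1 (hU.mem_nhds hs)
  obtain ⟨M, hM⟩ := ((isCompact_closedBall s ε).prod
    (isCompact_sphere (0 : 𝔸) 1)).exists_bound_of_continuousOn
    (hF'.mono (Set.prod_mono hεU subset_rfl))
  refine (hasDerivAt_integral_of_dominated_loc_of_deriv_le (𝕜 := ℝ) (F := F) (F' := F')
    (s := closedBall s ε) (bound := fun _ => M) (closedBall_mem_nhds s hε) ?_ ?_ ?_ ?_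
    (integrable_const M) ?_).2
  · filter_upwards [hU.mem_nhds hs] with t ht
    exact (integrable_of_continuousOn_sphere hm (hFc t ht)).aestronglyMeasurable
  · exact integrable_of_continuousOn_sphere hm (hFc s hs)
  · exact (integrable_of_continuousOn_sphere hm (hF'.comp (f := fun y => (s, y)) (by fun_prop)
      fun y hy => ⟨hs, hy⟩)).aestronglyMeasurable
  · filter_upwards [hm] with y hy t ht
    exact hM (t, y) ⟨ht, mem_sphere_zero_iff_norm.2 hy⟩
  · filter_upwards [hm] with y hy t ht
    exact hF t (hεU ht) y hy

/-- Continuously differentiable functions on the unit ball annihilated by the Dirac operator,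
with their derivative. -/
structure IsMonogenic (f : ℍ[ℝ] → ℍ[ℝ]) (f' : ℍ[ℝ] → ℍ[ℝ] →L[ℝ] ℍ[ℝ]) : Prop where
  hasFDerivAt : ∀ x, ‖x‖ < 1 → HasFDerivAt f (f' x) x
  continuousOn_deriv : ContinuousOn f' (ball 0 1)
  dirac : ∀ x, ‖x‖ < 1 → ∑ j, f' x (qe j) * qe j = 0

theorem IsMonogenic.continuousOn {f : ℍ[ℝ] → ℍ[ℝ]} {f' : ℍ[ℝ] → ℍ[ℝ] →L[ℝ] ℍ[ℝ]}
    (hf : IsMonogenic f f') : ContinuousOn f (ball 0 1) := fun x hx =>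
  (hf.hasFDerivAt x (mem_ball_zero_iff.1 hx)).continuousAt.continuousWithinAt

theorem isMonogenic_one : IsMonogenic (fun _ => 1) fun _ => 0 :=
  ⟨fun _ _ => hasFDerivAt_const _ _, continuousOn_const, fun _ _ => by simp⟩

theorem sum_apply_qe_mul (L : ℍ[ℝ] →L[ℝ] ℍ[ℝ]) (y : ℍ[ℝ]) :
    ∑ j, L (qe j * y) * qe j = (∑ j, L (qe j) * qe j) * star y := by
  have h : ∀ j, L (qe j * y) = ∑ m, innerLeft (qe m) (qe j * y) • L (qe m) := fun j => by
    conv_lhs => rw [← sum_innerLeft_smul_qe (qe j * y)]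
    simp only [map_sum, map_smul]
  simp only [h, Finset.sum_mul]
  rw [Finset.sum_comm]
  refine Finset.sum_congr rfl fun m _ => ?_
  conv_rhs => rw [mul_assoc, ← sum_innerLeft_smul_qe (qe m * star y), Finset.mul_sum]
  refine Finset.sum_congr rfl fun j _ => ?_
  rw [innerLeft_mul_left, smul_mul_assoc, mul_smul_comm]

theorem IsMonogenic.apply_self_eq {f : ℍ[ℝ] → ℍ[ℝ]} {f' : ℍ[ℝ] → ℍ[ℝ] →L[ℝ] ℍ[ℝ]}
    (hf : IsMonogenic f f') {x : ℍ[ℝ]} (hx : ‖x‖ < 1) (y : ℍ[ℝ]) :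
    f' x y = -∑ k : Fin 3, f' x (qe k.succ * y) * qe k.succ := by
  have h := sum_apply_qe_mul (f' x) y
  have h1 : qe 0 = 1 := by apply Quaternion.ext <;> simp [qe_coords]
  rw [hf.dirac x hx, zero_mul, Fin.sum_univ_succ, h1, one_mul, mul_one] at h
  exact eq_neg_of_add_eq_zero_left h

theorem cauchyKernelDeriv_self (x : ℍ[ℝ]) :
    cauchyKernelDeriv x x = ∑ k : Fin 3, qe k.succ * cauchyKernelDeriv x (qe k.succ * x) := by
  have h := sum_qe_mul_cauchyKernelDeriv x
  have h1 : qe 0 = 1 := by apply Quaternion.ext <;> simp [qe_coords]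
  rw [Fin.sum_univ_succ, h1, one_mul, one_mul, two_smul] at h
  exact (add_left_cancel h).symm

theorem continuousOn_cauchyKernelDeriv : ContinuousOn cauchyKernelDeriv {1}ᶜ := by
  have h : Continuous innerLeft := (innerSL ℝ).continuous
  have h0 (n : ℕ) : ∀ x ∈ ({1}ᶜ : Set ℍ[ℝ]), ‖1 - x‖ ^ n ≠ 0 := fun x hx =>
    pow_ne_zero _ (norm_ne_zero_iff.2 (sub_ne_zero.2 fun h => hx h.symm))
  have hc (n : ℕ) : ContinuousOn (fun x : ℍ[ℝ] => ‖1 - x‖ ^ n) {1}ᶜ :=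
    Continuous.continuousOn (by fun_prop)
  have h4 := ((hc 4).inv₀ (h0 4)).neg
  have h6 : ContinuousOn (fun x : ℍ[ℝ] => 4 * (‖1 - x‖ ^ 6)⁻¹) {1}ᶜ :=
    continuousOn_const.mul ((hc 6).inv₀ (h0 6))
  have hs : Continuous fun x : ℍ[ℝ] => (innerLeft (1 - x)).smulRight (1 - x) :=
    ((ContinuousLinearMap.smulRightL ℝ ℍ[ℝ] ℍ[ℝ]).continuous.comp
      (h.comp (by fun_prop : Continuous fun x : ℍ[ℝ] => 1 - x))).clm_apply (by fun_prop)
  have aux : ∀ (a b : ℍ[ℝ] → ℝ) (L : ℍ[ℝ] → ℍ[ℝ] →L[ℝ] ℍ[ℝ]), ContinuousOn a {1}ᶜ →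
      ContinuousOn b {1}ᶜ → Continuous L →
      ContinuousOn (fun x => a x • ContinuousLinearMap.id ℝ ℍ[ℝ] + b x • L x) {1}ᶜ := by
    intro a b L ha hb hL
    fun_prop
  exact aux _ _ _ h4 h6 hs

theorem continuousOn_cauchyKernel : ContinuousOn cauchyKernel {1}ᶜ := fun _ hx =>
  (hasFDerivAt_cauchyKernel hx).continuousAt.continuousWithinAt

end

section

variable {ψ : Measure ℍ[ℝ]}

theorem continuousOn_precompR_add_precompL {D E F G : Type*} [NormedAddCommGroup D]
    [NormedSpace ℝ D] [NormedAddCommGroup E]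
    [NormedSpace ℝ E] [NormedAddCommGroup F] [NormedSpace ℝ F] [NormedAddCommGroup G]
    [NormedSpace ℝ G] (B : E →L[ℝ] F →L[ℝ] G) {s : Set D} {a : D → E} {a' : D → D →L[ℝ] E}
    {b : D → F} {b' : D → D →L[ℝ] F} (ha : ContinuousOn a s) (hb : ContinuousOn b s)
    (ha' : ContinuousOn a' s) (hb' : ContinuousOn b' s) :
    ContinuousOn (fun y => B.precompR D (a y) (b' y) + B.precompL D (a' y) (b y)) s := by
  fun_prop

theorem IsSphereMeasure.integral_bilin_fderiv_eq_zero {E F G : Type*} [NormedAddCommGroup E]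
    [NormedSpace ℝ E] [NormedAddCommGroup F] [NormedSpace ℝ F] [NormedAddCommGroup G]
    [NormedSpace ℝ G] (hψ : IsSphereMeasure ψ) (B : E →L[ℝ] F →L[ℝ] G) {n : ℍ[ℝ]}
    (hn : star n = -n) (hn1 : ‖n‖ = 1) {a : ℍ[ℝ] → E} {a' : ℍ[ℝ] → ℍ[ℝ] →L[ℝ] E}
    {b : ℍ[ℝ] → F} {b' : ℍ[ℝ] → ℍ[ℝ] →L[ℝ] F}
    (ha : ∀ y, ‖y‖ = 1 → HasFDerivAt a (a' y) y) (hb : ∀ y, ‖y‖ = 1 → HasFDerivAt b (b' y) y)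
    (ha' : ContinuousOn a' (sphere 0 1)) (hb' : ContinuousOn b' (sphere 0 1)) :
    Integrable (fun y => B (a y) (b' y (n * y)) + B (a' y (n * y)) (b y)) ψ ∧
      ∫ y, (B (a y) (b' y (n * y)) + B (a' y (n * y)) (b y)) ∂ψ = 0 := by
  have := hψ.isProbabilityMeasure
  have hac : ContinuousOn a (sphere 0 1) := fun y hy =>
    (ha y (mem_sphere_zero_iff_norm.1 hy)).continuousAt.continuousWithinAt
  have hbc : ContinuousOn b (sphere 0 1) := fun y hy =>
    (hb y (mem_sphere_zero_iff_norm.1 hy)).continuousAt.continuousWithinAt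
  have hc := continuousOn_precompR_add_precompL B hac hbc ha' hb'
  refine ⟨integrable_of_continuousOn_sphere hψ.ae_norm
    (hc.clm_apply (g := fun y => n * y) (by fun_prop)),
    hψ.integral_fderiv_eq_zero hn hn1 (G := fun y => B (a y) (b y))
    (G' := fun y => B.precompR ℍ[ℝ] (a y) (b' y) + B.precompL ℍ[ℝ] (a' y) (b y))
    (fun y hy => B.hasFDerivAt_of_bilinear (ha y hy) (hb y hy)) hc⟩

theorem integral_mul_cauchyKernel_by_parts (hψ : IsSphereMeasure ψ) {f : ℍ[ℝ] → ℍ[ℝ]}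
    {f' : ℍ[ℝ] → ℍ[ℝ] →L[ℝ] ℍ[ℝ]} (hf : IsMonogenic f f') {s c : ℝ} (hs0 : 0 < s) (hs : s < 1)
    (hc0 : 0 ≤ c) (hc : c ≠ 1) {z : ℍ[ℝ]} (hz : ‖z‖ = 1) (k : Fin 3) :
    Integrable (fun y => f (s • y) * (qe k.succ * cauchyKernelDeriv (c • (y * star z))
        (c • (qe k.succ * y * star z))) +
      f' (s • y) (s • (qe k.succ * y)) * (qe k.succ * cauchyKernel (c • (y * star z)))) ψ ∧
    ∫ y, (f (s • y) * (qe k.succ * cauchyKernelDeriv (c • (y * star z))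
        (c • (qe k.succ * y * star z))) +
      f' (s • y) (s • (qe k.succ * y)) * (qe k.succ * cauchyKernel (c • (y * star z)))) ∂ψ = 0 := by
  have hsy : ∀ y : ℍ[ℝ], ‖y‖ = 1 → ‖s • y‖ < 1 := fun y hy => by
    rwa [norm_smul, hy, mul_one, Real.norm_of_nonneg hs0.le]
  have hcy : ∀ y : ℍ[ℝ], ‖y‖ = 1 → c • (y * star z) ∈ ({1}ᶜ : Set ℍ[ℝ]) := fun y hy h => by
    have h1 := congrArg norm (Set.mem_singleton_iff.1 h)
    rw [norm_smul, norm_mul_star_of_norm_eq_one hy, hz, mul_one, norm_one,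
      Real.norm_of_nonneg hc0] at h1
    exact hc h1
  let L : ℍ[ℝ] →L[ℝ] ℍ[ℝ] := c • (ContinuousLinearMap.mul ℝ ℍ[ℝ]).flip (star z)
  have hL : ∀ y, L y = c • (y * star z) := fun y => rfl
  refine hψ.integral_bilin_fderiv_eq_zero (ContinuousLinearMap.mul ℝ ℍ[ℝ])
    (star_qe k.succ (Fin.succ_ne_zero k)) (norm_qe k.succ) (a := fun y => f (s • y))
    (a' := fun y => (f' (s • y)).comp (s • ContinuousLinearMap.id ℝ ℍ[ℝ])) (b := fun y => qe k.succ * cauchyKernel (c • (y * star z)))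
    (b' := fun y => (ContinuousLinearMap.mul ℝ ℍ[ℝ] (qe k.succ)).comp
      ((cauchyKernelDeriv (L y)).comp L)) ?_ ?_ ?_ ?_
  · intro y hy
    exact (hf.hasFDerivAt _ (hsy y hy)).comp y (s • ContinuousLinearMap.id ℝ ℍ[ℝ]).hasFDerivAt
  · intro y hy
    exact (ContinuousLinearMap.mul ℝ ℍ[ℝ] (qe k.succ)).hasFDerivAt.comp y
      ((hasFDerivAt_cauchyKernel (x := L y) (hcy y hy)).comp y L.hasFDerivAt)
  · refine ContinuousOn.clm_comp ?_ continuousOn_const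
    exact hf.continuousOn_deriv.comp (by fun_prop) fun y hy =>
      mem_ball_zero_iff.2 (hsy y (mem_sphere_zero_iff_norm.1 hy))
  · refine ContinuousOn.clm_comp continuousOn_const (ContinuousOn.clm_comp ?_ continuousOn_const)
    exact continuousOn_cauchyKernelDeriv.comp L.continuous.continuousOn fun y hy =>
      hcy y (mem_sphere_zero_iff_norm.1 hy)

end

section

variable {ψ : Measure ℍ[ℝ]}

theorem norm_smul_mul_star {y z : ℍ[ℝ]} (hy : ‖y‖ = 1) (hz : ‖z‖ = 1) {c : ℝ} (hc : 0 ≤ c) :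
    ‖c • (y * star z)‖ = c := by
  rw [norm_smul, norm_mul_star_of_norm_eq_one hy, hz, mul_one, Real.norm_of_nonneg hc]

theorem smul_mul_star_ne_one {y z : ℍ[ℝ]} (hy : ‖y‖ = 1) (hz : ‖z‖ = 1) {c : ℝ} (hc : 0 ≤ c)
    (hc1 : c ≠ 1) : c • (y * star z) ≠ 1 := fun h => hc1 <| by
  rw [← norm_smul_mul_star hy hz hc, h, norm_one]

theorem hasDerivAt_cauchy_pairing (hψ : IsSphereMeasure ψ) {f : ℍ[ℝ] → ℍ[ℝ]}
    {f' : ℍ[ℝ] → ℍ[ℝ] →L[ℝ] ℍ[ℝ]} (hf : IsMonogenic f f') {R : ℝ} (hR : 0 ≤ R) {z : ℍ[ℝ]}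
    (hz : ‖z‖ = 1) {s : ℝ} (hs0 : 0 < s) (hs1 : s < 1) (hsR : s ≠ R) :
    HasDerivAt (fun s => ∫ y, f (s • y) * cauchyKernel ((R / s) • (y * star z)) ∂ψ) 0 s := by
  have := hψ.isProbabilityMeasure
  have hsy : ∀ s : ℝ, 0 < s → s < 1 → ∀ y : ℍ[ℝ], ‖y‖ = 1 → ‖s • y‖ < 1 :=
    fun s hs0 hs y hy => by rwa [norm_smul, hy, mul_one, Real.norm_of_nonneg hs0.le]
  have hcy : ∀ s : ℝ, 0 < s → s ≠ R → ∀ y : ℍ[ℝ], ‖y‖ = 1 → (R / s) • (y * star z) ≠ 1 :=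
    fun s hs0 hsR y hy => smul_mul_star_ne_one hy hz (by positivity) fun h => hsR <| by
      rw [div_eq_one_iff_eq hs0.ne'] at h; exact h.symm
  let F : ℝ → ℍ[ℝ] → ℍ[ℝ] := fun s y => f (s • y) * cauchyKernel ((R / s) • (y * star z))
  let F' : ℝ → ℍ[ℝ] → ℍ[ℝ] := fun s y => f (s • y) * cauchyKernelDeriv ((R / s) • (y * star z))
      ((-(R / s ^ 2)) • (y * star z)) + f' (s • y) y * cauchyKernel ((R / s) • (y * star z))
  let U : Set ℝ := Set.Ioo 0 1 ∩ {R}ᶜ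
  have hU : IsOpen U := isOpen_Ioo.inter isOpen_compl_singleton
  have hU0 : ContinuousOn (fun q : ℝ × ℍ[ℝ] => R / q.1) (U ×ˢ sphere 0 1) :=
    continuousOn_const.div continuousOn_fst fun q hq => hq.1.1.1.ne'
  have hU0' : ContinuousOn (fun q : ℝ × ℍ[ℝ] => -(R / q.1 ^ 2)) (U ×ˢ sphere 0 1) :=
    (continuousOn_const.div (continuousOn_fst.pow 2) fun q hq => pow_ne_zero 2 hq.1.1.1.ne').neg
  have hx : ContinuousOn (fun q : ℝ × ℍ[ℝ] => (R / q.1) • (q.2 * star z)) (U ×ˢ sphere 0 1) :=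
    hU0.smul (by fun_prop)
  have hx' : ContinuousOn (fun q : ℝ × ℍ[ℝ] => (-(R / q.1 ^ 2)) • (q.2 * star z))
    (U ×ˢ sphere 0 1) := hU0'.smul (by fun_prop)
  have hxm : Set.MapsTo (fun q : ℝ × ℍ[ℝ] => (R / q.1) • (q.2 * star z)) (U ×ˢ sphere 0 1) {1}ᶜ :=
    fun q hq => hcy _ hq.1.1.1 hq.1.2 _ (mem_sphere_zero_iff_norm.1 hq.2)
  have hw : ContinuousOn (fun q : ℝ × ℍ[ℝ] => q.1 • q.2) (U ×ˢ sphere 0 1) := by fun_prop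
  have hwm : Set.MapsTo (fun q : ℝ × ℍ[ℝ] => q.1 • q.2) (U ×ˢ sphere 0 1) (ball 0 1) :=
    fun q hq => mem_ball_zero_iff.2
      (hsy _ hq.1.1.1 hq.1.1.2 _ (mem_sphere_zero_iff_norm.1 hq.2))
  have hFc : ContinuousOn (Function.uncurry F) (U ×ˢ sphere 0 1) :=
    (hf.continuousOn.comp hw hwm).mul (continuousOn_cauchyKernel.comp hx hxm)
  have hF'c : ContinuousOn (Function.uncurry F') (U ×ˢ sphere 0 1) :=
    ((hf.continuousOn.comp hw hwm).mul
      ((continuousOn_cauchyKernelDeriv.comp hx hxm).clm_apply hx')).add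
    (((hf.continuousOn_deriv.comp hw hwm).clm_apply continuousOn_snd).mul
      (continuousOn_cauchyKernel.comp hx hxm))
  have hder := hasDerivAt_integral_sphere hψ.ae_norm (F := F) (F' := F') hU ?_
    (fun s hs => hFc.comp (f := fun y => (s, y)) (by fun_prop) fun y hy => ⟨hs, hy⟩) hF'c
    (s := s) ⟨⟨hs0, hs1⟩, hsR⟩
  · suffices h0 : ∫ y, F' s y ∂ψ = 0 by
      rw [h0] at hder
      exact hder
    have hk := integral_mul_cauchyKernel_by_parts hψ hf hs0 hs1 (c := R / s) (by positivity)
      (fun h => hsR (by rw [div_eq_one_iff_eq hs0.ne'] at h; exact h.symm)) hz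
    have hsum := integral_finsetSum (μ := ψ) Finset.univ (fun k _ => (hk k).1)
    rw [Finset.sum_eq_zero fun k _ => (hk k).2] at hsum
    rw [← smul_zero (-s⁻¹ : ℝ), ← hsum, ← integral_smul]
    refine integral_congr_ae ?_
    filter_upwards [hψ.ae_norm] with y hy
    have h1 := hf.apply_self_eq (hsy s hs0 hs1 y hy) y
    have h2 := cauchyKernelDeriv_self ((R / s) • (y * star z))
    have h3 : ∀ k, (R / s) • (qe k * y * star z) = qe k * ((R / s) • (y * star z)) := fun k => by
      rw [mul_smul_comm, mul_assoc]
    have h4 : -(R / s ^ 2) = (-s⁻¹) * (R / s) := by field_simp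
    simp only [F', h3, h4, Finset.sum_add_distrib, ← Finset.mul_sum, ← h2, mul_smul (-s⁻¹) (R / s),
      map_smul (cauchyKernelDeriv _) (-s⁻¹), map_smul (f' _) s]
    simp only [← mul_assoc, smul_mul_assoc, ← Finset.sum_mul, ← Finset.smul_sum, h1, smul_add,
      smul_smul, mul_smul_comm]
    rw [neg_mul s⁻¹ s, inv_mul_cancel₀ hs0.ne']
    simp
  · intro t ht y hy
    have h1 : HasDerivAt (fun t : ℝ => f (t • y)) (f' (t • y) y) t := by
      have h := (hf.hasFDerivAt _ (hsy t ht.1.1 ht.1.2 y hy)).comp_hasDerivAt t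
        ((hasDerivAt_id t).smul_const y)
      rw [one_smul] at h
      exact h
    have h2 : HasDerivAt (fun t : ℝ => cauchyKernel ((R / t) • (y * star z)))
        (cauchyKernelDeriv ((R / t) • (y * star z)) ((-(R / t ^ 2)) • (y * star z))) t := by
      have h0 : HasDerivAt (fun t : ℝ => R / t) (-(R / t ^ 2)) t := by
        have h := (hasDerivAt_inv ht.1.1.ne').const_mul R
        simpa [div_eq_mul_inv] using h
      exact (hasFDerivAt_cauchyKernel (hcy t ht.1.1 ht.2 y hy)).comp_hasDerivAt t
        (h0.smul_const (y * star z))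
    have h := h1.mul h2
    rw [add_comm] at h
    exact h

end

section

variable {ψ : Measure ℍ[ℝ]}

theorem cauchy_pairing_eq (hψ : IsSphereMeasure ψ) {f : ℍ[ℝ] → ℍ[ℝ]}
    {f' : ℍ[ℝ] → ℍ[ℝ] →L[ℝ] ℍ[ℝ]} (hf : IsMonogenic f f') {R : ℝ} (hR : 0 ≤ R) {z : ℍ[ℝ]}
    (hz : ‖z‖ = 1) {a b s t : ℝ} (ha : 0 ≤ a) (hb : b ≤ 1) (hab : R ∉ Set.Ioo a b)
    (hs : s ∈ Set.Ioo a b) (ht : t ∈ Set.Ioo a b) :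
    ∫ y, f (s • y) * cauchyKernel ((R / s) • (y * star z)) ∂ψ =
      ∫ y, f (t • y) * cauchyKernel ((R / t) • (y * star z)) ∂ψ := by
  have h : ∀ s ∈ Set.Ioo a b, HasDerivAt
      (fun s => ∫ y, f (s • y) * cauchyKernel ((R / s) • (y * star z)) ∂ψ) 0 s := fun s hs =>
    hasDerivAt_cauchy_pairing hψ hf hR hz (ha.trans_lt hs.1) (hs.2.trans_le hb)
      fun h => hab (h ▸ hs)
  exact isOpen_Ioo.is_const_of_deriv_eq_zero (𝕜 := ℝ) isPreconnected_Ioo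
    (f := fun s => ∫ y, f (s • y) * cauchyKernel ((R / s) • (y * star z)) ∂ψ)
    (fun s hs => (h s hs).differentiableAt.differentiableWithinAt) (fun s hs => (h s hs).deriv)
    hs ht

theorem norm_cauchyKernel (x : ℍ[ℝ]) : ‖cauchyKernel x‖ = (‖1 - x‖ ^ 3)⁻¹ := by
  rw [cauchyKernel, norm_smul, norm_inv, norm_pow, norm_norm]
  rcases eq_or_ne ‖1 - x‖ 0 with h | h
  · simp [h]
  · field_simp

theorem IsMonogenic.exists_bound {f : ℍ[ℝ] → ℍ[ℝ]} {f' : ℍ[ℝ] → ℍ[ℝ] →L[ℝ] ℍ[ℝ]}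
    (hf : IsMonogenic f f') {s : ℝ} (hs : s < 1) : ∃ M, ∀ x : ℍ[ℝ], ‖x‖ ≤ s → ‖f x‖ ≤ M := by
  obtain ⟨M, hM⟩ := (isCompact_closedBall (0 : ℍ[ℝ]) s).exists_bound_of_continuousOn
    (hf.continuousOn.mono (closedBall_subset_ball hs))
  exact ⟨M, fun x hx => hM x (mem_closedBall_zero_iff.2 hx)⟩

theorem cauchy_pairing_eq_zero (hψ : IsSphereMeasure ψ) {f : ℍ[ℝ] → ℍ[ℝ]}
    {f' : ℍ[ℝ] → ℍ[ℝ] →L[ℝ] ℍ[ℝ]} (hf : IsMonogenic f f') {R : ℝ} {z : ℍ[ℝ]}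
    (hz : ‖z‖ = 1) {s : ℝ} (hs0 : 0 < s) (hs1 : s < 1) (hsR : s < R) :
    ∫ y, f (s • y) * cauchyKernel ((R / s) • (y * star z)) ∂ψ = 0 := by
  have := hψ.isProbabilityMeasure
  obtain ⟨M, hM⟩ := hf.exists_bound hs1
  have hM0 : 0 ≤ M := (norm_nonneg _).trans (hM 0 (by simpa using hs0.le))
  have hR : 0 < R := hs0.trans hsR
  have hb : ∀ t ∈ Set.Ioo 0 s,
      ‖∫ y, f (s • y) * cauchyKernel ((R / s) • (y * star z)) ∂ψ‖ ≤ M * (t / (R - t)) ^ 3 := by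
    intro t ht
    have htR : t < R := ht.2.trans hsR
    rw [cauchy_pairing_eq hψ hf hR.le hz (a := 0) (b := min R 1) le_rfl (min_le_right _ _)
      (fun h => (h.2.trans_le (min_le_left _ _)).false) ⟨hs0, lt_min hsR hs1⟩
      ⟨ht.1, lt_min htR (ht.2.trans hs1)⟩,
      ← mul_one (M * _), ← probReal_univ (μ := ψ)]
    refine norm_integral_le_of_norm_le_const ?_
    filter_upwards [hψ.ae_norm] with y hy
    rw [norm_mul, norm_cauchyKernel]
    have h1 : ‖t • y‖ ≤ s := by
      rw [norm_smul, hy, mul_one, Real.norm_of_nonneg ht.1.le]; exact ht.2.le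
    have h2 : R / t - 1 ≤ ‖1 - (R / t) • (y * star z)‖ := by
      have h := norm_sub_norm_le ((R / t) • (y * star z)) 1
      rw [norm_smul_mul_star hy hz (div_nonneg hR.le ht.1.le), norm_one, norm_sub_rev] at h
      exact h
    have h3 : t / (R - t) = (R / t - 1)⁻¹ := by
      have := ht.1.ne'
      have : R - t ≠ 0 := (sub_pos.2 htR).ne'
      field_simp
    have h4 : 0 < R / t - 1 := by
      rw [sub_pos, one_lt_div ht.1]; exact htR
    rw [h3, inv_pow]
    gcongr
    exact hM _ h1
  have hc : ContinuousAt (fun t : ℝ => M * (t / (R - t)) ^ 3) 0 :=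
    ((continuousAt_id.div (continuousAt_const.sub continuousAt_id) (by simpa using hR.ne')).pow
      3).const_mul M
  have hl : Filter.Tendsto (fun t : ℝ => M * (t / (R - t)) ^ 3) (nhdsWithin 0 (Set.Ioi 0))
      (nhds 0) := by
    have h := hc.tendsto.mono_left (nhdsWithin_le_nhds (s := Set.Ioi 0))
    simpa using h
  refine norm_le_zero_iff.1 (ge_of_tendsto hl ?_)
  filter_upwards [Ioo_mem_nhdsGT hs0] with t ht using hb t ht

/-- The Poisson kernel of the unit ball in dimension four. -/
noncomputable def spherePoisson (ρ : ℝ) (g : ℍ[ℝ]) : ℝ := (1 - ρ ^ 2) / ‖1 - ρ • g‖ ^ 4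

theorem spherePoisson_nonneg {ρ : ℝ} (h0 : 0 ≤ ρ) (h1 : ρ < 1) (g : ℍ[ℝ]) :
    0 ≤ spherePoisson ρ g :=
  div_nonneg (by nlinarith) (by positivity)

theorem cauchyKernel_sub_eq_spherePoisson {ρ : ℝ} (h0 : 0 < ρ) (h1 : ρ < 1) {g : ℍ[ℝ]}
    (hg : ‖g‖ = 1) :
    cauchyKernel (ρ • g) - (ρ ^ 2)⁻¹ • cauchyKernel (ρ⁻¹ • g) = spherePoisson ρ g • 1 := by
  have hn := norm_one_sub_smul_sq ρ hg
  have hn' := norm_one_sub_smul_sq ρ⁻¹ hg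
  have hD : ‖1 - ρ • g‖ ^ 2 ≠ 0 :=
    pow_ne_zero _ (norm_ne_zero_iff.2 (one_sub_smul_ne_zero h0.le h1 hg))
  have e : ‖1 - ρ⁻¹ • g‖ ^ 2 = ‖1 - ρ • g‖ ^ 2 / ρ ^ 2 := by
    rw [hn, hn']; field_simp; ring
  have e4 : ∀ x : ℝ, x ^ 4 = (x ^ 2) ^ 2 := fun x => by ring
  rw [cauchyKernel, cauchyKernel, spherePoisson, e4, e4, e]
  generalize ‖1 - ρ • g‖ ^ 2 = D at hD
  have h : ((D / ρ ^ 2) ^ 2)⁻¹ = ρ ^ 4 * (D ^ 2)⁻¹ := by field_simp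
  rw [h, smul_smul, smul_sub (_ : ℝ) (1 : ℍ[ℝ]) (ρ⁻¹ • g), smul_smul]
  have h2 : (ρ ^ 2)⁻¹ * (ρ ^ 4 * (D ^ 2)⁻¹) = ρ ^ 2 * (D ^ 2)⁻¹ := by field_simp
  have h3 : ρ ^ 2 * (D ^ 2)⁻¹ * ρ⁻¹ = ρ * (D ^ 2)⁻¹ := by field_simp
  rw [h2, h3, div_eq_mul_inv]
  module

theorem IsMonogenic.cauchy_pairing_eq_poisson (hψ : IsSphereMeasure ψ) {f : ℍ[ℝ] → ℍ[ℝ]}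
    {f' : ℍ[ℝ] → ℍ[ℝ] →L[ℝ] ℍ[ℝ]} (hf : IsMonogenic f f') {R : ℝ} (hR : 0 < R) {z : ℍ[ℝ]}
    (hz : ‖z‖ = 1) {s : ℝ} (hRs : R < s) (hs1 : s < 1) :
    ∫ y, f (s • y) * cauchyKernel ((R / s) • (y * star z)) ∂ψ =
      ∫ y, spherePoisson (R / s) (y * star z) • f (s • y) ∂ψ := by
  have := hψ.isProbabilityMeasure
  have hs0 : 0 < s := hR.trans hRs
  have hfc : ContinuousOn (fun y : ℍ[ℝ] => f (s • y)) (sphere 0 1) :=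
    hf.continuousOn.comp (f := fun y : ℍ[ℝ] => s • y) (by fun_prop) fun y hy => by
      rwa [mem_ball_zero_iff, norm_smul, mem_sphere_zero_iff_norm.1 hy, mul_one,
        Real.norm_of_nonneg hs0.le]
  have hi : ∀ c : ℝ, 0 ≤ c → c ≠ 1 →
      Integrable (fun y => f (s • y) * cauchyKernel (c • (y * star z))) ψ := fun c hc hc1 => by
    refine integrable_of_continuousOn_sphere hψ.ae_norm (hfc.mul
      (continuousOn_cauchyKernel.comp (f := fun y => c • (y * star z)) (by fun_prop)
        fun y hy => ?_))
    exact smul_mul_star_ne_one (mem_sphere_zero_iff_norm.1 hy) hz hc hc1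
  have hρ0 : 0 < R / s := by positivity
  have hρ1 : R / s < 1 := (div_lt_one hs0).2 hRs
  have h0 := cauchy_pairing_eq_zero hψ hf hz (R := s ^ 2 / R) hs0 hs1
    (by rw [lt_div_iff₀ hR]; nlinarith)
  have e : s ^ 2 / R / s = (R / s)⁻¹ := by field_simp
  rw [e] at h0
  have hI := integral_sub (hi (R / s) hρ0.le hρ1.ne)
    ((hi (R / s)⁻¹ (inv_nonneg.2 hρ0.le) (one_lt_inv₀ hρ0 |>.2 hρ1).ne').smul ((R / s) ^ 2)⁻¹)
  simp only [Pi.smul_apply] at hI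
  rw [integral_smul, h0, smul_zero, sub_zero] at hI
  rw [← hI]
  refine integral_congr_ae ?_
  filter_upwards [hψ.ae_norm] with y hy
  have hg : ‖y * star z‖ = 1 := by rw [norm_mul_star_of_norm_eq_one hy, hz]
  change f (s • y) * _ - _ • (f (s • y) * _) = _
  rw [← mul_smul_comm ((R / s) ^ 2)⁻¹ (f (s • y)), ← mul_sub, cauchyKernel_sub_eq_spherePoisson hρ0 hρ1 hg, mul_smul_comm,
    mul_one]

end

section

variable {ψ : Measure ℍ[ℝ]}

theorem continuousOn_spherePoisson {ρ : ℝ} (h0 : 0 ≤ ρ) (h1 : ρ < 1) :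
    ContinuousOn (spherePoisson ρ) (sphere 0 1) := by
  refine ContinuousOn.div continuousOn_const (by fun_prop) fun g hg => ?_
  exact pow_ne_zero _ (norm_ne_zero_iff.2
    (one_sub_smul_ne_zero h0 h1 (mem_sphere_zero_iff_norm.1 hg)))

theorem mapsTo_mul_star {z : ℍ[ℝ]} (hz : ‖z‖ = 1) :
    Set.MapsTo (fun y : ℍ[ℝ] => y * star z) (sphere 0 1) (sphere 0 1) := fun y hy => by
  rw [mem_sphere_zero_iff_norm] at hy ⊢
  rw [norm_mul_star_of_norm_eq_one hy, hz]

theorem integral_cauchyKernel_eq_one (hψ : IsSphereMeasure ψ) {ρ : ℝ} (h0 : 0 < ρ) (h1 : ρ < 1)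
    {z : ℍ[ℝ]} (hz : ‖z‖ = 1) : ∫ y, cauchyKernel (ρ • (y * star z)) ∂ψ = 1 := by
  have := hψ.isProbabilityMeasure
  have hconst : ∀ t ∈ Set.Ioo 0 ρ, ∫ y, cauchyKernel (t • (y * star z)) ∂ψ =
      ∫ y, cauchyKernel (ρ • (y * star z)) ∂ψ := by
    intro t ht
    have hR : 0 < t / 2 := half_pos ht.1
    obtain ⟨s, hs1, hs2⟩ : ∃ s, t / 2 / ρ < s ∧ t / 2 / t < s ∧ s < 1 := by
      have : t / 2 / ρ < 1 / 2 := by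
        rw [div_lt_iff₀ h0]; linarith [ht.2]
      exact ⟨3 / 4, by linarith, by rw [div_div, mul_comm, ← div_div, div_self ht.1.ne']; norm_num,
        by norm_num⟩
    have hlt : t / 2 < t / 2 / ρ := by
      rw [lt_div_iff₀ h0]; nlinarith
    have ht1 : t < 1 := ht.2.trans h1
    have hlt' : t / 2 < t / 2 / t := by
      rw [lt_div_iff₀ ht.1]; nlinarith
    have h := cauchy_pairing_eq hψ isMonogenic_one hR.le hz (a := t / 2) (b := 1) hR.le le_rfl
      (fun h => h.1.false) (s := t / 2 / t) ⟨hlt', hs2.1.trans hs2.2⟩ (t := t / 2 / ρ)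
      ⟨hlt, hs1.trans hs2.2⟩
    have e1 : t / 2 / (t / 2 / t) = t := by field_simp [ht.1.ne']
    have e2 : t / 2 / (t / 2 / ρ) = ρ := by
      have := ht.1.ne'
      field_simp
    simpa only [one_mul, e1, e2] using h
  have hc : ContinuousOn (fun t : ℝ => ∫ y, cauchyKernel (t • (y * star z)) ∂ψ)
      (Set.Icc 0 (1 / 2)) := by
    refine continuousOn_integral_of_sphere hψ.ae_norm isCompact_Icc ?_
    refine continuousOn_cauchyKernel.comp (f := fun q : ℝ × ℍ[ℝ] => q.1 • (q.2 * star z))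
      (by fun_prop) fun q hq => ?_
    exact smul_mul_star_ne_one (mem_sphere_zero_iff_norm.1 hq.2) hz hq.1.1
      (hq.1.2.trans_lt (by norm_num)).ne
  have h00 : ∫ y, cauchyKernel ((0 : ℝ) • (y * star z)) ∂ψ = 1 := by
    simp [cauchyKernel]
  have h := (hc 0 ⟨le_rfl, by norm_num⟩).tendsto.mono_left
    (nhdsWithin_mono _ (fun x hx => ⟨hx.1.le, hx.2.le⟩ : Set.Ioo (0 : ℝ) (1 / 2) ⊆ Set.Icc 0 (1 / 2)))
  rw [nhdsWithin_Ioo_eq_nhdsGT (by norm_num), h00] at h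
  refine tendsto_nhds_unique (tendsto_const_nhds.congr' ?_) h
  filter_upwards [Ioo_mem_nhdsGT h0] with t ht using (hconst t ht).symm

theorem integral_spherePoisson_eq_one (hψ : IsSphereMeasure ψ) {ρ : ℝ} (h0 : 0 < ρ) (h1 : ρ < 1)
    {z : ℍ[ℝ]} (hz : ‖z‖ = 1) : ∫ y, spherePoisson ρ (y * star z) ∂ψ = 1 := by
  obtain ⟨s, hs, hs1⟩ := exists_between (h1)
  have hs0 := h0.trans hs
  have h := isMonogenic_one.cauchy_pairing_eq_poisson hψ (R := ρ * s) (by positivity) hz (s := s)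
    (by nlinarith) hs1
  have e : ρ * s / s = ρ := mul_div_cancel_right₀ _ hs0.ne'
  rw [e] at h
  simp only [one_mul] at h
  rw [integral_cauchyKernel_eq_one hψ h0 h1 hz, integral_smul_const] at h
  have := congrArg (fun q : ℍ[ℝ] => q.re) h
  simpa using this.symm

theorem norm_one_sub_smul_mul_star {y z : ℍ[ℝ]} (hy : ‖y‖ = 1) (hz : ‖z‖ = 1) {s R : ℝ}
    (hs : 0 < s) : ‖1 - (R / s) • (y * star z)‖ = ‖s • y - R • z‖ / s := by
  have h1 := norm_one_sub_smul_sq (R / s) (g := y * star z)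
    (by rw [norm_mul_star_of_norm_eq_one hy, hz])
  have h2 : ‖s • y - R • z‖ ^ 2 = s ^ 2 - 2 * s * R * (y * star z).re + R ^ 2 := by
    rw [norm_sub_sq_real, norm_smul, norm_smul, hy, hz, inner_smul_left, inner_smul_right,
      Quaternion.inner_def]
    simp
    ring
  refine (sq_eq_sq₀ (norm_nonneg _) (by positivity)).1 ?_
  generalize (y * star z).re = w at h1 h2
  rw [h1, div_pow ‖s • y - R • z‖, h2]
  field_simp

theorem IsMonogenic.eq_integral_spherePoisson (hψ : IsSphereMeasure ψ) {f : ℍ[ℝ] → ℍ[ℝ]}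
    {f' : ℍ[ℝ] → ℍ[ℝ] →L[ℝ] ℍ[ℝ]} (hf : IsMonogenic f f') {R : ℝ} (hR : 0 < R) {z : ℍ[ℝ]}
    (hz : ‖z‖ = 1) {s : ℝ} (hRs : R < s) (hs1 : s < 1) :
    f (R • z) = ∫ y, spherePoisson (R / s) (y * star z) • f (s • y) ∂ψ := by
  have := hψ.isProbabilityMeasure
  obtain ⟨M, hM⟩ := hf.exists_bound hs1
  have hfin : ∀ t ∈ Set.Ioo R s, ∫ y, spherePoisson (R / s) (y * star z) • f (s • y) ∂ψ =
      ∫ y, spherePoisson (R / t) (y * star z) • f (t • y) ∂ψ := fun t ht => by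
    rw [← hf.cauchy_pairing_eq_poisson hψ hR hz hRs hs1,
      ← hf.cauchy_pairing_eq_poisson hψ hR hz ht.1 (ht.2.trans hs1)]
    exact cauchy_pairing_eq hψ hf hR.le hz hR.le le_rfl (fun h => h.1.false) ⟨hRs, hs1⟩
      ⟨ht.1, ht.2.trans hs1⟩
  have huc : UniformContinuousOn f (closedBall 0 s) :=
    (isCompact_closedBall _ _).uniformContinuousOn_of_continuous
      (hf.continuousOn.mono (closedBall_subset_ball hs1))
  refine (sub_eq_zero.1 (norm_le_zero_iff.1 (le_of_forall_pos_le_add fun ε hε => ?_))).symm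
  rw [zero_add]
  obtain ⟨δ, hδ, hfδ⟩ := Metric.uniformContinuousOn_iff.1 huc ε hε
  have hb : ∀ t ∈ Set.Ioo R s,
      ‖(∫ y, spherePoisson (R / s) (y * star z) • f (s • y) ∂ψ) - f (R • z)‖ ≤
        ε + (1 - (R / t) ^ 2) / δ ^ 4 * (2 * M) := by
    intro t ht
    have ht0 : 0 < t := hR.trans ht.1
    have ht1 : t < 1 := ht.2.trans hs1
    have hρ0 : 0 < R / t := by positivity
    have hρ1 : R / t < 1 := (div_lt_one ht0).2 ht.1
    have hnt : ∀ y : ℍ[ℝ], ‖y‖ = 1 → ‖t • y‖ ≤ s := fun y hy => by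
      rw [norm_smul, hy, mul_one, Real.norm_of_nonneg ht0.le]; exact ht.2.le
    have hnR : ‖R • z‖ ≤ s := by
      rw [norm_smul, hz, mul_one, Real.norm_of_nonneg hR.le]; exact hRs.le
    have hPc : ContinuousOn (fun y => spherePoisson (R / t) (y * star z)) (sphere 0 1) :=
      (continuousOn_spherePoisson hρ0.le hρ1).comp (by fun_prop) (mapsTo_mul_star hz)
    have hPi := integrable_of_continuousOn_sphere hψ.ae_norm hPc
    have hfc : ContinuousOn (fun y : ℍ[ℝ] => f (t • y)) (sphere 0 1) :=
      hf.continuousOn.comp (f := fun y : ℍ[ℝ] => t • y) (by fun_prop) fun y hy =>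
        mem_ball_zero_iff.2 ((hnt y (mem_sphere_zero_iff_norm.1 hy)).trans_lt hs1)
    have hi1 : Integrable (fun y => spherePoisson (R / t) (y * star z) • f (t • y)) ψ :=
      integrable_of_continuousOn_sphere hψ.ae_norm (hPc.smul hfc)
    have e : (∫ y, spherePoisson (R / t) (y * star z) • f (t • y) ∂ψ) - f (R • z) =
        ∫ y, spherePoisson (R / t) (y * star z) • (f (t • y) - f (R • z)) ∂ψ := by
      simp only [smul_sub]
      rw [integral_sub hi1 (hPi.smul_const _), integral_smul_const,
        integral_spherePoisson_eq_one hψ hρ0 hρ1 hz, one_smul]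
    rw [hfin t ht, e]
    refine (norm_integral_le_of_norm_le (g := fun y => spherePoisson (R / t) (y * star z) * ε +
      (1 - (R / t) ^ 2) / δ ^ 4 * (2 * M)) ((hPi.mul_const ε).add (integrable_const _)) ?_).trans ?_
    · filter_upwards [hψ.ae_norm] with y hy
      have hP0 := spherePoisson_nonneg hρ0.le hρ1 (y * star z)
      have hM0 : 0 ≤ M := (norm_nonneg _).trans (hM _ hnR)
      have hρ2 : 0 ≤ 1 - (R / t) ^ 2 := by nlinarith
      rw [norm_smul, Real.norm_of_nonneg hP0]
      rcases lt_or_ge (dist (t • y) (R • z)) δ with h | h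
      · have h1 := (hfδ (t • y) (mem_closedBall_zero_iff.2 (hnt y hy)) (R • z)
          (mem_closedBall_zero_iff.2 hnR) h).le
        rw [dist_eq_norm] at h1
        exact (mul_le_mul_of_nonneg_left h1 hP0).trans (le_add_of_nonneg_right (by positivity))
      · have h1 : ‖f (t • y) - f (R • z)‖ ≤ 2 * M :=
          (norm_sub_le _ _).trans (by linarith [hM _ (hnt y hy), hM _ hnR])
        have h2 : spherePoisson (R / t) (y * star z) ≤ (1 - (R / t) ^ 2) / δ ^ 4 := by
          rw [dist_eq_norm] at h
          rw [spherePoisson, norm_one_sub_smul_mul_star hy hz ht0]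
          gcongr
          rw [le_div_iff₀ ht0]
          nlinarith
        exact (mul_le_mul h2 h1 (norm_nonneg _) (by positivity)).trans
          (le_add_of_nonneg_left (by positivity))
    · rw [integral_add (hPi.mul_const ε) (integrable_const _), integral_mul_const,
        integral_spherePoisson_eq_one hψ hρ0 hρ1 hz]
      simp
  have hc : ContinuousAt (fun t : ℝ => ε + (1 - (R / t) ^ 2) / δ ^ 4 * (2 * M)) R := by
    refine continuousAt_const.add (ContinuousAt.mul_const (ContinuousAt.div_const
      (continuousAt_const.sub ((continuousAt_const.div continuousAt_id hR.ne').pow 2)) _) _)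
  have hl := hc.tendsto.mono_left (nhdsWithin_le_nhds (s := Set.Ioi R))
  rw [div_self hR.ne', one_pow, sub_self, zero_div, zero_mul, add_zero] at hl
  refine ge_of_tendsto hl ?_
  filter_upwards [Ioo_mem_nhdsGT hRs] with t ht using hb t ht

theorem IsMonogenic.eq_cauchy_integral (hψ : IsSphereMeasure ψ) {f : ℍ[ℝ] → ℍ[ℝ]}
    {f' : ℍ[ℝ] → ℍ[ℝ] →L[ℝ] ℍ[ℝ]} (hf : IsMonogenic f f') {R : ℝ} (hR : 0 < R) {z : ℍ[ℝ]}
    (hz : ‖z‖ = 1) {s : ℝ} (hRs : R < s) (hs1 : s < 1) :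
    f (R • z) = ∫ y, f (s • y) * cauchyKernel ((R / s) • (y * star z)) ∂ψ := by
  rw [hf.eq_integral_spherePoisson hψ hR hz hRs hs1,
    hf.cauchy_pairing_eq_poisson hψ hR hz hRs hs1]

end

section

variable {ψ : Measure ℍ[ℝ]}

theorem rpow_norm_midpoint_lt {E : Type*} [NormedAddCommGroup E] [NormedSpace ℝ E]
    [StrictConvexSpace ℝ E] {p : ℝ} (hp : 1 < p) {a b : E} (hab : a ≠ b) :
    ‖(1 / 2 : ℝ) • (a + b)‖ ^ p < (‖a‖ ^ p + ‖b‖ ^ p) / 2 := by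
  have hp0 : 0 < p := by linarith
  rcases eq_or_ne ‖a‖ ‖b‖ with h | h
  · have h1 := (norm_midpoint_lt_iff h).2 hab
    have h2 := Real.rpow_lt_rpow (norm_nonneg _) h1 hp0
    rw [← h]
    linarith
  · have h1 := (strictConvexOn_rpow hp).2 (norm_nonneg a) (norm_nonneg b) h
      (show (0 : ℝ) < 1 / 2 by norm_num) (show (0 : ℝ) < 1 / 2 by norm_num) (by norm_num)
    simp only [smul_eq_mul] at h1
    have h2 : ‖(1 / 2 : ℝ) • (a + b)‖ ≤ 1 / 2 * ‖a‖ + 1 / 2 * ‖b‖ := by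
      rw [norm_smul, Real.norm_of_nonneg (by norm_num)]
      linarith [norm_add_le a b]
    have h3 := Real.rpow_le_rpow (norm_nonneg _) h2 hp0.le
    linarith

theorem exists_rpow_norm_sub_le {E : Type*} [NormedAddCommGroup E] [NormedSpace ℝ E]
    [StrictConvexSpace ℝ E] [ProperSpace E] {p : ℝ} (hp : 1 < p) {δ : ℝ} (hδ : 0 < δ) :
    ∃ C, 0 ≤ C ∧ ∀ a b : E, ‖a - b‖ ^ p ≤ δ * (‖a‖ ^ p + ‖b‖ ^ p) +
      C * ((‖a‖ ^ p + ‖b‖ ^ p) / 2 - ‖(1 / 2 : ℝ) • (a + b)‖ ^ p) := by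
  have hp0 : 0 < p := by linarith
  have hc : ∀ f : E × E → E, Continuous f → Continuous fun x => ‖f x‖ ^ p := fun f hf =>
    hf.norm.rpow_const fun _ => Or.inr hp0.le
  have hg : Continuous fun x : E × E =>
      (‖x.1‖ ^ p + ‖x.2‖ ^ p) / 2 - ‖(1 / 2 : ℝ) • (x.1 + x.2)‖ ^ p :=
    (((hc _ continuous_fst).add (hc _ continuous_snd)).div_const 2).sub (hc _ (by fun_prop))
  have hK : IsCompact (sphere (0 : E × E) 1 ∩
      {x | δ * (‖x.1‖ ^ p + ‖x.2‖ ^ p) ≤ ‖x.1 - x.2‖ ^ p}) :=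
    (isCompact_sphere _ _).inter_right (isClosed_le
      (((hc _ continuous_fst).add (hc _ continuous_snd)).const_mul δ) (hc _ (by fun_prop)))
  obtain ⟨c, hc0, hc⟩ := hK.exists_forall_le' hg.continuousOn (a := 0) (fun x hx => by
    rw [sub_pos]
    refine rpow_norm_midpoint_lt hp fun h => ?_
    have h1 := hx.2
    rw [Set.mem_ofPred_eq, h, sub_self, norm_zero, Real.zero_rpow hp0.ne'] at h1
    have h2 : ‖x.2‖ ^ p ≤ 0 := by
      have := Real.rpow_nonneg (norm_nonneg x.2) p
      nlinarith
    have h3 : x.2 = 0 := by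
      by_contra h3
      exact absurd h2 (Real.rpow_pos_of_pos (norm_pos_iff.2 h3) p).not_ge
    have h4 : x = 0 := Prod.ext (h.trans h3) h3
    have h5 := mem_sphere_zero_iff_norm.1 hx.1
    simp [h4] at h5)
  have hunit : ∀ x : E × E, ‖x‖ = 1 → ‖x.1 - x.2‖ ^ p ≤ δ * (‖x.1‖ ^ p + ‖x.2‖ ^ p) +
      2 ^ p / c * ((‖x.1‖ ^ p + ‖x.2‖ ^ p) / 2 - ‖(1 / 2 : ℝ) • (x.1 + x.2)‖ ^ p) := by
    intro x hx
    rcases le_or_gt (δ * (‖x.1‖ ^ p + ‖x.2‖ ^ p)) (‖x.1 - x.2‖ ^ p) with h | h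
    · have h1 := hc x ⟨mem_sphere_zero_iff_norm.2 hx, h⟩
      have h2 : ‖x.1 - x.2‖ ^ p ≤ 2 ^ p := by
        refine Real.rpow_le_rpow (norm_nonneg _) ?_ hp0.le
        have := norm_fst_le x
        have := norm_snd_le x
        linarith [norm_sub_le x.1 x.2]
      have h3 : 2 ^ p ≤ 2 ^ p / c *
          ((‖x.1‖ ^ p + ‖x.2‖ ^ p) / 2 - ‖(1 / 2 : ℝ) • (x.1 + x.2)‖ ^ p) := by
        rw [div_mul_eq_mul_div, le_div_iff₀ hc0]
        gcongr
      have : 0 ≤ δ * (‖x.1‖ ^ p + ‖x.2‖ ^ p) := by positivity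
      linarith
    · have h1 : 0 ≤ (‖x.1‖ ^ p + ‖x.2‖ ^ p) / 2 - ‖(1 / 2 : ℝ) • (x.1 + x.2)‖ ^ p := by
        rcases eq_or_ne x.1 x.2 with h | h
        · rw [h, ← two_smul ℝ x.2, smul_smul]; norm_num
        · exact (sub_pos.2 (rpow_norm_midpoint_lt hp h)).le
      have : 0 ≤ 2 ^ p / c *
          ((‖x.1‖ ^ p + ‖x.2‖ ^ p) / 2 - ‖(1 / 2 : ℝ) • (x.1 + x.2)‖ ^ p) := by positivity
      linarith
  refine ⟨2 ^ p / c, by positivity, fun a b => ?_⟩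
  rcases eq_or_ne (a, b) (0 : E × E) with h | h
  · rw [Prod.mk_eq_zero] at h
    simp [h.1, h.2, Real.zero_rpow hp0.ne']
  · have ht : 0 < ‖(a, b)‖ := norm_pos_iff.2 h
    set t := ‖(a, b)‖ with htd
    have h1 := hunit (t⁻¹ • (a, b)) (by
      rw [norm_smul, norm_inv, norm_norm, ← htd, inv_mul_cancel₀ ht.ne'])
    have hs : ∀ w : E, ‖t⁻¹ • w‖ ^ p = (t ^ p)⁻¹ * ‖w‖ ^ p := fun w => by
      rw [norm_smul, norm_inv, Real.norm_of_nonneg ht.le,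
        Real.mul_rpow (by positivity) (norm_nonneg _), Real.inv_rpow ht.le]
    simp only [Prod.smul_fst, Prod.smul_snd, ← smul_sub, ← smul_add, smul_comm (1 / 2 : ℝ) t⁻¹,
      hs] at h1
    have htp : 0 < (t ^ p)⁻¹ := by positivity
    refine le_of_mul_le_mul_left ?_ htp
    linarith

end

section

variable {ψ : Measure ℍ[ℝ]}

theorem integral_comp_mul_right (hψ : IsSphereMeasure ψ) {E : Type*} [NormedAddCommGroup E]
    [NormedSpace ℝ E] {F : ℍ[ℝ] → E} (hF : ContinuousOn F (sphere 0 1)) {z : ℍ[ℝ]}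
    (hz : ‖z‖ = 1) : ∫ g, F (g * z) ∂ψ = ∫ y, F y ∂ψ :=
  have := hψ.isProbabilityMeasure
  integral_comp_measurePreserving hψ.ae_norm (hψ.measurePreserving (mulRightIsometry z hz)) hF

theorem integral_rpow_norm_spherePoisson_le (hψ : IsSphereMeasure ψ) {p : ℝ} (hp : 1 < p)
    {f : ℍ[ℝ] → ℍ[ℝ]} (hf : ContinuousOn f (sphere 0 1)) {ρ : ℝ} (h0 : 0 < ρ) (h1 : ρ < 1) :
    ∫ z, ‖∫ y, spherePoisson ρ (y * star z) • f y ∂ψ‖ ^ p ∂ψ ≤ ∫ z, ‖f z‖ ^ p ∂ψ := by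
  have hP := continuousOn_spherePoisson h0.le h1
  have h := integral_rpow_norm_real_multiplier_le hψ hp hf hP
  have hmass : ∫ g, |spherePoisson ρ g| ∂ψ = 1 := by
    simp only [abs_of_nonneg (spherePoisson_nonneg h0.le h1 _)]
    simpa using integral_spherePoisson_eq_one hψ h0 h1 (z := 1) norm_one
  rw [hmass, Real.one_rpow, one_mul] at h
  refine le_trans (le_of_eq (integral_congr_ae ?_)) h
  filter_upwards [hψ.ae_norm] with z hz
  have h2 := integral_comp_mul_right hψ (F := fun y => spherePoisson ρ (y * star z) • f y)
    ((hP.comp (f := fun y => y * star z) (by fun_prop) (mapsTo_mul_star hz)).smul hf) hz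
  simp only [mul_assoc, self_mul_star_of_norm_eq_one hz, mul_one] at h2
  simp only [h2]

theorem IsMonogenic.continuousOn_smul {f : ℍ[ℝ] → ℍ[ℝ]} {f' : ℍ[ℝ] → ℍ[ℝ] →L[ℝ] ℍ[ℝ]}
    (hf : IsMonogenic f f') {r : ℝ} (h0 : 0 ≤ r) (h1 : r < 1) :
    ContinuousOn (fun y : ℍ[ℝ] => f (r • y)) (sphere 0 1) :=
  hf.continuousOn.comp (f := fun y : ℍ[ℝ] => r • y) (by fun_prop) fun y hy => by
    rwa [mem_ball_zero_iff, norm_smul, mem_sphere_zero_iff_norm.1 hy, mul_one,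
      Real.norm_of_nonneg h0]

theorem IsMonogenic.integral_rpow_norm_add_le (hψ : IsSphereMeasure ψ) {p : ℝ} (hp : 1 < p)
    {f : ℍ[ℝ] → ℍ[ℝ]} {f' : ℍ[ℝ] → ℍ[ℝ] →L[ℝ] ℍ[ℝ]} (hf : IsMonogenic f f') {r s t : ℝ}
    (hr : 0 < r) (hrs : r < s) (hs : s < 1) (ht0 : 0 < t) (ht : t < 1) :
    ∫ z, ‖(1 / 2 : ℝ) • (f (r • z) + f ((t / s * r) • z))‖ ^ p ∂ψ ≤
      ∫ z, ‖(1 / 2 : ℝ) • (f (s • z) + f (t • z))‖ ^ p ∂ψ := by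
  have := hψ.isProbabilityMeasure
  have hs0 : 0 < s := hr.trans hrs
  have hρ0 : 0 < r / s := by positivity
  have hρ1 : r / s < 1 := (div_lt_one hs0).2 hrs
  have hc1 := hf.continuousOn_smul hs0.le hs
  have hc2 := hf.continuousOn_smul ht0.le ht
  refine le_trans (le_of_eq (integral_congr_ae ?_)) (integral_rpow_norm_spherePoisson_le hψ hp
    ((hc1.add hc2).const_smul (1 / 2 : ℝ)) hρ0 hρ1)
  filter_upwards [hψ.ae_norm] with z hz
  have hP : ContinuousOn (fun y => spherePoisson (r / s) (y * star z)) (sphere 0 1) :=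
    (continuousOn_spherePoisson hρ0.le hρ1).comp (by fun_prop) (mapsTo_mul_star hz)
  have h1 := hf.eq_integral_spherePoisson hψ hr hz hrs hs
  have h2 := hf.eq_integral_spherePoisson hψ (R := t / s * r) (by positivity) hz (s := t)
    (by rw [div_mul_eq_mul_div, div_lt_iff₀ hs0]; nlinarith) ht
  have e : t / s * r / t = r / s := by field_simp
  rw [e] at h2
  have hi1 : Integrable (fun y => spherePoisson (r / s) (y * star z) • f (s • y)) ψ :=
    integrable_of_continuousOn_sphere hψ.ae_norm (hP.smul hc1)
  have hi2 : Integrable (fun y => spherePoisson (r / s) (y * star z) • f (t • y)) ψ :=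
    integrable_of_continuousOn_sphere hψ.ae_norm (hP.smul hc2)
  rw [h1, h2, ← integral_add hi1 hi2, ← integral_smul]
  congr 3
  ext1 y
  rw [← smul_add, smul_comm]
  rfl

theorem IsMonogenic.exists_integral_rpow_norm_sub_le (hψ : IsSphereMeasure ψ) {p : ℝ} (hp : 1 < p)
    {f : ℍ[ℝ] → ℍ[ℝ]} {f' : ℍ[ℝ] → ℍ[ℝ] →L[ℝ] ℍ[ℝ]} (hf : IsMonogenic f f') {A : ℝ}
    (hA : ∀ r : ℝ, 0 < r → r < 1 → ∫ y, ‖f (r • y)‖ ^ p ∂ψ ≤ A) {ε : ℝ} (hε : 0 < ε) :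
    ∃ r₀ < (1 : ℝ), ∀ s t : ℝ, r₀ < s → s ≤ t → t < 1 → ∫ y, ‖f (s • y) - f (t • y)‖ ^ p ∂ψ ≤ ε := by
  have := hψ.isProbabilityMeasure
  have hp0 : 0 < p := by linarith
  have hA0 : 0 ≤ A := (integral_nonneg fun y => by positivity).trans (hA (1 / 2) (by norm_num)
    (by norm_num))
  obtain ⟨C, hC0, hC⟩ := exists_rpow_norm_sub_le (E := ℍ[ℝ]) hp
    (δ := ε / (4 * (A + 1))) (by positivity)
  have hη : 0 < ε / (2 * (C + 1)) := by positivity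
  let S : Set ℝ := (fun r : ℝ => ∫ y, ‖f (r • y)‖ ^ p ∂ψ) '' Set.Ioo 0 1
  have hSb : BddAbove S := ⟨A, by rintro _ ⟨r, hr, rfl⟩; exact hA r hr.1 hr.2⟩
  have hSn : S.Nonempty := ⟨_, 1 / 2, ⟨by norm_num, by norm_num⟩, rfl⟩
  obtain ⟨_, ⟨r, hr, rfl⟩, hrS⟩ := exists_lt_of_lt_csSup hSn (sub_lt_self (sSup S) hη)
  have hle : ∀ r : ℝ, 0 < r → r < 1 → ∫ y, ‖f (r • y)‖ ^ p ∂ψ ≤ sSup S := fun r h0 h1 =>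
    le_csSup hSb ⟨r, ⟨h0, h1⟩, rfl⟩
  have hSA : sSup S ≤ A := csSup_le hSn (by rintro _ ⟨r, hr, rfl⟩; exact hA r hr.1 hr.2)
  obtain ⟨r1, hr1, hr1'⟩ := exists_between hr.2
  have hm : ContinuousOn (fun τ : ℝ => ∫ z, ‖(1 / 2 : ℝ) • (f (r • z) + f ((τ * r) • z))‖ ^ p ∂ψ)
      (Set.Icc 1 (r1 / r)) := by
    refine continuousOn_integral_of_sphere hψ.ae_norm isCompact_Icc ?_
    refine continuousOn_rpow_norm (f := fun q : ℝ × ℍ[ℝ] =>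
      (1 / 2 : ℝ) • (f (r • q.2) + f ((q.1 * r) • q.2))) hp0.le ?_
    have hadd : ∀ {a b : ℝ × ℍ[ℝ] → ℍ[ℝ]} {s : Set (ℝ × ℍ[ℝ])}, ContinuousOn a s →
        ContinuousOn b s → ContinuousOn (fun q => (1 / 2 : ℝ) • (a q + b q)) s :=
      fun ha hb => (ha.add hb).const_smul (1 / 2 : ℝ)
    refine hadd (hf.continuousOn.comp (f := fun q : ℝ × ℍ[ℝ] => r • q.2) (by fun_prop)
      fun q hq => ?_) (hf.continuousOn.comp (f := fun q : ℝ × ℍ[ℝ] => (q.1 * r) • q.2)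
        (by fun_prop) fun q hq => ?_)
    · rw [mem_ball_zero_iff, norm_smul, mem_sphere_zero_iff_norm.1 hq.2, mul_one,
        Real.norm_of_nonneg hr.1.le]
      exact hr.2
    · rw [mem_ball_zero_iff, norm_smul, mem_sphere_zero_iff_norm.1 hq.2, mul_one,
        Real.norm_of_nonneg (mul_nonneg (zero_le_one.trans hq.1.1) hr.1.le)]
      exact ((le_div_iff₀ hr.1).1 hq.1.2).trans_lt hr1'
  have hq1 : 1 < r1 / r := (one_lt_div hr.1).2 hr1
  have hm1 : ∫ z, ‖(1 / 2 : ℝ) • (f (r • z) + f (((1 : ℝ) * r) • z))‖ ^ p ∂ψ =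
      ∫ z, ‖f (r • z)‖ ^ p ∂ψ := by
    congr 1
    ext1 z
    rw [one_mul, ← two_smul ℝ, smul_smul]
    norm_num
  have hev := (hm 1 ⟨le_rfl, hq1.le⟩).tendsto.eventually (lt_mem_nhds (hrS.trans_eq hm1.symm))
  obtain ⟨d, hd, hdm⟩ := Metric.mem_nhdsWithin_iff.1 hev
  refine ⟨max r (max (1 + d)⁻¹ (r1 / r)⁻¹), ?_, fun s t hs hst ht => ?_⟩
  · exact max_lt hr.2 (max_lt (inv_lt_one_of_one_lt₀ (by linarith)) (inv_lt_one_of_one_lt₀ hq1))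
  have hrs : r < s := (le_max_left _ _).trans_lt hs
  have hds : (1 + d)⁻¹ < s := ((le_max_left _ _).trans (le_max_right _ _)).trans_lt hs
  have hqs : (r1 / r)⁻¹ < s := ((le_max_right _ _).trans (le_max_right _ _)).trans_lt hs
  have hs0 : 0 < s := hr.1.trans hrs
  have hs1 : s < 1 := hst.trans_lt ht
  have ht0 : 0 < t := hs0.trans_le hst
  have hts1 : 1 ≤ t / s := (one_le_div hs0).2 hst
  have htsd : t / s < 1 + d := by
    rw [div_lt_iff₀ hs0]
    rw [inv_lt_iff_one_lt_mul₀ (by linarith)] at hds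
    linarith
  have htsq : t / s ≤ r1 / r := by
    rw [div_le_iff₀ hs0]
    rw [inv_lt_iff_one_lt_mul₀ (by linarith)] at hqs
    linarith
  have hlow : sSup S - ε / (2 * (C + 1)) < ∫ z, ‖(1 / 2 : ℝ) • (f (s • z) + f (t • z))‖ ^ p ∂ψ := by
    refine lt_of_lt_of_le ?_ (hf.integral_rpow_norm_add_le hψ hp hr.1 hrs hs1 ht0 ht)
    refine hdm ⟨?_, hts1, htsq⟩
    rw [mem_ball, Real.dist_eq, abs_of_nonneg (by linarith)]
    linarith
  have hc1 := hf.continuousOn_smul hs0.le hs1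
  have hc2 := hf.continuousOn_smul ht0.le ht
  have hI : ∀ {g : ℍ[ℝ] → ℍ[ℝ]}, ContinuousOn g (sphere 0 1) →
      Integrable (fun y => ‖g y‖ ^ p) ψ := fun hg =>
    integrable_of_continuousOn_sphere hψ.ae_norm (continuousOn_rpow_norm hp0.le hg)
  have hi1 := hI hc1
  have hi2 := hI hc2
  have hi3 := hI ((hc1.add hc2).const_smul (1 / 2 : ℝ))
  have hintg := integral_mono (hI (hc1.sub hc2)) (((hi1.add hi2).const_mul (ε / (4 * (A + 1)))).add
    ((((hi1.add hi2).div_const 2).sub hi3).const_mul C)) fun y => hC (f (s • y)) (f (t • y))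
  refine hintg.trans ?_
  have e1 : ∫ y, (ε / (4 * (A + 1)) * (‖f (s • y)‖ ^ p + ‖f (t • y)‖ ^ p) +
      C * ((‖f (s • y)‖ ^ p + ‖f (t • y)‖ ^ p) / 2 -
        ‖(1 / 2 : ℝ) • (f (s • y) + f (t • y))‖ ^ p)) ∂ψ =
      ε / (4 * (A + 1)) * (∫ y, ‖f (s • y)‖ ^ p ∂ψ + ∫ y, ‖f (t • y)‖ ^ p ∂ψ) +
      C * ((∫ y, ‖f (s • y)‖ ^ p ∂ψ + ∫ y, ‖f (t • y)‖ ^ p ∂ψ) / 2 -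
        ∫ y, ‖(1 / 2 : ℝ) • (f (s • y) + f (t • y))‖ ^ p ∂ψ) := by
    have j1 : Integrable (fun y => ‖f (s • y)‖ ^ p + ‖f (t • y)‖ ^ p) ψ := hi1.add hi2
    have j2 : Integrable (fun y => (‖f (s • y)‖ ^ p + ‖f (t • y)‖ ^ p) / 2) ψ := j1.div_const 2
    have j3 : Integrable (fun y => ‖(1 / 2 : ℝ) • (f (s • y) + f (t • y))‖ ^ p) ψ := hi3
    have j4 : Integrable (fun y => (‖f (s • y)‖ ^ p + ‖f (t • y)‖ ^ p) / 2 -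
      ‖(1 / 2 : ℝ) • (f (s • y) + f (t • y))‖ ^ p) ψ := j2.sub j3
    rw [integral_add (j1.const_mul _) (j4.const_mul C), integral_const_mul,
      integral_const_mul, integral_sub j2 j3, integral_div, integral_add hi1 hi2]
  have h1 := hle s hs0 hs1
  have h2 := hle t ht0 ht
  refine e1.le.trans ?_
  have k1 : ε / (4 * (A + 1)) * (∫ y, ‖f (s • y)‖ ^ p ∂ψ + ∫ y, ‖f (t • y)‖ ^ p ∂ψ) ≤ ε / 2 := by
    calc _ ≤ ε / (4 * (A + 1)) * (2 * (A + 1)) := by gcongr; linarith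
      _ = ε / 2 := by field_simp; ring
  have k2 : C * ((∫ y, ‖f (s • y)‖ ^ p ∂ψ + ∫ y, ‖f (t • y)‖ ^ p ∂ψ) / 2 -
        ∫ y, ‖(1 / 2 : ℝ) • (f (s • y) + f (t • y))‖ ^ p ∂ψ) ≤ ε / 2 := by
    calc _ ≤ C * (ε / (2 * (C + 1))) := by gcongr; linarith
      _ ≤ (C + 1) * (ε / (2 * (C + 1))) := by gcongr; linarith
      _ = ε / 2 := by field_simp
  linarith

end

section

variable {ψ : Measure ℍ[ℝ]}

theorem integral_norm_le_norm {α E : Type*} [MeasurableSpace α] {μ : Measure α}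
    [IsProbabilityMeasure μ] [NormedAddCommGroup E] {q : ℝ≥0∞} [hq : Fact (1 ≤ q)] (v : Lp E q μ) :
    ∫ y, ‖v y‖ ∂μ ≤ ‖v‖ := by
  rw [integral_norm_eq_lintegral_enorm (Lp.aestronglyMeasurable v),
    ← eLpNorm_one_eq_lintegral_enorm, Lp.norm_def]
  exact ENNReal.toReal_mono (Lp.eLpNorm_ne_top v)
    (eLpNorm_le_eLpNorm_of_exponent_le hq.out (Lp.aestronglyMeasurable v))

theorem integrable_coeFn {α E : Type*} [MeasurableSpace α] {μ : Measure α}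
    [IsProbabilityMeasure μ] [NormedAddCommGroup E] {q : ℝ≥0∞} [hq : Fact (1 ≤ q)] (v : Lp E q μ) :
    Integrable v μ :=
  (Lp.memLp v).integrable hq.out

theorem norm_integral_mul_le (hψ : IsSphereMeasure ψ) {q : ℝ≥0∞} [Fact (1 ≤ q)]
    (v : Lp ℍ[ℝ] q ψ) {w : ℍ[ℝ] → ℍ[ℝ]} {M : ℝ} (hw : ∀ y, ‖y‖ = 1 → ‖w y‖ ≤ M) :
    ‖∫ y, v y * w y ∂ψ‖ ≤ M * ‖v‖ := by
  have := hψ.isProbabilityMeasure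
  have hM : 0 ≤ M := (norm_nonneg _).trans (hw 1 norm_one)
  refine (norm_integral_le_of_norm_le ((integrable_coeFn v).norm.const_mul M) ?_).trans ?_
  · filter_upwards [hψ.ae_norm] with y hy
    rw [norm_mul, mul_comm]
    exact mul_le_mul_of_nonneg_right (hw y hy) (norm_nonneg _)
  · rw [integral_const_mul]
    exact mul_le_mul_of_nonneg_left (integral_norm_le_norm v) hM

theorem integral_sub_mul (hψ : IsSphereMeasure ψ) {q : ℝ≥0∞} [Fact (1 ≤ q)]
    (u v : Lp ℍ[ℝ] q ψ) {w : ℍ[ℝ] → ℍ[ℝ]} (hw : ContinuousOn w (sphere 0 1)) :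
    ∫ y, (u - v) y * w y ∂ψ = ∫ y, u y * w y ∂ψ - ∫ y, v y * w y ∂ψ := by
  have := hψ.isProbabilityMeasure
  rw [← integral_sub (integrable_mul_of_continuousOn hψ (integrable_coeFn u) hw)
    (integrable_mul_of_continuousOn hψ (integrable_coeFn v) hw)]
  refine integral_congr_ae ?_
  filter_upwards [Lp.coeFn_sub u v] with y hy
  rw [hy, Pi.sub_apply, sub_mul]

theorem tendsto_integral_mul (hψ : IsSphereMeasure ψ) {q : ℝ≥0∞} [Fact (1 ≤ q)] {ι : Type*}
    {l : Filter ι} {u : ι → Lp ℍ[ℝ] q ψ} {v : Lp ℍ[ℝ] q ψ} (hu : Filter.Tendsto u l (nhds v))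
    {w : ℍ[ℝ] → ℍ[ℝ]} (hw : ContinuousOn w (sphere 0 1)) :
    Filter.Tendsto (fun i => ∫ y, u i y * w y ∂ψ) l (nhds (∫ y, v y * w y ∂ψ)) := by
  obtain ⟨M, hM⟩ := (isCompact_sphere (0 : ℍ[ℝ]) 1).exists_bound_of_continuousOn hw
  have h0 : Filter.Tendsto (fun i => M * ‖u i - v‖) l (nhds 0) := by
    simpa using (tendsto_iff_norm_sub_tendsto_zero.1 hu).const_mul M
  refine tendsto_iff_norm_sub_tendsto_zero.2
    (squeeze_zero (fun _ => norm_nonneg _) (fun i => ?_) h0)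
  rw [← integral_sub_mul hψ (u i) v hw]
  exact norm_integral_mul_le hψ _ fun y hy => hM y (mem_sphere_zero_iff_norm.2 hy)

open Classical in
/-- The restriction of `f` to the sphere of radius `r`, rescaled to the unit sphere, in `L^p`. -/
noncomputable def slice (ψ : Measure ℍ[ℝ]) (p : ℝ) (f : ℍ[ℝ] → ℍ[ℝ]) (r : ℝ) :
    Lp ℍ[ℝ] (ENNReal.ofReal p) ψ :=
  if h : MemLp (fun y => f (r • y)) (ENNReal.ofReal p) ψ then h.toLp _ else 0

theorem coeFn_slice_of_memLp {p : ℝ} {f : ℍ[ℝ] → ℍ[ℝ]} {r : ℝ}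
    (h : MemLp (fun y => f (r • y)) (ENNReal.ofReal p) ψ) :
    slice ψ p f r =ᵐ[ψ] fun y => f (r • y) := by
  rw [slice, dif_pos h]
  exact h.coeFn_toLp

theorem memLp_of_continuousOn_sphere (hψ : IsSphereMeasure ψ) {p : ℝ}
    {g : ℍ[ℝ] → ℍ[ℝ]} (hg : ContinuousOn g (sphere 0 1)) : MemLp g (ENNReal.ofReal p) ψ := by
  have := hψ.isProbabilityMeasure
  obtain ⟨M, hM⟩ := (isCompact_sphere (0 : ℍ[ℝ]) 1).exists_bound_of_continuousOn hg
  refine MemLp.of_bound (integrable_of_continuousOn_sphere hψ.ae_norm hg).aestronglyMeasurable M ?_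
  filter_upwards [hψ.ae_norm] with y hy using hM y (mem_sphere_zero_iff_norm.2 hy)

theorem IsMonogenic.coeFn_slice (hψ : IsSphereMeasure ψ) {p : ℝ} {f : ℍ[ℝ] → ℍ[ℝ]}
    {f' : ℍ[ℝ] → ℍ[ℝ] →L[ℝ] ℍ[ℝ]} (hf : IsMonogenic f f') {r : ℝ} (h0 : 0 ≤ r) (h1 : r < 1) :
    slice ψ p f r =ᵐ[ψ] fun y => f (r • y) :=
  coeFn_slice_of_memLp (memLp_of_continuousOn_sphere hψ (hf.continuousOn_smul h0 h1))

theorem IsMonogenic.norm_slice_rpow (hψ : IsSphereMeasure ψ) {p : ℝ} (hp : 1 < p)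
    {f : ℍ[ℝ] → ℍ[ℝ]} {f' : ℍ[ℝ] → ℍ[ℝ] →L[ℝ] ℍ[ℝ]} (hf : IsMonogenic f f') {r : ℝ}
    (h0 : 0 ≤ r) (h1 : r < 1) : ‖slice ψ p f r‖ ^ p = ∫ y, ‖f (r • y)‖ ^ p ∂ψ := by
  rw [norm_rpow_eq_integral hp]
  refine integral_congr_ae ?_
  filter_upwards [hf.coeFn_slice hψ h0 h1] with y hy
  rw [hy]

theorem IsMonogenic.norm_slice_sub_rpow (hψ : IsSphereMeasure ψ) {p : ℝ} (hp : 1 < p)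
    {f : ℍ[ℝ] → ℍ[ℝ]} {f' : ℍ[ℝ] → ℍ[ℝ] →L[ℝ] ℍ[ℝ]} (hf : IsMonogenic f f') {s t : ℝ}
    (hs0 : 0 ≤ s) (hs1 : s < 1) (ht0 : 0 ≤ t) (ht1 : t < 1) :
    ‖slice ψ p f s - slice ψ p f t‖ ^ p = ∫ y, ‖f (s • y) - f (t • y)‖ ^ p ∂ψ := by
  rw [norm_rpow_eq_integral hp]
  refine integral_congr_ae ?_
  filter_upwards [hf.coeFn_slice hψ hs0 hs1, hf.coeFn_slice hψ ht0 ht1,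
    Lp.coeFn_sub (slice ψ p f s) (slice ψ p f t)] with y h1 h2 h3
  rw [h3, Pi.sub_apply, h1, h2]

/-- The boundary value of a function on the ball, as an element of `L^p`. -/
noncomputable def bdry (ψ : Measure ℍ[ℝ]) (p : ℝ) [Fact (1 ≤ ENNReal.ofReal p)]
    (f : ℍ[ℝ] → ℍ[ℝ]) : Lp ℍ[ℝ] (ENNReal.ofReal p) ψ :=
  Filter.limUnder (nhdsWithin 1 (Set.Iio 1)) (slice ψ p f)

theorem IsMonogenic.tendsto_slice (hψ : IsSphereMeasure ψ) {p : ℝ} [Fact (1 ≤ ENNReal.ofReal p)]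
    (hp : 1 < p) {f : ℍ[ℝ] → ℍ[ℝ]} {f' : ℍ[ℝ] → ℍ[ℝ] →L[ℝ] ℍ[ℝ]} (hf : IsMonogenic f f') {A : ℝ}
    (hA : ∀ r : ℝ, 0 < r → r < 1 → ∫ y, ‖f (r • y)‖ ^ p ∂ψ ≤ A) :
    Filter.Tendsto (slice ψ p f) (nhdsWithin 1 (Set.Iio 1)) (nhds (bdry ψ p f)) := by
  have hp0 : 0 < p := by linarith
  refine tendsto_nhds_limUnder (cauchy_map_iff_exists_tendsto.1 ?_)
  rw [Metric.cauchy_iff]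
  refine ⟨inferInstance, fun ε hε => ?_⟩
  obtain ⟨r, hr, h⟩ := hf.exists_integral_rpow_norm_sub_le hψ hp hA
    (ε := (ε / 2) ^ p) (by positivity)
  refine ⟨slice ψ p f '' Set.Ioo (max r 0) 1,
    Filter.image_mem_map (Ioo_mem_nhdsLT (max_lt hr one_pos)), ?_⟩
  have key : ∀ s t, s ∈ Set.Ioo (max r 0) 1 → t ∈ Set.Ioo (max r 0) 1 → s ≤ t →
      dist (slice ψ p f s) (slice ψ p f t) < ε := by
    intro s t hs ht hst
    have h1 := h s t ((le_max_left _ _).trans_lt hs.1) hst ht.2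
    rw [← hf.norm_slice_sub_rpow hψ hp ((le_max_right _ _).trans hs.1.le) hs.2
      ((le_max_right _ _).trans ht.1.le) ht.2, Real.rpow_le_rpow_iff (norm_nonneg _)
      (by positivity) hp0] at h1
    rw [dist_eq_norm]
    linarith
  rintro _ ⟨s, hs, rfl⟩ _ ⟨t, ht, rfl⟩
  rcases le_total s t with hst | hst
  · exact key s t hs ht hst
  · rw [dist_comm]
    exact key t s ht hs hst

theorem IsMonogenic.norm_bdry_rpow_le (hψ : IsSphereMeasure ψ) {p : ℝ}
    [Fact (1 ≤ ENNReal.ofReal p)] (hp : 1 < p) {f : ℍ[ℝ] → ℍ[ℝ]} {f' : ℍ[ℝ] → ℍ[ℝ] →L[ℝ] ℍ[ℝ]}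
    (hf : IsMonogenic f f') {A : ℝ}
    (hA : ∀ r : ℝ, 0 < r → r < 1 → ∫ y, ‖f (r • y)‖ ^ p ∂ψ ≤ A) : ‖bdry ψ p f‖ ^ p ≤ A := by
  refine le_of_tendsto (((hf.tendsto_slice hψ hp hA).norm).rpow_const
    (Or.inr (by linarith))) ?_
  filter_upwards [Ioo_mem_nhdsLT one_pos] with r hr
  rw [hf.norm_slice_rpow hψ hp hr.1.le hr.2]
  exact hA r hr.1 hr.2

theorem IsMonogenic.eq_integral_bdry (hψ : IsSphereMeasure ψ) {p : ℝ}
    [Fact (1 ≤ ENNReal.ofReal p)] (hp : 1 < p) {f : ℍ[ℝ] → ℍ[ℝ]} {f' : ℍ[ℝ] → ℍ[ℝ] →L[ℝ] ℍ[ℝ]}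
    (hf : IsMonogenic f f') {A : ℝ}
    (hA : ∀ r : ℝ, 0 < r → r < 1 → ∫ y, ‖f (r • y)‖ ^ p ∂ψ ≤ A) {R : ℝ} (hR0 : 0 < R)
    (hR1 : R < 1) {z : ℍ[ℝ]} (hz : ‖z‖ = 1) :
    f (R • z) = ∫ y, bdry ψ p f y * cauchyKernel (R • (y * star z)) ∂ψ := by
  have hκ : ContinuousOn (fun y => cauchyKernel (R • (y * star z))) (sphere 0 1) :=
    continuousOn_cauchyKernel.comp (f := fun y => R • (y * star z)) (by fun_prop) fun y hy =>
      smul_mul_star_ne_one (mem_sphere_zero_iff_norm.1 hy) hz hR0.le hR1.ne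
  have h1 := tendsto_integral_mul hψ (hf.tendsto_slice hψ hp hA) hκ
  have h2 : Filter.Tendsto (fun s : ℝ => f ((R * s) • z)) (nhdsWithin 1 (Set.Iio 1))
      (nhds (f (R • z))) := by
    have hfc : ContinuousAt f (R • z) := (hf.hasFDerivAt _ (by
      rwa [norm_smul, hz, mul_one, Real.norm_of_nonneg hR0.le])).continuousAt
    have hg : ContinuousAt (fun s : ℝ => (R * s) • z) 1 := by fun_prop
    have := ContinuousAt.comp (g := f) (f := fun s : ℝ => (R * s) • z) (x := 1)
      (by simpa using hfc) hg
    have h := this.tendsto.mono_left (nhdsWithin_le_nhds (s := Set.Iio 1))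
    simp only [Function.comp_def, mul_one] at h
    exact h
  refine tendsto_nhds_unique h2 (h1.congr' ?_)
  filter_upwards [Ioo_mem_nhdsLT one_pos] with s hs
  have h3 := hf.eq_cauchy_integral hψ (R := R * s) (mul_pos hR0 hs.1) hz (s := s)
    (by nlinarith [hs.1]) hs.2
  rw [mul_div_cancel_right₀ _ hs.1.ne'] at h3
  rw [h3]
  refine integral_congr_ae ?_
  filter_upwards [hf.coeFn_slice hψ hs.1.le hs.2] with y hy
  rw [hy]

end

section

variable {ψ : Measure ℍ[ℝ]}

theorem coeff_eq_zero_of_norm_sum_pow_smul_le {E : Type*} [NormedAddCommGroup E] [NormedSpace ℝ E]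
    {δ C : ℝ} (hδ : 0 < δ) (N : ℕ) : ∀ (c : ℕ → E) (α : ℝ),
      (∀ r : ℝ, 0 < r → r < δ → ‖∑ n ∈ Finset.range N, r ^ n • c n‖ ≤ C * r ^ α) →
      ∀ n < N, (n : ℝ) < α → c n = 0 := by
  induction N with
  | zero => exact fun _ _ _ n hn => absurd hn (Nat.not_lt_zero n)
  | succ N ih =>
    intro c α h
    rcases le_or_gt α 0 with hα | hα
    · exact fun n _ hn => absurd (hn.trans_le hα) (Nat.cast_nonneg n).not_gt
    have hcont : Continuous fun r : ℝ => ∑ n ∈ Finset.range (N + 1), r ^ n • c n := by fun_prop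
    have h0 : c 0 = 0 := by
      have h1 := ((hcont.tendsto 0).mono_left (nhdsWithin_le_nhds (s := Set.Ioi 0))).norm
      have h2 : Filter.Tendsto (fun r : ℝ => C * r ^ α) (nhdsWithin 0 (Set.Ioi 0))
          (nhds (C * 0 ^ α)) :=
        (((Real.continuous_rpow_const hα.le).tendsto 0).mono_left nhdsWithin_le_nhds).const_mul C
      have h3 := le_of_tendsto_of_tendsto h1 h2 (by
        filter_upwards [Ioo_mem_nhdsGT hδ] with r hr using h r hr.1 hr.2)
      rw [Real.zero_rpow hα.ne', mul_zero, Finset.sum_range_succ'] at h3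
      simpa using h3
    have h4 := ih (fun n => c (n + 1)) (α - 1) fun r hr hrδ => by
      have h5 := h r hr hrδ
      rw [Finset.sum_range_succ', h0, smul_zero, add_zero] at h5
      have h6 : ∑ n ∈ Finset.range N, r ^ (n + 1) • c (n + 1) =
          r • ∑ n ∈ Finset.range N, r ^ n • c (n + 1) := by
        rw [Finset.smul_sum]
        exact Finset.sum_congr rfl fun n _ => by rw [smul_smul, pow_succ']
      rw [h6, norm_smul, Real.norm_of_nonneg hr.le] at h5
      rw [Real.rpow_sub_one hr.ne', ← mul_div_assoc, le_div_iff₀ hr]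
      linarith
    rintro (_ | n) hn hnα
    · exact h0
    · refine h4 n (by omega) ?_
      push_cast at hnα
      linarith

/-- The degrees of the Taylor coefficients at the origin that vanish for functions of finite Hardy
norm. -/
noncomputable def lowDegrees (p : ℝ) : Finset ℕ := (Finset.range 3).filter fun n => (n : ℝ) < 3 / p

/-- The Cauchy kernel without its zonal parts of low degree. -/
noncomputable def hardyKernel (p : ℝ) (x : ℍ[ℝ]) : ℍ[ℝ] :=
  cauchyKernel x - ∑ n ∈ lowDegrees p, zonal n x

/-- The operator `f - ∑ i ∈ s, g i`. -/
def subSum {E F ι : Type*} [NormedAddCommGroup E] [NormedSpace ℝ E]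
    [NormedAddCommGroup F] [NormedSpace ℝ F] (s : Finset ι) (f : E →L[ℝ] F) (g : ι → E →L[ℝ] F) :
    E →L[ℝ] F := f - ∑ i ∈ s, g i

/-- The derivative of `hardyKernel`. -/
noncomputable def hardyKernelDeriv (p : ℝ) (x : ℍ[ℝ]) : ℍ[ℝ] →L[ℝ] ℍ[ℝ] :=
  subSum (lowDegrees p) (cauchyKernelDeriv x) fun n => zonalDeriv n x

theorem ne_one_of_norm_lt_one {x : ℍ[ℝ]} (hx : ‖x‖ < 1) : x ≠ 1 := fun h => by
  rw [h, norm_one] at hx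
  exact lt_irrefl _ hx

theorem hasFDerivAt_sub_sum {E F ι : Type*} [NormedAddCommGroup E] [NormedSpace ℝ E]
    [NormedAddCommGroup F] [NormedSpace ℝ F] {f : E → F} {f' : E →L[ℝ] F} {g : ι → E → F}
    {g' : ι → E →L[ℝ] F} {x : E} (s : Finset ι) (hf : HasFDerivAt f f' x)
    (hg : ∀ i, HasFDerivAt (g i) (g' i) x) :
    HasFDerivAt (fun x => f x - ∑ i ∈ s, g i x) (subSum s f' g') x :=
  hf.sub (HasFDerivAt.fun_sum fun i _ => hg i)

theorem continuousOn_subSum {X E F ι : Type*} [TopologicalSpace X] [NormedAddCommGroup E]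
    [NormedSpace ℝ E] [NormedAddCommGroup F] [NormedSpace ℝ F] {f : X → E →L[ℝ] F}
    {g : ι → X → E →L[ℝ] F} {t : Set X} (s : Finset ι) (hf : ContinuousOn f t)
    (hg : ∀ i, Continuous (g i)) : ContinuousOn (fun x => subSum s (f x) fun i => g i x) t :=
  hf.sub (continuous_finsetSum s fun i _ => hg i).continuousOn

theorem subSum_apply {E F ι : Type*} [NormedAddCommGroup E] [NormedSpace ℝ E]
    [NormedAddCommGroup F] [NormedSpace ℝ F] (s : Finset ι) (f : E →L[ℝ] F) (g : ι → E →L[ℝ] F)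
    (x : E) : subSum s f g x = f x - ∑ i ∈ s, g i x := by
  rw [subSum, sub_apply, sum_apply]

theorem hasFDerivAt_hardyKernel (p : ℝ) (x : ℍ[ℝ]) (hx : ‖x‖ < 1) :
    HasFDerivAt (hardyKernel p) (hardyKernelDeriv p x) x :=
  hasFDerivAt_sub_sum _ (hasFDerivAt_cauchyKernel (ne_one_of_norm_lt_one hx))
    fun n => hasFDerivAt_zonal n x

theorem continuousOn_hardyKernelDeriv (p : ℝ) : ContinuousOn (hardyKernelDeriv p) (ball 0 1) :=
  continuousOn_subSum _ (continuousOn_cauchyKernelDeriv.mono fun _ hx =>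
    ne_one_of_norm_lt_one (mem_ball_zero_iff.1 hx)) continuous_zonalDeriv

theorem sum_hardyKernelDeriv (p : ℝ) (x y : ℍ[ℝ]) :
    ∑ j, hardyKernelDeriv p x (y * star (qe j)) * qe j = 0 := by
  have h : ∀ j, hardyKernelDeriv p x (y * star (qe j)) * qe j =
      cauchyKernelDeriv x (y * star (qe j)) * qe j -
        ∑ n ∈ lowDegrees p, zonalDeriv n x (y * star (qe j)) * qe j := fun j => by
    rw [hardyKernelDeriv, subSum_apply, sub_mul, Finset.sum_mul]
  simp only [h, Finset.sum_sub_distrib, sum_cauchyKernelDeriv]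
  rw [Finset.sum_comm]
  simp [sum_zonalDeriv]

theorem continuous_zonal (n : ℕ) : Continuous (zonal n) :=
  continuous_iff_continuousAt.2 fun x => (hasFDerivAt_zonal n x).continuousAt

theorem norm_hardyKernel_le {p : ℝ} (hp : 1 < p) {x : ℍ[ℝ]} (hx : ‖x‖ ≤ 1 / 2) :
    ‖hardyKernel p x‖ ≤ 10054 * ‖x‖ ^ (3 / p) := by
  have hα : 0 < 3 / p := by positivity
  have hα3 : 3 / p ≤ 3 := by
    rw [div_le_iff₀ (by linarith)]
    linarith
  have hpow : ∀ n : ℕ, 3 / p ≤ n → ‖x‖ ^ n ≤ ‖x‖ ^ (3 / p) := fun n hn => by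
    rw [← Real.rpow_natCast]
    exact Real.rpow_le_rpow_of_exponent_ge' (norm_nonneg _) (by linarith) hα.le hn
  have h1 : hardyKernel p x = (cauchyKernel x - ∑ n ∈ Finset.range 3, zonal n x) +
      ∑ n ∈ (Finset.range 3).filter (fun n : ℕ => ¬ (n : ℝ) < 3 / p), zonal n x := by
    rw [hardyKernel, lowDegrees,
      ← Finset.sum_filter_add_sum_filter_not (Finset.range 3) (fun n : ℕ => (n : ℝ) < 3 / p)]
    abel
  have h2 : ‖∑ n ∈ (Finset.range 3).filter (fun n : ℕ => ¬ (n : ℝ) < 3 / p), zonal n x‖ ≤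
      3 * (18 * ‖x‖ ^ (3 / p)) := by
    refine (norm_sum_le_of_le _ (f := fun n => zonal n x) (n := fun _ => 18 * ‖x‖ ^ (3 / p))
      fun n hn => ?_).trans ?_
    · refine (norm_zonal_le n x).trans ?_
      have := hpow n (not_lt.1 (Finset.mem_filter.1 hn).2)
      gcongr
    · rw [Finset.sum_const, nsmul_eq_mul]
      have h3 := (Finset.range 3).card_filter_le fun n : ℕ => ¬ (n : ℝ) < 3 / p
      rw [Finset.card_range] at h3
      gcongr
      exact_mod_cast h3
  have h4 := hpow 3 (by exact_mod_cast hα3)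
  rw [h1]
  refine (norm_add_le _ _).trans ?_
  have h5 := norm_cauchyKernel_sub_zonal_le hx
  linarith

theorem IsMonogenic.norm_le_rpow (hψ : IsSphereMeasure ψ) {p : ℝ}
    [Fact (1 ≤ ENNReal.ofReal p)] (hp : 1 < p) {f : ℍ[ℝ] → ℍ[ℝ]} {f' : ℍ[ℝ] → ℍ[ℝ] →L[ℝ] ℍ[ℝ]}
    (hf : IsMonogenic f f') {A : ℝ} (hA0 : 0 ≤ A)
    (hA : ∀ r : ℝ, 0 < r → r < 1 → ∫ y, ‖f (r • y)‖ ^ p ∂ψ ≤ A * r ^ 3) {r : ℝ} (h0 : 0 < r)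
    (h1 : r < 1 / 2) {z : ℍ[ℝ]} (hz : ‖z‖ = 1) :
    ‖f (r • z)‖ ≤ 8 * (A * 2 ^ 3) ^ (1 / p) * r ^ (3 / p) := by
  have hp0 : 0 < p := by linarith
  have h2r : 2 * r < 1 := by linarith
  have h2 := hf.eq_cauchy_integral hψ h0 hz (s := 2 * r) (by linarith) h2r
  have h3 : r / (2 * r) = 1 / 2 := by field_simp
  have h4 : ∫ y, f ((2 * r) • y) * cauchyKernel ((1 / 2 : ℝ) • (y * star z)) ∂ψ =
      ∫ y, slice ψ p f (2 * r) y * cauchyKernel ((1 / 2 : ℝ) • (y * star z)) ∂ψ := by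
    refine integral_congr_ae ?_
    filter_upwards [hf.coeFn_slice hψ (p := p) (by linarith : 0 ≤ 2 * r) h2r] with y hy
    rw [hy]
  have h5 : ‖slice ψ p f (2 * r)‖ ≤ (A * 2 ^ 3) ^ (1 / p) * r ^ (3 / p) := by
    rw [← Real.rpow_le_rpow_iff (norm_nonneg _) (by positivity) hp0,
      hf.norm_slice_rpow hψ hp (by linarith) h2r, Real.mul_rpow (by positivity) (by positivity),
      ← Real.rpow_mul (by positivity), ← Real.rpow_mul h0.le, one_div_mul_cancel hp0.ne',
      div_mul_cancel₀ _ hp0.ne', Real.rpow_one]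
    refine (hA _ (by linarith) h2r).trans_eq ?_
    rw [show (3 : ℝ) = (3 : ℕ) by norm_num, Real.rpow_natCast]
    ring
  rw [h2, h3, h4]
  refine (norm_integral_mul_le hψ (slice ψ p f (2 * r)) (M := 8) fun y hy => ?_).trans ?_
  · rw [norm_cauchyKernel]
    have h6 : 1 / 2 ≤ ‖1 - (1 / 2 : ℝ) • (y * star z)‖ := by
      have h7 := norm_sub_norm_le (1 : ℍ[ℝ]) ((1 / 2 : ℝ) • (y * star z))
      rw [norm_one, norm_smul_mul_star hy hz (by norm_num)] at h7
      linarith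
    rw [inv_le_comm₀ (by positivity) (by norm_num)]
    calc (8 : ℝ)⁻¹ = (1 / 2) ^ 3 := by norm_num
      _ ≤ _ := by gcongr
  · rw [mul_assoc]
    gcongr

theorem IsMonogenic.integral_bdry_zonal_eq_zero (hψ : IsSphereMeasure ψ) {p : ℝ}
    [Fact (1 ≤ ENNReal.ofReal p)] (hp : 1 < p) {f : ℍ[ℝ] → ℍ[ℝ]} {f' : ℍ[ℝ] → ℍ[ℝ] →L[ℝ] ℍ[ℝ]}
    (hf : IsMonogenic f f') {A : ℝ} (hA0 : 0 ≤ A)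
    (hA : ∀ r : ℝ, 0 < r → r < 1 → ∫ y, ‖f (r • y)‖ ^ p ∂ψ ≤ A * r ^ 3) {z : ℍ[ℝ]} (hz : ‖z‖ = 1)
    {n : ℕ} (hn : n ∈ lowDegrees p) : ∫ y, bdry ψ p f y * zonal n (y * star z) ∂ψ = 0 := by
  have hA' : ∀ r : ℝ, 0 < r → r < 1 → ∫ y, ‖f (r • y)‖ ^ p ∂ψ ≤ A := fun r h0 h1 =>
    (hA r h0 h1).trans (mul_le_of_le_one_right hA0 (pow_le_one₀ h0.le h1.le))
  have hα3 : 3 / p ≤ 3 := by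
    rw [div_le_iff₀ (by linarith)]
    linarith
  have hi : ∀ n, Integrable (fun y => bdry ψ p f y * zonal n (y * star z)) ψ := fun n =>
    have := hψ.isProbabilityMeasure
    integrable_mul_of_continuousOn hψ (integrable_coeFn _)
      ((continuous_zonal n).comp (by fun_prop : Continuous fun y => y * star z)).continuousOn
  obtain ⟨hn3, hnp⟩ := Finset.mem_filter.1 hn
  refine coeff_eq_zero_of_norm_sum_pow_smul_le (δ := 1 / 2)
    (C := 8 * (A * 2 ^ 3) ^ (1 / p) + 10000 * ‖bdry ψ p f‖) (by norm_num) 3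
    (fun n => ∫ y, bdry ψ p f y * zonal n (y * star z) ∂ψ) (3 / p) (fun r h0 h1 => ?_) n
    (Finset.mem_range.1 hn3) hnp
  have h2 := hf.eq_integral_bdry hψ hp hA' h0 (by linarith) hz
  have hκ : Integrable (fun y => bdry ψ p f y * cauchyKernel (r • (y * star z))) ψ := by
    have := hψ.isProbabilityMeasure
    refine integrable_mul_of_continuousOn hψ (integrable_coeFn _)
      (continuousOn_cauchyKernel.comp (f := fun y => r • (y * star z)) (by fun_prop) fun y hy =>
      smul_mul_star_ne_one (mem_sphere_zero_iff_norm.1 hy) hz h0.le (by linarith))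
  have his : ∀ n, Integrable (fun y => r ^ n • (bdry ψ p f y * zonal n (y * star z))) ψ :=
    fun n => (hi n).smul (r ^ n)
  have hiS : Integrable
      (fun y => ∑ n ∈ Finset.range 3, r ^ n • (bdry ψ p f y * zonal n (y * star z))) ψ :=
    integrable_finsetSum _ fun n _ => his n
  have h3 : ∑ n ∈ Finset.range 3, r ^ n • ∫ y, bdry ψ p f y * zonal n (y * star z) ∂ψ =
      ∫ y, ∑ n ∈ Finset.range 3, r ^ n • (bdry ψ p f y * zonal n (y * star z)) ∂ψ := by
    rw [integral_finsetSum _ fun n _ => his n]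
    simp only [integral_smul]
  have h4 : ∑ n ∈ Finset.range 3, r ^ n • ∫ y, bdry ψ p f y * zonal n (y * star z) ∂ψ =
      f (r • z) - ∫ y, bdry ψ p f y * (cauchyKernel (r • (y * star z)) -
        ∑ n ∈ Finset.range 3, zonal n (r • (y * star z))) ∂ψ := by
    rw [h2, h3, eq_sub_iff_add_eq, ← integral_add hiS]
    · refine integral_congr_ae (Filter.Eventually.of_forall fun y => ?_)
      simp only [zonal_smul, mul_sub, Finset.mul_sum, mul_smul_comm]
      abel
    · have h5 : Integrable (fun y => bdry ψ p f y * cauchyKernel (r • (y * star z)) -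
          ∑ n ∈ Finset.range 3, r ^ n • (bdry ψ p f y * zonal n (y * star z))) ψ :=
        hκ.sub hiS
      refine h5.congr (Filter.Eventually.of_forall fun y => ?_)
      simp only [zonal_smul, mul_sub, Finset.mul_sum, mul_smul_comm]
  rw [h4]
  refine (norm_sub_le _ _).trans ?_
  have h6 := norm_integral_mul_le hψ (bdry ψ p f) (w := fun y => cauchyKernel (r • (y * star z)) -
        ∑ n ∈ Finset.range 3, zonal n (r • (y * star z))) (M := 10000 * r ^ 3) fun y hy => by
    have h7 := norm_smul_mul_star hy hz h0.le
    have h8 := norm_cauchyKernel_sub_zonal_le (x := r • (y * star z)) (by rw [h7]; exact h1.le)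
    rwa [h7] at h8
  have h9 := hf.norm_le_rpow hψ hp hA0 hA h0 h1 hz
  have h10 : r ^ 3 ≤ r ^ (3 / p) := by
    rw [← Real.rpow_natCast]
    exact Real.rpow_le_rpow_of_exponent_ge h0 (by linarith) (by exact_mod_cast hα3)
  have h11 : 10000 * r ^ 3 * ‖bdry ψ p f‖ ≤ 10000 * ‖bdry ψ p f‖ * r ^ (3 / p) := by
    have := mul_le_mul_of_nonneg_left h10 (by positivity : 0 ≤ 10000 * ‖bdry ψ p f‖)
    linarith
  linarith

theorem continuousAt_transform (hψ : IsSphereMeasure ψ) {p : ℝ} {v : ℍ[ℝ] → ℍ[ℝ]}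
    (hv : Integrable v ψ) {z : ℍ[ℝ]} (hz : ‖z‖ < 1) :
    ContinuousAt (transform ψ (hardyKernel p) v) z :=
  (contDiffOn_transform hψ (hasFDerivAt_hardyKernel p)
    (continuousOn_hardyKernelDeriv p) hv).continuousOn.continuousAt
    (isOpen_ball.mem_nhds (mem_ball_zero_iff.2 hz))

theorem mul_star_real_smul (y z : ℍ[ℝ]) (r : ℝ) : y * star (r • z) = r • (y * star z) := by
  rw [Quaternion.star_smul, mul_smul_comm]

/-- A monogenic function of finite Hardy norm is reproduced from its boundary values. -/
theorem IsMonogenic.eq_transform_bdry (hψ : IsSphereMeasure ψ) {p : ℝ}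
    [Fact (1 ≤ ENNReal.ofReal p)] (hp : 1 < p) {f : ℍ[ℝ] → ℍ[ℝ]} {f' : ℍ[ℝ] → ℍ[ℝ] →L[ℝ] ℍ[ℝ]}
    (hf : IsMonogenic f f') {A : ℝ} (hA0 : 0 ≤ A)
    (hA : ∀ r : ℝ, 0 < r → r < 1 → ∫ y, ‖f (r • y)‖ ^ p ∂ψ ≤ A * r ^ 3) {z : ℍ[ℝ]} (hz : ‖z‖ < 1) :
    f z = transform ψ (hardyKernel p) (bdry ψ p f) z := by
  have := hψ.isProbabilityMeasure
  have hA' : ∀ r : ℝ, 0 < r → r < 1 → ∫ y, ‖f (r • y)‖ ^ p ∂ψ ≤ A := fun r h0 h1 =>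
    (hA r h0 h1).trans (mul_le_of_le_one_right hA0 (pow_le_one₀ h0.le h1.le))
  have hmain : ∀ (z : ℍ[ℝ]) (r : ℝ), ‖z‖ = 1 → 0 < r → r < 1 →
      f (r • z) = transform ψ (hardyKernel p) (bdry ψ p f) (r • z) := fun z r hz h0 h1 => by
    have hκ : Integrable (fun y => bdry ψ p f y * cauchyKernel (r • (y * star z))) ψ := by
      refine integrable_mul_of_continuousOn hψ (integrable_coeFn _)
        (continuousOn_cauchyKernel.comp (f := fun y => r • (y * star z)) (by fun_prop) fun y hy =>
        smul_mul_star_ne_one (mem_sphere_zero_iff_norm.1 hy) hz h0.le h1.ne)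
    have hi : ∀ n, Integrable (fun y => bdry ψ p f y * zonal n (r • (y * star z))) ψ := fun n =>
      integrable_mul_of_continuousOn hψ (integrable_coeFn _)
        ((continuous_zonal n).comp (by fun_prop : Continuous fun y => r • (y * star z))).continuousOn
    have h2 : ∀ y, bdry ψ p f y * hardyKernel p (r • (y * star z)) =
        bdry ψ p f y * cauchyKernel (r • (y * star z)) -
          ∑ n ∈ lowDegrees p, bdry ψ p f y * zonal n (r • (y * star z)) := fun y => by
      rw [hardyKernel, mul_sub, Finset.mul_sum]
    simp only [transform, mul_star_real_smul, h2]
    rw [integral_sub hκ (integrable_finsetSum _ fun n _ => hi n),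
      integral_finsetSum _ fun n _ => hi n, hf.eq_integral_bdry hψ hp hA' h0 h1 hz,
      Finset.sum_eq_zero fun n hn => ?_, sub_zero]
    simp only [zonal_smul, mul_smul_comm]
    rw [integral_smul, hf.integral_bdry_zonal_eq_zero hψ hp hA0 hA hz hn, smul_zero]
  rcases eq_or_ne z 0 with rfl | hz0
  · have hg : Filter.Tendsto (fun r : ℝ => r • (1 : ℍ[ℝ])) (nhdsWithin 0 (Set.Ioi 0)) (nhds 0) := by
      have h : Continuous fun r : ℝ => r • (1 : ℍ[ℝ]) := by fun_prop
      have h1 := (h.tendsto 0).mono_left (nhdsWithin_le_nhds (s := Set.Ioi 0))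
      rwa [zero_smul] at h1
    refine tendsto_nhds_unique ((hf.hasFDerivAt 0 (by simp)).continuousAt.tendsto.comp hg)
      (((continuousAt_transform hψ (integrable_coeFn (bdry ψ p f))
        (by simp : ‖(0 : ℍ[ℝ])‖ < 1)).tendsto.comp hg).congr' ?_)
    filter_upwards [Ioo_mem_nhdsGT one_pos] with r hr
    exact (hmain 1 r norm_one hr.1 hr.2).symm
  · have h := hmain (‖z‖⁻¹ • z) ‖z‖ (by
      rw [norm_smul, norm_inv, norm_norm, inv_mul_cancel₀ (norm_ne_zero_iff.2 hz0)])
      (norm_pos_iff.2 hz0) hz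
    rwa [smul_inv_smul₀ (norm_ne_zero_iff.2 hz0)] at h

end

section

variable {ψ : Measure ℍ[ℝ]}

theorem continuousOn_fderiv_ball {E F : Type*} [NormedAddCommGroup E] [NormedSpace ℝ E]
    [NormedAddCommGroup F] [NormedSpace ℝ F] {f : E → F} (hf : ContDiffOn ℝ 1 f (ball 0 1)) :
    ContinuousOn (fderiv ℝ f) (ball 0 1) :=
  hf.continuousOn_fderiv_of_isOpen isOpen_ball le_rfl

theorem isMonogenic_of_contDiffOn {f : ℍ[ℝ] → ℍ[ℝ]} (hf : ContDiffOn ℝ 1 f (ball 0 1))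
    (hd : ∀ z ∈ ball (0 : ℍ[ℝ]) 1, Dirac f z = 0) : IsMonogenic f (fderiv ℝ f) where
  hasFDerivAt _ hx := ((hf.differentiableOn one_ne_zero).differentiableAt
    (isOpen_ball.mem_nhds (mem_ball_zero_iff.2 hx))).hasFDerivAt
  continuousOn_deriv := continuousOn_fderiv_ball hf
  dirac x hx := hd x (mem_ball_zero_iff.2 hx)

theorem isMonogenic_transform_cauchyKernel (hψ : IsSphereMeasure ψ) {v : ℍ[ℝ] → ℍ[ℝ]}
    (hv : Integrable v ψ) : IsMonogenic (transform ψ cauchyKernel v)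
      (fderiv ℝ (transform ψ cauchyKernel v)) := by
  have hk : ∀ x : ℍ[ℝ], ‖x‖ < 1 → HasFDerivAt cauchyKernel (cauchyKernelDeriv x) x := fun x hx =>
    hasFDerivAt_cauchyKernel (ne_one_of_norm_lt_one hx)
  have hk' : ContinuousOn cauchyKernelDeriv (ball 0 1) :=
    continuousOn_cauchyKernelDeriv.mono fun _ hx => ne_one_of_norm_lt_one (mem_ball_zero_iff.1 hx)
  exact isMonogenic_of_contDiffOn (contDiffOn_transform hψ hk hk' hv) fun z hz =>
    dirac_transform hψ hk hk' sum_cauchyKernelDeriv hv (mem_ball_zero_iff.1 hz)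

theorem isMonogenic_transform_hardyKernel (hψ : IsSphereMeasure ψ) (p : ℝ) {v : ℍ[ℝ] → ℍ[ℝ]}
    (hv : Integrable v ψ) : IsMonogenic (transform ψ (hardyKernel p) v)
      (fderiv ℝ (transform ψ (hardyKernel p) v)) :=
  isMonogenic_of_contDiffOn (contDiffOn_transform hψ (hasFDerivAt_hardyKernel p)
    (continuousOn_hardyKernelDeriv p) hv) fun _ hz => dirac_transform hψ (hasFDerivAt_hardyKernel p)
      (continuousOn_hardyKernelDeriv p) (sum_hardyKernelDeriv p) hv (mem_ball_zero_iff.1 hz)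

theorem integral_rpow_norm_le (hψ : IsSphereMeasure ψ) {p M : ℝ} (hp : 0 ≤ p)
    {f : ℍ[ℝ] → ℍ[ℝ]} (h : ∀ z, ‖z‖ = 1 → ‖f z‖ ≤ M) : ∫ z, ‖f z‖ ^ p ∂ψ ≤ M ^ p := by
  have := hψ.isProbabilityMeasure
  calc ∫ z, ‖f z‖ ^ p ∂ψ ≤ ∫ _, M ^ p ∂ψ := by
        refine integral_mono_of_nonneg (Filter.Eventually.of_forall fun _ => by positivity)
          (integrable_const _) ?_
        filter_upwards [hψ.ae_norm] with z hz using Real.rpow_le_rpow (norm_nonneg _) (h z hz) hp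
    _ = M ^ p := by simp

theorem norm_cauchyKernel_smul_mul_star_le {y z : ℍ[ℝ]} (hy : ‖y‖ = 1) (hz : ‖z‖ = 1) {r : ℝ}
    (h0 : 0 ≤ r) (h1 : r < 1) : ‖cauchyKernel (r • (y * star z))‖ ≤ ((1 - r) ^ 3)⁻¹ := by
  have h2 := norm_sub_norm_le (1 : ℍ[ℝ]) (r • (y * star z))
  rw [norm_one, norm_smul_mul_star hy hz h0] at h2
  rw [norm_cauchyKernel]
  have h3 : 0 < 1 - r := by linarith
  gcongr

theorem integral_rpow_norm_transform_le_of_continuousOn (hψ : IsSphereMeasure ψ) {p C : ℝ}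
    (hC : ∀ r : ℝ, 0 ≤ r → r < 1 → ∀ f : ℍ[ℝ] → ℍ[ℝ], ContinuousOn f (sphere 0 1) →
      ∫ z, ‖∫ g, f (g * z) * cauchyKernel (r • g) ∂ψ‖ ^ p ∂ψ ≤ C * ∫ z, ‖f z‖ ^ p ∂ψ)
    {r : ℝ} (h0 : 0 ≤ r) (h1 : r < 1) {f : ℍ[ℝ] → ℍ[ℝ]} (hf : ContinuousOn f (sphere 0 1)) :
    ∫ z, ‖transform ψ cauchyKernel f (r • z)‖ ^ p ∂ψ ≤ C * ∫ z, ‖f z‖ ^ p ∂ψ := by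
  refine le_trans (le_of_eq (integral_congr_ae ?_)) (hC r h0 h1 f hf)
  filter_upwards [hψ.ae_norm] with z hz
  have h2 := integral_comp_mul_right hψ (F := fun y => f y * cauchyKernel (r • (y * star z)))
    (hf.mul (continuousOn_cauchyKernel.comp (f := fun y => r • (y * star z)) (by fun_prop)
      fun y hy => smul_mul_star_ne_one (mem_sphere_zero_iff_norm.1 hy) hz h0 h1.ne)) hz
  simp only [mul_assoc, self_mul_star_of_norm_eq_one hz, mul_one] at h2
  simp only [transform, mul_star_real_smul, ← h2]

theorem exists_integral_rpow_norm_transform_cauchyKernel_le (hψ : IsSphereMeasure ψ) {p : ℝ}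
    [Fact (1 ≤ ENNReal.ofReal p)] (hp : 1 < p) :
    ∃ C : ℝ, 0 ≤ C ∧ ∀ (v : Lp ℍ[ℝ] (ENNReal.ofReal p) ψ) (r : ℝ), 0 ≤ r → r < 1 →
      ∫ z, ‖transform ψ cauchyKernel v (r • z)‖ ^ p ∂ψ ≤ C * ‖v‖ ^ p := by
  have := hψ.isProbabilityMeasure
  have hp0 : 0 ≤ p := by linarith
  obtain ⟨C, hC0, hC⟩ := exists_cauchy_integral_bound hψ hp
  refine ⟨2 ^ p * C, by positivity, fun v r h0 h1 => ?_⟩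
  set M := ((1 - r) ^ 3)⁻¹
  have hM : 0 ≤ M := inv_nonneg.2 (pow_nonneg (by linarith) 3)
  have hcont : ∀ {w : ℍ[ℝ] → ℍ[ℝ]}, Integrable w ψ →
      ContinuousOn (fun z => transform ψ cauchyKernel w (r • z)) (sphere 0 1) := fun hw =>
    (isMonogenic_transform_cauchyKernel hψ hw).continuousOn_smul h0 h1
  have key : ∀ ε : ℝ, 0 < ε → ∫ z, ‖transform ψ cauchyKernel v (r • z)‖ ^ p ∂ψ ≤
      2 ^ p * (C * (‖v‖ + ε) ^ p + (M * ε) ^ p) := fun ε hε => by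
    obtain ⟨g, hg, hgp⟩ := (Lp.memLp v).exists_boundedContinuous_eLpNorm_sub_le
      ENNReal.ofReal_ne_top (ENNReal.ofReal_pos.2 hε).ne'
    set u := hgp.toLp g
    have hug : u =ᵐ[ψ] g := hgp.coeFn_toLp
    have huv : ‖v - u‖ ≤ ε := by
      refine ENNReal.toReal_le_of_le_ofReal hε.le (le_trans (le_of_eq (eLpNorm_congr_ae ?_)) hg)
      filter_upwards [hug, Lp.coeFn_sub v u] with y h2 h3
      rw [h3, Pi.sub_apply, Pi.sub_apply, h2]
    have hu : ‖u‖ ≤ ‖v‖ + ε := by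
      have := norm_sub_norm_le u v
      rw [norm_sub_rev] at this
      linarith
    have hTu : ∀ z, transform ψ cauchyKernel u z = transform ψ cauchyKernel g z := fun z =>
      integral_congr_ae (by filter_upwards [hug] with y hy; rw [hy])
    have h2 : ∫ z, ‖transform ψ cauchyKernel u (r • z)‖ ^ p ∂ψ ≤ C * (‖v‖ + ε) ^ p := by
      simp only [hTu]
      refine (integral_rpow_norm_transform_le_of_continuousOn hψ hC h0 h1
        g.continuous.continuousOn).trans (mul_le_mul_of_nonneg_left ?_ hC0)
      calc ∫ z, ‖g z‖ ^ p ∂ψ = ‖u‖ ^ p := by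
            rw [norm_rpow_eq_integral hp]
            refine integral_congr_ae ?_
            filter_upwards [hug] with y hy
            rw [hy]
        _ ≤ _ := by gcongr
    have h3 : ∫ z, ‖transform ψ cauchyKernel v (r • z) - transform ψ cauchyKernel u (r • z)‖ ^ p ∂ψ
        ≤ (M * ε) ^ p := by
      refine integral_rpow_norm_le hψ hp0 fun z hz => ?_
      have hκ : ContinuousOn (fun y => cauchyKernel (r • (y * star z))) (sphere 0 1) :=
        continuousOn_cauchyKernel.comp (f := fun y => r • (y * star z)) (by fun_prop) fun y hy =>
          smul_mul_star_ne_one (mem_sphere_zero_iff_norm.1 hy) hz h0 h1.ne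
      simp only [transform, mul_star_real_smul]
      rw [← integral_sub_mul hψ v u hκ]
      refine (norm_integral_mul_le hψ (v - u) fun y hy =>
        norm_cauchyKernel_smul_mul_star_le hy hz h0 h1).trans ?_
      gcongr
    have hcu := hcont (integrable_coeFn u)
    have hcd : ContinuousOn (fun z => transform ψ cauchyKernel v (r • z) -
        transform ψ cauchyKernel u (r • z)) (sphere 0 1) := (hcont (integrable_coeFn v)).sub hcu
    have h4 := integral_norm_add_rpow_le hp (m := ψ)
      (integrable_of_continuousOn_sphere hψ.ae_norm (continuousOn_rpow_norm hp0 hcu))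
      (integrable_of_continuousOn_sphere hψ.ae_norm (continuousOn_rpow_norm hp0 hcd))
      (integrable_of_continuousOn_sphere hψ.ae_norm hcu).aestronglyMeasurable
      (integrable_of_continuousOn_sphere hψ.ae_norm hcd).aestronglyMeasurable
    simp only [add_sub_cancel] at h4
    refine h4.trans ?_
    gcongr
  have hlim : Filter.Tendsto (fun ε : ℝ => 2 ^ p * (C * (‖v‖ + ε) ^ p + (M * ε) ^ p))
      (nhdsWithin 0 (Set.Ioi 0)) (nhds (2 ^ p * (C * (‖v‖ + 0) ^ p + (M * 0) ^ p))) := by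
    have h : Continuous fun ε : ℝ => 2 ^ p * (C * (‖v‖ + ε) ^ p + (M * ε) ^ p) := by
      have h5 := Real.continuous_rpow_const hp0
      exact continuous_const.mul ((continuous_const.mul (h5.comp (by fun_prop :
        Continuous fun ε : ℝ => ‖v‖ + ε))).add (h5.comp (by fun_prop : Continuous fun ε => M * ε)))
    exact (h.tendsto 0).mono_left nhdsWithin_le_nhds
  have h6 := ge_of_tendsto hlim (by filter_upwards [self_mem_nhdsWithin] with ε hε using key ε hε)
  rw [add_zero, mul_zero, Real.zero_rpow (by linarith), add_zero] at h6
  linarith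

/-- The transform with kernel `hardyKernel p` is bounded from `L^p` to the Hardy space. -/
theorem exists_integral_rpow_norm_transform_hardyKernel_le (hψ : IsSphereMeasure ψ) {p : ℝ}
    [Fact (1 ≤ ENNReal.ofReal p)] (hp : 1 < p) :
    ∃ C : ℝ, 0 ≤ C ∧ ∀ (v : Lp ℍ[ℝ] (ENNReal.ofReal p) ψ) (r : ℝ), 0 < r → r < 1 →
      ∫ z, ‖transform ψ (hardyKernel p) v (r • z)‖ ^ p ∂ψ ≤ C * ‖v‖ ^ p * r ^ 3 := by
  have := hψ.isProbabilityMeasure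
  have hp0 : 0 ≤ p := by linarith
  obtain ⟨C, hC0, hC⟩ := exists_integral_rpow_norm_transform_cauchyKernel_le hψ hp
  refine ⟨10054 ^ p + 8 * (2 ^ p * (C + 54 ^ p)), by positivity, fun v r h0 h1 => ?_⟩
  rcases le_or_gt r (1 / 2) with h2 | h2
  · have h3 := integral_rpow_norm_le hψ hp0 (M := 10054 * r ^ (3 / p) * ‖v‖)
      (f := fun z => transform ψ (hardyKernel p) v (r • z)) fun z hz => by
        simp only [transform, mul_star_real_smul]
        refine norm_integral_mul_le hψ v fun y hy => ?_
        have h4 := norm_smul_mul_star hy hz h0.le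
        have h5 := norm_hardyKernel_le hp (x := r • (y * star z)) (by rwa [h4])
        rwa [h4] at h5
    refine h3.trans ?_
    have h4 : (r ^ (3 / p)) ^ p = r ^ 3 := by
      rw [← Real.rpow_mul h0.le, div_mul_cancel₀ _ (by linarith : p ≠ 0), ← Real.rpow_natCast]
      norm_num
    rw [Real.mul_rpow (by positivity) (by positivity), Real.mul_rpow (by positivity)
      (by positivity), h4, add_mul, add_mul]
    have h5 : 0 ≤ 8 * (2 ^ p * (C + 54 ^ p)) * ‖v‖ ^ p * r ^ 3 := by positivity
    linarith
  · have hcont := (isMonogenic_transform_cauchyKernel hψ (integrable_coeFn v)).continuousOn_smul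
      h0.le h1
    have hcont' := (isMonogenic_transform_hardyKernel hψ p (integrable_coeFn v)).continuousOn_smul
      h0.le h1
    have hcd : ContinuousOn (fun z => transform ψ (hardyKernel p) v (r • z) -
      transform ψ cauchyKernel v (r • z)) (sphere 0 1) := hcont'.sub hcont
    have h3 : ∫ z, ‖transform ψ (hardyKernel p) v (r • z) -
        transform ψ cauchyKernel v (r • z)‖ ^ p ∂ψ ≤ (54 * ‖v‖) ^ p := by
      refine integral_rpow_norm_le hψ hp0 fun z hz => ?_
      have hκ : Integrable (fun y => v y * cauchyKernel (r • (y * star z))) ψ :=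
        integrable_mul_of_continuousOn hψ (integrable_coeFn _)
          (continuousOn_cauchyKernel.comp (f := fun y => r • (y * star z)) (by fun_prop) fun y hy =>
          smul_mul_star_ne_one (mem_sphere_zero_iff_norm.1 hy) hz h0.le h1.ne)
      have hκ' : Integrable (fun y => v y * hardyKernel p (r • (y * star z))) ψ := by
        refine integrable_mul_of_continuousOn hψ (integrable_coeFn _)
          ((continuousOn_of_hasFDerivAt (hasFDerivAt_hardyKernel p)).comp
            (f := fun y => r • (y * star z)) (by fun_prop) fun y hy => ?_)
        rwa [mem_ball_zero_iff, norm_smul_mul_star (mem_sphere_zero_iff_norm.1 hy) hz h0.le]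
      simp only [transform, mul_star_real_smul]
      rw [← integral_sub hκ' hκ]
      simp only [← mul_sub]
      refine norm_integral_mul_le hψ v fun y hy => ?_
      rw [hardyKernel, sub_sub_cancel_left, norm_neg]
      refine (norm_sum_le_of_le _ (n := fun _ => 18) fun n _ => (norm_zonal_le n _).trans ?_).trans ?_
      · rw [norm_smul_mul_star hy hz h0.le]
        have := pow_le_one₀ h0.le h1.le (n := n)
        linarith
      · rw [Finset.sum_const, nsmul_eq_mul]
        have h4 : ((lowDegrees p).card : ℝ) ≤ 3 := by
          exact_mod_cast (Finset.card_filter_le _ _).trans_eq (Finset.card_range 3)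
        linarith
    have h4 := integral_norm_add_rpow_le hp (m := ψ)
      (integrable_of_continuousOn_sphere hψ.ae_norm (continuousOn_rpow_norm hp0 hcont))
      (integrable_of_continuousOn_sphere hψ.ae_norm (continuousOn_rpow_norm hp0 hcd))
      (integrable_of_continuousOn_sphere hψ.ae_norm hcont).aestronglyMeasurable
      (integrable_of_continuousOn_sphere hψ.ae_norm hcd).aestronglyMeasurable
    simp only [add_sub_cancel] at h4
    rw [Real.mul_rpow (by norm_num) (norm_nonneg _)] at h3
    have h5 : 1 ≤ 8 * r ^ 3 := by
      calc (1 : ℝ) = 8 * (1 / 2) ^ 3 := by norm_num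
        _ ≤ _ := by gcongr
    calc _ ≤ 2 ^ p * (C * ‖v‖ ^ p + 54 ^ p * ‖v‖ ^ p) := by
          refine h4.trans ?_
          have := hC v r h0.le h1
          gcongr
      _ ≤ 2 ^ p * (C * ‖v‖ ^ p + 54 ^ p * ‖v‖ ^ p) * (8 * r ^ 3) :=
          le_mul_of_one_le_right (by positivity) h5
      _ ≤ _ := by
          have h6 : 0 ≤ 10054 ^ p * ‖v‖ ^ p * r ^ 3 := by positivity
          linarith

end

section

variable {ψ : Measure ℍ[ℝ]} {p : ℝ}

theorem hardyNorm_le (hp : 1 < p) {f : ℍ[ℝ] → ℍ[ℝ]} {D : ℝ} (hD : 0 ≤ D)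
    (h : ∀ r : ℝ, 0 < r → r ≤ 1 →
      ∫⁻ y, ENNReal.ofReal (‖f (r • y)‖ ^ p) ∂ψ ≤ ENNReal.ofReal (D ^ p * r ^ 3)) :
    hardyNorm ψ p f ≤ ENNReal.ofReal D := by
  have hp0 : 0 < p := by linarith
  have h1 : (⨆ r ∈ Set.Ioc (0 : ℝ) 1, ENNReal.ofReal (r ^ (-(3 : ℝ))) *
      ∫⁻ y, ENNReal.ofReal (‖f (r • y)‖ ^ p) ∂ψ) ≤ ENNReal.ofReal (D ^ p) := by
    refine iSup₂_le fun r hr => ?_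
    refine (mul_le_mul_right (h r hr.1 hr.2) _).trans_eq ?_
    rw [← ENNReal.ofReal_mul (Real.rpow_nonneg hr.1.le _), Real.rpow_neg hr.1.le]
    congr 1
    have : r ^ (3 : ℝ) = r ^ 3 := by exact_mod_cast Real.rpow_natCast r 3
    rw [this]
    have := hr.1.ne'
    field_simp
  refine (ENNReal.rpow_le_rpow h1 (by positivity)).trans_eq ?_
  rw [ENNReal.ofReal_rpow_of_nonneg (by positivity) (by positivity), ← Real.rpow_mul hD,
    mul_one_div_cancel hp0.ne', Real.rpow_one]

theorem lintegral_le_hardyNorm (hp : 1 < p) {f : ℍ[ℝ] → ℍ[ℝ]} (hf : hardyNorm ψ p f < ⊤) {r : ℝ}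
    (h0 : 0 < r) (h1 : r ≤ 1) : ∫⁻ y, ENNReal.ofReal (‖f (r • y)‖ ^ p) ∂ψ ≤
      ENNReal.ofReal ((hardyNorm ψ p f).toReal ^ p * r ^ 3) := by
  have hp0 : 0 < p := by linarith
  have h2 : ENNReal.ofReal (r ^ (-(3 : ℝ))) * ∫⁻ y, ENNReal.ofReal (‖f (r • y)‖ ^ p) ∂ψ ≤
      hardyNorm ψ p f ^ p := by
    rw [hardyNorm, ← ENNReal.rpow_mul, one_div_mul_cancel hp0.ne', ENNReal.rpow_one]
    exact le_iSup₂ (f := fun r (_ : r ∈ Set.Ioc (0 : ℝ) 1) => ENNReal.ofReal (r ^ (-(3 : ℝ))) *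
      ∫⁻ y, ENNReal.ofReal (‖f (r • y)‖ ^ p) ∂ψ) r ⟨h0, h1⟩
  have h3 : r ^ (-(3 : ℝ)) = (r ^ 3)⁻¹ := by
    rw [Real.rpow_neg h0.le]
    exact_mod_cast congrArg _ (Real.rpow_natCast r 3)
  have h4 := mul_le_mul_right h2 (ENNReal.ofReal (r ^ 3))
  rw [← mul_assoc, ← ENNReal.ofReal_mul (by positivity), h3, mul_inv_cancel₀ (by positivity),
    ENNReal.ofReal_one, one_mul] at h4
  refine h4.trans_eq ?_
  rw [mul_comm (_ ^ p : ℝ), ENNReal.ofReal_mul (by positivity),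
    ← ENNReal.ofReal_rpow_of_nonneg ENNReal.toReal_nonneg hp0.le, ENNReal.ofReal_toReal hf.ne]

theorem slice_congr (hψ : IsSphereMeasure ψ) {f g : ℍ[ℝ] → ℍ[ℝ]}
    {f' g' : ℍ[ℝ] → ℍ[ℝ] →L[ℝ] ℍ[ℝ]} (hf : IsMonogenic f f') (hg : IsMonogenic g g')
    (h : ∀ z, ‖z‖ < 1 → f z = g z) {r : ℝ} (h0 : 0 ≤ r) (h1 : r < 1) :
    slice ψ p f r = slice ψ p g r := by
  refine Lp.ext ?_
  filter_upwards [hf.coeFn_slice hψ (p := p) h0 h1, hg.coeFn_slice hψ (p := p) h0 h1, hψ.ae_norm]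
    with y hfy hgy hy
  rw [hfy, hgy, h _ (by rwa [norm_smul, hy, mul_one, Real.norm_of_nonneg h0])]

theorem integrable_mul_hardyKernel (hψ : IsSphereMeasure ψ) {v : ℍ[ℝ] → ℍ[ℝ]}
    (hv : Integrable v ψ) {z : ℍ[ℝ]} (hz : ‖z‖ < 1) :
    Integrable (fun y => v y * hardyKernel p (y * star z)) ψ :=
  integrable_mul_of_continuousOn hψ hv
    (continuousOn_kernel_mul_star (continuousOn_of_hasFDerivAt (hasFDerivAt_hardyKernel p)) hz)

variable [Fact (1 ≤ ENNReal.ofReal p)]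

theorem bdry_congr (hψ : IsSphereMeasure ψ) {f g : ℍ[ℝ] → ℍ[ℝ]}
    {f' g' : ℍ[ℝ] → ℍ[ℝ] →L[ℝ] ℍ[ℝ]} (hf : IsMonogenic f f') (hg : IsMonogenic g g')
    (h : ∀ z, ‖z‖ < 1 → f z = g z) : bdry ψ p f = bdry ψ p g := by
  have h1 : slice ψ p f =ᶠ[nhdsWithin 1 (Set.Iio 1)] slice ψ p g := by
    filter_upwards [Ioo_mem_nhdsLT one_pos] with r hr using slice_congr hψ hf hg h hr.1.le hr.2
  rw [bdry, bdry, Filter.limUnder, Filter.limUnder, Filter.map_congr h1]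

theorem transform_add (hψ : IsSphereMeasure ψ) (u v : Lp ℍ[ℝ] (ENNReal.ofReal p) ψ) {z : ℍ[ℝ]}
    (hz : ‖z‖ < 1) : transform ψ (hardyKernel p) (u + v : Lp ℍ[ℝ] (ENNReal.ofReal p) ψ) z =
      transform ψ (hardyKernel p) u z + transform ψ (hardyKernel p) v z := by
  have := hψ.isProbabilityMeasure
  simp only [transform]
  rw [← integral_add (integrable_mul_hardyKernel hψ (integrable_coeFn u) hz)
    (integrable_mul_hardyKernel hψ (integrable_coeFn v) hz)]
  refine integral_congr_ae ?_
  filter_upwards [Lp.coeFn_add u v] with y hy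
  rw [hy, Pi.add_apply, add_mul]

theorem transform_smul (hψ : IsSphereMeasure ψ) (a : ℍ[ℝ]) (v : Lp ℍ[ℝ] (ENNReal.ofReal p) ψ)
    {z : ℍ[ℝ]} (hz : ‖z‖ < 1) :
    transform ψ (hardyKernel p) (a • v : Lp ℍ[ℝ] (ENNReal.ofReal p) ψ) z =
      a * transform ψ (hardyKernel p) v z := by
  have := hψ.isProbabilityMeasure
  simp only [transform]
  rw [← integral_const_mul_of_integrable (integrable_mul_hardyKernel hψ (integrable_coeFn v) hz)]
  refine integral_congr_ae ?_
  filter_upwards [Lp.coeFn_smul a v] with y hy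
  rw [hy, Pi.smul_apply, smul_eq_mul, mul_assoc]

/-- `f` is given by the transform of `b` in the ball, where `b` is the boundary value of this
transform, and by `s` on the sphere. -/
structure Represents (f : ℍ[ℝ] → ℍ[ℝ]) (b s : Lp ℍ[ℝ] (ENNReal.ofReal p) ψ) : Prop where
  measurable : Measurable f
  eq_transform : ∀ z, ‖z‖ < 1 → f z = transform ψ (hardyKernel p) b z
  bdry_eq : bdry ψ p (transform ψ (hardyKernel p) b) = b
  coeFn_eq : s =ᵐ[ψ] f

theorem isMonogenic_transform_coeFn (hψ : IsSphereMeasure ψ)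
    (v : Lp ℍ[ℝ] (ENNReal.ofReal p) ψ) : IsMonogenic (transform ψ (hardyKernel p) v)
      (fderiv ℝ (transform ψ (hardyKernel p) v)) :=
  have := hψ.isProbabilityMeasure
  isMonogenic_transform_hardyKernel hψ p (integrable_coeFn v)

theorem Represents.unique (hψ : IsSphereMeasure ψ) {f : ℍ[ℝ] → ℍ[ℝ]}
    {b s b' s' : Lp ℍ[ℝ] (ENNReal.ofReal p) ψ} (h : Represents f b s) (h' : Represents f b' s') :
    b = b' ∧ s = s' := by
  refine ⟨?_, Lp.ext (h.coeFn_eq.trans h'.coeFn_eq.symm)⟩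
  rw [← h.bdry_eq, ← h'.bdry_eq]
  exact bdry_congr hψ (isMonogenic_transform_coeFn hψ b) (isMonogenic_transform_coeFn hψ b')
    fun z hz => by rw [← h.eq_transform z hz, h'.eq_transform z hz]

/-- Every function of `K_p` is represented by its two boundary values. -/
theorem exists_represents (hψ : IsSphereMeasure ψ) (hp : 1 < p) {f : ℍ[ℝ] → ℍ[ℝ]}
    (hf : memKp ψ p f) : ∃ b s : Lp ℍ[ℝ] (ENNReal.ofReal p) ψ, Represents f b s ∧
      ‖b‖ ≤ (hardyNorm ψ p f).toReal ∧ ‖s‖ ≤ (hardyNorm ψ p f).toReal := by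
  have := hψ.isProbabilityMeasure
  have hp0 : 0 < p := by linarith
  obtain ⟨hm, hc, hd, hN⟩ := hf
  set N := (hardyNorm ψ p f).toReal with hNdef
  have hN0 : 0 ≤ N := ENNReal.toReal_nonneg
  have hmono := isMonogenic_of_contDiffOn hc hd
  have hI : ∀ r : ℝ, 0 < r → r < 1 → ∫ y, ‖f (r • y)‖ ^ p ∂ψ ≤ N ^ p * r ^ 3 := fun r h0 h1 => by
    have h2 := lintegral_le_hardyNorm hp hN h0 h1.le
    rw [← ofReal_integral_eq_lintegral_ofReal (integrable_of_continuousOn_sphere hψ.ae_norm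
      (continuousOn_rpow_norm hp0.le (hmono.continuousOn_smul h0.le h1)))
      (Filter.Eventually.of_forall fun _ => by positivity)] at h2
    exact (ENNReal.ofReal_le_ofReal_iff (by positivity)).1 h2
  have hI' : ∀ r : ℝ, 0 < r → r < 1 → ∫ y, ‖f (r • y)‖ ^ p ∂ψ ≤ N ^ p := fun r h0 h1 =>
    (hI r h0 h1).trans (mul_le_of_le_one_right (by positivity) (pow_le_one₀ h0.le h1.le))
  have hone := lintegral_le_hardyNorm hp hN one_pos le_rfl
  simp only [one_smul, one_pow, mul_one] at hone
  have hLp : MemLp f (ENNReal.ofReal p) ψ :=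
    (memLp_ofReal_iff hp hm.aestronglyMeasurable).2 (hone.trans_lt ENNReal.ofReal_lt_top)
  have heq : ∀ z, ‖z‖ < 1 → f z = transform ψ (hardyKernel p) (bdry ψ p f) z := fun z hz =>
    hmono.eq_transform_bdry hψ hp (by positivity) hI hz
  refine ⟨bdry ψ p f, hLp.toLp f, ⟨hm, heq, ?_, hLp.coeFn_toLp⟩, ?_, ?_⟩
  · exact (bdry_congr hψ hmono (isMonogenic_transform_coeFn hψ _) heq).symm
  · rw [← Real.rpow_le_rpow_iff (norm_nonneg _) hN0 hp0]
    exact hmono.norm_bdry_rpow_le hψ hp hI'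
  · rw [← Real.rpow_le_rpow_iff (norm_nonneg _) hN0 hp0,
      ← ENNReal.ofReal_le_ofReal_iff (by positivity), norm_rpow_eq_lintegral hp]
    refine le_trans (le_of_eq (lintegral_congr_ae ?_)) hone
    filter_upwards [hLp.coeFn_toLp] with y hy
    rw [hy]

/-- A represented function belongs to `K_p`, with control of its norm. -/
theorem exists_hardyNorm_le_of_represents (hψ : IsSphereMeasure ψ) (hp : 1 < p) :
    ∃ C : ℝ, 0 ≤ C ∧ ∀ (f : ℍ[ℝ] → ℍ[ℝ]) (b s : Lp ℍ[ℝ] (ENNReal.ofReal p) ψ), Represents f b s →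
      memKp ψ p f ∧ hardyNorm ψ p f ≤ ENNReal.ofReal (C * (‖b‖ + ‖s‖)) := by
  have := hψ.isProbabilityMeasure
  have hp0 : 0 < p := by linarith
  obtain ⟨C, hC0, hC⟩ := exists_integral_rpow_norm_transform_hardyKernel_le hψ hp
  refine ⟨(C + 1) ^ (1 / p), by positivity, fun f b s h => ?_⟩
  have hmono := isMonogenic_transform_coeFn hψ b
  have hD : ((C + 1) ^ (1 / p) * (‖b‖ + ‖s‖)) ^ p = (C + 1) * (‖b‖ + ‖s‖) ^ p := by
    rw [Real.mul_rpow (by positivity) (by positivity), ← Real.rpow_mul (by positivity),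
      one_div_mul_cancel hp0.ne', Real.rpow_one]
  have hN : hardyNorm ψ p f ≤ ENNReal.ofReal ((C + 1) ^ (1 / p) * (‖b‖ + ‖s‖)) := by
    refine hardyNorm_le hp (by positivity) fun r h0 h1 => ?_
    rw [hD]
    rcases h1.lt_or_eq with h1 | rfl
    · have h2 : ∫⁻ y, ENNReal.ofReal (‖f (r • y)‖ ^ p) ∂ψ =
          ENNReal.ofReal (∫ y, ‖transform ψ (hardyKernel p) b (r • y)‖ ^ p ∂ψ) := by
        rw [ofReal_integral_eq_lintegral_ofReal (integrable_of_continuousOn_sphere hψ.ae_norm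
          (continuousOn_rpow_norm hp0.le (hmono.continuousOn_smul h0.le h1)))
          (Filter.Eventually.of_forall fun _ => by positivity)]
        refine lintegral_congr_ae ?_
        filter_upwards [hψ.ae_norm] with y hy
        rw [h.eq_transform _ (by rwa [norm_smul, hy, mul_one, Real.norm_of_nonneg h0.le])]
      rw [h2]
      refine ENNReal.ofReal_le_ofReal ((hC b r h0 h1).trans ?_)
      have h3 : ‖b‖ ^ p ≤ (‖b‖ + ‖s‖) ^ p := by
        gcongr
        exact le_add_of_nonneg_right (norm_nonneg _)
      gcongr
      linarith
    · have h2 : ∫⁻ y, ENNReal.ofReal (‖f ((1 : ℝ) • y)‖ ^ p) ∂ψ = ENNReal.ofReal (‖s‖ ^ p) := by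
        rw [norm_rpow_eq_lintegral hp]
        refine lintegral_congr_ae ?_
        filter_upwards [h.coeFn_eq] with y hy
        rw [hy, one_smul]
      rw [h2, one_pow, mul_one]
      refine ENNReal.ofReal_le_ofReal ?_
      have h3 : ‖s‖ ^ p ≤ (‖b‖ + ‖s‖) ^ p := by
        gcongr
        exact le_add_of_nonneg_left (norm_nonneg _)
      have h4 : 0 ≤ C * (‖b‖ + ‖s‖) ^ p := by positivity
      linarith
  have heq : Set.EqOn f (transform ψ (hardyKernel p) b) (ball 0 1) := fun z hz =>
    h.eq_transform z (mem_ball_zero_iff.1 hz)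
  refine ⟨⟨h.measurable, ?_, fun z hz => ?_, hN.trans_lt ENNReal.ofReal_lt_top⟩, hN⟩
  · exact (contDiffOn_transform hψ (hasFDerivAt_hardyKernel p)
      (continuousOn_hardyKernelDeriv p) (integrable_coeFn b)).congr heq
  · have h2 := (heq.eventuallyEq_of_mem (isOpen_ball.mem_nhds hz)).fderiv_eq (𝕜 := ℝ)
    have h3 := hmono.dirac z (mem_ball_zero_iff.1 hz)
    rw [Dirac, h2]
    exact h3

theorem Represents.exists_of_bdry_eq (hψ : IsSphereMeasure ψ)
    {b : Lp ℍ[ℝ] (ENNReal.ofReal p) ψ} (hb : bdry ψ p (transform ψ (hardyKernel p) b) = b)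
    (s : Lp ℍ[ℝ] (ENNReal.ofReal p) ψ) : ∃ f, Represents f b s := by
  classical
  have hcont := (isMonogenic_transform_coeFn hψ b).continuousOn
  have hsm : AEStronglyMeasurable s ψ := Lp.aestronglyMeasurable s
  have hrest : Measurable (hsm.mk s) := hsm.stronglyMeasurable_mk.measurable
  refine ⟨(ball (0 : ℍ[ℝ]) 1).piecewise (transform ψ (hardyKernel p) b) (hsm.mk s),
    ?_, fun z hz => Set.piecewise_eq_of_mem _ _ _ (mem_ball_zero_iff.2 hz), hb, ?_⟩
  · refine measurable_of_restrict_of_restrict_compl (s := ball (0 : ℍ[ℝ]) 1) measurableSet_ball ?_ ?_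
    · rw [Set.domRestrict_piecewise]
      exact (continuousOn_iff_continuous_domRestrict.1 hcont).measurable
    · rw [Set.domRestrict_piecewise_compl]
      exact hrest.comp measurable_subtype_coe
  · filter_upwards [hsm.ae_eq_mk, hψ.ae_norm] with y hy hy1
    rw [Set.piecewise_eq_of_notMem _ _ _ (by simp [hy1]), hy]

end

section

variable {ψ : Measure ℍ[ℝ]} {p : ℝ} [Fact (1 ≤ ENNReal.ofReal p)]

theorem exists_integral_rpow_norm_transform_coeFn_le (hψ : IsSphereMeasure ψ) (hp : 1 < p) :
    ∃ C : ℝ, 0 ≤ C ∧ ∀ (v : Lp ℍ[ℝ] (ENNReal.ofReal p) ψ) (r : ℝ), 0 < r → r < 1 →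
      ∫ y, ‖transform ψ (hardyKernel p) v (r • y)‖ ^ p ∂ψ ≤ C * ‖v‖ ^ p := by
  obtain ⟨C, hC0, hC⟩ := exists_integral_rpow_norm_transform_hardyKernel_le hψ hp
  exact ⟨C, hC0, fun v r h0 h1 => (hC v r h0 h1).trans
    (mul_le_of_le_one_right (by positivity) (pow_le_one₀ h0.le h1.le))⟩

theorem coeFn_slice_transform (hψ : IsSphereMeasure ψ) (v : Lp ℍ[ℝ] (ENNReal.ofReal p) ψ) {r : ℝ}
    (h0 : 0 ≤ r) (h1 : r < 1) : slice ψ p (transform ψ (hardyKernel p) v) r =ᵐ[ψ]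
      fun y => transform ψ (hardyKernel p) v (r • y) :=
  (isMonogenic_transform_coeFn hψ v).coeFn_slice hψ h0 h1

theorem tendsto_slice_transform (hψ : IsSphereMeasure ψ) (hp : 1 < p)
    (v : Lp ℍ[ℝ] (ENNReal.ofReal p) ψ) :
    Filter.Tendsto (slice ψ p (transform ψ (hardyKernel p) v)) (nhdsWithin 1 (Set.Iio 1))
      (nhds (bdry ψ p (transform ψ (hardyKernel p) v))) := by
  obtain ⟨C, -, hC⟩ := exists_integral_rpow_norm_transform_coeFn_le hψ hp
  exact (isMonogenic_transform_coeFn hψ v).tendsto_slice hψ hp (hC v)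

/-- The Hardy projection: the boundary value of the transform. -/
noncomputable def hardyProj (hψ : IsSphereMeasure ψ) (hp : 1 < p) :
    Lp ℍ[ℝ] (ENNReal.ofReal p) ψ →ₗ[ℍ[ℝ]] Lp ℍ[ℝ] (ENNReal.ofReal p) ψ where
  toFun v := bdry ψ p (transform ψ (hardyKernel p) v)
  map_add' u v := by
    refine tendsto_nhds_unique (tendsto_slice_transform hψ hp (u + v)) (Filter.Tendsto.congr' ?_
      ((tendsto_slice_transform hψ hp u).add (tendsto_slice_transform hψ hp v)))
    filter_upwards [Ioo_mem_nhdsLT one_pos] with r hr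
    refine Lp.ext ?_
    filter_upwards [Lp.coeFn_add (slice ψ p (transform ψ (hardyKernel p) u) r)
      (slice ψ p (transform ψ (hardyKernel p) v) r), coeFn_slice_transform hψ u hr.1.le hr.2,
      coeFn_slice_transform hψ v hr.1.le hr.2, coeFn_slice_transform hψ (u + v) hr.1.le hr.2,
      hψ.ae_norm] with y h1 h2 h3 h4 hy
    rw [h1, h4, Pi.add_apply, h2, h3, transform_add hψ u v
      (by rw [norm_smul, hy, mul_one, Real.norm_of_nonneg hr.1.le]; exact hr.2)]
  map_smul' a v := by
    refine tendsto_nhds_unique (tendsto_slice_transform hψ hp (a • v)) (Filter.Tendsto.congr' ?_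
      ((tendsto_slice_transform hψ hp v).const_smul a))
    filter_upwards [Ioo_mem_nhdsLT one_pos] with r hr
    refine Lp.ext ?_
    filter_upwards [Lp.coeFn_smul a (slice ψ p (transform ψ (hardyKernel p) v) r),
      coeFn_slice_transform hψ v hr.1.le hr.2, coeFn_slice_transform hψ (a • v) hr.1.le hr.2,
      hψ.ae_norm] with y h1 h3 h4 hy
    rw [h1, h4, Pi.smul_apply, h3, smul_eq_mul, transform_smul hψ a v
      (by rw [norm_smul, hy, mul_one, Real.norm_of_nonneg hr.1.le]; exact hr.2)]

theorem exists_norm_hardyProj_le (hψ : IsSphereMeasure ψ) (hp : 1 < p) :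
    ∃ C : ℝ, 0 ≤ C ∧ ∀ v, ‖hardyProj hψ hp v‖ ≤ C * ‖v‖ := by
  have hp0 : 0 < p := by linarith
  obtain ⟨C, hC0, hC⟩ := exists_integral_rpow_norm_transform_coeFn_le hψ hp
  refine ⟨C ^ (1 / p), by positivity, fun v => ?_⟩
  rw [← Real.rpow_le_rpow_iff (norm_nonneg _) (by positivity) hp0,
    Real.mul_rpow (by positivity) (by positivity), ← Real.rpow_mul hC0,
    one_div_mul_cancel hp0.ne', Real.rpow_one]
  exact (isMonogenic_transform_coeFn hψ v).norm_bdry_rpow_le hψ hp (hC v)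

theorem hardyProj_hardyProj (hψ : IsSphereMeasure ψ) (hp : 1 < p)
    (v : Lp ℍ[ℝ] (ENNReal.ofReal p) ψ) :
    hardyProj hψ hp (hardyProj hψ hp v) = hardyProj hψ hp v := by
  obtain ⟨C, hC0, hC⟩ := exists_integral_rpow_norm_transform_hardyKernel_le hψ hp
  refine (bdry_congr hψ (isMonogenic_transform_coeFn hψ v) (isMonogenic_transform_coeFn hψ _)
    fun z hz => ?_).symm
  exact (isMonogenic_transform_coeFn hψ v).eq_transform_bdry hψ hp
    (A := C * ‖v‖ ^ p) (by positivity) (hC v) hz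

theorem Represents.hardyProj_eq {f : ℍ[ℝ] → ℍ[ℝ]} {b s : Lp ℍ[ℝ] (ENNReal.ofReal p) ψ}
    (h : Represents f b s) (hψ : IsSphereMeasure ψ) (hp : 1 < p) : hardyProj hψ hp b = b :=
  h.bdry_eq

theorem Represents.add (hψ : IsSphereMeasure ψ) (hp : 1 < p) {f g : ℍ[ℝ] → ℍ[ℝ]}
    {b s c t : Lp ℍ[ℝ] (ENNReal.ofReal p) ψ} (h : Represents f b s) (h' : Represents g c t) :
    Represents (fun z => f z + g z) (b + c) (s + t) where
  measurable := h.measurable.add h'.measurable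
  eq_transform z hz := by
    rw [h.eq_transform z hz, h'.eq_transform z hz, transform_add hψ b c hz]
  bdry_eq := ((hardyProj hψ hp).map_add b c).trans (congrArg₂ _ h.bdry_eq h'.bdry_eq)
  coeFn_eq := (Lp.coeFn_add s t).trans (h.coeFn_eq.add h'.coeFn_eq)

theorem Represents.const_mul (hψ : IsSphereMeasure ψ) (hp : 1 < p) {f : ℍ[ℝ] → ℍ[ℝ]}
    {b s : Lp ℍ[ℝ] (ENNReal.ofReal p) ψ} (a : ℍ[ℝ]) (h : Represents f b s) :
    Represents (fun z => a * f z) (a • b) (a • s) where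
  measurable := (continuous_const_mul a).measurable.comp h.measurable
  eq_transform z hz := by rw [h.eq_transform z hz, transform_smul hψ a b hz]
  bdry_eq := ((hardyProj hψ hp).map_smul a b).trans (congrArg _ h.bdry_eq)
  coeFn_eq := by
    filter_upwards [Lp.coeFn_smul a s, h.coeFn_eq] with y h1 h2
    rw [h1, Pi.smul_apply, h2, smul_eq_mul]

theorem Represents.sub_sum (hψ : IsSphereMeasure ψ) (hp : 1 < p) {f : ℍ[ℝ] → ℍ[ℝ]}
    {b s : Lp ℍ[ℝ] (ENNReal.ofReal p) ψ} (h : Represents f b s) {w : ℕ → ℍ[ℝ] → ℍ[ℝ]}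
    {c t : ℕ → Lp ℍ[ℝ] (ENNReal.ofReal p) ψ} (hw : ∀ m, Represents (w m) (c m) (t m))
    (a : ℕ → ℍ[ℝ]) (F : Finset ℕ) : Represents (fun z => f z - ∑ m ∈ F, a m * w m z)
      (b - ∑ m ∈ F, a m • c m) (s - ∑ m ∈ F, a m • t m) := by
  induction F using Finset.induction_on with
  | empty => simpa using h
  | insert m F hm ih =>
    have := ih.add hψ hp ((hw m).const_mul hψ hp (-a m))
    simp only [Finset.sum_insert hm]
    convert this using 1
    · funext z
      rw [neg_mul]
      abel
    · rw [neg_smul]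
      abel
    · rw [neg_smul]
      abel

end

section

section Swindle

variable {D V W : Type*} [NormedDivisionRing D] [NormedAddCommGroup V] [Module D V]
  [NormedAddCommGroup W] {p : ℝ}

theorem norm_add_rpow_le (hp : 1 < p) (x y : V) :
    ‖x + y‖ ^ p ≤ 2 ^ p * (‖x‖ ^ p + ‖y‖ ^ p) :=
  (Real.rpow_le_rpow (norm_nonneg _) (norm_add_le x y) (by linarith)).trans
    (add_rpow_le hp (norm_nonneg _) (norm_nonneg _))

theorem rpow_norm_le (hp : 1 < p) {u : V} {v : W} {C : ℝ} (hC : 0 ≤ C) (h : ‖u‖ ≤ C * ‖v‖) :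
    ‖u‖ ^ p ≤ C ^ p * ‖v‖ ^ p := by
  rw [← Real.mul_rpow hC (norm_nonneg _)]
  exact Real.rpow_le_rpow (norm_nonneg _) h (by linarith)

/-- The sequence of components of the image of the pair `(b, s)` under the swindle. -/
def swindleSeq (P : V →ₗ[D] V) (R : ℕ → V →ₗ[D] V) (b s : V) : ℕ → V
  | 0 => b + (R 0 s - P (R 0 s))
  | n + 1 => P (R n s) + (R (n + 1) s - P (R (n + 1) s))

theorem swindleSeq_add (P : V →ₗ[D] V) (R : ℕ → V →ₗ[D] V) (b s b' s' : V) (n : ℕ) :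
    swindleSeq P R (b + b') (s + s') n = swindleSeq P R b s n + swindleSeq P R b' s' n := by
  cases n <;> simp only [swindleSeq, map_add] <;> abel

theorem swindleSeq_smul (P : V →ₗ[D] V) (R : ℕ → V →ₗ[D] V) (a : D) (b s : V) (n : ℕ) :
    swindleSeq P R (a • b) (a • s) n = a • swindleSeq P R b s n := by
  cases n <;> simp only [swindleSeq, map_smul, smul_add, smul_sub]

variable {P : V →ₗ[D] V} {R : ℕ → V →ₗ[D] V} {C : ℝ}

theorem norm_sub_map_le (hP : ∀ v, ‖P v‖ ≤ C * ‖v‖) (v : V) : ‖v - P v‖ ≤ (1 + C) * ‖v‖ := by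
  rw [add_mul, one_mul]
  exact (norm_sub_le _ _).trans (add_le_add_right (hP v) _)

theorem exists_tsum_swindleSeq_le (hp : 1 < p) (hC : 0 ≤ C) (hP : ∀ v, ‖P v‖ ≤ C * ‖v‖)
    (hR : ∀ v, HasSum (fun n => ‖R n v‖ ^ p) (‖v‖ ^ p)) : ∃ A : ℝ, 0 ≤ A ∧ ∀ b s,
      Summable (fun n => ‖swindleSeq P R b s n‖ ^ p) ∧
        ∑' n, ‖swindleSeq P R b s n‖ ^ p ≤ A * (‖b‖ ^ p + ‖s‖ ^ p) := by
  have hQ := fun v => rpow_norm_le hp (by positivity) (norm_sub_map_le hP v)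
  have hP' := fun v => rpow_norm_le hp hC (hP v)
  refine ⟨2 ^ p * (1 + C ^ p + (1 + C) ^ p), by positivity, fun b s => ?_⟩
  have hs := hR s
  have hs1 := (hasSum_nat_add_iff' 1).2 hs
  rw [Finset.sum_range_one] at hs1
  have hmaj : ∀ n, ‖swindleSeq P R b s (n + 1)‖ ^ p ≤
      2 ^ p * (C ^ p * ‖R n s‖ ^ p + (1 + C) ^ p * ‖R (n + 1) s‖ ^ p) := fun n =>
    (norm_add_rpow_le hp _ _).trans (by gcongr <;> [exact hP' _; exact hQ _])
  have hmajs := ((hs.mul_left (C ^ p)).add (hs1.mul_left ((1 + C) ^ p))).mul_left (2 ^ p)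
  have hsum1 : Summable fun n => ‖swindleSeq P R b s (n + 1)‖ ^ p :=
    Summable.of_nonneg_of_le (fun n => by positivity) hmaj hmajs.summable
  have hsum : Summable fun n => ‖swindleSeq P R b s n‖ ^ p :=
    (summable_nat_add_iff (f := fun n => ‖swindleSeq P R b s n‖ ^ p) 1).1 hsum1
  refine ⟨hsum, ?_⟩
  have h0 : ‖swindleSeq P R b s 0‖ ^ p ≤ 2 ^ p * (‖b‖ ^ p + (1 + C) ^ p * ‖R 0 s‖ ^ p) :=
    (norm_add_rpow_le hp _ _).trans (by gcongr; exact hQ _)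
  have h1 := (hsum1.tsum_le_tsum hmaj hmajs.summable).trans_eq hmajs.tsum_eq
  rw [hsum.tsum_eq_zero_add]
  have h2 : 0 ≤ 2 ^ p * (C ^ p + (1 + C) ^ p) * ‖b‖ ^ p := by positivity
  have h3 : 0 ≤ (2 : ℝ) ^ p * ‖s‖ ^ p := by positivity
  linarith

theorem norm_map_le_of_hasSum (hp : 1 < p) (hR : ∀ v, HasSum (fun n => ‖R n v‖ ^ p) (‖v‖ ^ p))
    (n : ℕ) (v : V) : ‖R n v‖ ≤ ‖v‖ := by
  rw [← Real.rpow_le_rpow_iff (norm_nonneg _) (norm_nonneg _) (by linarith : 0 < p)]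
  exact le_hasSum (hR v) n fun _ _ => by positivity

theorem eq_of_forall_map_eq (hp : 1 < p) (hR : ∀ v, HasSum (fun n => ‖R n v‖ ^ p) (‖v‖ ^ p))
    {u v : V} (h : ∀ n, R n u = R n v) : u = v := by
  have h1 := hR (u - v)
  have h2 : ∀ n, ‖R n (u - v)‖ ^ p = 0 := fun n => by
    rw [map_sub, h, sub_self, norm_zero, Real.zero_rpow (by linarith)]
  simp only [h2] at h1
  have h3 := (h1.unique hasSum_zero)
  rwa [Real.rpow_eq_zero (norm_nonneg _) (by linarith), norm_eq_zero, sub_eq_zero] at h3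

/-- The Pełczyński swindle: if `P` is a bounded projection of `V` and `V` is isometric to the
`ℓᵖ`-sum of countably many copies of itself by means of `R`, then the direct sum of the range of
`P` with `V` is isomorphic to `V`. -/
theorem exists_swindle (hp : 1 < p) (hC : 0 ≤ C) (hP : ∀ v, ‖P v‖ ≤ C * ‖v‖)
    (hPP : ∀ v, P (P v) = P v) (hR : ∀ v, HasSum (fun n => ‖R n v‖ ^ p) (‖v‖ ^ p))
    (hsurj : ∀ u : ℕ → V, Summable (fun n => ‖u n‖ ^ p) → ∃ v, ∀ n, R n v = u n) :
    ∃ (T : V × V →ₗ[D] V) (A : ℝ), 0 ≤ A ∧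
      (∀ b s, ‖T (b, s)‖ ≤ A * (‖b‖ + ‖s‖)) ∧
      (∀ b s, P b = b → ‖b‖ + ‖s‖ ≤ A * ‖T (b, s)‖) ∧
      ∀ v, ∃ b s, P b = b ∧ T (b, s) = v := by
  have hp0 : 0 < p := by linarith
  obtain ⟨A, hA0, hA⟩ := exists_tsum_swindleSeq_le hp hC hP hR
  choose t ht using fun b s => hsurj _ (hA b s).1
  let T : V × V →ₗ[D] V :=
    { toFun := fun x => t x.1 x.2
      map_add' := fun x y => eq_of_forall_map_eq hp hR fun n => by
        rw [map_add, ht, ht, ht, Prod.fst_add, Prod.snd_add, swindleSeq_add]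
      map_smul' := fun a x => eq_of_forall_map_eq hp hR fun n => by
        rw [map_smul, ht, ht, Prod.smul_fst, Prod.smul_snd, swindleSeq_smul, RingHom.id_apply] }
  have hT : ∀ b s n, R n (T (b, s)) = swindleSeq P R b s n := fun b s n => ht b s n
  have hPQ : ∀ v, P (v - P v) = 0 := fun v => by rw [map_sub, hPP, sub_self]
  have hPseq0 : ∀ b s, P b = b → P (R 0 (T (b, s))) = b := fun b s hb => by
    rw [hT, swindleSeq, map_add, hPQ, hb, add_zero]
  have hQseq : ∀ b s n, P b = b → R n (T (b, s)) - P (R n (T (b, s))) =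
      R n s - P (R n s) := fun b s n hb => by
    rw [hT]
    cases n with
    | zero => rw [swindleSeq, map_add, hPQ, hb, add_zero, add_sub_cancel_left]
    | succ n => rw [swindleSeq, map_add, hPQ, hPP, add_zero, add_sub_cancel_left]
  have hPseq : ∀ b s n, P (R (n + 1) (T (b, s))) = P (R n s) := fun b s n => by
    rw [hT, swindleSeq, map_add, hPQ, hPP, add_zero]
  have hQ := fun v => rpow_norm_le hp (by positivity) (norm_sub_map_le hP v)
  have hP' := fun v => rpow_norm_le hp hC (hP v)
  have hrev : ∀ v n, ‖(R n v - P (R n v)) + P (R (n + 1) v)‖ ^ p ≤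
      2 ^ p * ((1 + C) ^ p * ‖R n v‖ ^ p + C ^ p * ‖R (n + 1) v‖ ^ p) := fun v n =>
    (norm_add_rpow_le hp _ _).trans (by gcongr <;> [exact hQ _; exact hP' _])
  have hrevs := fun v => (((hR v).mul_left ((1 + C) ^ p)).add
    (((hasSum_nat_add_iff' 1).2 (hR v)).mul_left (C ^ p))).mul_left (2 ^ p)
  have hs : ∀ b s n, P b = b → R n s =
      (R n (T (b, s)) - P (R n (T (b, s)))) + P (R (n + 1) (T (b, s))) := fun b s n hb => by
    rw [hQseq b s n hb, hPseq, sub_add_cancel]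
  set K : ℝ := (2 ^ p * ((1 + C) ^ p + C ^ p)) ^ (1 / p) with hK
  have hKp : K ^ p = 2 ^ p * ((1 + C) ^ p + C ^ p) := by
    rw [hK, ← Real.rpow_mul (by positivity), one_div_mul_cancel hp0.ne', Real.rpow_one]
  have hK0 : 0 ≤ K := by positivity
  set B : ℝ := (2 * A) ^ (1 / p) with hB
  have hBp : B ^ p = 2 * A := by
    rw [hB, ← Real.rpow_mul (by positivity), one_div_mul_cancel hp0.ne', Real.rpow_one]
  have hB0 : 0 ≤ B := by positivity
  refine ⟨T, B + (C + K), by positivity, fun b s => ?_, fun b s hb => ?_, fun v => ?_⟩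
  · have h1 : ‖T (b, s)‖ ≤ B * (‖b‖ + ‖s‖) := by
      rw [← Real.rpow_le_rpow_iff (norm_nonneg _) (by positivity) hp0,
        Real.mul_rpow hB0 (by positivity), hBp, ← (hR _).tsum_eq]
      simp only [hT]
      refine (hA b s).2.trans ?_
      have h2 : ‖b‖ ^ p ≤ (‖b‖ + ‖s‖) ^ p := by
        gcongr
        exact le_add_of_nonneg_right (norm_nonneg _)
      have h3 : ‖s‖ ^ p ≤ (‖b‖ + ‖s‖) ^ p := by
        gcongr
        exact le_add_of_nonneg_left (norm_nonneg _)
      nlinarith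
    exact h1.trans (by gcongr; linarith)
  · have h1 : ‖b‖ ≤ C * ‖T (b, s)‖ := by
      calc ‖b‖ = ‖P (R 0 (T (b, s)))‖ := by rw [hPseq0 b s hb]
        _ ≤ C * ‖R 0 (T (b, s))‖ := hP _
        _ ≤ C * ‖T (b, s)‖ := by
          gcongr
          exact norm_map_le_of_hasSum hp hR 0 _
    have h2 : ‖s‖ ≤ K * ‖T (b, s)‖ := by
      rw [← Real.rpow_le_rpow_iff (norm_nonneg _) (by positivity) hp0,
        Real.mul_rpow hK0 (norm_nonneg _), hKp]
      refine (hasSum_le (fun n => ?_) (hR s) (hrevs (T (b, s)))).trans ?_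
      · rw [hs b s n hb]
        exact hrev _ n
      · rw [Finset.sum_range_one, mul_assoc, add_mul]
        gcongr
        exact sub_le_self _ (by positivity)
    have h3 : 0 ≤ B * ‖T (b, s)‖ := by positivity
    linarith
  · obtain ⟨s, hs'⟩ := hsurj (fun n => (R n v - P (R n v)) + P (R (n + 1) v))
      (Summable.of_nonneg_of_le (fun n => by positivity) (hrev v) (hrevs v).summable)
    have hPs : ∀ n, P (R n s) = P (R (n + 1) v) := fun n => by
      rw [hs', map_add, hPQ, hPP, zero_add]
    refine ⟨P (R 0 v), s, hPP _, eq_of_forall_map_eq hp hR fun n => ?_⟩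
    rw [hT]
    cases n with
    | zero => rw [swindleSeq, hPs, hs', add_sub_cancel_right, add_sub_cancel]
    | succ n => rw [swindleSeq, hPs, hPs, hs', add_sub_cancel_right, add_sub_cancel]

end Swindle

end

section

variable {ψ : Measure ℍ[ℝ]} {p : ℝ} [Fact (1 ≤ ENNReal.ofReal p)]

/-- The pairs of boundary values of the functions of `K_p` form a module isomorphic to
`Lᵖ([0, 1], ℍ)`. -/
theorem exists_coordinates (hψ : IsSphereMeasure ψ) (hp : 1 < p) :
    ∃ (T : Lp ℍ[ℝ] (ENNReal.ofReal p) ψ × Lp ℍ[ℝ] (ENNReal.ofReal p) ψ →ₗ[ℍ[ℝ]]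
        Lp ℍ[ℝ] (ENNReal.ofReal p) unitVol) (A : ℝ), 0 ≤ A ∧
      (∀ b s, ‖T (b, s)‖ ≤ A * (‖b‖ + ‖s‖)) ∧
      (∀ b s, hardyProj hψ hp b = b → ‖b‖ + ‖s‖ ≤ A * ‖T (b, s)‖) ∧
      ∀ v, ∃ b s, hardyProj hψ hp b = b ∧ T (b, s) = v := by
  obtain ⟨C, hC0, hC⟩ := exists_norm_hardyProj_le hψ hp
  obtain ⟨R, hR, hsurj⟩ := exists_sequence_maps hψ hp
  obtain ⟨T, A, hA0, h1, h2, h3⟩ :=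
    exists_swindle hp hC0 hC (hardyProj_hardyProj hψ hp) hR hsurj
  obtain ⟨Ψ, hΨ, hΨs⟩ := exists_linearIsometry_unitVol (p := p) hψ
  refine ⟨Ψ.comp T, A, hA0, fun b s => ?_, fun b s hb => ?_, fun v => ?_⟩
  · rw [LinearMap.comp_apply, hΨ]
    exact h1 b s
  · rw [LinearMap.comp_apply, hΨ]
    exact h2 b s hb
  · obtain ⟨u, rfl⟩ := hΨs v
    obtain ⟨b, s, hb, rfl⟩ := h3 u
    exact ⟨b, s, hb, rfl⟩

theorem hasSum_iff_forall_norm_sub_le {V : Type*} [NormedAddCommGroup V] {f : ℕ → V} {v : V} :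
    HasSum f v ↔ ∀ ε : ℝ, 0 < ε → ∃ F₀ : Finset ℕ, ∀ F : Finset ℕ, F₀ ⊆ F →
      ‖v - ∑ m ∈ F, f m‖ ≤ ε := by
  unfold HasSum
  rw [SummationFilter.unconditional_filter, Metric.tendsto_atTop]
  simp only [dist_eq_norm_sub']
  refine ⟨fun h ε hε => ?_, fun h ε hε => ?_⟩
  · obtain ⟨N, hN⟩ := h ε hε
    exact ⟨N, fun n hn => (hN n hn).le⟩
  · obtain ⟨N, hN⟩ := h (ε / 2) (half_pos hε)
    exact ⟨N, fun n hn => (hN n hn).trans_lt (half_lt_self hε)⟩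

theorem exists_unconditional_basis (hψ : IsSphereMeasure ψ) (hp : 1 < p) :
    ∃ w : ℕ → (ℍ[ℝ] → ℍ[ℝ]), (∀ m, memKp ψ p (w m)) ∧
      ∀ h : ℍ[ℝ] → ℍ[ℝ], memKp ψ p h →
        ∃! a : ℕ → ℍ[ℝ], ∀ ε : ℝ, 0 < ε → ∃ F₀ : Finset ℕ, ∀ F : Finset ℕ, F₀ ⊆ F →
          hardyNorm ψ p (fun z => h z - ∑ m ∈ F, a m * w m z) ≤ ENNReal.ofReal ε := by
  obtain ⟨T, A, hA0, hT1, hT2, hT3⟩ := exists_coordinates hψ hp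
  obtain ⟨C, hC0, hC⟩ := exists_hardyNorm_le_of_represents hψ hp
  choose c t hc hct using fun m => hT3 (haarLp p m)
  choose w hw using fun m => Represents.exists_of_bdry_eq hψ (hc m) (t m)
  refine ⟨w, fun m => (hC _ _ _ (hw m)).1, fun h hh => ?_⟩
  obtain ⟨b, s, hr, -, -⟩ := exists_represents hψ hp hh
  obtain ⟨B, hB⟩ := exists_haarLp_bound hp
  have : NormSMulClass ℍ[ℝ] (Lp ℍ[ℝ] (ENNReal.ofReal p) unitVol) :=
    NormedDivisionRing.toNormSMulClass
  refine (existsUnique_congr fun a => ?_).mp (existsUnique_hasSum_of_projections_bounded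
    dense_span_haarLp haarLp_ne_zero hB (T (b, s)))
  have hsub := fun F => hr.sub_sum hψ hp hw a F
  have hTsub : ∀ F : Finset ℕ, T (b - ∑ m ∈ F, a m • c m, s - ∑ m ∈ F, a m • t m) =
      T (b, s) - ∑ m ∈ F, a m • haarLp p m := fun F => by
    simp only [← hct, ← map_smul, ← map_sum, ← map_sub]
    congr 1
    ext1 <;> simp [Prod.fst_sum, Prod.snd_sum]
  rw [hasSum_iff_forall_norm_sub_le]
  refine ⟨fun H ε hε => ?_, fun H ε hε => ?_⟩
  · obtain ⟨F₀, hF₀⟩ := H (ε / (C * A + 1)) (by positivity)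
    refine ⟨F₀, fun F hF => (hC _ _ _ (hsub F)).2.trans (ENNReal.ofReal_le_ofReal ?_)⟩
    have h1 := hT2 _ (s - ∑ m ∈ F, a m • t m) ((hsub F).hardyProj_eq hψ hp)
    rw [hTsub] at h1
    have h2 := hF₀ F hF
    rw [le_div_iff₀ (by positivity)] at h2
    refine (mul_le_mul_of_nonneg_left h1 hC0).trans ?_
    have h3 := norm_nonneg (T (b, s) - ∑ m ∈ F, a m • haarLp p m)
    linarith
  · obtain ⟨F₀, hF₀⟩ := H (ε / (2 * A + 1)) (by positivity)
    refine ⟨F₀, fun F hF => ?_⟩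
    obtain ⟨b', s', hr', hb', hs'⟩ := exists_represents hψ hp (hC _ _ _ (hsub F)).1
    obtain ⟨rfl, rfl⟩ := (hsub F).unique hψ hr'
    have h2 := ENNReal.toReal_le_of_le_ofReal (by positivity) (hF₀ F hF)
    have h1 := hT1 (b - ∑ m ∈ F, a m • c m) (s - ∑ m ∈ F, a m • t m)
    rw [hTsub] at h1
    refine h1.trans ((mul_le_mul_of_nonneg_left (add_le_add (hb'.trans h2) (hs'.trans h2))
      hA0).trans ?_)
    have h3 : ε / (2 * A + 1) * (2 * A + 1) = ε := div_mul_cancel₀ _ (by positivity)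
    have h4 : 0 ≤ ε / (2 * A + 1) := by positivity
    linarith

end

end HardyDirac

/-- For `1 < p < ∞`, the left ℍ-module `K_p(B, ℍ)` with the Hardy norm has an
unconditional basis over the quaternion skew field: a sequence `w` in `K_p(B, ℍ)` such
that every `h ∈ K_p(B, ℍ)` has a unique sequence of quaternion coefficients `a` for which
the family `(aₘ·wₘ)` is unconditionally summable to `h` in the Hardy norm (the net of
finite partial sums over finite subsets of ℕ converges to `h`). Here `ψ` is the
rotation-invariant probability measure on `S³`. -/
theorem memKp_has_unconditional_basis
    (p : ℝ) (hp : 1 < p)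
    (ψ : Measure ℍ[ℝ]) (hψone : ψ (sphere (0 : ℍ[ℝ]) 1) = 1)
    (hψsupp : ψ (sphere (0 : ℍ[ℝ]) 1)ᶜ = 0)
    (hψrot : ∀ T : ℍ[ℝ] ≃ₗᵢ[ℝ] ℍ[ℝ], ψ.map T = ψ) :
    ∃ w : ℕ → (ℍ[ℝ] → ℍ[ℝ]), (∀ m, memKp ψ p (w m)) ∧
      ∀ h : ℍ[ℝ] → ℍ[ℝ], memKp ψ p h →
        ∃! a : ℕ → ℍ[ℝ], ∀ ε : ℝ, 0 < ε → ∃ F₀ : Finset ℕ, ∀ F : Finset ℕ, F₀ ⊆ F →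
          hardyNorm ψ p (fun z => h z - ∑ m ∈ F, a m * w m z) ≤ ENNReal.ofReal ε := by
  have : Fact (1 ≤ ENNReal.ofReal p) := ⟨ENNReal.one_le_ofReal.2 hp.le⟩
  exact HardyDirac.exists_unconditional_basis ⟨hψone, hψsupp, hψrot⟩ hp
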